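/- Assume N ≤ 2, or N ≥ 3 and p = 2r+1 < p_B(N). There exists a constant C = C(N,p,B) > 0 (independent of Ω, T and U) such that for every nonempty proper open subset Ω ⊊ ℝ^N, every T ∈ (0,∞), and every nonnegative classical solution U = (u_1,…,u_m) of (S) on Ω × (0,T), one has u_i(x,t) ≤ C ( t^{−1/(p−1)} + (T−t)^{−1/(p−1)} + dist(x, ℝ^N \ Ω)^{−2/(p−1)} ) for all (x,t) ∈ Ω × (0,T) and all i = 1,…,m. -/

import Mathlib

open Real Set Metric MeasureTheory

/-- The Laplacian in the space variable, as the sum of second derivatives in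
the coordinate directions. -/
noncomputable def lap {N : ℕ} (f : EuclideanSpace ℝ (Fin N) → ℝ)
    (x : EuclideanSpace ℝ (Fin N)) : ℝ :=
  ∑ i, iteratedFDeriv ℝ 2 f x ![EuclideanSpace.single i 1, EuclideanSpace.single i 1]

open scoped ContDiff Topology

section Calculus

variable {X : Type*} [NormedAddCommGroup X] [NormedSpace ℝ X]

/-- The directional derivative of `f` along `w`. -/
noncomputable def dd (w : X) (f : X → ℝ) : X → ℝ := fun z => fderiv ℝ f z w

theorem contDiff_dd {f : X → ℝ} (w : X) (hf : ContDiff ℝ ∞ f) : ContDiff ℝ ∞ (dd w f) :=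
  (hf.fderiv_right (m := ∞) (by simp)).clm_apply contDiff_const

theorem ContDiff.differentiableAt_infty {f : X → ℝ} (hf : ContDiff ℝ ∞ f) (z : X) :
    DifferentiableAt ℝ f z := (hf.differentiable (by simp)) z

theorem dd_mul {f g : X → ℝ} (w : X) (hf : ContDiff ℝ ∞ f) (hg : ContDiff ℝ ∞ g) (z : X) :
    dd w (fun z => f z * g z) z = dd w f z * g z + f z * dd w g z := by
  have := fderiv_fun_mul (hf.differentiableAt_infty z) (hg.differentiableAt_infty z)
  simp [dd, this]; ring

theorem dd_const_mul {f : X → ℝ} (w : X) (c : ℝ) (hf : ContDiff ℝ ∞ f) (z : X) :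
    dd w (fun z => c * f z) z = c * dd w f z := by
  have := fderiv_const_mul (hf.differentiableAt_infty z) c
  simp [dd, this]

theorem dd_sum {ι : Type*} (s : Finset ι) {f : ι → X → ℝ} (w : X)
    (hf : ∀ i, ContDiff ℝ ∞ (f i)) (z : X) :
    dd w (fun z => ∑ i ∈ s, f i z) z = ∑ i ∈ s, dd w (f i) z := by
  have := fderiv_fun_sum (u := s) (fun i _ => (hf i).differentiableAt_infty z)
  simp [dd, this]

theorem dd_pow {f : X → ℝ} (w : X) (n : ℕ) (hf : ContDiff ℝ ∞ f) (z : X) :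
    dd w (fun z => f z ^ n) z = n * f z ^ (n - 1) * dd w f z := by
  have := ((hf.differentiableAt_infty z).hasFDerivAt.pow n).fderiv
  simp [dd, this]

theorem dd_rpow {f : X → ℝ} (w : X) (s : ℝ) (hf : ContDiff ℝ ∞ f) (hpos : ∀ z, 0 < f z) (z : X) :
    dd w (fun z => f z ^ s) z = s * f z ^ (s - 1) * dd w f z := by
  have := ((hf.differentiableAt_infty z).hasFDerivAt.rpow_const (p := s)
    (Or.inl (hpos z).ne')).fderiv
  simp [dd, this]

theorem dd_inv {f : X → ℝ} (w : X) (hf : ContDiff ℝ ∞ f) (hpos : ∀ z, 0 < f z) (z : X) :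
    dd w (fun z => (f z)⁻¹) z = - (dd w f z * (f z)⁻¹ ^ 2) := by
  have := ((hasDerivAt_inv (hpos z).ne').comp_hasFDerivAt z
    (hf.differentiableAt_infty z).hasFDerivAt).fderiv
  have h2 : (fun z => (f z)⁻¹) = (fun x => x⁻¹) ∘ f := rfl
  simp [dd, h2, this]; ring

theorem dd_comm {f : X → ℝ} (w w' : X) (hf : ContDiff ℝ ∞ f) (z : X) :
    dd w (dd w' f) z = dd w' (dd w f) z := by
  have h : IsSymmSndFDerivAt ℝ f z :=
    hf.contDiffAt.isSymmSndFDerivAt (by simpa using (mod_cast le_top : ((2 : ℕ∞) : WithTop ℕ∞) ≤ ∞))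
  have hd : DifferentiableAt ℝ (fderiv ℝ f) z :=
    ((hf.fderiv_right (m := ∞) (by simp)).differentiable (by simp)) z
  have key : ∀ a b : X, dd a (dd b f) z = fderiv ℝ (fderiv ℝ f) z a b := by
    intro a b
    have := (hd.hasFDerivAt.clm_apply (hasFDerivAt_const b z)).fderiv
    unfold dd; rw [this]; simp
  rw [key, key]; exact h w w'

theorem HasCompactSupport.dd {f : X → ℝ} (w : X) (hf : HasCompactSupport f) :
    HasCompactSupport (dd w f) := hf.fderiv_apply (𝕜 := ℝ) w

end Calculus

section Integral

/-- Integrable with zero integral. -/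
def NullInt {X : Type*} [MeasurableSpace X] (μ : Measure X) (J : X → ℝ) : Prop :=
  Integrable J μ ∧ ∫ z, J z ∂μ = 0

section
variable {X : Type*} [MeasurableSpace X] {μ : Measure X}

theorem NullInt.add {J K : X → ℝ} (hJ : NullInt μ J) (hK : NullInt μ K) :
    NullInt μ (fun z => J z + K z) :=
  ⟨hJ.1.add hK.1, by rw [integral_add hJ.1 hK.1, hJ.2, hK.2, add_zero]⟩

theorem NullInt.const_mul {J : X → ℝ} (hJ : NullInt μ J) (c : ℝ) :
    NullInt μ (fun z => c * J z) :=
  ⟨hJ.1.const_mul c, by rw [integral_const_mul, hJ.2, mul_zero]⟩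

theorem NullInt.sub {J K : X → ℝ} (hJ : NullInt μ J) (hK : NullInt μ K) :
    NullInt μ (fun z => J z - K z) :=
  ⟨hJ.1.sub hK.1, by rw [integral_sub hJ.1 hK.1, hJ.2, hK.2, sub_zero]⟩

theorem NullInt.sum {ι : Type*} (s : Finset ι) {J : ι → X → ℝ} (hJ : ∀ i, NullInt μ (J i)) :
    NullInt μ (fun z => ∑ i ∈ s, J i z) :=
  ⟨integrable_finsetSum s fun i _ => (hJ i).1, by
    rw [integral_finsetSum s fun i _ => (hJ i).1]
    exact Finset.sum_eq_zero fun i _ => (hJ i).2⟩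

theorem NullInt.congr {J K : X → ℝ} (hJ : NullInt μ J) (h : ∀ z, J z = K z) : NullInt μ K := by
  rwa [← funext h]

theorem integral_le_of_nullInt {J A B : X → ℝ} (hJ : NullInt μ J) (hA : Integrable A μ)
    (hB : Integrable B μ) (h : ∀ z, A z ≤ J z + B z) : ∫ z, A z ∂μ ≤ ∫ z, B z ∂μ := by
  have := integral_mono hA (hJ.1.add hB) h
  rw [integral_add' hJ.1 hB, hJ.2, zero_add] at this
  exact this
end

variable {X : Type*} [NormedAddCommGroup X] [NormedSpace ℝ X] [FiniteDimensional ℝ X]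
  [MeasurableSpace X] [BorelSpace X] {μ : Measure X} [μ.IsAddHaarMeasure]

theorem nullInt_dd {g : X → ℝ} (w : X) (hg : ContDiff ℝ ∞ g) (hc : HasCompactSupport g) :
    NullInt μ (dd w g) := by
  have hi : Integrable (dd w g) μ :=
    (contDiff_dd w hg).continuous.integrable_of_hasCompactSupport (hc.dd w)
  refine ⟨hi, ?_⟩
  have := integral_mul_fderiv_eq_neg_fderiv_mul_of_integrable (μ := μ) (f := fun _ : X => (1 : ℝ))
    (g := g) (v := w) (by simp) (by simpa using (show Integrable (fun x => fderiv ℝ g x w) μ from hi))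
    (by simpa using hg.continuous.integrable_of_hasCompactSupport hc)
    (fun _ _ => differentiableAt_const _) (fun x _ => hg.differentiableAt_infty x)
  simpa [dd] using this

variable {φ u f : X → ℝ}

theorem nullInt_hessian (w w' : X) (hφ : ContDiff ℝ ∞ φ) (hc : HasCompactSupport φ)
    (hu : ContDiff ℝ ∞ u) :
    NullInt μ (fun z => φ z * (dd w (dd w' u) z ^ 2 - dd w (dd w u) z * dd w' (dd w' u) z)
      - dd w (dd w φ) z * dd w' u z ^ 2 / 2 - dd w' φ z * dd w' u z * dd w (dd w u) z) := by
  have s1 := contDiff_dd w hu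
  have s2 := contDiff_dd w' hu
  have s12 := contDiff_dd w s2
  have s11 := contDiff_dd w s1
  have sφ := contDiff_dd w hφ
  have h1 := nullInt_dd (μ := μ) w (hφ.mul (s2.mul s12)) (hc.mul_right)
  have h2 := nullInt_dd (μ := μ) w' (hφ.mul (s2.mul s11)) (hc.mul_right)
  have h3 := nullInt_dd (μ := μ) w (sφ.mul (s2.mul s2)) ((hc.dd w).mul_right)
  refine ((h1.sub h2).sub (h3.const_mul (1 / 2))).congr fun z => ?_
  simp only [dd_mul _ hφ (s2.mul s12), dd_mul _ hφ (s2.mul s11), dd_mul _ sφ (s2.mul s2),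
    dd_mul _ s2 s12, dd_mul _ s2 s11, dd_mul _ s2 s2]
  have e : dd w (dd w (dd w' u)) z = dd w' (dd w (dd w u)) z := by
    rw [show dd w (dd w' u) = dd w' (dd w u) from funext fun z => dd_comm w w' hu z]
    exact dd_comm w w' s1 z
  rw [e]; ring

theorem nullInt_cross (w w' : X) (hφ : ContDiff ℝ ∞ φ) (hc : HasCompactSupport φ)
    (hu : ContDiff ℝ ∞ u) (hpos : ∀ z, 0 < u z) :
    NullInt μ (fun z => φ z * (dd w (dd w' u) z * dd w u z * dd w' u z / u z)
      + dd w u z ^ 2 / u z * (dd w' φ z * dd w' u z) / 2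
      + φ z * (dd w u z ^ 2 / u z) * dd w' (dd w' u) z / 2
      - φ z * (dd w u z ^ 2 / u z) * (dd w' u z ^ 2 / u z) / 2) := by
  have s1 := contDiff_dd w hu
  have s2 := contDiff_dd w' hu
  have si : ContDiff ℝ ∞ (fun z => (u z)⁻¹) := hu.inv fun z => (hpos z).ne'
  have h1 := nullInt_dd (μ := μ) w' (hφ.mul (s2.mul ((s1.mul s1).mul si))) (hc.mul_right)
  refine (h1.const_mul (1 / 2)).congr fun z => ?_
  simp only [dd_mul _ hφ (s2.mul ((s1.mul s1).mul si)), dd_mul _ s2 ((s1.mul s1).mul si),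
    dd_mul _ (s1.mul s1) si, dd_mul _ s1 s1, dd_inv _ hu hpos, dd_comm w' w hu z]
  have := (hpos z).ne'
  field_simp
  ring

theorem nullInt_time (w τ : X) (hφ : ContDiff ℝ ∞ φ) (hc : HasCompactSupport φ)
    (hu : ContDiff ℝ ∞ u) :
    NullInt μ (fun z => φ z * dd τ u z * dd w (dd w u) z + dd τ u z * (dd w φ z * dd w u z)
      - dd τ φ z * dd w u z ^ 2 / 2) := by
  have s1 := contDiff_dd w hu
  have s2 := contDiff_dd τ hu
  have h1 := nullInt_dd (μ := μ) w (hφ.mul (s2.mul s1)) (hc.mul_right)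
  have h2 := nullInt_dd (μ := μ) τ (hφ.mul (s1.mul s1)) (hc.mul_right)
  refine (h1.sub (h2.const_mul (1 / 2))).congr fun z => ?_
  simp only [dd_mul _ hφ (s2.mul s1), dd_mul _ hφ (s1.mul s1), dd_mul _ s2 s1,
    dd_mul _ s1 s1, dd_comm τ w hu z]
  ring

theorem nullInt_source (w : X) (hφ : ContDiff ℝ ∞ φ) (hc : HasCompactSupport φ)
    (hu : ContDiff ℝ ∞ u) (hf : ContDiff ℝ ∞ f) :
    NullInt μ (fun z => φ z * f z * dd w (dd w u) z + φ z * (dd w f z * dd w u z)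
      + f z * (dd w φ z * dd w u z)) := by
  have s1 := contDiff_dd w hu
  refine (nullInt_dd (μ := μ) w (hφ.mul (hf.mul s1)) (hc.mul_right)).congr fun z => ?_
  simp only [dd_mul _ hφ (hf.mul s1), dd_mul _ hf s1]
  ring

theorem nullInt_mul (τ : X) (hφ : ContDiff ℝ ∞ φ) (hc : HasCompactSupport φ)
    (hf : ContDiff ℝ ∞ f) :
    NullInt μ (fun z => φ z * dd τ f z + dd τ φ z * f z) := by
  refine (nullInt_dd (μ := μ) τ (hφ.mul hf) (hc.mul_right)).congr fun z => ?_
  simp only [dd_mul _ hφ hf]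
  ring

end Integral

theorem mul_le_young (a b : ℝ) {η : ℝ} (hη : 0 < η) : a * b ≤ η * a ^ 2 + b ^ 2 / (4 * η) := by
  have : η * a ^ 2 + b ^ 2 / (4 * η) - a * b = (2 * η * a - b) ^ 2 / (4 * η) := by
    field_simp; ring
  have h2 : 0 ≤ (2 * η * a - b) ^ 2 / (4 * η) := by positivity
  linarith

theorem boundary_terms_le {c θ : ℝ} (hc : 0 ≤ c) (hθ : 0 < θ) : ∃ C : ℝ, 0 ≤ C ∧
    ∀ T b f e g y : ℝ, 0 ≤ b → 0 ≤ y → g ^ 2 ≤ c * b * y →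
      |T| * |g| + |f| * |g| + b * |g| + |e| * |g| + b * y + |f| * y + b * |e| + |f| * |e| + |T| * |e|
        + e ^ 2 ≤ θ * (T ^ 2 + b ^ 2 + f ^ 2) + C * (y ^ 2 + e ^ 2) := by
  obtain ⟨η, hη, rfl⟩ : ∃ η : ℝ, 0 < η ∧ θ = 4 * η := ⟨θ / 4, by positivity, by ring⟩
  set D : ℝ := c / η + 1 with hD
  have hD0 : 0 ≤ D := by positivity
  refine ⟨D ^ 2 / (4 * η) + 1 / (4 * η) + η + 3 / (4 * η) + 1, by positivity, ?_⟩
  intro T b f e g y hb hy hg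
  have hT := mul_le_young |T| |g| hη
  have hf := mul_le_young |f| |g| hη
  have hb1 := mul_le_young b |g| hη
  have he := mul_le_young |e| |g| hη
  have h1 := mul_le_young b (D * y) hη
  have h2 := mul_le_young |f| y hη
  have h3 := mul_le_young b |e| hη
  have h4 := mul_le_young |f| |e| hη
  have h5 := mul_le_young |T| |e| hη
  simp only [sq_abs] at *
  have h6 : g ^ 2 / (4 * η) * 4 ≤ c / η * (b * y) := by
    rw [div_mul_eq_mul_div, div_le_iff₀ (by positivity)]
    have : c / η * (b * y) * (4 * η) = 4 * (c * b * y) := by field_simp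
    rw [this]; linarith
  have h7 : b * (D * y) = c / η * (b * y) + b * y := by rw [hD]; ring
  have e1 : (D * y) ^ 2 / (4 * η) = D ^ 2 / (4 * η) * y ^ 2 := by ring
  have e2 : y ^ 2 / (4 * η) = 1 / (4 * η) * y ^ 2 := by ring
  have e3 : e ^ 2 / (4 * η) = 1 / (4 * η) * e ^ 2 := by ring
  have e4 : 3 / (4 * η) = 3 * (1 / (4 * η)) := by ring
  rw [e1] at h1; rw [e2] at h2; rw [e3] at h3 h4 h5; rw [e4]
  set A := D ^ 2 / (4 * η)
  have hA : 0 ≤ A := by positivity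
  have hB : 0 ≤ 1 / (4 * η) := by positivity
  set B := 1 / (4 * η)
  nlinarith [mul_nonneg hA (sq_nonneg e), mul_nonneg hB (sq_nonneg e), mul_nonneg hB (sq_nonneg y),
    mul_nonneg hη.le (sq_nonneg y), sq_nonneg y, mul_nonneg hη.le (sq_nonneg T),
    mul_nonneg hη.le (sq_nonneg b), mul_nonneg hη.le (sq_nonneg f)]

theorem residual_terms_le {c c1 c2 a p T f e b g u y Δ ℓ τ : ℝ} (hc : 0 ≤ c) (c1n : 0 ≤ c1)
    (c2n : 0 ≤ c2) (ha : 0 < a) (hp : 1 < p) (hf : 0 ≤ f) (hb : 0 ≤ b) (hu : 0 ≤ u) (hy : 0 ≤ y)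
    (hℓ : |ℓ| * u ≤ c * y) (hτ : |τ| * u ≤ c * y) (hΔ : Δ = T - f - e) {Z : ℝ}
    (hZ : Z = |T| * |g| + |f| * |g| + b * |g| + |e| * |g| + b * y + |f| * y
      + b * |e| + |f| * |e| + |T| * |e| + e ^ 2) :
    -c1 * (b * e) + c2 * (-(T * g) + τ * (b * u) / 2 + f * g - e * Δ)
        + ℓ * (b * u) / 2 + Δ * g + a * (b * g) ≤ (c1 + c2 + c2 * c + c + 1 + a) * Z ∧
    f * g - f * e - τ * (u * f / (p + 1)) ≤ (c1 + c2 + c2 * c + c + 1 + a) * Z ∧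
    -(T * g) + τ * (b * u) / 2 + T * e - τ * (u * f / (p + 1)) ≤
      (c1 + c2 + c2 * c + c + 1 + a) * Z := by
  obtain ⟨z1, z1'⟩ := abs_le.1 (abs_mul T g).le
  obtain ⟨z2, z2'⟩ := abs_le.1 (abs_mul f g).le
  obtain ⟨z3, z3'⟩ := abs_le.1 (show |b * g| ≤ b * |g| by rw [abs_mul, abs_of_nonneg hb])
  obtain ⟨z4, z4'⟩ := abs_le.1 (abs_mul e g).le
  obtain ⟨z5, z5'⟩ := abs_le.1 (show |b * e| ≤ b * |e| by rw [abs_mul, abs_of_nonneg hb])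
  obtain ⟨z6, z6'⟩ := abs_le.1 (abs_mul f e).le
  obtain ⟨z7, z7'⟩ := abs_le.1 (abs_mul T e).le
  have p1 : 0 ≤ |T| * |g| := by positivity
  have p2 : 0 ≤ |f| * |g| := by positivity
  have p3 : 0 ≤ b * |g| := by positivity
  have p4 : 0 ≤ |e| * |g| := by positivity
  have p5 : 0 ≤ b * y := by positivity
  have p6 : 0 ≤ |f| * y := by positivity
  have p7 : 0 ≤ b * |e| := by positivity
  have p8 : 0 ≤ |f| * |e| := by positivity
  have p9 : 0 ≤ |T| * |e| := by positivity
  have p10 : 0 ≤ e ^ 2 := by positivity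
  obtain ⟨q1, q1'⟩ := abs_le.1 (show |τ * (b * u)| ≤ c * (b * y) by
    rw [abs_mul, abs_of_nonneg (mul_nonneg hb hu)]
    nlinarith)
  obtain ⟨q2, q2'⟩ := abs_le.1 (show |ℓ * (b * u)| ≤ c * (b * y) by
    rw [abs_mul, abs_of_nonneg (mul_nonneg hb hu)]
    nlinarith)
  obtain ⟨q3, q3'⟩ := abs_le.1 (show |τ * (u * f / (p + 1))| ≤ c * (|f| * y) by
    rw [abs_mul, abs_of_nonneg (div_nonneg (mul_nonneg hu hf) (by linarith)), abs_of_nonneg hf]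
    have : u * f / (p + 1) ≤ u * f := div_le_self (mul_nonneg hu hf) (by linarith)
    nlinarith [mul_le_mul_of_nonneg_left this (abs_nonneg τ)])
  have hZ0 : 0 ≤ Z := by rw [hZ]; linarith
  have s1 : 0 ≤ c2 * c * Z := by positivity
  have s2 : 0 ≤ c * Z := by positivity
  have s3 : 0 ≤ c1 * Z := by positivity
  have s4 : 0 ≤ c2 * Z := by positivity
  have s5 : 0 ≤ a * Z := by positivity
  have w1 : c * (b * y) ≤ c * Z := mul_le_mul_of_nonneg_left (by linarith) hc
  have w2 : c * (|f| * y + b * y) ≤ c * Z := mul_le_mul_of_nonneg_left (by linarith) hc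
  have w3 : 0 ≤ c * (b * y) := by positivity
  have w4 : 0 ≤ c * (|f| * y) := by positivity
  have r1 : -(b * e) ≤ Z := by linarith only [z5, hZ, p1, p2, p3, p4, p5, p6, p7, p8, p9, p10]
  have r2 : -(T * g) + τ * (b * u) / 2 + f * g - e * Δ ≤ (1 + c) * Z := by
    have h2 : e * Δ = T * e - f * e - e ^ 2 := by rw [hΔ]; ring
    linarith only [h2, z1, q1', z2', z7, z6', w1, w3, hZ, p1, p2, p3, p4, p5, p6, p7, p8, p9, p10]
  have r3 : ℓ * (b * u) / 2 ≤ c * Z := by linarith only [q2', w1, w3, s2]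
  have r4 : Δ * g ≤ Z := by
    have h2 : Δ * g = T * g - f * g - e * g := by rw [hΔ]; ring
    linarith only [h2, z1', z2, z4, hZ, p1, p2, p3, p4, p5, p6, p7, p8, p9, p10]
  have r5 : b * g ≤ Z := by linarith only [z3', hZ, p1, p2, p3, p4, p5, p6, p7, p8, p9, p10]
  have r1' := mul_le_mul_of_nonneg_left r1 c1n
  have r2' := mul_le_mul_of_nonneg_left r2 c2n
  have r5' := mul_le_mul_of_nonneg_left r5 ha.le
  refine ⟨by linarith only [r1', r2', r3, r4, r5', s1, s2, s3, s4, s5, hZ0], ?_, ?_⟩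
  · linarith only [z2', z6, q3, w1, w2, w3, w4, s1, s3, s4, s5, hZ, p1, p2, p3, p4, p5, p6, p7, p8,
      p9, p10]
  · linarith only [z1, q1', z7', q3, w1, w2, w3, w4, s1, s3, s4, s5, hZ, p1, p2, p3, p4, p5, p6,
      p7, p8, p9, p10]

/-- The pointwise inequality behind the integral estimate. -/
theorem pointwise_estimate {n p a c : ℝ} (hn : 1 ≤ n) (hp : 1 < p) (ha : 0 < a)
    (ha1 : a * (n - 1) < n) (ha2 : p * (n - 1) < (n + 2) * a) (hc : 0 ≤ c) :
    ∃ x1 x2 x3 x4 x5 C : ℝ, 0 ≤ C ∧ ∀ {ι : Type} [Fintype ι]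
      (S Δ H K T f e b g u y : ι → ℝ) (ℓ τ : ℝ),
      (∀ k, 0 ≤ f k) → (∀ k, 0 ≤ b k) → (∀ k, 0 ≤ u k) → (∀ k, 0 ≤ y k) →
      (∀ k, g k ^ 2 ≤ c * b k * y k) → (∀ k, |ℓ| * u k ≤ c * y k) → (∀ k, |τ| * u k ≤ c * y k) →
      (∀ k, Δ k = T k - f k - e k) →
      (∀ k, (Δ k - a * b k) ^ 2 / n ≤ S k - 2 * a * H k + a ^ 2 * b k ^ 2) →
      (∑ k, K k ≤ p * ∑ k, f k * b k) →
      ∑ k, f k ^ 2 ≤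
        x1 * ∑ k, (S k - Δ k ^ 2 - ℓ * (b k * u k) / 2 - Δ k * g k) +
        x2 * ∑ k, (H k + b k * g k / 2 + b k * Δ k / 2 - b k ^ 2 / 2) +
        x3 * ∑ k, (T k * Δ k + T k * g k - τ * (b k * u k) / 2) +
        x4 * ∑ k, (f k * Δ k + K k + f k * g k) +
        x5 * (∑ k, f k * T k + τ * ((∑ k, u k * f k) / (p + 1))) + C * ∑ k, (y k ^ 2 + e k ^ 2) := by
  have hn0 : 0 < n := by linarith
  obtain ⟨c2, hc2⟩ : ∃ c2, c2 = (n - 1) / n := ⟨_, rfl⟩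
  obtain ⟨c1, hc1⟩ : ∃ c1, c1 = (n + 2) * a / n := ⟨_, rfl⟩
  obtain ⟨α, hα⟩ : ∃ α, α = a - a ^ 2 * c2 := ⟨_, rfl⟩
  obtain ⟨γ, hγ⟩ : ∃ γ, γ = c1 - c2 * p := ⟨_, rfl⟩
  have c2n : 0 ≤ c2 := by rw [hc2]; exact div_nonneg (by linarith) hn0.le
  have c1n : 0 ≤ c1 := by rw [hc1]; positivity
  have αp : 0 < α := by
    have : α = a * (n - a * (n - 1)) / n := by rw [hα, hc2]; field_simp
    rw [this]
    exact div_pos (mul_pos ha (by linarith)) hn0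
  have γp : 0 < γ := by
    have : γ = ((n + 2) * a - p * (n - 1)) / n := by rw [hγ, hc1, hc2]; field_simp
    rw [this]
    exact div_pos (by linarith) hn0
  obtain ⟨μ, hμ⟩ : ∃ μ, μ = p / γ := ⟨_, rfl⟩
  have μp : 0 < μ := by rw [hμ]; positivity
  have hμγ : μ * (c1 - c2 * p) = p := by rw [← hγ, hμ]; field_simp
  obtain ⟨ν, hν⟩ : ∃ ν, ν = μ * c1 ^ 2 / (2 * α) + 1 := ⟨_, rfl⟩
  have νp : 0 < ν := by rw [hν]; positivity
  obtain ⟨M, hM⟩ : ∃ M, M = c1 + c2 + c2 * c + c + 1 + a := ⟨_, rfl⟩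
  have hM0 : 0 < M := by rw [hM]; positivity
  obtain ⟨R, hR⟩ : ∃ R, R = (μ + 1 + ν) * M := ⟨_, rfl⟩
  have hR0 : 0 < R := by rw [hR]; positivity
  obtain ⟨θ, hθ0, hθ1, hθ2⟩ : ∃ θ : ℝ, 0 < θ ∧ θ ≤ 1 / 2 ∧ θ ≤ μ * α / 2 :=
    ⟨min (1 / 2) (μ * α / 2), by positivity, min_le_left _ _, min_le_right _ _⟩
  obtain ⟨C, hC0, hC⟩ := boundary_terms_le hc (div_pos hθ0 hR0)
  refine ⟨2 * μ, 2 * (-2 * a * μ), 2 * (μ * c2 + ν), 2 * (-μ * c2 - 1), 2 * (1 + ν), 2 * (R * C),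
    by positivity, ?_⟩
  intro ι _ S Δ H K T f e b g u y ℓ τ hf hb hu hy hg hℓ hτ hΔ hS hK
  have main : ∀ k, μ * c1 * (f k * b k) + 1 / 2 * f k ^ 2 ≤
      μ * (S k - Δ k ^ 2 - ℓ * (b k * u k) / 2 - Δ k * g k) +
      (-2 * a * μ) * (H k + b k * g k / 2 + b k * Δ k / 2 - b k ^ 2 / 2) +
      (μ * c2 + ν) * (T k * Δ k + T k * g k - τ * (b k * u k) / 2) +
      (-μ * c2 - 1) * (f k * Δ k + K k + f k * g k) +
      (1 + ν) * (f k * T k + τ * (u k * f k / (p + 1))) + (μ * c2 + 1) * K k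
      + R * C * (y k ^ 2 + e k ^ 2) := by
    intro k
    have hS := hS k; have hΔ := hΔ k; have hτ := hτ k; have hℓ := hℓ k
    have hB := hC (T k) (b k) (f k) (e k) (g k) (y k) (hb k) (hy k) (hg k)
    have hf := hf k; have hb := hb k; have hu := hu k; have hy := hy k
    generalize S k = S, Δ k = Δ, H k = H, K k = K, T k = T, f k = f, e k = e, b k = b, g k = g,
      u k = u, y k = y at *
    obtain ⟨Z, hZ⟩ : ∃ Z, Z = |T| * |g| + |f| * |g| + b * |g| + |e| * |g| + b * y + |f| * y
      + b * |e| + |f| * |e| + |T| * |e| + e ^ 2 := ⟨_, rfl⟩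
    rw [← hZ] at hB
    obtain ⟨BdB, BdC, BdD⟩ := residual_terms_le hc c1n c2n ha hp hf hb hu hy hℓ hτ hΔ hZ
    rw [← hM] at BdB BdC BdD
    clear hZ hℓ hτ
    have hS' : (α * b ^ 2 + c1 * (f * b)) - (c2 * Δ ^ 2 + c1 * (b * Δ) + c1 * (f * b)
        + (S - Δ ^ 2 - ℓ * (b * u) / 2 - Δ * g)
        - 2 * a * (H + b * g / 2 + b * Δ / 2 - b ^ 2 / 2) + ℓ * (b * u) / 2 + Δ * g + a * (b * g))
        ≤ 0 := by
      have : (α * b ^ 2 + c1 * (f * b)) - (c2 * Δ ^ 2 + c1 * (b * Δ) + c1 * (f * b)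
        + (S - Δ ^ 2 - ℓ * (b * u) / 2 - Δ * g)
        - 2 * a * (H + b * g / 2 + b * Δ / 2 - b ^ 2 / 2) + ℓ * (b * u) / 2 + Δ * g + a * (b * g))
        = (Δ - a * b) ^ 2 / n - (S - 2 * a * H + a ^ 2 * b ^ 2) := by
        rw [hα, hc1, hc2]; field_simp; ring
      rw [this]; linarith
    have Bk : α * b ^ 2 + c1 * (f * b) ≤ c1 * (b * T)
        + (S - Δ ^ 2 - ℓ * (b * u) / 2 - Δ * g)
        - 2 * a * (H + b * g / 2 + b * Δ / 2 - b ^ 2 / 2)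
        + c2 * ((T * Δ + T * g - τ * (b * u) / 2) - (f * Δ + K + f * g)) + c2 * K + M * Z := by
      have e1 : c2 * Δ ^ 2 = c2 * ((T - f - e) * Δ) := by rw [← hΔ]; ring
      have e2 : c1 * (b * Δ) + c1 * (f * b) = c1 * (b * T) - c1 * (b * e) := by rw [hΔ]; ring
      linarith only [hS', BdB, e1, e2]
    have Ck : f ^ 2 ≤ (f * T + τ * (u * f / (p + 1))) - (f * Δ + K + f * g) + K + M * Z := by
      have e1 : f ^ 2 = f * T - f * Δ - f * e := by rw [hΔ]; ring
      rw [e1]; linarith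
    have Dk : T ^ 2 ≤ (T * Δ + T * g - τ * (b * u) / 2) + (f * T + τ * (u * f / (p + 1)))
        + M * Z := by
      have e1 : T ^ 2 = T * Δ + f * T + T * e := by rw [hΔ]; ring
      rw [e1]; linarith
    have Bk' := mul_le_mul_of_nonneg_left Bk μp.le
    have Dk' := mul_le_mul_of_nonneg_left Dk νp.le
    have hRZ : R * Z ≤ θ * (T ^ 2 + b ^ 2 + f ^ 2) + R * C * (y ^ 2 + e ^ 2) := by
      have := mul_le_mul_of_nonneg_left hB hR0.le
      have e1 : R * (θ / R * (T ^ 2 + b ^ 2 + f ^ 2) + C * (y ^ 2 + e ^ 2)) =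
        θ * (T ^ 2 + b ^ 2 + f ^ 2) + R * C * (y ^ 2 + e ^ 2) := by field_simp
      linarith
    have hbT : μ * (c1 * (b * T)) ≤ μ * α / 2 * b ^ 2 + (ν - 1) * T ^ 2 := by
      have h1 := mul_le_young b (c1 * T) (η := α / 2) (by positivity)
      have h2 := mul_le_mul_of_nonneg_left h1 μp.le
      have e1 : μ * (α / 2 * b ^ 2 + (c1 * T) ^ 2 / (4 * (α / 2))) =
        μ * α / 2 * b ^ 2 + (ν - 1) * T ^ 2 := by rw [hν]; field_simp; ring
      rw [← e1]
      linarith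
    have t1 := mul_le_mul_of_nonneg_right hθ1 (sq_nonneg T)
    have t2 := mul_le_mul_of_nonneg_right hθ1 (sq_nonneg f)
    have t3 := mul_le_mul_of_nonneg_right hθ2 (sq_nonneg b)
    have e3 : R * Z = μ * (M * Z) + M * Z + ν * (M * Z) := by rw [hR]; ring
    have t4 := sq_nonneg T
    linarith
  have hsum := Finset.sum_le_sum (s := Finset.univ) fun k _ => main k
  simp only [Finset.sum_add_distrib, ← Finset.mul_sum, ← Finset.sum_div] at hsum
  have hK' := mul_le_mul_of_nonneg_left hK (show 0 ≤ μ * c2 + 1 by positivity)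
  have e1 : (μ * c2 + 1) * (p * ∑ k, f k * b k) = μ * c1 * ∑ k, f k * b k := by
    have : (μ * c2 + 1) * p = μ * c1 := by linarith
    rw [← this]; ring
  simp only [Finset.sum_add_distrib]
  linarith

/-- The nonlinearity of the system. -/
noncomputable def src {m : ℕ} (r : ℝ) (β : Fin m → Fin m → ℝ) (a : Fin m → ℝ) (i : Fin m) : ℝ :=
  ∑ j, β i j * a i ^ r * a j ^ (r + 1)

section Source

variable {m : ℕ} {r : ℝ} {β : Fin m → Fin m → ℝ}

theorem coeff_nonneg (hoff : ∀ i j, i ≠ j → 0 ≤ β i j) (hdiag : ∀ i, 0 < β i i) (i j : Fin m) :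
    0 ≤ β i j := by
  by_cases h : i = j
  · subst h; exact (hdiag i).le
  · exact hoff i j h

theorem src_nonneg (hβ : ∀ i j, 0 ≤ β i j) {a : Fin m → ℝ} (ha : ∀ i, 0 ≤ a i) (i : Fin m) :
    0 ≤ src r β a i :=
  Finset.sum_nonneg fun j _ => mul_nonneg (mul_nonneg (hβ i j) (rpow_nonneg (ha i) _))
    (rpow_nonneg (ha j) _)

theorem le_src (hr : 0 < r) (hβ : ∀ i j, 0 ≤ β i j) {a : Fin m → ℝ} (ha : ∀ i, 0 ≤ a i)
    (i : Fin m) : β i i * a i ^ (2 * r + 1) ≤ src r β a i := by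
  have h : β i i * a i ^ (2 * r + 1) = β i i * a i ^ r * a i ^ (r + 1) := by
    rw [mul_assoc, ← rpow_add_of_nonneg (ha i) hr.le (by linarith)]; ring_nf
  rw [h]
  exact Finset.single_le_sum (f := fun j => β i j * a i ^ r * a j ^ (r + 1))
    (fun j _ => mul_nonneg (mul_nonneg (hβ i j) (rpow_nonneg (ha i) _)) (rpow_nonneg (ha j) _))
    (Finset.mem_univ i)

variable {X : Type*} [NormedAddCommGroup X] [NormedSpace ℝ X] {v : Fin m → X → ℝ}

theorem contDiff_src (hv : ∀ i, ContDiff ℝ ∞ (v i)) (hpos : ∀ i z, 0 < v i z) (i : Fin m) :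
    ContDiff ℝ ∞ (fun z => src r β (fun j => v j z) i) :=
  ContDiff.sum fun j _ => (contDiff_const.mul ((hv i).rpow_const_of_ne fun z => (hpos i z).ne')).mul
    ((hv j).rpow_const_of_ne fun z => (hpos j z).ne')

theorem dd_src (hv : ∀ i, ContDiff ℝ ∞ (v i)) (hpos : ∀ i z, 0 < v i z) (w : X) (i : Fin m)
    (z : X) : dd w (fun z => src r β (fun j => v j z) i) z =
      ∑ j, β i j * (r * v i z ^ (r - 1) * v j z ^ (r + 1) * dd w (v i) z
        + (r + 1) * v i z ^ r * v j z ^ r * dd w (v j) z) := by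
  have hs : ∀ (s : ℝ) j, ContDiff ℝ ∞ (fun z => v j z ^ s) := fun s j =>
    ContDiff.rpow_const_of_ne (hv j) fun z => (hpos j z).ne'
  unfold src
  rw [dd_sum _ _ fun j => (contDiff_const.mul (hs r i)).mul (hs (r + 1) j)]
  refine Finset.sum_congr rfl fun j _ => ?_
  rw [dd_mul _ (contDiff_const.mul (hs r i)) (hs (r + 1) j), dd_const_mul _ _ (hs r i),
    dd_rpow _ _ (hv i) (hpos i), dd_rpow _ _ (hv j) (hpos j)]
  rw [show r + 1 - 1 = r by ring]; ring

theorem sum_dd_src_mul_le (hr : 0 < r) (hsym : ∀ i j, β i j = β j i)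
    (hoff : ∀ i j, i ≠ j → 0 ≤ β i j)
    (hv : ∀ i, ContDiff ℝ ∞ (v i)) (hpos : ∀ i z, 0 < v i z) (w : X) (z : X) :
    ∑ i, dd w (fun z => src r β (fun j => v j z) i) z * dd w (v i) z ≤
      (2 * r + 1) * ∑ i, src r β (fun j => v j z) i * (dd w (v i) z ^ 2 / v i z) := by
  have e1 : ∀ i, v i z ^ (r - 1) = v i z ^ r * (v i z)⁻¹ := fun i => by
    rw [rpow_sub_one (hpos i z).ne', div_eq_mul_inv]
  have e2 : ∀ i, v i z ^ (r + 1) = v i z ^ r * v i z := fun i => by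
    rw [rpow_add_one (hpos i z).ne']
  simp only [dd_src hv hpos]
  simp only [src, Finset.sum_mul, Finset.mul_sum, e1, e2]
  generalize hP : (fun i => dd w (v i) z) = P
  have hP' : ∀ i, dd w (v i) z = P i := fun i => congrFun hP i
  generalize hV : (fun i => v i z) = V
  have hV' : ∀ i, v i z = V i := fun i => congrFun hV i
  have hVp : ∀ i, 0 < V i := fun i => hV' i ▸ hpos i z
  generalize hR : (fun i => V i ^ r) = R
  have hR' : ∀ i, V i ^ r = R i := fun i => congrFun hR i
  have hRp : ∀ i, 0 < R i := fun i => hR' i ▸ rpow_pos_of_pos (hVp i) r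
  simp only [hP', hV', hR']
  clear hP hP' hV hV' hR hR' hpos hv e1 e2
  have hswap : ∀ G : Fin m → Fin m → ℝ, ∑ i, ∑ j, G i j = ∑ i, ∑ j, (G i j + G j i) / 2 := by
    intro G
    simp only [← Finset.sum_div, Finset.sum_add_distrib]
    rw [Finset.sum_comm (f := fun i j => G j i)]; ring
  rw [hswap, hswap (fun i j => _ * _)]
  refine Finset.sum_le_sum fun i _ => Finset.sum_le_sum fun j _ => ?_
  rw [hsym j i]
  have hi := hVp i; have hj := hVp j; have ri := hRp i; have rj := hRp j
  by_cases hij : i = j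
  · subst hij
    apply le_of_eq
    field_simp; ring
  · have hb := hoff i j hij
    have key : 0 ≤ β i j * (R i * R j * (r + 1)) * ((P i * V j - P j * V i) ^ 2 / (V i * V j)) := by
      have : 0 ≤ r + 1 := by linarith
      positivity
    refine le_of_sub_nonneg (le_of_le_of_eq (div_nonneg key zero_le_two) ?_)
    field_simp; ring

theorem dd_potential (hr : 0 < r) (hsym : ∀ i j, β i j = β j i)
    (hv : ∀ i, ContDiff ℝ ∞ (v i)) (hpos : ∀ i z, 0 < v i z) (w : X) (z : X) :
    dd w (fun z => (∑ i, v i z * src r β (fun j => v j z) i) / (2 * r + 1 + 1)) z =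
      ∑ i, src r β (fun j => v j z) i * dd w (v i) z := by
  have hs := contDiff_src (r := r) (β := β) hv hpos
  have e0 : (fun z => (∑ i, v i z * src r β (fun j => v j z) i) / (2 * r + 1 + 1)) =
      fun z => (2 * r + 1 + 1)⁻¹ * ∑ i, v i z * src r β (fun j => v j z) i := by
    funext z; rw [div_eq_inv_mul]
  rw [e0, dd_const_mul _ _ (ContDiff.sum fun i _ => (hv i).mul (hs i)),
    dd_sum _ _ fun i => (hv i).mul (hs i)]
  simp only [dd_mul _ (hv _) (hs _), dd_src hv hpos]
  simp only [src]
  have e1 : ∀ i, v i z ^ (r - 1) = v i z ^ r * (v i z)⁻¹ := fun i => by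
    rw [rpow_sub_one (hpos i z).ne', div_eq_mul_inv]
  have e2 : ∀ i, v i z ^ (r + 1) = v i z ^ r * v i z := fun i => by
    rw [rpow_add_one (hpos i z).ne']
  simp only [e1, e2, Finset.sum_mul, Finset.mul_sum, ← Finset.sum_add_distrib]
  have hswap : ∀ G : Fin m → Fin m → ℝ, ∑ i, ∑ j, G i j = ∑ i, ∑ j, (G i j + G j i) / 2 := by
    intro G
    simp only [← Finset.sum_div, Finset.sum_add_distrib]
    rw [Finset.sum_comm (f := fun i j => G j i)]; ring
  rw [hswap, hswap (fun i j => _ * dd w (v i) z)]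
  refine Finset.sum_congr rfl fun i _ => Finset.sum_congr rfl fun j _ => ?_
  rw [hsym j i]
  have := (hpos i z).ne'; have := (hpos j z).ne'
  have : 2 * r + 1 + 1 ≠ 0 := by positivity
  field_simp; ring

end Source

section FiniteSums

variable {N : ℕ} (D : Fin N → Fin N → ℝ) (P g h : Fin N → ℝ) (φ u : ℝ)

theorem sum_sq_trace_le (M : Fin N → Fin N → ℝ) :
    (∑ i, M i i) ^ 2 / N ≤ ∑ i, ∑ j, M i j ^ 2 := by
  have h1 : (∑ i, M i i) ^ 2 ≤ N * ∑ i, M i i ^ 2 := by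
    simpa using sq_sum_le_card_mul_sum_sq (s := Finset.univ) (f := fun i => M i i)
  have h2 : ∑ i, M i i ^ 2 ≤ ∑ i, ∑ j, M i j ^ 2 := Finset.sum_le_sum fun i _ =>
    Finset.single_le_sum (f := fun j => M i j ^ 2) (fun j _ => sq_nonneg _) (Finset.mem_univ i)
  rcases Nat.eq_zero_or_pos N with h0 | h0
  · subst h0; simp
  · rw [div_le_iff₀ (by exact_mod_cast h0)]
    nlinarith [h1, mul_le_mul_of_nonneg_left h2 (Nat.cast_nonneg (α := ℝ) N)]

theorem trace_sub_sq_le (a : ℝ) :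
    (∑ i, D i i - a * ∑ i, P i ^ 2 / u) ^ 2 / N ≤
      ∑ i, ∑ j, D i j ^ 2 - 2 * a * ∑ i, ∑ j, D i j * P i * P j / u
        + a ^ 2 * (∑ i, P i ^ 2 / u) ^ 2 := by
  have h := sum_sq_trace_le fun i j => D i j - a * (P i * P j / u)
  have e1 : ∑ i, (D i i - a * (P i * P i / u)) = ∑ i, D i i - a * ∑ i, P i ^ 2 / u := by
    simp only [Finset.sum_sub_distrib, Finset.mul_sum, pow_two]
  have e2 : ∑ i, ∑ j, (D i j - a * (P i * P j / u)) ^ 2 =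
      ∑ i, ∑ j, D i j ^ 2 - 2 * a * ∑ i, ∑ j, D i j * P i * P j / u
        + a ^ 2 * (∑ i, P i ^ 2 / u) ^ 2 := by
    rw [pow_two (∑ i, P i ^ 2 / u), Finset.sum_mul_sum]
    simp only [Finset.mul_sum, ← Finset.sum_sub_distrib, ← Finset.sum_add_distrib]
    refine Finset.sum_congr rfl fun i _ => Finset.sum_congr rfl fun j _ => ?_
    ring
  rw [e1, e2] at h
  exact h

theorem sum_hessian_eq : ∑ i, ∑ j, (φ * (D i j ^ 2 - D i i * D j j) - h i * P j ^ 2 / 2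
      - g j * P j * D i i) =
    φ * (∑ i, ∑ j, D i j ^ 2 - (∑ i, D i i) ^ 2) - (∑ i, h i) * (∑ j, P j ^ 2) / 2
      - (∑ j, g j * P j) * ∑ i, D i i := by
  simp only [Finset.sum_sub_distrib, ← Finset.mul_sum, ← Finset.sum_mul, ← Finset.sum_div]
  ring

theorem sum_cross_eq : ∑ i, ∑ j, (φ * (D i j * P i * P j / u) + P i ^ 2 / u * (g j * P j) / 2
      + φ * (P i ^ 2 / u) * D j j / 2 - φ * (P i ^ 2 / u) * (P j ^ 2 / u) / 2) =
    φ * (∑ i, ∑ j, D i j * P i * P j / u) + (∑ i, P i ^ 2 / u) * (∑ j, g j * P j) / 2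
      + φ * (∑ i, P i ^ 2 / u) * (∑ j, D j j) / 2 - φ * (∑ i, P i ^ 2 / u) ^ 2 / 2 := by
  simp only [Finset.sum_sub_distrib, Finset.sum_add_distrib, ← Finset.mul_sum, ← Finset.sum_mul,
    ← Finset.sum_div]
  ring

theorem sum_time_eq (T φt : ℝ) : ∑ i, (φ * T * D i i + T * (g i * P i) - φt * P i ^ 2 / 2) =
    φ * T * (∑ i, D i i) + T * (∑ j, g j * P j) - φt * (∑ j, P j ^ 2) / 2 := by
  simp only [Finset.sum_sub_distrib, Finset.sum_add_distrib, ← Finset.mul_sum, ← Finset.sum_div]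

theorem sum_source_eq (f : ℝ) : ∑ i, (φ * f * D i i + φ * (h i * P i) + f * (g i * P i)) =
    φ * f * (∑ i, D i i) + φ * (∑ j, h j * P j) + f * (∑ j, g j * P j) := by
  simp only [Finset.sum_add_distrib, ← Finset.mul_sum]

end FiniteSums

/-- Young's inequality in the form needed to absorb the zero order terms. -/
theorem pow_four_mul_sq_le {p δ : ℝ} (hp : 1 < p) (hδ : 0 < δ) : ∃ K : ℝ, 0 ≤ K ∧
    ∀ m u : ℝ, 0 ≤ m → 0 ≤ u →
      (m ^ 2 * u) ^ 2 ≤ δ * (u ^ p) ^ 2 + K * m ^ (4 * (p / (p - 1))) := by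
  have hp0 : 0 < p := by linarith
  have hc : p.HolderConjugate (p / (p - 1)) := Real.HolderConjugate.conjExponent hp
  set ε := (δ * p) ^ (1 / p) with hε
  have hε0 : 0 < ε := rpow_pos_of_pos (by positivity) _
  have hεp : ε ^ p = δ * p := by
    rw [hε, ← rpow_mul (by positivity), one_div_mul_cancel hp0.ne', rpow_one]
  set q := p / (p - 1) with hq
  have hq0 : 0 < q := hc.symm.pos
  refine ⟨(1 / ε) ^ q / q, by positivity, fun m u hm hu => ?_⟩
  have := Real.young_inequality_of_nonneg (a := ε * u ^ 2) (b := 1 / ε * m ^ 4)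
    (by positivity) (by positivity) hc
  have e1 : ε * u ^ 2 * (1 / ε * m ^ 4) = (m ^ 2 * u) ^ 2 := by field_simp
  have e2 : (ε * u ^ 2) ^ p / p = δ * (u ^ p) ^ 2 := by
    have : (u ^ 2) ^ p = (u ^ p) ^ 2 := by
      rw [← rpow_natCast, ← rpow_natCast, ← rpow_mul hu, ← rpow_mul hu, mul_comm]
    rw [mul_rpow hε0.le (by positivity), hεp, this]
    field_simp
  have e3 : (1 / ε * m ^ 4) ^ q / q = (1 / ε) ^ q / q * m ^ (4 * q) := by
    rw [mul_rpow (by positivity) (by positivity), ← rpow_natCast m 4, ← rpow_mul hm]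
    push_cast; ring
  rw [e1, e2, e3] at this
  exact this

section Estimate

variable {X : Type*} [NormedAddCommGroup X] [NormedSpace ℝ X]

theorem dd_dd_pow {f : X → ℝ} (w : X) (n : ℕ) (hf : ContDiff ℝ ∞ f) (z : X) :
    dd w (dd w (fun z => f z ^ n)) z = n * ((n - 1 : ℕ) * f z ^ (n - 1 - 1) * dd w f z ^ 2
      + f z ^ (n - 1) * dd w (dd w f) z) := by
  have e : dd w (fun z => f z ^ n) = fun z => n * (f z ^ (n - 1) * dd w f z) := by
    funext z; rw [dd_pow _ _ hf]; ring
  have h1 := contDiff_dd w hf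
  rw [e, dd_const_mul _ _ ((hf.pow _).mul h1), dd_mul _ (hf.pow _) h1, dd_pow _ _ hf]
  ring

/-- The defect of `v` as a solution of the system. -/
noncomputable def defect {N m : ℕ} (r : ℝ) (β : Fin m → Fin m → ℝ) (w : Fin N → X) (τ : X)
    (v : Fin m → X → ℝ) (k : Fin m) (z : X) : ℝ :=
  dd τ (v k) z - ∑ i, dd (w i) (dd (w i) (v k)) z - src r β (fun j => v j z) k

theorem continuous_defect {N m : ℕ} {r : ℝ} {β : Fin m → Fin m → ℝ} (w : Fin N → X) (τ : X)
    {v : Fin m → X → ℝ} (hv : ∀ i, ContDiff ℝ ∞ (v i)) (hpos : ∀ i z, 0 < v i z) (k : Fin m) :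
    Continuous (defect r β w τ v k) :=
  ((contDiff_dd τ (hv k)).continuous.sub (continuous_finsetSum _ fun _ _ =>
    (contDiff_dd _ (contDiff_dd _ (hv k))).continuous)).sub (contDiff_src hv hpos k).continuous

/-- Facts about a power of a cutoff function, at a point where it does not vanish. -/
theorem cutoff_pow_bounds {N q : ℕ} (hN : 1 ≤ N) (hq : 3 ≤ q) {χ κ : ℝ} (hχ0 : 0 < χ)
    (hχ1 : χ ≤ 1) (hκ : 0 < κ) {g h P : Fin N → ℝ} {t u : ℝ} (hg : ∀ i, |g i| ≤ κ)
    (hh : ∀ i, |h i| ≤ κ ^ 2) (ht : |t| ≤ κ ^ 2) (hu : 0 < u) :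
    (q / χ * ∑ i, g i * P i) ^ 2 ≤ N * q ^ 2 * (∑ i, P i ^ 2 / u) * ((κ / χ) ^ 2 * u) ∧
    |∑ i, (q * ((q - 1 : ℕ) / χ ^ 2 * g i ^ 2 + h i / χ))| * u ≤ N * q ^ 2 * ((κ / χ) ^ 2 * u) ∧
    |q / χ * t| * u ≤ N * q ^ 2 * ((κ / χ) ^ 2 * u) := by
  have hN' : (1 : ℝ) ≤ N := by exact_mod_cast hN
  have hq' : (3 : ℝ) ≤ q := by exact_mod_cast hq
  have hq0 : (0 : ℝ) < q := by linarith
  refine ⟨?_, ?_, ?_⟩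
  · have h1 : (∑ i, g i * P i) ^ 2 ≤ N * ∑ i, (g i * P i) ^ 2 := by
      simpa using sq_sum_le_card_mul_sum_sq (s := Finset.univ) (f := fun i => g i * P i)
    have h2 : ∑ i, (g i * P i) ^ 2 ≤ κ ^ 2 * ∑ i, P i ^ 2 := by
      rw [Finset.mul_sum]
      refine Finset.sum_le_sum fun i _ => ?_
      rw [mul_pow]
      exact mul_le_mul_of_nonneg_right (sq_le_sq.2 (by rw [abs_of_pos hκ]; exact hg i))
        (sq_nonneg _)
    have h3 : (∑ i, g i * P i) ^ 2 ≤ N * (κ ^ 2 * ∑ i, P i ^ 2) :=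
      h1.trans (mul_le_mul_of_nonneg_left h2 (by positivity))
    have e : N * q ^ 2 * (∑ i, P i ^ 2 / u) * ((κ / χ) ^ 2 * u) =
        (q / χ) ^ 2 * (N * (κ ^ 2 * ∑ i, P i ^ 2)) := by
      rw [← Finset.sum_div]; field_simp
    rw [e, mul_pow]
    exact mul_le_mul_of_nonneg_left h3 (by positivity)
  · rw [← mul_assoc]
    refine mul_le_mul_of_nonneg_right ?_ hu.le
    refine (Finset.abs_sum_le_sum_abs _ _).trans ?_
    have : ∀ i ∈ Finset.univ, |(q : ℝ) * ((q - 1 : ℕ) / χ ^ 2 * g i ^ 2 + h i / χ)| ≤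
        q ^ 2 * (κ / χ) ^ 2 := by
      intro i _
      rw [abs_mul, abs_of_pos hq0]
      have a1 : |(q - 1 : ℕ) / χ ^ 2 * g i ^ 2| ≤ (q - 1) * (κ / χ) ^ 2 := by
        rw [abs_of_nonneg (by positivity), Nat.cast_sub (by omega), div_pow]
        have : g i ^ 2 ≤ κ ^ 2 := sq_le_sq.2 (by rw [abs_of_pos hκ]; exact hg i)
        push_cast
        rw [div_mul_eq_mul_div, mul_div_assoc]
        exact mul_le_mul_of_nonneg_left (by gcongr) (by linarith)
      have a2 : |h i / χ| ≤ (κ / χ) ^ 2 := by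
        rw [abs_div, abs_of_pos hχ0, div_pow]
        refine div_le_div₀ (by positivity) (hh i) (by positivity) ?_
        nlinarith
      have := abs_add_le ((q - 1 : ℕ) / χ ^ 2 * g i ^ 2) (h i / χ)
      have : |((q - 1 : ℕ) / χ ^ 2 * g i ^ 2) + (h i / χ)| ≤ q * (κ / χ) ^ 2 := by linarith
      calc _ ≤ (q : ℝ) * (q * (κ / χ) ^ 2) := mul_le_mul_of_nonneg_left this hq0.le
        _ = _ := by ring
    refine (Finset.sum_le_sum this).trans (le_of_eq ?_)
    simp; ring
  · rw [← mul_assoc]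
    refine mul_le_mul_of_nonneg_right ?_ hu.le
    rw [abs_mul, abs_of_pos (by positivity), div_pow]
    have h1 : q / χ * |t| ≤ q / χ * κ ^ 2 := mul_le_mul_of_nonneg_left ht (by positivity)
    refine h1.trans ?_
    rw [div_mul_eq_mul_div, ← mul_div_assoc]
    refine div_le_div₀ (by positivity) ?_ (by positivity) (by nlinarith)
    refine mul_le_mul_of_nonneg_right ?_ (by positivity)
    nlinarith

end Estimate

theorem factor_sums {ι : Type*} [Fintype ι] (φ x1 x2 x3 x4 x5 ℓ τ G : ℝ)
    (S Δ H K T f b g u : ι → ℝ) :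
    x1 * ∑ k, (φ * (S k - Δ k ^ 2) - φ * ℓ * (b k * u k) / 2 - φ * g k * Δ k) +
      x2 * ∑ k, (φ * H k + b k * (φ * g k) / 2 + φ * b k * Δ k / 2 - φ * b k ^ 2 / 2) +
      x3 * ∑ k, (φ * T k * Δ k + T k * (φ * g k) - φ * τ * (b k * u k) / 2) +
      x4 * ∑ k, (φ * f k * Δ k + φ * K k + f k * (φ * g k)) +
      x5 * (φ * ∑ k, f k * T k + φ * τ * G) =
    φ * (x1 * ∑ k, (S k - Δ k ^ 2 - ℓ * (b k * u k) / 2 - Δ k * g k) +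
      x2 * ∑ k, (H k + b k * g k / 2 + b k * Δ k / 2 - b k ^ 2 / 2) +
      x3 * ∑ k, (T k * Δ k + T k * g k - τ * (b k * u k) / 2) +
      x4 * ∑ k, (f k * Δ k + K k + f k * g k) +
      x5 * (∑ k, f k * T k + τ * G)) := by
  have hdist : ∀ A B : ι → ℝ, (∀ k, A k = φ * B k) → ∑ k, A k = φ * ∑ k, B k := fun A B h => by
    rw [Finset.mul_sum]; exact Finset.sum_congr rfl fun k _ => h k
  have h1 := hdist (fun k => φ * (S k - Δ k ^ 2) - φ * ℓ * (b k * u k) / 2 - φ * g k * Δ k)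
    (fun k => S k - Δ k ^ 2 - ℓ * (b k * u k) / 2 - Δ k * g k) (fun k => by ring)
  have h2 := hdist
    (fun k => φ * H k + b k * (φ * g k) / 2 + φ * b k * Δ k / 2 - φ * b k ^ 2 / 2)
    (fun k => H k + b k * g k / 2 + b k * Δ k / 2 - b k ^ 2 / 2) (fun k => by ring)
  have h3 := hdist (fun k => φ * T k * Δ k + T k * (φ * g k) - φ * τ * (b k * u k) / 2)
    (fun k => T k * Δ k + T k * g k - τ * (b k * u k) / 2) (fun k => by ring)
  have h4 := hdist (fun k => φ * f k * Δ k + φ * K k + f k * (φ * g k))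
    (fun k => f k * Δ k + K k + f k * g k) (fun k => by ring)
  rw [h1, h2, h3, h4]
  ring

theorem absorb_terms {ι : Type*} [Fintype ι] {φ F G C L ρ σ : ℝ} {Y E : ι → ℝ}
    (h1 : φ * F ≤ φ * (G + C * ∑ k, (Y k + E k)))
    (h2 : φ * (C * ∑ k, Y k) ≤ φ * (1 / 2 * F + L * ρ)) (h3 : L * (φ * ρ) ≤ L * σ) :
    1 / 2 * (φ * F) ≤ φ * G + (C * (φ * ∑ k, E k) + L * σ) := by
  rw [Finset.sum_add_distrib] at h1
  linarith

section Estimate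

variable {X : Type*} [NormedAddCommGroup X] [NormedSpace ℝ X]

theorem dd_pow_eq {f : X → ℝ} (w : X) {q : ℕ} (hq : 3 ≤ q) (hf : ContDiff ℝ ∞ f) {z : X}
    (h0 : 0 < f z) : dd w (fun z => f z ^ q) z = f z ^ q * (q / f z * dd w f z) := by
  rw [dd_pow _ _ hf]
  obtain ⟨q', rfl⟩ : ∃ q', q = q' + 1 := ⟨q - 1, by omega⟩
  rw [Nat.add_sub_cancel, pow_succ]
  field_simp

theorem dd_dd_pow_eq {f : X → ℝ} (w : X) {q : ℕ} (hq : 3 ≤ q) (hf : ContDiff ℝ ∞ f) {z : X}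
    (h0 : 0 < f z) : dd w (dd w (fun z => f z ^ q)) z = f z ^ q *
      (q * ((q - 1 : ℕ) / f z ^ 2 * dd w f z ^ 2 + dd w (dd w f) z / f z)) := by
  rw [dd_dd_pow _ _ hf]
  obtain ⟨q', rfl⟩ : ∃ q', q = q' + 2 := ⟨q - 2, by omega⟩
  rw [show q' + 2 - 1 = q' + 1 by omega, Nat.add_sub_cancel, pow_succ, pow_succ]
  field_simp
  ring

theorem sum_sum_dd_src_mul_le {N m : ℕ} {r : ℝ} {β : Fin m → Fin m → ℝ} (hr : 0 < r)
    (hsym : ∀ i j, β i j = β j i) (hoff : ∀ i j, i ≠ j → 0 ≤ β i j) {v : Fin m → X → ℝ}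
    (hv : ∀ i, ContDiff ℝ ∞ (v i)) (hpos : ∀ i z, 0 < v i z) (w : Fin N → X) (z : X) :
    ∑ k, ∑ i, dd (w i) (fun z => src r β (fun j => v j z) k) z * dd (w i) (v k) z ≤
      (2 * r + 1) * ∑ k, src r β (fun j => v j z) k * ∑ i, dd (w i) (v k) z ^ 2 / v k z := by
  rw [Finset.sum_comm]
  refine (Finset.sum_le_sum fun i _ =>
    sum_dd_src_mul_le (β := β) hr hsym hoff hv hpos (w i) z).trans (le_of_eq ?_)
  rw [← Finset.mul_sum, Finset.sum_comm]
  simp only [Finset.mul_sum]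

end Estimate

set_option maxHeartbeats 1000000 in
/-- The integral estimate for smooth positive approximate solutions (gradient structure). -/
theorem integral_src_sq_le {N m : ℕ} (hN : 1 ≤ N) {r : ℝ} (hr : 0 < r) {β : Fin m → Fin m → ℝ}
    (hsym : ∀ i j, β i j = β j i) (hoff : ∀ i j, i ≠ j → 0 ≤ β i j) (hdiag : ∀ i, 0 < β i i)
    {a : ℝ} (ha : 0 < a) (ha1 : a * ((N : ℝ) - 1) < N)
    (ha2 : (2 * r + 1) * ((N : ℝ) - 1) < (N + 2) * a) {q : ℕ} (hq3 : 3 ≤ q)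
    (hq : 4 * ((2 * r + 1) / (2 * r + 1 - 1)) ≤ q) :
    ∃ C : ℝ, 0 ≤ C ∧ ∀ {X : Type} [NormedAddCommGroup X] [NormedSpace ℝ X] [FiniteDimensional ℝ X]
      [MeasurableSpace X] [BorelSpace X] (μ : Measure X) [μ.IsAddHaarMeasure]
      (w : Fin N → X) (τ : X) (χ : X → ℝ) (κ : ℝ),
      ContDiff ℝ ∞ χ → HasCompactSupport χ → (∀ z, 0 ≤ χ z) → (∀ z, χ z ≤ 1) → 0 < κ →
      (∀ i z, |dd (w i) χ z| ≤ κ) → (∀ i z, |dd (w i) (dd (w i) χ) z| ≤ κ ^ 2) →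
      (∀ z, |dd τ χ z| ≤ κ ^ 2) →
      ∀ v : Fin m → X → ℝ, (∀ i, ContDiff ℝ ∞ (v i)) → (∀ i z, 0 < v i z) →
      ∫ z, χ z ^ q * ∑ k, src r β (fun j => v j z) k ^ 2 ∂μ ≤
        C * (κ ^ (4 * ((2 * r + 1) / (2 * r + 1 - 1))) * μ.real (tsupport χ)
          + ∫ z, χ z ^ q * ∑ k, defect r β w τ v k z ^ 2 ∂μ) := by
  have hN' : (1 : ℝ) ≤ N := by exact_mod_cast hN
  have hp : 1 < 2 * r + 1 := by linarith
  obtain ⟨x1, x2, x3, x4, x5, C0, hC0, hpt⟩ := pointwise_estimate (n := N) (p := 2 * r + 1)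
    (a := a) (c := N * (q : ℝ) ^ 2) hN' hp ha ha1 ha2 (by positivity)
  obtain ⟨b0, hb0, hb⟩ : ∃ b0 : ℝ, 0 < b0 ∧ ∀ k, b0 ≤ β k k := by
    rcases isEmpty_or_nonempty (Fin m) with h | h
    · exact ⟨1, one_pos, fun k => h.elim k⟩
    · obtain ⟨k, hk⟩ := Finite.exists_min fun k => β k k
      exact ⟨β k k, hdiag k, hk⟩
  obtain ⟨K, hK0, hK⟩ := pow_four_mul_sq_le (p := 2 * r + 1) (δ := b0 ^ 2 / (2 * (C0 + 1))) hp
    (by positivity)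
  set s := 4 * ((2 * r + 1) / (2 * r + 1 - 1)) with hs
  refine ⟨2 * (C0 * K * m) + 2 * C0, by positivity, ?_⟩
  intro X _ _ _ _ _ μ _ w τ χ κ hχ hcs hχ0 hχ1 hκ hd hdd hdt v hv hpos
  have hβ := coeff_nonneg hoff hdiag
  have hφ : ContDiff ℝ ∞ fun z => χ z ^ q := hχ.pow q
  have hφc : HasCompactSupport fun z => χ z ^ q := by
    have := hcs.comp_left (g := fun x : ℝ => x ^ q) (by simp; omega)
    exact this
  have hsrc := contDiff_src (r := r) (β := β) hv hpos
  have J1 := (NullInt.sum (μ := μ) (Finset.univ : Finset (Fin m)) fun k =>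
    NullInt.sum (Finset.univ : Finset (Fin N)) fun i =>
      NullInt.sum (Finset.univ : Finset (Fin N)) fun j =>
        nullInt_hessian (w i) (w j) hφ hφc (hv k)).congr fun z => Finset.sum_congr rfl fun k _ =>
    sum_hessian_eq (fun i j => dd (w i) (dd (w j) (v k)) z) (fun i => dd (w i) (v k) z)
      (fun i => dd (w i) (fun z => χ z ^ q) z) (fun i => dd (w i) (dd (w i) fun z => χ z ^ q) z)
      (χ z ^ q)
  have J2 := (NullInt.sum (μ := μ) (Finset.univ : Finset (Fin m)) fun k =>
    NullInt.sum (Finset.univ : Finset (Fin N)) fun i =>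
      NullInt.sum (Finset.univ : Finset (Fin N)) fun j =>
        nullInt_cross (w i) (w j) hφ hφc (hv k) (hpos k)).congr fun z =>
    Finset.sum_congr rfl fun k _ =>
      sum_cross_eq (fun i j => dd (w i) (dd (w j) (v k)) z) (fun i => dd (w i) (v k) z)
        (fun i => dd (w i) (fun z => χ z ^ q) z) (χ z ^ q) (v k z)
  have J3 := (NullInt.sum (μ := μ) (Finset.univ : Finset (Fin m)) fun k =>
    NullInt.sum (Finset.univ : Finset (Fin N)) fun i =>
      nullInt_time (w i) τ hφ hφc (hv k)).congr fun z => Finset.sum_congr rfl fun k _ =>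
    sum_time_eq (fun i j => dd (w i) (dd (w j) (v k)) z) (fun i => dd (w i) (v k) z)
      (fun i => dd (w i) (fun z => χ z ^ q) z) (χ z ^ q) (dd τ (v k) z)
      (dd τ (fun z => χ z ^ q) z)
  have J4 := (NullInt.sum (μ := μ) (Finset.univ : Finset (Fin m)) fun k =>
    NullInt.sum (Finset.univ : Finset (Fin N)) fun i =>
      nullInt_source (w i) hφ hφc (hv k) (hsrc k)).congr fun z => Finset.sum_congr rfl fun k _ =>
    sum_source_eq (fun i j => dd (w i) (dd (w j) (v k)) z) (fun i => dd (w i) (v k) z)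
      (fun i => dd (w i) (fun z => χ z ^ q) z)
      (fun i => dd (w i) (fun z => src r β (fun j => v j z) k) z) (χ z ^ q)
      (src r β (fun j => v j z) k)
  have hF : ContDiff ℝ ∞
      fun z => (∑ i, v i z * src r β (fun j => v j z) i) / (2 * r + 1 + 1) :=
    (ContDiff.sum fun i _ => (hv i).mul (hsrc i)).div_const _
  have J5 := nullInt_mul (μ := μ) τ hφ hφc hF
  have J := ((((J1.const_mul x1).add (J2.const_mul x2)).add (J3.const_mul x3)).add
    (J4.const_mul x4)).add (J5.const_mul x5)
  have iA : Integrable (fun z => 1 / 2 * (χ z ^ q * ∑ k, src r β (fun j => v j z) k ^ 2)) μ := by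
    refine Continuous.integrable_of_hasCompactSupport ?_ (hφc.mul_right.mul_left)
    exact continuous_const.mul (hφ.continuous.mul
      (continuous_finsetSum _ fun k _ => (hsrc k).continuous.pow 2))
  have iE : Integrable (fun z => C0 * (χ z ^ q * ∑ k, defect r β w τ v k z ^ 2)) μ := by
    refine Continuous.integrable_of_hasCompactSupport ?_ (hφc.mul_right.mul_left)
    exact continuous_const.mul (hφ.continuous.mul
      (continuous_finsetSum _ fun k _ => (continuous_defect w τ hv hpos k).pow 2))
  have hmeas : MeasurableSet (tsupport χ) := (isClosed_tsupport χ).measurableSet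
  have iI : Integrable ((tsupport χ).indicator fun _ => C0 * K * m * κ ^ s) μ :=
    (integrable_indicator_iff hmeas).2
      (integrableOn_const (hs := hcs.isCompact.measure_lt_top.ne))
  have key := integral_le_of_nullInt J iA (iE.add iI) ?_
  · have e := integral_add' iE iI
    rw [e, integral_const_mul, integral_const_mul, integral_indicator_const _ hmeas,
      smul_eq_mul] at key
    have h0 : 0 ≤ ∫ z, χ z ^ q * ∑ k, defect r β w τ v k z ^ 2 ∂μ :=
      integral_nonneg fun z => mul_nonneg (pow_nonneg (hχ0 z) _)
        (Finset.sum_nonneg fun k _ => sq_nonneg _)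
    have h1 : 0 ≤ κ ^ s * μ.real (tsupport χ) := by positivity
    have h2 : 0 ≤ C0 * K * m := by positivity
    nlinarith [mul_nonneg hC0 h1, mul_nonneg h2 h0]
  intro z
  simp only [Pi.add_apply]
  rcases (hχ0 z).eq_or_lt with h0 | h0
  · have z1 : χ z ^ q = 0 := by rw [← h0]; exact zero_pow (by omega)
    have z2 : ∀ w', dd w' (fun z => χ z ^ q) z = 0 := fun w' => by
      rw [dd_pow _ _ hχ, ← h0, zero_pow (by omega)]; ring
    have z3 : ∀ w', dd w' (dd w' (fun z => χ z ^ q)) z = 0 := fun w' => by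
      rw [dd_dd_pow _ _ hχ, ← h0, zero_pow (by omega), zero_pow (by omega)]; ring
    have z4 : 0 ≤ (tsupport χ).indicator (fun _ => C0 * K * m * κ ^ s) z :=
      indicator_nonneg (fun _ _ => by positivity) z
    simp only [z1, z2, z3]
    simp [z4]
  · have hmem : z ∈ tsupport χ := subset_tsupport _ (by simpa using h0.ne')
    rw [indicator_of_mem hmem]
    have hbd := fun k => cutoff_pow_bounds hN hq3 h0 (hχ1 z) hκ (fun i => hd i z)
      (fun i => hdd i z) (hdt z) (hpos k z) (P := fun i => dd (w i) (v k) z)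
    have hP := hpt (fun k => ∑ i, ∑ j, dd (w i) (dd (w j) (v k)) z ^ 2)
      (fun k => ∑ i, dd (w i) (dd (w i) (v k)) z)
      (fun k => ∑ i, ∑ j, dd (w i) (dd (w j) (v k)) z * dd (w i) (v k) z * dd (w j) (v k) z / v k z)
      (fun k => ∑ i, dd (w i) (fun z => src r β (fun j => v j z) k) z * dd (w i) (v k) z)
      (fun k => dd τ (v k) z) (fun k => src r β (fun j => v j z) k)
      (fun k => defect r β w τ v k z) (fun k => ∑ i, dd (w i) (v k) z ^ 2 / v k z)
      (fun k => q / χ z * ∑ i, dd (w i) χ z * dd (w i) (v k) z) (fun k => v k z)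
      (fun k => (κ / χ z) ^ 2 * v k z)
      (∑ i, (q * ((q - 1 : ℕ) / χ z ^ 2 * dd (w i) χ z ^ 2 + dd (w i) (dd (w i) χ) z / χ z)))
      (q / χ z * dd τ χ z)
      (fun k => src_nonneg hβ (fun i => (hpos i z).le) k)
      (fun k => Finset.sum_nonneg fun i _ => div_nonneg (sq_nonneg _) (hpos k z).le)
      (fun k => (hpos k z).le) (fun k => mul_nonneg (sq_nonneg _) (hpos k z).le)
      (fun k => (hbd k).1) (fun k => (hbd k).2.1) (fun k => (hbd k).2.2)
      (fun k => by simp only [defect]; ring)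
      (fun k => trace_sub_sq_le (fun i j => dd (w i) (dd (w j) (v k)) z)
        (fun i => dd (w i) (v k) z) (v k z) a)
      (sum_sum_dd_src_mul_le hr hsym hoff hv hpos w z)
    have hy : C0 * ∑ k, ((κ / χ z) ^ 2 * v k z) ^ 2 ≤
        1 / 2 * ∑ k, src r β (fun j => v j z) k ^ 2 + C0 * K * m * (κ / χ z) ^ s := by
      have h1 : ∀ k ∈ Finset.univ, C0 * ((κ / χ z) ^ 2 * v k z) ^ 2 ≤
          1 / 2 * src r β (fun j => v j z) k ^ 2 + C0 * K * (κ / χ z) ^ s := by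
        intro k _
        have h2 := mul_le_mul_of_nonneg_left (hK (κ / χ z) (v k z) (by positivity) (hpos k z).le) hC0
        have h3 := le_src hr hβ (fun i => (hpos i z).le) k (r := r)
        have h4 : b0 * v k z ^ (2 * r + 1) ≤ src r β (fun j => v j z) k :=
          (mul_le_mul_of_nonneg_right (hb k) (rpow_nonneg (hpos k z).le _)).trans h3
        have h5 : (b0 * v k z ^ (2 * r + 1)) ^ 2 ≤ src r β (fun j => v j z) k ^ 2 :=
          pow_le_pow_left₀ (mul_nonneg hb0.le (rpow_nonneg (hpos k z).le _)) h4 2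
        have h6 : C0 * (b0 ^ 2 / (2 * (C0 + 1)) * (v k z ^ (2 * r + 1)) ^ 2) ≤
            1 / 2 * (b0 * v k z ^ (2 * r + 1)) ^ 2 := by
          have : C0 * (b0 ^ 2 / (2 * (C0 + 1)) * (v k z ^ (2 * r + 1)) ^ 2) =
            C0 / (C0 + 1) * (1 / 2 * (b0 * v k z ^ (2 * r + 1)) ^ 2) := by field_simp
          rw [this]
          refine mul_le_of_le_one_left (by positivity) ?_
          rw [div_le_one (by positivity)]; linarith
        linarith
      have := Finset.sum_le_sum h1
      rw [← Finset.mul_sum, Finset.sum_add_distrib, ← Finset.mul_sum] at this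
      simp only [Finset.sum_const, Finset.card_univ, Fintype.card_fin, nsmul_eq_mul] at this
      linarith
    have hχs : χ z ^ q * (κ / χ z) ^ s ≤ κ ^ s := by
      rw [div_rpow hκ.le h0.le, ← mul_div_assoc, div_le_iff₀ (rpow_pos_of_pos h0 _), mul_comm]
      refine mul_le_mul_of_nonneg_left ?_ (rpow_nonneg hκ.le _)
      rw [← rpow_natCast]
      exact rpow_le_rpow_of_exponent_ge h0 (hχ1 z) hq
    have hφ0 : 0 ≤ χ z ^ q := by positivity
    clear hK hpt J J1 J2 J3 J4 J5 iA iE iI hbd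
    have eg := fun w' => dd_pow_eq w' hq3 hχ h0
    have eL := fun w' => dd_dd_pow_eq w' hq3 hχ h0
    simp only [eg, eL]
    rw [dd_potential hr hsym hv hpos]
    have hP' := mul_le_mul_of_nonneg_left hP hφ0
    have hy' := mul_le_mul_of_nonneg_left hy hφ0
    have hχs' := mul_le_mul_of_nonneg_left hχs (show 0 ≤ C0 * K * m by positivity)
    have eb : ∀ k, ∑ j, dd (w j) (v k) z ^ 2 = (∑ i, dd (w i) (v k) z ^ 2 / v k z) * v k z :=
      fun k => by rw [← Finset.sum_div, div_mul_cancel₀ _ (hpos k z).ne']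
    have eG : ∀ k, ∑ j, χ z ^ q * (q / χ z * dd (w j) χ z) * dd (w j) (v k) z =
        χ z ^ q * (q / χ z * ∑ j, dd (w j) χ z * dd (w j) (v k) z) := fun k => by
      simp only [Finset.mul_sum, mul_assoc]
    simp only [eb, eG, ← Finset.mul_sum]
    simp only [← Finset.mul_sum] at hP'
    refine le_trans ?_ (add_le_add (factor_sums (χ z ^ q) x1 x2 x3 x4 x5
      (q * ∑ i, ((q - 1 : ℕ) / χ z ^ 2 * dd (w i) χ z ^ 2 + dd (w i) (dd (w i) χ) z / χ z))
      (q / χ z * dd τ χ z) _ _ _ _ _ _ _ _ _ _).ge le_rfl)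
    exact absorb_terms hP' hy' hχs'

theorem sq_mul_le_young {p δ : ℝ} (hp : 1 < p) (hδ : 0 < δ) : ∃ K : ℝ, 0 ≤ K ∧
    ∀ m u : ℝ, 0 ≤ m → 0 ≤ u → m ^ 2 * u ≤ δ * u ^ p + K * m ^ (2 * (p / (p - 1))) := by
  obtain ⟨K, hK0, hK⟩ := pow_four_mul_sq_le (p := p) (δ := δ ^ 2) hp (by positivity)
  refine ⟨√K, sqrt_nonneg _, fun m u hm hu => ?_⟩
  have h := hK m u hm hu
  have e : m ^ (4 * (p / (p - 1))) = (m ^ (2 * (p / (p - 1)))) ^ 2 := by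
    rw [← rpow_natCast, ← rpow_mul hm]; ring_nf
  have a := rpow_nonneg hm (2 * (p / (p - 1)))
  have b := rpow_nonneg hu p
  have c := sqrt_nonneg K
  refine le_of_sq_le_sq ?_ (by positivity)
  rw [e] at h
  nlinarith [mul_nonneg (mul_nonneg hδ.le b) (mul_nonneg c a), sq_sqrt hK0]

theorem cutoff_young {p b : ℝ} (hp : 1 < p) (hb : 0 < b) (c : ℝ) {q : ℕ} (hq3 : 3 ≤ q)
    (hq : 2 * (p / (p - 1)) ≤ q) (hc : 0 ≤ c) : ∃ K : ℝ, 0 ≤ K ∧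
    ∀ χ κ u f : ℝ, 0 ≤ χ → χ ≤ 1 → 0 ≤ κ → 0 ≤ u → b * u ^ p ≤ f →
      c * (κ ^ 2 * χ ^ (q - 2) * u) ≤ 1 / 2 * (χ ^ q * f) + K * κ ^ (2 * (p / (p - 1))) := by
  obtain ⟨K, hK0, hK⟩ := sq_mul_le_young (p := p) (δ := b / (2 * (c + 1))) hp (by positivity)
  refine ⟨c * K, by positivity, fun χ κ u f h0 h1 hκ hu hf => ?_⟩
  have hu' : 0 ≤ u ^ p := rpow_nonneg hu p
  have hf0 : 0 ≤ f := (mul_nonneg hb.le hu').trans hf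
  have hκ' : 0 ≤ κ ^ (2 * (p / (p - 1))) := rpow_nonneg hκ _
  rcases h0.eq_or_lt with h | h
  · rw [← h, zero_pow (by omega), zero_pow (by omega)]; simp; positivity
  have h2 := mul_le_mul_of_nonneg_left (hK (κ / χ) u (by positivity) hu) (pow_nonneg h0 q)
  have e1 : χ ^ q * ((κ / χ) ^ 2 * u) = κ ^ 2 * χ ^ (q - 2) * u := by
    obtain ⟨q', rfl⟩ : ∃ q', q = q' + 2 := ⟨q - 2, by omega⟩
    rw [Nat.add_sub_cancel]; field_simp; ring
  have e2 : χ ^ q * (κ / χ) ^ (2 * (p / (p - 1))) ≤ κ ^ (2 * (p / (p - 1))) := by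
    rw [div_rpow hκ h.le, ← mul_div_assoc, div_le_iff₀ (rpow_pos_of_pos h _), mul_comm]
    refine mul_le_mul_of_nonneg_left ?_ hκ'
    rw [← rpow_natCast]
    exact rpow_le_rpow_of_exponent_ge h h1 hq
  have e3 : c * (b / (2 * (c + 1)) * u ^ p) ≤ 1 / 2 * f := by
    have : c * (b / (2 * (c + 1)) * u ^ p) = c / (c + 1) * (1 / 2 * (b * u ^ p)) := by field_simp
    rw [this]
    refine (mul_le_of_le_one_left (by positivity) ?_).trans (by linarith)
    rw [div_le_one (by positivity)]; linarith
  have e4 := mul_le_mul_of_nonneg_left e3 (pow_nonneg h0 q)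
  rw [e1] at h2
  nlinarith [mul_le_mul_of_nonneg_left h2 hc, mul_le_mul_of_nonneg_left e2 (mul_nonneg hc hK0)]

section Cutoff

variable {X : Type*} [NormedAddCommGroup X] [NormedSpace ℝ X] {N : ℕ} {χ : X → ℝ} {κ : ℝ}

theorem cutoff_lap_le (hN : 1 ≤ N) {q : ℕ} (hq : 3 ≤ q) (hχ : ContDiff ℝ ∞ χ)
    (hχ0 : ∀ z, 0 ≤ χ z) (hχ1 : ∀ z, χ z ≤ 1) (hκ : 0 < κ) {w : Fin N → X}
    (hd : ∀ i z, |dd (w i) χ z| ≤ κ) (hdd : ∀ i z, |dd (w i) (dd (w i) χ) z| ≤ κ ^ 2) (z : X) :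
    |∑ i, dd (w i) (dd (w i) fun z => χ z ^ q) z| ≤ N * q ^ 2 * (κ ^ 2 * χ z ^ (q - 2)) ∧
    ∀ P : Fin N → ℝ, (∑ i, dd (w i) (fun z => χ z ^ q) z * P i) ^ 2 ≤
      χ z ^ q * (N * q ^ 2 * (κ ^ 2 * χ z ^ (q - 2)) * ∑ i, P i ^ 2) := by
  rcases (hχ0 z).eq_or_lt with h0 | h0
  · have z2 : ∀ w', dd w' (fun z => χ z ^ q) z = 0 := fun w' => by
      rw [dd_pow _ _ hχ, ← h0, zero_pow (by omega)]; ring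
    have z3 : ∀ w', dd w' (dd w' (fun z => χ z ^ q)) z = 0 := fun w' => by
      rw [dd_dd_pow _ _ hχ, ← h0, zero_pow (by omega), zero_pow (by omega)]; ring
    simp [z2, z3, ← h0, zero_pow (show q ≠ 0 by omega), zero_pow (show q - 2 ≠ 0 by omega)]
  have e1 : κ ^ 2 * χ z ^ (q - 2) = χ z ^ q * (κ / χ z) ^ 2 := by
    obtain ⟨q', rfl⟩ : ∃ q', q = q' + 2 := ⟨q - 2, by omega⟩
    rw [Nat.add_sub_cancel]; field_simp; ring
  have hb := fun P => cutoff_pow_bounds hN hq h0 (hχ1 z) hκ (fun i => hd i z)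
    (fun i => hdd i z) (t := 0) (by simp; positivity) (one_pos) (P := P)
  have hp := pow_nonneg (hχ0 z) q
  constructor
  · have h2 := (hb 0).2.1
    simp only [dd_dd_pow_eq _ hq hχ h0, ← Finset.mul_sum, abs_mul, abs_of_nonneg hp] at h2 ⊢
    rw [e1]
    have := mul_le_mul_of_nonneg_left h2 hp
    linarith
  · intro P
    have h2 := (hb P).1
    have e2 : ∑ i, dd (w i) (fun z => χ z ^ q) z * P i =
        χ z ^ q * (q / χ z * ∑ i, dd (w i) χ z * P i) := by
      simp only [dd_pow_eq _ hq hχ h0, Finset.mul_sum]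
      exact Finset.sum_congr rfl fun i _ => by ring
    rw [e1, e2, mul_pow]
    have := mul_le_mul_of_nonneg_left h2 (mul_nonneg hp hp)
    simp only [div_one, mul_one] at this
    linarith

theorem cutoff_time_le (hN : 1 ≤ N) {q : ℕ} (hq : 3 ≤ q) (hχ : ContDiff ℝ ∞ χ)
    (hχ0 : ∀ z, 0 ≤ χ z) (hχ1 : ∀ z, χ z ≤ 1) {τ : X} (hd : ∀ z, |dd τ χ z| ≤ κ ^ 2) (z : X) :
    |dd τ (fun z => χ z ^ q) z| ≤ N * q ^ 2 * (κ ^ 2 * χ z ^ (q - 2)) := by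
  have hN' : (1 : ℝ) ≤ N := by exact_mod_cast hN
  have hq' : (3 : ℝ) ≤ q := by exact_mod_cast hq
  rw [dd_pow _ _ hχ, abs_mul, abs_of_nonneg (mul_nonneg (Nat.cast_nonneg _) (pow_nonneg (hχ0 z) _))]
  have h1 : χ z ^ (q - 1) ≤ χ z ^ (q - 2) := pow_le_pow_of_le_one (hχ0 z) (hχ1 z) (by omega)
  have h2 := pow_nonneg (hχ0 z) (q - 2)
  have h3 := pow_nonneg (hχ0 z) (q - 1)
  have h4 : (q : ℝ) ≤ N * q ^ 2 := by nlinarith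
  calc (q : ℝ) * χ z ^ (q - 1) * |dd τ χ z| ≤ (N * q ^ 2) * χ z ^ (q - 2) * κ ^ 2 := by
        gcongr
        exact hd z
    _ = _ := by ring

theorem dd_half_sq {f : X → ℝ} (w : X) (hf : ContDiff ℝ ∞ f) (z : X) :
    dd w (fun z => 1 / 2 * f z ^ 2) z = f z * dd w f z := by
  rw [dd_const_mul _ _ (hf.pow 2), dd_pow _ _ hf]; norm_num; ring

theorem dd_dd_half_sq {f : X → ℝ} (w : X) (hf : ContDiff ℝ ∞ f) (z : X) :
    dd w (dd w (fun z => 1 / 2 * f z ^ 2)) z = f z * dd w (dd w f) z + dd w f z ^ 2 := by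
  rw [show dd w (fun z => 1 / 2 * f z ^ 2) = fun z => f z * dd w f z from
    funext fun z => dd_half_sq w hf z, dd_mul _ hf (contDiff_dd w hf)]
  ring

end Cutoff

section Null

variable {X : Type*} [NormedAddCommGroup X] [NormedSpace ℝ X] [FiniteDimensional ℝ X]
  [MeasurableSpace X] [BorelSpace X] {μ : Measure X} [μ.IsAddHaarMeasure] {φ f : X → ℝ}

theorem nullInt_second (w : X) (hφ : ContDiff ℝ ∞ φ) (hc : HasCompactSupport φ)
    (hf : ContDiff ℝ ∞ f) :
    NullInt μ (fun z => φ z * dd w (dd w f) z - dd w (dd w φ) z * f z) := by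
  refine ((nullInt_mul (μ := μ) w hφ hc (contDiff_dd w hf)).sub
    (nullInt_mul (μ := μ) w (contDiff_dd w hφ) (hc.dd w) hf)).congr fun z => ?_
  ring

theorem nullInt_laplace {N : ℕ} (w : Fin N → X) (hφ : ContDiff ℝ ∞ φ) (hc : HasCompactSupport φ)
    (hf : ContDiff ℝ ∞ f) :
    NullInt μ (fun z => φ z * (∑ i, dd (w i) (dd (w i) f) z)
      - (∑ i, dd (w i) (dd (w i) φ) z) * f z) := by
  refine (NullInt.sum (μ := μ) (Finset.univ : Finset (Fin N)) fun i =>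
    nullInt_second (w i) hφ hc hf).congr fun z => ?_
  rw [Finset.sum_sub_distrib, Finset.mul_sum, Finset.sum_mul]

end Null

/-- Smooth compactly supported cutoffs with derivatives controlled by `κ` in the directions `w`. -/
structure IsCutoff {X : Type*} [NormedAddCommGroup X] [NormedSpace ℝ X] {N : ℕ} (w : Fin N → X)
    (χ : X → ℝ) (κ : ℝ) : Prop where
  smooth : ContDiff ℝ ∞ χ
  supp : HasCompactSupport χ
  nonneg : ∀ z, 0 ≤ χ z
  le_one : ∀ z, χ z ≤ 1
  pos : 0 < κ
  grad : ∀ i z, |dd (w i) χ z| ≤ κ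
  hess : ∀ i z, |dd (w i) (dd (w i) χ) z| ≤ κ ^ 2

section LowDimension

variable {X : Type*} [NormedAddCommGroup X] [NormedSpace ℝ X] {N : ℕ} {w : Fin N → X} {τ : X}
  {χ : X → ℝ} {κ : ℝ}

theorem IsCutoff.pow_supp (h : IsCutoff w χ κ) {q : ℕ} (hq : 3 ≤ q) :
    HasCompactSupport fun z => χ z ^ q := by
  have := h.supp.comp_left (g := fun x : ℝ => x ^ q) (by simp; omega)
  exact this

theorem le_add_indicator_tsupport {K : ℝ} (hK : 0 ≤ K) {A B : ℝ} {z : X}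
    (hz : χ z ≠ 0 → A ≤ B + K) (h0 : χ z = 0 → A ≤ B) :
    A ≤ B + (tsupport χ).indicator (fun _ => K) z := by
  by_cases hc : χ z = 0
  · have : 0 ≤ (tsupport χ).indicator (fun _ => K) z := indicator_nonneg (fun _ _ => hK) z
    linarith [h0 hc]
  · rw [indicator_of_mem (subset_tsupport _ hc)]
    exact hz hc

variable [FiniteDimensional ℝ X] [MeasurableSpace X] [BorelSpace X] {μ : Measure X}
  [μ.IsAddHaarMeasure]

theorem IsCutoff.integrable (h : IsCutoff w χ κ) {q : ℕ} (hq : q ≠ 0) {g : X → ℝ}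
    (hg : Continuous g) : Integrable (fun z => χ z ^ q * g z) μ := by
  have : HasCompactSupport fun z => χ z ^ q :=
    h.supp.comp_left (g := fun x : ℝ => x ^ q) (by simp [hq])
  exact ((h.smooth.continuous.pow q).mul hg).integrable_of_hasCompactSupport this.mul_right

theorem IsCutoff.integral_indicator (h : IsCutoff w χ κ) (K : ℝ) :
    Integrable ((tsupport χ).indicator fun _ => K) μ ∧
      ∫ z, (tsupport χ).indicator (fun _ => K) z ∂μ = K * μ.real (tsupport χ) := by
  have hmeas : MeasurableSet (tsupport χ) := (isClosed_tsupport χ).measurableSet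
  refine ⟨(integrable_indicator_iff hmeas).2
      (integrableOn_const (hs := h.supp.isCompact.measure_lt_top.ne)), ?_⟩
  rw [integral_indicator_const _ hmeas, smul_eq_mul, mul_comm]

/-- Testing the equation with a power of a cutoff depending on time. -/
theorem integral_src_le {p b : ℝ} (hN : 1 ≤ N) (hp : 1 < p) (hb : 0 < b) {q : ℕ} (hq3 : 3 ≤ q)
    (hq : 2 * (p / (p - 1)) ≤ q) : ∃ C : ℝ, 0 ≤ C ∧
    ∀ {X : Type} [NormedAddCommGroup X] [NormedSpace ℝ X] [FiniteDimensional ℝ X]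
      [MeasurableSpace X] [BorelSpace X] (μ : Measure X) [μ.IsAddHaarMeasure]
      (w : Fin N → X) (τ : X) (χ : X → ℝ) (κ : ℝ), IsCutoff w χ κ →
      (∀ z, |dd τ χ z| ≤ κ ^ 2) →
      ∀ v f : X → ℝ, ContDiff ℝ ∞ v → ContDiff ℝ ∞ f → (∀ z, 0 < v z) →
      (∀ z, b * v z ^ p ≤ f z) →
      ∫ z, χ z ^ q * f z ∂μ + κ ^ 2 * ∫ z, χ z ^ (q - 2) * v z ∂μ ≤
        C * (κ ^ (2 * (p / (p - 1))) * μ.real (tsupport χ)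
          + ∫ z, χ z ^ q * |dd τ v z - ∑ i, dd (w i) (dd (w i) v) z - f z| ∂μ) := by
  obtain ⟨K, hK0, hK⟩ := cutoff_young (p := p) (b := b) hp hb (2 * (N * q ^ 2) + 1 / 2) hq3 hq
    (by positivity)
  refine ⟨2 * K + 2, by positivity, ?_⟩
  intro X _ _ _ _ _ μ _ w τ χ κ h hdt v f hv hf hpos hbf
  have hφ : ContDiff ℝ ∞ fun z => χ z ^ q := h.smooth.pow q
  have hφc := h.pow_supp hq3
  have J := (nullInt_mul (μ := μ) τ hφ hφc hv).sub (nullInt_laplace w hφ hφc hv)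
  set e := fun z => dd τ v z - ∑ i, dd (w i) (dd (w i) v) z - f z with he
  have hec : Continuous e := ((contDiff_dd τ hv).continuous.sub (continuous_finsetSum _ fun i _ =>
    (contDiff_dd _ (contDiff_dd _ hv)).continuous)).sub hf.continuous
  have iF := h.integrable (μ := μ) (q := q) (by omega) hf.continuous
  have iV := h.integrable (μ := μ) (q := q - 2) (by omega) hv.continuous
  have iE := h.integrable (μ := μ) (q := q) (by omega) hec.abs
  obtain ⟨iI, eI⟩ := h.integral_indicator (μ := μ) (K * κ ^ (2 * (p / (p - 1))))
  have hκ : 0 ≤ κ ^ (2 * (p / (p - 1))) := rpow_nonneg h.pos.le _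
  have key := integral_le_of_nullInt J
    ((iF.const_mul (1 / 2)).add (iV.const_mul (1 / 2 * κ ^ 2))) (iE.add iI) fun z => by
      simp only [Pi.add_apply]
      rw [← add_assoc]
      obtain ⟨l1, -⟩ := cutoff_lap_le hN hq3 h.smooth h.nonneg h.le_one h.pos h.grad h.hess z
      have l2 := cutoff_time_le hN hq3 h.smooth h.nonneg h.le_one hdt z
      have l3 := hK (χ z) κ (v z) (f z) (h.nonneg z) (h.le_one z) h.pos.le (hpos z).le (hbf z)
      refine le_add_indicator_tsupport (by positivity) (fun _ => ?_) (fun h0 => ?_)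
      · have l4 := mul_le_mul_of_nonneg_right ((neg_le_abs _).trans l1)
          (hpos z).le
        have l5 := mul_le_mul_of_nonneg_right ((neg_le_abs _).trans l2) (hpos z).le
        have l6 := mul_le_mul_of_nonneg_left (neg_abs_le (e z)) (pow_nonneg (h.nonneg z) q)
        have l7 : χ z ^ q * f z = χ z ^ q * dd τ v z -
          χ z ^ q * ∑ i, dd (w i) (dd (w i) v) z - χ z ^ q * e z := by simp only [he]; ring
        linarith
      · have l4 : dd τ (fun z => χ z ^ q) z = 0 := by
          rw [h0, zero_pow (by omega)] at l2; simpa using l2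
        have l5 : ∑ i, dd (w i) (dd (w i) fun z => χ z ^ q) z = 0 := by
          rw [h0, zero_pow (by omega)] at l1; simpa using l1
        simp only [l4, l5, h0, zero_pow (show q ≠ 0 by omega), zero_pow (show q - 2 ≠ 0 by omega)]
        simp
  rw [integral_add' (iF.const_mul _) (iV.const_mul _), integral_add' iE iI, integral_const_mul,
    integral_const_mul, eI] at key
  have h1 : 0 ≤ ∫ z, χ z ^ q * |e z| ∂μ :=
    integral_nonneg fun z => mul_nonneg (pow_nonneg (h.nonneg z) _) (abs_nonneg _)
  have h2 : 0 ≤ κ ^ (2 * (p / (p - 1))) * μ.real (tsupport χ) := by positivity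
  nlinarith [mul_nonneg hK0 h1]

/-- Testing the equation with a power of a cutoff, keeping the time derivative. -/
theorem integral_src_le_time {p b : ℝ} (hN : 1 ≤ N) (hp : 1 < p) (hb : 0 < b) {q : ℕ}
    (hq3 : 3 ≤ q) (hq : 2 * (p / (p - 1)) ≤ q) : ∃ C : ℝ, 0 ≤ C ∧
    ∀ {X : Type} [NormedAddCommGroup X] [NormedSpace ℝ X] [FiniteDimensional ℝ X]
      [MeasurableSpace X] [BorelSpace X] (μ : Measure X) [μ.IsAddHaarMeasure]
      (w : Fin N → X) (τ : X) (χ : X → ℝ) (κ : ℝ), IsCutoff w χ κ →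
      ∀ v f : X → ℝ, ContDiff ℝ ∞ v → ContDiff ℝ ∞ f → (∀ z, 0 < v z) →
      (∀ z, b * v z ^ p ≤ f z) →
      ∫ z, χ z ^ q * f z ∂μ ≤
        C * (κ ^ (2 * (p / (p - 1))) * μ.real (tsupport χ) + ∫ z, χ z ^ q * |dd τ v z| ∂μ
          + ∫ z, χ z ^ q * |dd τ v z - ∑ i, dd (w i) (dd (w i) v) z - f z| ∂μ) := by
  obtain ⟨K, hK0, hK⟩ := cutoff_young (p := p) (b := b) hp hb (N * q ^ 2) hq3 hq
    (by positivity)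
  refine ⟨2 * K + 2, by positivity, ?_⟩
  intro X _ _ _ _ _ μ _ w τ χ κ h v f hv hf hpos hbf
  have hφ : ContDiff ℝ ∞ fun z => χ z ^ q := h.smooth.pow q
  have hφc := h.pow_supp hq3
  have J := (nullInt_laplace (μ := μ) w hφ hφc hv).const_mul (-1)
  set e := fun z => dd τ v z - ∑ i, dd (w i) (dd (w i) v) z - f z with he
  have hec : Continuous e := ((contDiff_dd τ hv).continuous.sub (continuous_finsetSum _ fun i _ =>
    (contDiff_dd _ (contDiff_dd _ hv)).continuous)).sub hf.continuous
  have iF := h.integrable (μ := μ) (q := q) (by omega) hf.continuous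
  have iT := h.integrable (μ := μ) (q := q) (by omega) (contDiff_dd τ hv).continuous.abs
  have iE := h.integrable (μ := μ) (q := q) (by omega) hec.abs
  obtain ⟨iI, eI⟩ := h.integral_indicator (μ := μ) (K * κ ^ (2 * (p / (p - 1))))
  have hκ : 0 ≤ κ ^ (2 * (p / (p - 1))) := rpow_nonneg h.pos.le _
  have key := integral_le_of_nullInt J (iF.const_mul (1 / 2)) ((iT.add iE).add iI) fun z => by
      simp only [Pi.add_apply]
      rw [← add_assoc]
      obtain ⟨l1, -⟩ := cutoff_lap_le hN hq3 h.smooth h.nonneg h.le_one h.pos h.grad h.hess z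
      have l3 := hK (χ z) κ (v z) (f z) (h.nonneg z) (h.le_one z) h.pos.le (hpos z).le (hbf z)
      refine le_add_indicator_tsupport (by positivity) (fun _ => ?_) (fun h0 => ?_)
      · have l4 := mul_le_mul_of_nonneg_right ((neg_le_abs _).trans l1)
          (hpos z).le
        have l5 := mul_le_mul_of_nonneg_left (le_abs_self (dd τ v z)) (pow_nonneg (h.nonneg z) q)
        have l6 := mul_le_mul_of_nonneg_left (neg_abs_le (e z)) (pow_nonneg (h.nonneg z) q)
        have l7 : χ z ^ q * f z = χ z ^ q * dd τ v z -
          χ z ^ q * ∑ i, dd (w i) (dd (w i) v) z - χ z ^ q * e z := by simp only [he]; ring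
        linarith
      · have l5 : ∑ i, dd (w i) (dd (w i) fun z => χ z ^ q) z = 0 := by
          rw [h0, zero_pow (by omega)] at l1; simpa using l1
        simp only [l5, h0, zero_pow (show q ≠ 0 by omega)]
        simp
  rw [integral_add' (iT.add iE) iI, integral_add' iT iE, integral_const_mul, eI] at key
  have h1 : 0 ≤ ∫ z, χ z ^ q * |e z| ∂μ :=
    integral_nonneg fun z => mul_nonneg (pow_nonneg (h.nonneg z) _) (abs_nonneg _)
  have h3 : 0 ≤ ∫ z, χ z ^ q * |dd τ v z| ∂μ :=
    integral_nonneg fun z => mul_nonneg (pow_nonneg (h.nonneg z) _) (abs_nonneg _)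
  have h2 : 0 ≤ κ ^ (2 * (p / (p - 1))) * μ.real (tsupport χ) := by positivity
  nlinarith [mul_nonneg hK0 h1, mul_nonneg hK0 h3]

/-- Testing the equation with the solution itself. -/
theorem integral_grad_sq_le (hN : 1 ≤ N) {q : ℕ} (hq3 : 3 ≤ q) (h : IsCutoff w χ κ)
    (hdt : ∀ z, |dd τ χ z| ≤ κ ^ 2) {v f : X → ℝ} (hv : ContDiff ℝ ∞ v) (hf : ContDiff ℝ ∞ f)
    (hpos : ∀ z, 0 < v z) (hf0 : ∀ z, 0 ≤ f z) {A : ℝ} (hA : ∀ z ∈ tsupport χ, v z ≤ A) :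
    ∫ z, χ z ^ q * ∑ i, dd (w i) v z ^ 2 ∂μ ≤ (N * q ^ 2 * A) *
      (∫ z, χ z ^ q * f z ∂μ + κ ^ 2 * ∫ z, χ z ^ (q - 2) * v z ∂μ
        + ∫ z, χ z ^ q * |dd τ v z - ∑ i, dd (w i) (dd (w i) v) z - f z| ∂μ) := by
  have hφ : ContDiff ℝ ∞ fun z => χ z ^ q := h.smooth.pow q
  have hφc := h.pow_supp hq3
  have hv2 : ContDiff ℝ ∞ fun z => 1 / 2 * v z ^ 2 := contDiff_const.mul (hv.pow 2)
  have J := ((nullInt_laplace (μ := μ) w hφ hφc hv2).sub (nullInt_mul τ hφ hφc hv2))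
  set e := fun z => dd τ v z - ∑ i, dd (w i) (dd (w i) v) z - f z with he
  have hec : Continuous e := ((contDiff_dd τ hv).continuous.sub (continuous_finsetSum _ fun i _ =>
    (contDiff_dd _ (contDiff_dd _ hv)).continuous)).sub hf.continuous
  have iP := h.integrable (μ := μ) (q := q) (g := fun z => ∑ i, dd (w i) v z ^ 2) (by omega)
    (continuous_finsetSum Finset.univ
    fun i _ => (contDiff_dd (w i) hv).continuous.pow 2)
  have iF := h.integrable (μ := μ) (q := q) (by omega) hf.continuous
  have iV := h.integrable (μ := μ) (q := q - 2) (by omega) hv.continuous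
  have iE := h.integrable (μ := μ) (q := q) (by omega) hec.abs
  have hN' : (1 : ℝ) ≤ N := by exact_mod_cast hN
  have hq' : (3 : ℝ) ≤ q := by exact_mod_cast hq3
  have hc : (1 : ℝ) ≤ N * q ^ 2 := by nlinarith
  have key := integral_le_of_nullInt J iP
    (((iF.add (iV.const_mul (κ ^ 2))).add iE).const_mul (N * q ^ 2 * A)) fun z => by
      simp only [Pi.add_apply]
      obtain ⟨l1, -⟩ := cutoff_lap_le hN hq3 h.smooth h.nonneg h.le_one h.pos h.grad h.hess z
      have l2 := cutoff_time_le hN hq3 h.smooth h.nonneg h.le_one hdt z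
      by_cases h0 : χ z = 0
      · have l4 : dd τ (fun z => χ z ^ q) z = 0 := by
          rw [h0, zero_pow (by omega)] at l2; simpa using l2
        have l5 : ∑ i, dd (w i) (dd (w i) fun z => χ z ^ q) z = 0 := by
          rw [h0, zero_pow (by omega)] at l1; simpa using l1
        simp only [l4, l5, h0, zero_pow (show q ≠ 0 by omega), zero_pow (show q - 2 ≠ 0 by omega)]
        simp
      · have hvA := hA z (subset_tsupport _ h0)
        have hp := pow_nonneg (h.nonneg z) q
        have hp2 := pow_nonneg (h.nonneg z) (q - 2)
        have v2 : v z * v z ≤ A * v z := mul_le_mul_of_nonneg_right hvA (hpos z).le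
        have A0 : 0 ≤ A := (hpos z).le.trans hvA
        have w0 : 0 ≤ κ ^ 2 * χ z ^ (q - 2) := by positivity
        have w1 := mul_le_mul_of_nonneg_left v2 (mul_nonneg (zero_le_one.trans hc) w0)
        have l4 := mul_le_mul_of_nonneg_right ((le_abs_self _).trans l1)
          (show 0 ≤ 1 / 2 * v z ^ 2 by positivity)
        have l5 := mul_le_mul_of_nonneg_right ((le_abs_self _).trans l2)
          (show 0 ≤ 1 / 2 * v z ^ 2 by positivity)
        have l6 := mul_le_mul_of_nonneg_left (le_abs_self (e z)) (mul_nonneg hp (hpos z).le)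
        have l8 := mul_le_mul_of_nonneg_left hvA (mul_nonneg hp (abs_nonneg (e z)))
        have l9 := mul_le_mul_of_nonneg_left hvA (mul_nonneg hp (hf0 z))
        have l10 : A * (χ z ^ q * f z + χ z ^ q * |e z|) ≤
            N * q ^ 2 * (A * (χ z ^ q * f z + χ z ^ q * |e z|)) :=
          le_mul_of_one_le_left (mul_nonneg A0 (add_nonneg (mul_nonneg hp (hf0 z))
            (mul_nonneg hp (abs_nonneg _)))) hc
        have l7 : χ z ^ q * v z * e z = χ z ^ q * (v z * dd τ v z) -
          χ z ^ q * v z * (∑ i, dd (w i) (dd (w i) v) z) - χ z ^ q * v z * f z := by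
          simp only [he]; ring
        simp only [dd_dd_half_sq _ hv, dd_half_sq _ hv, Finset.sum_add_distrib, ← Finset.mul_sum]
        linarith
  rw [integral_const_mul, integral_add' (iF.add (iV.const_mul _)) iE,
    integral_add' iF (iV.const_mul _), integral_const_mul] at key
  exact key

end LowDimension

theorem young_of_sq_le {φ T g B : ℝ} (hφ : 0 ≤ φ) (hB : 0 ≤ B) (h : g ^ 2 ≤ φ * B) :
    -(T * g) ≤ 1 / 4 * (φ * T ^ 2) + B := by
  rcases hφ.eq_or_lt with h0 | h0
  · have h' : g ^ 2 ≤ 0 := by rwa [← h0, zero_mul] at h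
    have : g = 0 := (pow_eq_zero_iff two_ne_zero).1 (le_antisymm h' (sq_nonneg g))
    rw [this, ← h0]; simpa using hB
  · by_contra! hc
    have := mul_lt_mul_of_pos_left hc h0
    nlinarith [sq_nonneg (φ * T / 2 + g)]

section TimeDerivative

variable {X : Type*} [NormedAddCommGroup X] [NormedSpace ℝ X] {N m : ℕ} {w : Fin N → X} {τ : X}
  {χ : X → ℝ} {κ : ℝ} [FiniteDimensional ℝ X] [MeasurableSpace X] [BorelSpace X] {μ : Measure X}
  [μ.IsAddHaarMeasure]

/-- The energy estimate for the time derivative. -/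
theorem integral_time_sq_le (hN : 1 ≤ N) {r : ℝ} (hr : 0 < r) {β : Fin m → Fin m → ℝ}
    (hsym : ∀ i j, β i j = β j i) (hβ : ∀ i j, 0 ≤ β i j)
    {q : ℕ} (hq3 : 3 ≤ q) (h : IsCutoff w χ κ)
    (hdt : ∀ z, |dd τ χ z| ≤ κ ^ 2) {v : Fin m → X → ℝ} (hv : ∀ k, ContDiff ℝ ∞ (v k))
    (hpos : ∀ k z, 0 < v k z) {A : ℝ} (hA : ∀ k, ∀ z ∈ tsupport χ, v k z ≤ A) :
    ∫ z, χ z ^ (q + 2) * ∑ k, dd τ (v k) z ^ 2 ∂μ ≤ 4 * (N * (q + 2 : ℕ) ^ 2) *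
      (κ ^ 2 * (∫ z, χ z ^ q * ∑ k, ∑ i, dd (w i) (v k) z ^ 2 ∂μ +
        A * ∫ z, χ z ^ q * ∑ k, src r β (fun j => v j z) k ∂μ)
        + ∫ z, χ z ^ (q + 2) * ∑ k, defect r β w τ v k z ^ 2 ∂μ) := by
  have hφ : ContDiff ℝ ∞ fun z => χ z ^ (q + 2) := h.smooth.pow (q + 2)
  have hφc := h.pow_supp (show 3 ≤ q + 2 by omega)
  have hsrc := contDiff_src (r := r) (β := β) hv hpos
  have J3 := (NullInt.sum (μ := μ) (Finset.univ : Finset (Fin m)) fun k =>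
    NullInt.sum (Finset.univ : Finset (Fin N)) fun i =>
      nullInt_time (w i) τ hφ hφc (hv k)).congr fun z => Finset.sum_congr rfl fun k _ =>
    sum_time_eq (fun i j => dd (w i) (dd (w j) (v k)) z) (fun i => dd (w i) (v k) z)
      (fun i => dd (w i) (fun z => χ z ^ (q + 2)) z) (χ z ^ (q + 2)) (dd τ (v k) z)
      (dd τ (fun z => χ z ^ (q + 2)) z)
  have hF : ContDiff ℝ ∞
      fun z => (∑ i, v i z * src r β (fun j => v j z) i) / (2 * r + 1 + 1) :=
    (ContDiff.sum fun i _ => (hv i).mul (hsrc i)).div_const _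
  have J5 := nullInt_mul (μ := μ) τ hφ hφc hF
  have J := J3.add J5
  have iT := h.integrable (μ := μ) (q := q + 2) (by omega) (g := fun z => ∑ k, dd τ (v k) z ^ 2)
    (continuous_finsetSum _ fun k _ => (contDiff_dd _ (hv k)).continuous.pow 2)
  have iP := h.integrable (μ := μ) (q := q) (by omega)
    (g := fun z => ∑ k, ∑ i, dd (w i) (v k) z ^ 2)
    (continuous_finsetSum _ fun k _ => continuous_finsetSum _ fun i _ =>
      (contDiff_dd _ (hv k)).continuous.pow 2)
  have iF := h.integrable (μ := μ) (q := q) (by omega)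
    (g := fun z => ∑ k, src r β (fun j => v j z) k)
    (continuous_finsetSum _ fun k _ => (hsrc k).continuous)
  have iE := h.integrable (μ := μ) (q := q + 2) (by omega)
    (g := fun z => ∑ k, defect r β w τ v k z ^ 2)
    (continuous_finsetSum _ fun k _ => (continuous_defect w τ hv hpos k).pow 2)
  obtain ⟨c, hc⟩ : ∃ c : ℝ, c = N * (q + 2 : ℕ) ^ 2 := ⟨_, rfl⟩
  have hc1 : 1 ≤ c := by
    have hN' : (1 : ℝ) ≤ N := by exact_mod_cast hN
    have hq' : (3 : ℝ) ≤ q := by exact_mod_cast hq3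
    rw [hc]; push_cast; nlinarith
  have key := integral_le_of_nullInt J (iT.const_mul (1 / 2))
    ((((iP.add (iF.const_mul A)).const_mul (κ ^ 2)).add iE).const_mul (2 * c)) fun z => by
      simp only [Pi.add_apply]
      obtain ⟨l1, l1'⟩ := cutoff_lap_le hN (show 3 ≤ q + 2 by omega) h.smooth h.nonneg h.le_one
        h.pos h.grad h.hess z
      have l2 := cutoff_time_le hN (show 3 ≤ q + 2 by omega) h.smooth h.nonneg h.le_one hdt z
      rw [Nat.add_sub_cancel, ← hc] at l1 l2
      simp only [Nat.add_sub_cancel, ← hc] at l1'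
      clear l1
      have hp := pow_nonneg (h.nonneg z) q
      have hp2 := pow_nonneg (h.nonneg z) (q + 2)
      have w0 : 0 ≤ κ ^ 2 * χ z ^ q := by positivity
      have c0 : 0 ≤ c := by linarith
      have hs : ∀ k, 0 ≤ src r β (fun j => v j z) k :=
        src_nonneg hβ (fun i => (hpos i z).le)
      set φt := dd τ (fun z => χ z ^ (q + 2)) z with hφt
      have hT : χ z ^ (q + 2) * ∑ k, dd τ (v k) z ^ 2 = ∑ k, (χ z ^ (q + 2) * dd τ (v k) z *
            (∑ i, dd (w i) (dd (w i) (v k)) z)) +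
          ∑ k, χ z ^ (q + 2) * (src r β (fun j => v j z) k * dd τ (v k) z) +
          ∑ k, χ z ^ (q + 2) * (dd τ (v k) z * defect r β w τ v k z) := by
        rw [← Finset.sum_add_distrib, ← Finset.sum_add_distrib, Finset.mul_sum]
        refine Finset.sum_congr rfl fun k _ => ?_
        simp only [defect]; ring
      have hk : ∑ k, (-(dd τ (v k) z * ∑ j, dd (w j) (fun z => χ z ^ (q + 2)) z * dd (w j) (v k) z)
            + φt * (∑ j, dd (w j) (v k) z ^ 2) / 2
            + χ z ^ (q + 2) * (dd τ (v k) z * defect r β w τ v k z)) ≤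
          1 / 2 * (χ z ^ (q + 2) * ∑ k, dd τ (v k) z ^ 2) +
          2 * c * (κ ^ 2 * (χ z ^ q * ∑ k, ∑ i, dd (w i) (v k) z ^ 2)) +
          2 * c * (χ z ^ (q + 2) * ∑ k, defect r β w τ v k z ^ 2) := by
        simp only [Finset.mul_sum, ← Finset.sum_add_distrib]
        refine Finset.sum_le_sum fun k _ => ?_
        simp only [← Finset.mul_sum]
        have P0 : 0 ≤ ∑ i, dd (w i) (v k) z ^ 2 := Finset.sum_nonneg fun i _ => sq_nonneg _
        have y1 := young_of_sq_le (T := dd τ (v k) z) hp2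
          (mul_nonneg (mul_nonneg c0 w0) P0) (l1' fun i => dd (w i) (v k) z)
        have y2 := mul_le_mul_of_nonneg_right ((le_abs_self φt).trans l2) P0
        have y3 : χ z ^ (q + 2) * (dd τ (v k) z * defect r β w τ v k z) ≤
            χ z ^ (q + 2) * (1 / 4 * dd τ (v k) z ^ 2 + defect r β w τ v k z ^ 2) :=
          mul_le_mul_of_nonneg_left (by
            nlinarith [sq_nonneg (dd τ (v k) z / 2 - defect r β w τ v k z)]) hp2
        have y4 : χ z ^ (q + 2) * defect r β w τ v k z ^ 2 ≤
            c * (χ z ^ (q + 2) * defect r β w τ v k z ^ 2) :=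
          le_mul_of_one_le_left (mul_nonneg hp2 (sq_nonneg _)) hc1
        have y5 := mul_nonneg hp2 (sq_nonneg (defect r β w τ v k z))
        have y6 := mul_nonneg (mul_nonneg c0 w0) P0
        linarith
      have hFle : -(φt * ((∑ i, v i z * src r β (fun j => v j z) i) / (2 * r + 1 + 1))) ≤
          2 * c * (κ ^ 2 * (A * (χ z ^ q * ∑ k, src r β (fun j => v j z) k))) := by
        by_cases h0 : χ z = 0
        · rw [h0, zero_pow (by omega)] at l2
          have : φt = 0 := by simpa using l2
          simp [this, h0, zero_pow (show q ≠ 0 by omega)]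
        have hmem := subset_tsupport _ h0
        have f0 : 0 ≤ (∑ i, v i z * src r β (fun j => v j z) i) / (2 * r + 1 + 1) :=
          div_nonneg (Finset.sum_nonneg fun i _ => mul_nonneg (hpos i z).le (hs i)) (by linarith)
        have f1 : (∑ i, v i z * src r β (fun j => v j z) i) / (2 * r + 1 + 1) ≤
            A * ∑ k, src r β (fun j => v j z) k := by
          refine (div_le_self (Finset.sum_nonneg fun i _ => mul_nonneg (hpos i z).le (hs i))
            (by linarith)).trans ?_
          rw [Finset.mul_sum]
          exact Finset.sum_le_sum fun i _ => mul_le_mul_of_nonneg_right (hA i z hmem) (hs i)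
        have f2 := mul_le_mul_of_nonneg_right ((neg_le_abs φt).trans l2) f0
        have f3 := mul_le_mul_of_nonneg_left f1 (mul_nonneg c0 w0)
        have f4 := mul_nonneg (mul_nonneg c0 w0) (f0.trans f1)
        linarith
      rw [dd_potential hr hsym hv hpos]
      simp only [Finset.sum_add_distrib, Finset.sum_sub_distrib, Finset.sum_neg_distrib,
        ← Finset.mul_sum] at hk hT ⊢
      linarith
  rw [integral_const_mul, integral_const_mul, integral_add' ((iP.add (iF.const_mul _)).const_mul _)
    iE, integral_const_mul, integral_add' iP (iF.const_mul _), integral_const_mul] at key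
  rw [← hc]
  linarith

end TimeDerivative

section ScaledCutoffs

theorem dd_comp_clm {X Y : Type*} [NormedAddCommGroup X] [NormedSpace ℝ X] [NormedAddCommGroup Y]
    [NormedSpace ℝ Y] {g : Y → ℝ} (L : X →L[ℝ] Y) (w : X) (hg : ContDiff ℝ ∞ g) (z : X) :
    dd w (fun z => g (L z)) z = dd (L w) g (L z) := by
  have := ((hg.differentiableAt_infty (L z)).hasFDerivAt.comp z L.hasFDerivAt).fderiv
  change fderiv ℝ (g ∘ L) z w = _
  rw [this]; rfl

theorem dd_smul {X : Type*} [NormedAddCommGroup X] [NormedSpace ℝ X] (g : X → ℝ) (c : ℝ) (w z : X) :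
    dd (c • w) g z = c * dd w g z := by simp [dd]

/-- The unit vectors of space, as directions in space-time. -/
noncomputable def spaceDir (N : ℕ) (i : Fin N) : EuclideanSpace ℝ (Fin N) × ℝ :=
  (EuclideanSpace.single i 1, 0)

/-- The time direction in space-time. -/
noncomputable def timeDir (N : ℕ) : EuclideanSpace ℝ (Fin N) × ℝ := (0, 1)

theorem exists_scaled_cutoff (N : ℕ) : ∃ M V : ℝ, 1 ≤ M ∧ 0 ≤ V ∧ ∀ a b : ℝ, 1 ≤ a → 1 ≤ b →
    ∃ χ : EuclideanSpace ℝ (Fin N) × ℝ → ℝ, IsCutoff (spaceDir N) χ (M / a) ∧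
      (∀ z, |dd (timeDir N) χ z| ≤ M / b) ∧ (∀ z, ‖z.1‖ ≤ a → |z.2| ≤ b → χ z = 1) ∧
      (∀ z ∈ tsupport χ, ‖z.1‖ ≤ 2 * a ∧ |z.2| ≤ 2 * b) ∧
      volume.real (tsupport χ) ≤ V * a ^ N * b := by
  let f : ContDiffBump (0 : EuclideanSpace ℝ (Fin N) × ℝ) := ⟨1, 2, one_pos, one_lt_two⟩
  have hf : ContDiff ℝ ∞ f := f.contDiff
  have bd : ∀ g : EuclideanSpace ℝ (Fin N) × ℝ → ℝ, Continuous g → HasCompactSupport g →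
      ∃ C : ℝ, ∀ z, |g z| ≤ C := fun g hg hc => hg.bounded_above_of_compact_support hc
  have c1 : ∀ w, HasCompactSupport (dd w f) := fun w => f.hasCompactSupport.dd w
  choose K1 hK1 using fun i => bd _ (contDiff_dd (spaceDir N i) hf).continuous (c1 _)
  choose K2 hK2 using fun i => bd _ (contDiff_dd (spaceDir N i)
    (contDiff_dd (spaceDir N i) hf)).continuous ((c1 (spaceDir N i)).dd (spaceDir N i))
  obtain ⟨K3, hK3⟩ := bd _ (contDiff_dd (timeDir N) hf).continuous (c1 (timeDir N))
  have p1 : ∀ i, 0 ≤ K1 i := fun i => (abs_nonneg _).trans (hK1 i 0)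
  have p2 : ∀ i, 0 ≤ K2 i := fun i => (abs_nonneg _).trans (hK2 i 0)
  have p3 : 0 ≤ K3 := (abs_nonneg _).trans (hK3 0)
  set M := 1 + ∑ i, K1 i + ∑ i, K2 i + K3 with hM
  have s1 : ∀ i, K1 i ≤ ∑ i, K1 i := fun i =>
    Finset.single_le_sum (f := K1) (fun i _ => p1 i) (Finset.mem_univ i)
  have s2 : ∀ i, K2 i ≤ ∑ i, K2 i := fun i =>
    Finset.single_le_sum (f := K2) (fun i _ => p2 i) (Finset.mem_univ i)
  have t1 : 0 ≤ ∑ i, K1 i := Finset.sum_nonneg fun i _ => p1 i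
  have t2 : 0 ≤ ∑ i, K2 i := Finset.sum_nonneg fun i _ => p2 i
  have hM1 : 1 ≤ M := by rw [hM]; linarith
  set V := 4 * 2 ^ N * volume.real (ball (0 : EuclideanSpace ℝ (Fin N)) 1) with hV
  refine ⟨M, V, hM1, by positivity, fun a b ha hb => ?_⟩
  have ha0 : 0 < a := by linarith
  have hb0 : 0 < b := by linarith
  let L : EuclideanSpace ℝ (Fin N) × ℝ →L[ℝ] EuclideanSpace ℝ (Fin N) × ℝ :=
    (a⁻¹ • ContinuousLinearMap.id ℝ _).prodMap (b⁻¹ • ContinuousLinearMap.id ℝ _)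
  have hL : ∀ z, L z = (a⁻¹ • z.1, b⁻¹ * z.2) := fun z => rfl
  have hLw : ∀ i, L (spaceDir N i) = a⁻¹ • spaceDir N i := fun i => by
    rw [hL]; simp [spaceDir]
  have hLt : L (timeDir N) = b⁻¹ • timeDir N := by
    rw [hL]; simp [timeDir]
  have hsub : tsupport (fun z => f (L z)) ⊆
      closedBall (0 : EuclideanSpace ℝ (Fin N)) (2 * a) ×ˢ closedBall (0 : ℝ) (2 * b) := by
    refine closure_minimal (fun z hz => ?_) (isClosed_closedBall.prod isClosed_closedBall)
    have h1 : L z ∈ ball (0 : EuclideanSpace ℝ (Fin N) × ℝ) 2 := by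
      rw [← show f.rOut = 2 from rfl, ← f.support_eq]; exact hz
    rw [mem_ball_zero_iff, hL, Prod.norm_mk, max_lt_iff, norm_smul, norm_inv, norm_mul, norm_inv,
      Real.norm_of_nonneg ha0.le, Real.norm_of_nonneg hb0.le, inv_mul_lt_iff₀ ha0,
      inv_mul_lt_iff₀ hb0] at h1
    rw [mem_prod, mem_closedBall_zero_iff, mem_closedBall_zero_iff]
    constructor <;> linarith [h1.1, h1.2]
  refine ⟨fun z => f (L z), ⟨hf.comp L.contDiff, ?_, fun z => f.nonneg, fun z => f.le_one,
    by positivity, fun i z => ?_, fun i z => ?_⟩, fun z => ?_, fun z h1 h2 => ?_, fun z hz => ?_, ?_⟩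
  · exact HasCompactSupport.of_support_subset_isCompact
      ((isCompact_closedBall _ _).prod (isCompact_closedBall _ _))
      ((subset_tsupport _).trans hsub)
  · rw [dd_comp_clm L _ hf, hLw, dd_smul, abs_mul, abs_inv, abs_of_pos ha0, inv_mul_eq_div]
    gcongr
    exact (hK1 i _).trans (by linarith [s1 i])
  · have e1 : dd (spaceDir N i) (fun z => f (L z)) = fun z => a⁻¹ * dd (spaceDir N i) f (L z) := by
      ext z; rw [dd_comp_clm L _ hf, hLw, dd_smul]
    rw [e1, dd_const_mul (f := fun z => dd (spaceDir N i) f (L z)) _ _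
      ((contDiff_dd _ hf).comp L.contDiff), dd_comp_clm L _ (contDiff_dd _ hf),
        hLw, dd_smul, abs_mul, abs_mul, abs_inv, abs_of_pos ha0]
    have h := (hK2 i (L z)).trans (show K2 i ≤ M by linarith [s2 i])
    have h' : M ≤ M ^ 2 := by nlinarith
    rw [div_pow, ← mul_assoc, ← mul_inv, ← sq, inv_mul_eq_div]
    gcongr
    exact h.trans h'
  · rw [dd_comp_clm L _ hf, hLt, dd_smul, abs_mul, abs_inv, abs_of_pos hb0, inv_mul_eq_div]
    gcongr
    exact (hK3 _).trans (by linarith)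
  · refine f.one_of_mem_closedBall ?_
    rw [mem_closedBall_zero_iff, hL, Prod.norm_mk, max_le_iff, norm_smul, norm_inv, norm_mul,
      norm_inv, Real.norm_of_nonneg ha0.le, Real.norm_of_nonneg hb0.le, inv_mul_le_iff₀ ha0,
      inv_mul_le_iff₀ hb0]
    exact ⟨by simpa [f] using h1, by simpa [f] using h2⟩
  · have := hsub hz
    rwa [mem_prod, mem_closedBall_zero_iff, mem_closedBall_zero_iff] at this
  · refine (measureReal_mono hsub ((isCompact_closedBall _ _).prod
      (isCompact_closedBall _ _)).measure_lt_top.ne).trans ?_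
    rw [Measure.volume_eq_prod, measureReal_prod_prod, Measure.addHaar_real_closedBall _ _
      (by positivity), Real.volume_real_closedBall (by positivity), finrank_euclideanSpace,
      Fintype.card_fin, hV, mul_pow]
    apply le_of_eq; ring

end ScaledCutoffs

section CutoffIntegrals

variable {X : Type*} [NormedAddCommGroup X] [NormedSpace ℝ X] {N : ℕ} {w : Fin N → X}
  {χ : X → ℝ} {κ : ℝ} [FiniteDimensional ℝ X] [MeasurableSpace X] [BorelSpace X] {μ : Measure X}
  [μ.IsAddHaarMeasure]

theorem IsCutoff.integral_le (h : IsCutoff w χ κ) {K : Set X} (hK : IsCompact K)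
    (hs : tsupport χ ⊆ K) {q : ℕ} (hq : q ≠ 0) {G : X → ℝ} (hG : Continuous G)
    (hG0 : ∀ z, 0 ≤ G z) : ∫ z, χ z ^ q * G z ∂μ ≤ ∫ z in K, G z ∂μ := by
  rw [← MeasureTheory.integral_indicator hK.isClosed.measurableSet]
  refine integral_mono (h.integrable hq hG) ((hG.continuousOn.integrableOn_compact
    hK).integrable_indicator hK.isClosed.measurableSet) fun z => ?_
  by_cases hz : χ z = 0
  · simp only [hz, zero_pow hq, zero_mul]
    exact indicator_nonneg (fun z _ => hG0 z) z
  · rw [indicator_of_mem (hs (subset_tsupport _ hz))]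
    exact mul_le_of_le_one_left (hG0 z) (pow_le_one₀ (h.nonneg z) (h.le_one z))

theorem IsCutoff.le_integral (h : IsCutoff w χ κ) {K : Set X} (hK : IsCompact K)
    (hs : ∀ z ∈ K, χ z = 1) {q : ℕ} (hq : q ≠ 0) {G : X → ℝ} (hG : Continuous G)
    (hG0 : ∀ z, 0 ≤ G z) : ∫ z in K, G z ∂μ ≤ ∫ z, χ z ^ q * G z ∂μ := by
  rw [← MeasureTheory.integral_indicator hK.isClosed.measurableSet]
  refine integral_mono ((hG.continuousOn.integrableOn_compact
    hK).integrable_indicator hK.isClosed.measurableSet) (h.integrable hq hG) fun z => ?_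
  by_cases hz : z ∈ K
  · simp [hz, hs z hz]
  · rw [indicator_of_notMem hz]
    exact mul_nonneg (pow_nonneg (h.nonneg z) _) (hG0 z)

end CutoffIntegrals

section SmallEnergy

instance {N : ℕ} : (volume : Measure (EuclideanSpace ℝ (Fin N) × ℝ)).IsAddHaarMeasure :=
  inferInstanceAs ((volume : Measure (EuclideanSpace ℝ (Fin N))).prod
    (volume : Measure ℝ)).IsAddHaarMeasure

/-- The integral of the errors in the system over a ball of space-time. -/
noncomputable def errInt {N m : ℕ} (r : ℝ) (β : Fin m → Fin m → ℝ)
    (v : Fin m → EuclideanSpace ℝ (Fin N) × ℝ → ℝ) (R : ℝ) : ℝ :=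
  ∫ z in closedBall 0 R, ∑ k, (|defect r β (spaceDir N) (timeDir N) v k z|
    + defect r β (spaceDir N) (timeDir N) v k z ^ 2)

variable {N m : ℕ} {r : ℝ} {β : Fin m → Fin m → ℝ}

theorem IsCutoff.integral_le_errInt {χ : EuclideanSpace ℝ (Fin N) × ℝ → ℝ} {κ : ℝ}
    (h : IsCutoff (spaceDir N) χ κ) {R : ℝ}
    (hs : tsupport χ ⊆ closedBall 0 R) {q : ℕ} (hq : q ≠ 0)
    {v : Fin m → EuclideanSpace ℝ (Fin N) × ℝ → ℝ} (hv : ∀ k, ContDiff ℝ ∞ (v k))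
    (hpos : ∀ k z, 0 < v k z) :
    ∫ z, χ z ^ q * ∑ k, |defect r β (spaceDir N) (timeDir N) v k z| ≤ errInt r β v R ∧
    (∀ k, ∫ z, χ z ^ q * |defect r β (spaceDir N) (timeDir N) v k z| ≤ errInt r β v R) ∧
    ∫ z, χ z ^ q * ∑ k, defect r β (spaceDir N) (timeDir N) v k z ^ 2 ≤ errInt r β v R := by
  have hc := fun k => continuous_defect (r := r) (β := β) (spaceDir N) (timeDir N) hv hpos k
  have hK := isCompact_closedBall (0 : EuclideanSpace ℝ (Fin N) × ℝ) R
  have hle : ∀ G : EuclideanSpace ℝ (Fin N) × ℝ → ℝ, Continuous G → (∀ z, 0 ≤ G z) →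
      (∀ z, G z ≤ ∑ k, (|defect r β (spaceDir N) (timeDir N) v k z|
        + defect r β (spaceDir N) (timeDir N) v k z ^ 2)) →
      ∫ z, χ z ^ q * G z ≤ errInt r β v R := by
    intro G hG hG0 hGle
    refine (h.integral_le hK hs hq hG hG0).trans ?_
    exact setIntegral_mono (hG.continuousOn.integrableOn_compact hK)
      ((continuous_finsetSum _ fun k _ => (hc k).abs.add
        ((hc k).pow 2)).continuousOn.integrableOn_compact hK) hGle
  refine ⟨hle _ (continuous_finsetSum _ fun k _ => (hc k).abs)
    (fun z => Finset.sum_nonneg fun k _ => abs_nonneg _)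
    (fun z => Finset.sum_le_sum fun k _ => le_add_of_nonneg_right (sq_nonneg _)), fun k =>
    hle _ (hc k).abs (fun z => abs_nonneg _) fun z => ?_,
    hle _ (continuous_finsetSum _ fun k _ => (hc k).pow 2)
    (fun z => Finset.sum_nonneg fun k _ => sq_nonneg _)
    (fun z => Finset.sum_le_sum fun k _ => le_add_of_nonneg_left (abs_nonneg _))⟩
  exact (le_add_of_nonneg_right (sq_nonneg _)).trans
    (Finset.single_le_sum (f := fun k => |defect r β (spaceDir N) (timeDir N) v k z|
        + defect r β (spaceDir N) (timeDir N) v k z ^ 2)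
      (fun k _ => add_nonneg (abs_nonneg _) (sq_nonneg _)) (Finset.mem_univ k))

theorem errInt_nonneg (v : Fin m → EuclideanSpace ℝ (Fin N) × ℝ → ℝ) (R : ℝ) :
    0 ≤ errInt r β v R :=
  integral_nonneg fun _ => Finset.sum_nonneg fun _ _ => add_nonneg (abs_nonneg _) (sq_nonneg _)

/-- The time derivative is small in the mean over large parabolic cylinders. -/
theorem integral_time_sq_le_of_le (hN : 1 ≤ N) (hr : 0 < r)
    (hsym : ∀ i j, β i j = β j i) (hoff : ∀ i j, i ≠ j → 0 ≤ β i j) (hdiag : ∀ i, 0 < β i i)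
    {A : ℝ} (hA0 : 0 ≤ A) : ∃ K : ℝ, 0 ≤ K ∧ ∀ a : ℝ, 1 ≤ a →
    ∀ v : Fin m → EuclideanSpace ℝ (Fin N) × ℝ → ℝ, (∀ k, ContDiff ℝ ∞ (v k)) →
      (∀ k z, 0 < v k z) → (∀ k, ∀ z ∈ closedBall 0 (2 * a ^ 2), v k z ≤ A) →
      ∫ z in closedBall 0 a ×ˢ closedBall 0 (a ^ 2), ∑ k, dd (timeDir N) (v k) z ^ 2 ≤
        K * (a ^ ((N : ℝ) - 2 * ((2 * r + 1) / (2 * r + 1 - 1))) + errInt r β v (2 * a ^ 2)) := by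
  obtain ⟨M, V, hM, hV, hcut⟩ := exists_scaled_cutoff N
  have hβ := coeff_nonneg hoff hdiag
  set s := 2 * ((2 * r + 1) / (2 * r + 1 - 1)) with hs
  obtain ⟨q, hq⟩ : ∃ q : ℕ, q = max 3 ⌈s⌉₊ := ⟨_, rfl⟩
  have hq3 : 3 ≤ q := by rw [hq]; exact le_max_left _ _
  have hqs : s ≤ q := by
    rw [hq]; push_cast; exact (Nat.le_ceil s).trans (le_max_right _ _)
  choose C1 hC1 hE1 using fun k => integral_src_le (p := 2 * r + 1) (b := β k k) hN (by linarith)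
    (hdiag k) hq3 hqs
  set C := ∑ k, C1 k with hC
  have hC0 : 0 ≤ C := Finset.sum_nonneg fun k _ => hC1 k
  set P := N * (q : ℝ) ^ 2 * A with hP
  have hP0 : 0 ≤ P := by positivity
  set D := 4 * (N * ((q + 2 : ℕ) : ℝ) ^ 2) with hD
  have hD0 : 0 ≤ D := by positivity
  have hMs : 0 ≤ M ^ s := rpow_nonneg (by linarith) _
  refine ⟨D * (M ^ 2 * (P * (C * (M ^ s * V) + C + m) + A * (C * (M ^ s * V) + C))
    + 1), by positivity, ?_⟩
  intro a ha v hv hpos hA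
  have ha0 : 0 < a := by linarith
  obtain ⟨χ, h, hdt, hone, hsupp, hvol⟩ := hcut a (a ^ 2) ha (one_le_pow₀ ha)
  have hsub : tsupport χ ⊆ closedBall 0 (2 * a ^ 2) := fun z hz => by
    obtain ⟨h1, h2⟩ := hsupp z hz
    rw [mem_closedBall_zero_iff, Prod.norm_def, max_le_iff]
    exact ⟨h1.trans (by nlinarith), h2⟩
  have hdt' : ∀ z, |dd (timeDir N) χ z| ≤ (M / a) ^ 2 := fun z => (hdt z).trans (by
    rw [div_pow]; gcongr; nlinarith)
  obtain ⟨e1, e1', e2⟩ := h.integral_le_errInt (r := r) (β := β) hsub (q := q) (by omega) hv hpos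
  obtain ⟨-, -, e3⟩ := h.integral_le_errInt (r := r) (β := β) hsub (q := q + 2) (by omega) hv hpos
  have hsrc := contDiff_src (r := r) (β := β) hv hpos
  set ER := errInt r β v (2 * a ^ 2)
  have hER : 0 ≤ ER := errInt_nonneg v _
  set S := (M / a) ^ s * volume.real (tsupport χ) with hS
  have hS0 : 0 ≤ S := by positivity
  have hs0 : ∀ k z, 0 ≤ src r β (fun j => v j z) k := fun k z =>
    src_nonneg hβ (fun i => (hpos i z).le) k
  have g0 : ∀ k, 0 ≤ ∫ z, χ z ^ q * src r β (fun j => v j z) k := fun k =>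
    integral_nonneg fun z => mul_nonneg (pow_nonneg (h.nonneg z) _) (hs0 k z)
  have g1 : ∀ k, 0 ≤ (M / a) ^ 2 * ∫ z, χ z ^ (q - 2) * v k z := fun k =>
    mul_nonneg (sq_nonneg _) (integral_nonneg fun z => mul_nonneg (pow_nonneg (h.nonneg z) _)
      (hpos k z).le)
  have f1 : ∀ k, (∫ z, χ z ^ q * src r β (fun j => v j z) k) +
      (M / a) ^ 2 * ∫ z, χ z ^ (q - 2) * v k z ≤ C1 k * (S + ER) := fun k =>
    (hE1 k volume (spaceDir N) (timeDir N) χ (M / a) h hdt' (v k) _ (hv k) (hsrc k) (hpos k)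
      (fun z => le_src hr hβ (fun i => (hpos i z).le) k)).trans
      (mul_le_mul_of_nonneg_left (add_le_add_right (e1' k) _) (hC1 k))
  have f2 : ∫ z, χ z ^ q * ∑ k, src r β (fun j => v j z) k ≤ C * (S + ER) := by
    simp only [Finset.mul_sum]
    rw [integral_finsetSum _ fun k _ => h.integrable (by omega) (hsrc k).continuous, hC,
      Finset.sum_mul]
    exact Finset.sum_le_sum fun k _ => by linarith [f1 k, g1 k]
  have f3 : ∫ z, χ z ^ q * ∑ k, ∑ i, dd (spaceDir N i) (v k) z ^ 2 ≤
      P * (C * (S + ER) + m * ER) := by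
    have hi : ∀ k, Continuous fun z => ∑ i, dd (spaceDir N i) (v k) z ^ 2 := fun k =>
      continuous_finsetSum _ fun i _ => (contDiff_dd _ (hv k)).continuous.pow 2
    have : ∀ z, χ z ^ q * ∑ k, ∑ i, dd (spaceDir N i) (v k) z ^ 2 =
      ∑ k, χ z ^ q * ∑ i, dd (spaceDir N i) (v k) z ^ 2 := fun z => Finset.mul_sum _ _ _
    simp only [this]
    rw [integral_finsetSum _ fun k _ => h.integrable (by omega) (hi k), hC, Finset.sum_mul]
    have hm : (m : ℝ) * ER = ∑ k : Fin m, ER := by simp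
    rw [hm, ← Finset.sum_add_distrib, Finset.mul_sum]
    refine Finset.sum_le_sum fun k _ => (integral_grad_sq_le hN hq3 h hdt' (hv k) (hsrc k)
      (hpos k) (hs0 k) (fun z hz => hA k z (hsub hz))).trans ?_
    exact mul_le_mul_of_nonneg_left (add_le_add (f1 k) (e1' k)) hP0
  have f4 := integral_time_sq_le (μ := volume) hN hr hsym hβ hq3 h hdt' hv hpos
    (fun k z hz => hA k z (hsub hz))
  have hS1 : (M / a) ^ 2 * S ≤ M ^ 2 * (M ^ s * V) * a ^ ((N : ℝ) - s) := by
    have e : a ^ ((N : ℝ) - s) * a ^ s = a ^ N := by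
      rw [← rpow_add ha0, sub_add_cancel, rpow_natCast]
    have e' : (M / a) ^ s = M ^ s / a ^ s := div_rpow (by linarith) ha0.le _
    have ps : 0 < a ^ s := rpow_pos_of_pos ha0 _
    have := mul_le_mul_of_nonneg_left hvol (show 0 ≤ (M / a) ^ 2 * (M / a) ^ s by positivity)
    rw [hS, ← mul_assoc]
    refine this.trans (le_of_eq ?_)
    rw [← e, e']; field_simp
  have hMa : (M / a) ^ 2 ≤ M ^ 2 := by
    gcongr; exact div_le_self (by linarith) ha
  set Z := a ^ ((N : ℝ) - s) with hZ
  have hZ0 : 0 ≤ Z := rpow_nonneg ha0.le _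
  refine (h.le_integral (q := q + 2) ((isCompact_closedBall _ _).prod (isCompact_closedBall _ _))
    (fun z hz => ?_) (by omega) (continuous_finsetSum _ fun k _ =>
      (contDiff_dd _ (hv k)).continuous.pow 2) (fun z => Finset.sum_nonneg fun k _ =>
      sq_nonneg _)).trans (f4.trans ?_)
  · rw [mem_prod, mem_closedBall_zero_iff, mem_closedBall_zero_iff] at hz
    exact hone z hz.1 hz.2
  have k1 := mul_le_mul_of_nonneg_left (add_le_add f3 (mul_le_mul_of_nonneg_left f2 hA0))
    (sq_nonneg (M / a))
  have k2 : (M / a) ^ 2 * ER ≤ M ^ 2 * ER := mul_le_mul_of_nonneg_right hMa hER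
  rw [← hD, mul_assoc D]
  refine mul_le_mul_of_nonneg_left ?_ hD0
  have k3 := mul_le_mul_of_nonneg_left hS1 (show 0 ≤ (P + A) * C by positivity)
  have k4 := mul_le_mul_of_nonneg_left k2 (show 0 ≤ (P + A) * C + P * m by positivity)
  have k5 : 0 ≤ M ^ 2 * (P * (C * (M ^ s * V)) + A * (C * (M ^ s * V))) * ER := by positivity
  have k6 : 0 ≤ (M ^ 2 * (P * (C + m) + A * C) + 1) * Z := by positivity
  linarith

end SmallEnergy

section SmallEnergyConclusion

theorem exists_mul_rpow_neg_le (K a₀ : ℝ) {s ε : ℝ} (hs : 0 < s) (hε : 0 < ε) :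
    ∃ a : ℝ, 1 ≤ a ∧ a₀ ≤ a ∧ K * a ^ (-s) ≤ ε := by
  have h := (tendsto_rpow_neg_atTop hs).const_mul K
  rw [mul_zero] at h
  obtain ⟨a, h1, h2, h3⟩ := ((Filter.eventually_ge_atTop 1).and
    ((Filter.eventually_ge_atTop a₀).and (h.eventually (ge_mem_nhds hε)))).exists
  exact ⟨a, h1, h2, h3⟩

variable {N m : ℕ} {r : ℝ} {β : Fin m → Fin m → ℝ}

/-- The conclusion of the energy method: solutions up to small errors that are bounded on a large
ball have small energy on the unit ball. -/
def SmallEnergy (N m : ℕ) (r : ℝ) (β : Fin m → Fin m → ℝ) : Prop :=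
  ∀ A ε : ℝ, 0 < A → 0 < ε → ∃ R C : ℝ, 1 ≤ R ∧ 0 ≤ C ∧
    ∀ v : Fin m → EuclideanSpace ℝ (Fin N) × ℝ → ℝ, (∀ k, ContDiff ℝ ∞ (v k)) →
      (∀ k z, 0 < v k z) → (∀ k, ∀ z ∈ closedBall 0 R, v k z ≤ A) →
      ∫ z in closedBall 0 1, ∑ k, (v k z ^ (2 * r + 1)) ^ 2 ≤ ε + C * errInt r β v R

theorem exists_diag_lower_bound (hdiag : ∀ i, 0 < β i i) : ∃ b : ℝ, 0 < b ∧ ∀ k, b ≤ β k k := by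
  rcases isEmpty_or_nonempty (Fin m) with h | h
  · exact ⟨1, one_pos, fun k => h.elim k⟩
  · obtain ⟨k, hk⟩ := Finite.exists_min fun k => β k k
    exact ⟨β k k, hdiag k, hk⟩

theorem smallEnergy_of_three_le (hN : 3 ≤ N) (hr : 0 < r)
    (hsym : ∀ i j, β i j = β j i) (hoff : ∀ i j, i ≠ j → 0 ≤ β i j) (hdiag : ∀ i, 0 < β i i)
    (hp : 2 * r + 1 < (N : ℝ) * (N + 2) / ((N : ℝ) - 1) ^ 2) : SmallEnergy N m r β := by
  intro A ε hA hε
  have hN' : (3 : ℝ) ≤ N := by exact_mod_cast hN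
  have hN1 : (0 : ℝ) < (N : ℝ) - 1 := by linarith
  obtain ⟨M, V, hM, hV, hcut⟩ := exists_scaled_cutoff N
  obtain ⟨b, hb, hbβ⟩ := exists_diag_lower_bound hdiag
  rw [lt_div_iff₀ (by positivity)] at hp
  obtain ⟨a, ha1, ha2⟩ := exists_between (show (2 * r + 1) * ((N : ℝ) - 1) / (N + 2) <
    N / ((N : ℝ) - 1) by
      rw [div_lt_div_iff₀ (by linarith) hN1]; linarith)
  rw [div_lt_iff₀ (by linarith)] at ha1
  rw [lt_div_iff₀ hN1] at ha2
  have ha : 0 < a := by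
    have : 0 < (2 * r + 1) * ((N : ℝ) - 1) := by positivity
    nlinarith
  set s := 4 * ((2 * r + 1) / (2 * r + 1 - 1)) with hs
  obtain ⟨C, hC, hE⟩ := integral_src_sq_le (by omega) hr hsym hoff hdiag ha ha2
    (by linarith) (q := max 3 ⌈s⌉₊) (le_max_left _ _)
    (by push_cast; exact (Nat.le_ceil s).trans (le_max_right _ _))
  set q := max 3 ⌈s⌉₊ with hq
  have hq3 : 3 ≤ q := le_max_left _ _
  have hsN : 0 < s - (N + 2) := by
    have h1 : s * (2 * r) = 4 * (2 * r + 1) := by rw [hs]; field_simp; ring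
    have h2 : (2 * r + 1) * ((N : ℝ) - 2) < N + 2 := by
      have : (N : ℝ) * (N - 2) ≤ (N - 1) ^ 2 := by nlinarith
      have h3 := mul_le_mul_of_nonneg_left this (show 0 ≤ 2 * r + 1 by linarith)
      by_contra! hc
      have h4 := mul_le_mul_of_nonneg_right hc (show (0 : ℝ) ≤ N by linarith)
      nlinarith
    by_contra! hc
    have := mul_le_mul_of_nonneg_right (show s ≤ N + 2 by linarith) (show 0 ≤ 2 * r by linarith)
    nlinarith
  obtain ⟨ρ, hρ1, -, hρ⟩ := exists_mul_rpow_neg_le (C / b ^ 2 * (M ^ s * V)) 1 hsN hε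
  have hρ0 : 0 < ρ := by linarith
  refine ⟨2 * ρ ^ 2, C / b ^ 2, by nlinarith, by positivity, fun v hv hpos hvA => ?_⟩
  obtain ⟨χ, h, hdt, hone, hsupp, hvol⟩ := hcut ρ (ρ ^ 2) hρ1 (one_le_pow₀ hρ1)
  have hsub : tsupport χ ⊆ closedBall 0 (2 * ρ ^ 2) := fun z hz => by
    obtain ⟨h1, h2⟩ := hsupp z hz
    rw [mem_closedBall_zero_iff, Prod.norm_def, max_le_iff]
    exact ⟨h1.trans (by nlinarith), h2⟩
  have hdt' : ∀ z, |dd (timeDir N) χ z| ≤ (M / ρ) ^ 2 := fun z => (hdt z).trans (by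
    rw [div_pow]; gcongr; nlinarith)
  obtain ⟨-, -, e3⟩ := h.integral_le_errInt (r := r) (β := β) hsub (q := q) (by omega) hv hpos
  have hsrc := contDiff_src (r := r) (β := β) hv hpos
  have hβ := coeff_nonneg hoff hdiag
  have hcp : ∀ k, Continuous fun z => (v k z ^ (2 * r + 1)) ^ 2 := fun k =>
    ((hv k).continuous.rpow_const fun z => Or.inl (hpos k z).ne').pow 2
  have step1 : ∫ z in closedBall 0 1, ∑ k, (v k z ^ (2 * r + 1)) ^ 2 ≤
      ∫ z, χ z ^ q * ∑ k, (v k z ^ (2 * r + 1)) ^ 2 :=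
    h.le_integral (isCompact_closedBall _ _) (fun z hz => by
      rw [mem_closedBall_zero_iff, Prod.norm_def, max_le_iff] at hz
      exact hone z (hz.1.trans hρ1) (hz.2.trans (one_le_pow₀ hρ1))) (by omega)
      (continuous_finsetSum _ fun k _ => hcp k) fun z => Finset.sum_nonneg fun k _ => sq_nonneg _
  have step2 : ∫ z, χ z ^ q * ∑ k, (v k z ^ (2 * r + 1)) ^ 2 ≤
      (b ^ 2)⁻¹ * ∫ z, χ z ^ q * ∑ k, src r β (fun j => v j z) k ^ 2 := by
    rw [← integral_const_mul]
    refine integral_mono (h.integrable (by omega) (continuous_finsetSum _ fun k _ => hcp k))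
      ((h.integrable (by omega) (continuous_finsetSum _ fun k _ =>
        (hsrc k).continuous.pow 2)).const_mul _) fun z => ?_
    have : ∑ k, (v k z ^ (2 * r + 1)) ^ 2 ≤
        (b ^ 2)⁻¹ * ∑ k, src r β (fun j => v j z) k ^ 2 := by
      rw [Finset.mul_sum]
      refine Finset.sum_le_sum fun k _ => ?_
      rw [inv_mul_eq_div, le_div_iff₀ (by positivity), mul_comm, ← mul_pow]
      have hvp : 0 ≤ v k z ^ (2 * r + 1) := rpow_nonneg (hpos k z).le _
      exact pow_le_pow_left₀ (by positivity) ((mul_le_mul_of_nonneg_right (hbβ k) hvp).trans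
        (le_src hr hβ (fun i => (hpos i z).le) k)) 2
    have := mul_le_mul_of_nonneg_left this (pow_nonneg (h.nonneg z) q)
    linarith
  have step3 := hE volume (spaceDir N) (timeDir N) χ (M / ρ) h.smooth h.supp h.nonneg h.le_one
    h.pos h.grad h.hess hdt' v hv hpos
  have hvol' : (M / ρ) ^ s * volume.real (tsupport χ) ≤ M ^ s * V * ρ ^ (-(s - (N + 2))) := by
    have e : ρ ^ (-(s - (N + 2))) * ρ ^ s = ρ ^ N * ρ ^ 2 := by
      rw [← rpow_add hρ0, ← rpow_natCast, ← rpow_natCast, ← rpow_add hρ0]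
      congr 1; push_cast; ring
    have e' : (M / ρ) ^ s = M ^ s / ρ ^ s := div_rpow (by linarith) hρ0.le _
    have ps : 0 < ρ ^ s := rpow_pos_of_pos hρ0 _
    have := mul_le_mul_of_nonneg_left hvol
      (show 0 ≤ (M / ρ) ^ s from rpow_nonneg (div_nonneg (by linarith) hρ0.le) _)
    refine this.trans (le_of_eq ?_)
    rw [mul_assoc V, ← e, e']; field_simp
  calc _ ≤ (b ^ 2)⁻¹ * ∫ z, χ z ^ q * ∑ k, src r β (fun j => v j z) k ^ 2 := step1.trans step2
    _ ≤ (b ^ 2)⁻¹ * (C * (M ^ s * V * ρ ^ (-(s - (N + 2))) + errInt r β v (2 * ρ ^ 2))) := by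
      refine mul_le_mul_of_nonneg_left (step3.trans ?_) (by positivity)
      exact mul_le_mul_of_nonneg_left (add_le_add hvol' e3) hC
    _ = C / b ^ 2 * (M ^ s * V) * ρ ^ (-(s - (N + 2))) + C / b ^ 2 * errInt r β v (2 * ρ ^ 2) := by
      field_simp
    _ ≤ _ := by linarith

set_option maxHeartbeats 400000 in
theorem smallEnergy_of_le_two (hN1 : 1 ≤ N) (hN2 : N ≤ 2) (hr : 0 < r)
    (hsym : ∀ i j, β i j = β j i) (hoff : ∀ i j, i ≠ j → 0 ≤ β i j) (hdiag : ∀ i, 0 < β i i) :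
    SmallEnergy N m r β := by
  intro A ε hA hε
  have hN' : (N : ℝ) ≤ 2 := by exact_mod_cast hN2
  obtain ⟨M, V, hM, hV, hcut⟩ := exists_scaled_cutoff N
  obtain ⟨b, hb, hbβ⟩ := exists_diag_lower_bound hdiag
  have hβ := coeff_nonneg hoff hdiag
  obtain ⟨K, hK, hT⟩ := integral_time_sq_le_of_le hN1 hr hsym hoff hdiag hA.le
  set s := 2 * ((2 * r + 1) / (2 * r + 1 - 1)) with hs
  have hsN : 0 < s - N := by
    have h1 : s * (2 * r) = 2 * (2 * r + 1) := by rw [hs]; field_simp; ring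
    by_contra! hc
    nlinarith
  obtain ⟨q, hq⟩ : ∃ q : ℕ, q = max 3 ⌈s⌉₊ := ⟨_, rfl⟩
  have hq3 : 3 ≤ q := by rw [hq]; exact le_max_left _ _
  have hqs : s ≤ q := by
    rw [hq]; push_cast; exact (Nat.le_ceil s).trans (le_max_right _ _)
  choose C1 hC1 hE1 using fun k => integral_src_le_time (p := 2 * r + 1) (b := β k k) hN1
    (by linarith) (hdiag k) hq3 hqs
  set C := A ^ (2 * r + 1) / b * ∑ k, C1 k with hC
  have hAp : 0 < A ^ (2 * r + 1) := rpow_pos_of_pos hA _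
  have hC0 : 0 ≤ C := mul_nonneg (by positivity) (Finset.sum_nonneg fun k _ => hC1 k)
  obtain ⟨ρ, hρ1, -, hρ⟩ := exists_mul_rpow_neg_le (C * (M ^ s * V)) 1 hsN
    (show 0 < ε / 3 by positivity)
  have hρ0 : 0 < ρ := by linarith
  obtain ⟨δ, hδ, hδε⟩ : ∃ δ : ℝ, 0 < δ ∧ C * (V * ρ ^ N) * δ ≤ ε / 3 := by
    have h0 : 0 ≤ C * (V * ρ ^ N) := by positivity
    refine ⟨ε / 3 / (C * (V * ρ ^ N) + 1), by positivity, ?_⟩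
    rw [mul_div_assoc', div_le_iff₀ (by positivity)]
    nlinarith
  obtain ⟨a, ha1, haρ, ha⟩ := exists_mul_rpow_neg_le (C * δ⁻¹ * K) (2 * ρ) hsN
    (show 0 < ε / 3 by positivity)
  refine ⟨2 * a ^ 2, C * δ⁻¹ * K + C, by nlinarith, by positivity, fun v hv hpos hvA => ?_⟩
  obtain ⟨χ, h, -, hone, hsupp, hvol⟩ := hcut ρ 1 hρ1 le_rfl
  have hsub' : tsupport χ ⊆ closedBall 0 a ×ˢ closedBall 0 (a ^ 2) := fun z hz => by
    obtain ⟨h1, h2⟩ := hsupp z hz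
    rw [mem_prod, mem_closedBall_zero_iff, mem_closedBall_zero_iff]
    exact ⟨h1.trans haρ, h2.trans (by nlinarith)⟩
  have hsub : tsupport χ ⊆ closedBall 0 (2 * a ^ 2) := fun z hz => by
    have := hsub' hz
    rw [mem_prod, mem_closedBall_zero_iff, mem_closedBall_zero_iff] at this
    rw [mem_closedBall_zero_iff, Prod.norm_def, max_le_iff]
    exact ⟨this.1.trans (by nlinarith), this.2.trans (by nlinarith)⟩
  obtain ⟨-, e1, -⟩ := h.integral_le_errInt (r := r) (β := β) hsub (q := q) (by omega) hv hpos
  have hT := hT a ha1 v hv hpos hvA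
  have hsrc := contDiff_src (r := r) (β := β) hv hpos
  have hTc : ∀ k, Continuous (dd (timeDir N) (v k)) := fun k => (contDiff_dd _ (hv k)).continuous
  have hcp : ∀ k, Continuous fun z => (v k z ^ (2 * r + 1)) ^ 2 := fun k =>
    ((hv k).continuous.rpow_const fun z => Or.inl (hpos k z).ne').pow 2
  have t1 : ∀ k, ∫ z, χ z ^ q * |dd (timeDir N) (v k) z| ≤
      δ * (V * ρ ^ N) + δ⁻¹ * (K * (a ^ (-(s - N)) + errInt r β v (2 * a ^ 2))) := by
    intro k
    obtain ⟨iI, eI⟩ := h.integral_indicator (μ := volume) δ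
    have iT := h.integrable (μ := volume) (q := q) (by omega)
      (g := fun z => dd (timeDir N) (v k) z ^ 2) ((hTc k).pow 2)
    have : ∫ z, χ z ^ q * |dd (timeDir N) (v k) z| ≤ ∫ z, ((tsupport χ).indicator (fun _ => δ) z +
        δ⁻¹ * (χ z ^ q * dd (timeDir N) (v k) z ^ 2)) := by
      refine integral_mono (h.integrable (by omega) (hTc k).abs) (iI.add (iT.const_mul _))
        fun z => ?_
      have hc := pow_nonneg (h.nonneg z) q
      by_cases h0 : χ z = 0
      · simp only [h0, zero_pow (show q ≠ 0 by omega), zero_mul, mul_zero, add_zero]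
        exact indicator_nonneg (fun _ _ => hδ.le) z
      · rw [indicator_of_mem (subset_tsupport _ h0)]
        have y : |dd (timeDir N) (v k) z| ≤ δ + δ⁻¹ * dd (timeDir N) (v k) z ^ 2 := by
          rw [← sq_abs (dd (timeDir N) (v k) z)]
          set y := |dd (timeDir N) (v k) z|
          have : 0 ≤ δ⁻¹ * (y - δ) ^ 2 := by positivity
          have e : δ⁻¹ * (y - δ) ^ 2 = δ + δ⁻¹ * y ^ 2 - 2 * y := by field_simp; ring
          have := abs_nonneg (dd (timeDir N) (v k) z)
          linarith
        have c1 := pow_le_one₀ (n := q) (h.nonneg z) (h.le_one z)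
        have := mul_le_mul_of_nonneg_left y hc
        nlinarith
    rw [integral_add iI (iT.const_mul _), eI, integral_const_mul] at this
    refine this.trans (add_le_add ?_ ?_)
    · exact mul_le_mul_of_nonneg_left (by linarith) hδ.le
    · refine mul_le_mul_of_nonneg_left ?_ (by positivity)
      rw [show -(s - (N : ℝ)) = N - s by ring]
      refine le_trans ?_ hT
      have hKc := (isCompact_closedBall (0 : EuclideanSpace ℝ (Fin N)) a).prod
        (isCompact_closedBall (0 : ℝ) (a ^ 2))
      refine (h.integral_le hKc hsub' (by omega) ((hTc k).pow 2) fun z => sq_nonneg _).trans ?_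
      refine setIntegral_mono (((hTc k).pow 2).continuousOn.integrableOn_compact hKc)
        ((continuous_finsetSum _ fun k _ => (hTc k).pow 2).continuousOn.integrableOn_compact hKc)
        fun z => ?_
      exact Finset.single_le_sum (f := fun k => dd (timeDir N) (v k) z ^ 2)
        (fun k _ => sq_nonneg _) (Finset.mem_univ k)
  have step1 : ∫ z in closedBall 0 1, ∑ k, (v k z ^ (2 * r + 1)) ^ 2 ≤
      ∫ z, χ z ^ q * ∑ k, (v k z ^ (2 * r + 1)) ^ 2 :=
    h.le_integral (isCompact_closedBall _ _) (fun z hz => by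
      rw [mem_closedBall_zero_iff, Prod.norm_def, max_le_iff] at hz
      exact hone z (hz.1.trans hρ1) hz.2) (by omega)
      (continuous_finsetSum _ fun k _ => hcp k) fun z => Finset.sum_nonneg fun k _ => sq_nonneg _
  have hvol' : (M / ρ) ^ s * volume.real (tsupport χ) ≤ M ^ s * V * ρ ^ (-(s - N)) := by
    have e : ρ ^ (-(s - N)) * ρ ^ s = ρ ^ N := by
      rw [← rpow_add hρ0, ← rpow_natCast]; congr 1; ring
    have e' : (M / ρ) ^ s = M ^ s / ρ ^ s := div_rpow (by linarith) hρ0.le _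
    have ps : 0 < ρ ^ s := rpow_pos_of_pos hρ0 _
    have := mul_le_mul_of_nonneg_left hvol
      (show 0 ≤ (M / ρ) ^ s from rpow_nonneg (div_nonneg (by linarith) hρ0.le) _)
    refine this.trans (le_of_eq ?_)
    rw [← e, e']; field_simp
  set ER := errInt r β v (2 * a ^ 2) with hER
  set W := M ^ s * V * ρ ^ (-(s - N)) + (δ * (V * ρ ^ N) + δ⁻¹ * (K * (a ^ (-(s - N)) + ER)))
    + ER with hW
  have step2 : ∫ z, χ z ^ q * ∑ k, (v k z ^ (2 * r + 1)) ^ 2 ≤ C * W := by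
    simp only [Finset.mul_sum]
    rw [integral_finsetSum _ fun k _ => h.integrable (by omega) (hcp k), hC, mul_assoc,
      Finset.sum_mul, Finset.mul_sum]
    refine Finset.sum_le_sum fun k _ => ?_
    have a1 := hE1 k volume (spaceDir N) (timeDir N) χ (M / ρ) h (v k) _ (hv k) (hsrc k) (hpos k)
      (fun z => le_src hr hβ (fun i => (hpos i z).le) k)
    have a2 : ∫ z, χ z ^ q * (v k z ^ (2 * r + 1)) ^ 2 ≤
        A ^ (2 * r + 1) / b * ∫ z, χ z ^ q * src r β (fun j => v j z) k := by
      rw [← integral_const_mul]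
      refine integral_mono (h.integrable (by omega) (hcp k))
        ((h.integrable (by omega) (hsrc k).continuous).const_mul _) fun z => ?_
      by_cases h0 : χ z = 0
      · simp [h0, zero_pow (show q ≠ 0 by omega)]
      have hvz := hvA k z (hsub (subset_tsupport _ h0))
      have hvp : 0 ≤ v k z ^ (2 * r + 1) := rpow_nonneg (hpos k z).le _
      have x1 : v k z ^ (2 * r + 1) ≤ A ^ (2 * r + 1) :=
        rpow_le_rpow (hpos k z).le hvz (by linarith)
      have x2 := (mul_le_mul_of_nonneg_right (hbβ k) hvp).trans
        (le_src hr hβ (fun i => (hpos i z).le) k)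
      have x3 : (v k z ^ (2 * r + 1)) ^ 2 ≤
          A ^ (2 * r + 1) / b * src r β (fun j => v j z) k := by
        rw [div_mul_eq_mul_div, le_div_iff₀ hb, sq, mul_assoc, mul_comm (v k z ^ (2 * r + 1)) b]
        exact mul_le_mul x1 x2 (by positivity) hAp.le
      have := mul_le_mul_of_nonneg_left x3 (pow_nonneg (h.nonneg z) q)
      linarith
    refine a2.trans (mul_le_mul_of_nonneg_left (a1.trans ?_) (by positivity))
    exact mul_le_mul_of_nonneg_left (add_le_add (add_le_add hvol' (t1 k)) (e1 k)) (hC1 k)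
  have : C * W = C * (M ^ s * V) * ρ ^ (-(s - N)) + C * (V * ρ ^ N) * δ +
      C * δ⁻¹ * K * a ^ (-(s - N)) + (C * δ⁻¹ * K + C) * ER := by rw [hW]; ring
  linarith

theorem smallEnergy (hN : 1 ≤ N) (hr : 0 < r)
    (hsym : ∀ i j, β i j = β j i) (hoff : ∀ i j, i ≠ j → 0 ≤ β i j) (hdiag : ∀ i, 0 < β i i)
    (hpB : N ≤ 2 ∨ (3 ≤ N ∧ 2 * r + 1 < ((N : ℝ) * (N + 2)) / ((N : ℝ) - 1) ^ 2)) :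
    SmallEnergy N m r β :=
  hpB.elim (fun h => smallEnergy_of_le_two hN h hr hsym hoff hdiag)
    fun h => smallEnergy_of_three_le h.1 hr hsym hoff hdiag h.2

end SmallEnergyConclusion

/-- Euclidean space. -/
abbrev Sp (N : ℕ) : Type := EuclideanSpace ℝ (Fin N)

section Laplacian

variable {N : ℕ}

/-- The square of the length of the gradient. -/
noncomputable def gradSq (f : Sp N → ℝ) (x : Sp N) : ℝ :=
  ∑ i, dd (EuclideanSpace.single i 1) f x ^ 2

/-- The scalar product of two gradients. -/
noncomputable def gradDot (f g : Sp N → ℝ) (x : Sp N) : ℝ :=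
  ∑ i, dd (EuclideanSpace.single i 1) f x * dd (EuclideanSpace.single i 1) g x

theorem contDiffAt_dd {f : Sp N → ℝ} {x : Sp N} (w : Sp N) (hf : ContDiffAt ℝ 2 f x) :
    ContDiffAt ℝ 1 (dd w f) x :=
  (hf.fderiv_right (m := 1) (by norm_num)).clm_apply contDiffAt_const

theorem lap_eq_sum_dd {f : Sp N → ℝ} {x : Sp N} (hf : ContDiffAt ℝ 2 f x) :
    lap f x = ∑ i, dd (EuclideanSpace.single i 1) (dd (EuclideanSpace.single i 1) f) x := by
  refine Finset.sum_congr rfl fun i _ => ?_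
  have h : DifferentiableAt ℝ (fderiv ℝ f) x :=
    (hf.fderiv_right (m := 1) (by norm_num)).differentiableAt one_ne_zero
  rw [iteratedFDeriv_two_apply]
  change _ = fderiv ℝ (fun z => fderiv ℝ f z _) x _
  rw [fderiv_clm_apply h (differentiableAt_const _)]
  simp

theorem eventually_contDiffAt {f : Sp N → ℝ} {x : Sp N} (hf : ContDiffAt ℝ 2 f x) :
    ∀ᶠ y in nhds x, ContDiffAt ℝ 2 f y := hf.eventually (by simp)

theorem ContDiffAt.differentiableAt_two {f : Sp N → ℝ} {x : Sp N} (hf : ContDiffAt ℝ 2 f x) :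
    DifferentiableAt ℝ f x := hf.differentiableAt two_ne_zero

theorem dd_congr {f g : Sp N → ℝ} {x : Sp N} (w : Sp N) (h : f =ᶠ[nhds x] g) :
    dd w f x = dd w g x := by
  simp [dd, h.fderiv_eq]

theorem lap_congr {f g : Sp N → ℝ} {x : Sp N} (h : f =ᶠ[nhds x] g) : lap f x = lap g x := by
  simp only [lap, (h.iteratedFDeriv ℝ 2).eq_of_nhds]

theorem lap_const (c : ℝ) (x : Sp N) : lap (fun _ => c) x = 0 := by
  have h : ∀ w : Sp N, dd w (fun _ : Sp N => c) = fun _ => 0 := fun w => by ext; simp [dd]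
  rw [lap_eq_sum_dd contDiffAt_const]
  simp only [h]
  simp [dd]

theorem lap_add {f g : Sp N → ℝ} {x : Sp N} (hf : ContDiffAt ℝ 2 f x) (hg : ContDiffAt ℝ 2 g x) :
    lap (fun y => f y + g y) x = lap f x + lap g x := by
  rw [lap_eq_sum_dd hf, lap_eq_sum_dd hg, lap_eq_sum_dd (hf.add hg), ← Finset.sum_add_distrib]
  refine Finset.sum_congr rfl fun i _ => ?_
  rw [dd_congr (g := fun y => dd (EuclideanSpace.single i 1) f y +
    dd (EuclideanSpace.single i 1) g y)]
  · have e : fderiv ℝ (fun y => dd (EuclideanSpace.single i 1) f y +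
        dd (EuclideanSpace.single i 1) g y) x = _ :=
      fderiv_fun_add ((contDiffAt_dd _ hf).differentiableAt one_ne_zero)
        ((contDiffAt_dd _ hg).differentiableAt one_ne_zero)
    rw [dd, e]
    rfl
  · filter_upwards [eventually_contDiffAt hf, eventually_contDiffAt hg] with y h1 h2
    simp only [dd]
    rw [fderiv_fun_add h1.differentiableAt_two h2.differentiableAt_two]
    rfl

theorem lap_mul {f g : Sp N → ℝ} {x : Sp N} (hf : ContDiffAt ℝ 2 f x) (hg : ContDiffAt ℝ 2 g x) :
    lap (fun y => f y * g y) x = f x * lap g x + 2 * gradDot f g x + g x * lap f x := by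
  rw [lap_eq_sum_dd hf, lap_eq_sum_dd hg, lap_eq_sum_dd (hf.mul hg), gradDot, Finset.mul_sum,
    Finset.mul_sum, Finset.mul_sum, ← Finset.sum_add_distrib, ← Finset.sum_add_distrib]
  refine Finset.sum_congr rfl fun i _ => ?_
  rw [dd_congr (g := fun y => f y * dd (EuclideanSpace.single i 1) g y +
    g y * dd (EuclideanSpace.single i 1) f y)]
  · have d1 := (contDiffAt_dd (EuclideanSpace.single i 1) hf).differentiableAt one_ne_zero
    have d2 := (contDiffAt_dd (EuclideanSpace.single i 1) hg).differentiableAt one_ne_zero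
    have e : fderiv ℝ (fun y => f y * dd (EuclideanSpace.single i 1) g y +
        g y * dd (EuclideanSpace.single i 1) f y) x = _ :=
      fderiv_fun_add (hf.differentiableAt_two.mul d2) (hg.differentiableAt_two.mul d1)
    have e2 := fderiv_fun_mul hf.differentiableAt_two d2
    have e3 := fderiv_fun_mul hg.differentiableAt_two d1
    rw [dd, e, e2, e3]
    simp only [dd, add_apply, smul_apply, smul_eq_mul]
    ring
  · filter_upwards [eventually_contDiffAt hf, eventually_contDiffAt hg] with y h1 h2
    simp only [dd]
    rw [fderiv_fun_mul h1.differentiableAt_two h2.differentiableAt_two]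
    simp

theorem lap_const_mul {f : Sp N → ℝ} {x : Sp N} (c : ℝ) (hf : ContDiffAt ℝ 2 f x) :
    lap (fun y => c * f y) x = c * lap f x := by
  rw [lap_mul contDiffAt_const hf, lap_const, gradDot]
  simp [dd]

theorem dd_comp_real {h : ℝ → ℝ} {f : Sp N → ℝ} {x : Sp N} (w : Sp N) (hh : ContDiff ℝ 2 h)
    (hf : DifferentiableAt ℝ f x) : dd w (fun y => h (f y)) x = deriv h (f x) * dd w f x := by
  have := ((hh.differentiable two_ne_zero (f x)).hasDerivAt.comp_hasFDerivAt x
    hf.hasFDerivAt).fderiv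
  change fderiv ℝ (h ∘ f) x w = _
  rw [this]; simp [dd]

theorem lap_comp {h : ℝ → ℝ} {f : Sp N → ℝ} {x : Sp N} (hh : ContDiff ℝ 2 h)
    (hf : ContDiffAt ℝ 2 f x) :
    lap (fun y => h (f y)) x =
      deriv (deriv h) (f x) * gradSq f x + deriv h (f x) * lap f x := by
  have hc : ContDiffAt ℝ 2 (fun y => h (f y)) x := hh.contDiffAt.comp x hf
  rw [lap_eq_sum_dd hf, lap_eq_sum_dd hc, gradSq, Finset.mul_sum,
    Finset.mul_sum, ← Finset.sum_add_distrib]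
  refine Finset.sum_congr rfl fun i _ => ?_
  rw [dd_congr (g := fun y => deriv h (f y) * dd (EuclideanSpace.single i 1) f y)]
  · have d1 := (contDiffAt_dd (EuclideanSpace.single i 1) hf).differentiableAt one_ne_zero
    have hd : ContDiff ℝ 1 (deriv h) := (contDiff_succ_iff_deriv (n := 1).1 hh).2.2
    have d2 := ((hd.differentiable one_ne_zero (f x)).hasDerivAt.comp_hasFDerivAt x
      hf.differentiableAt_two.hasFDerivAt)
    have e : fderiv ℝ (fun y => deriv h (f y) * dd (EuclideanSpace.single i 1) f y) x = _ :=
      fderiv_fun_mul (c := deriv h ∘ f) d2.differentiableAt d1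
    rw [dd, e, d2.fderiv]
    simp only [dd, add_apply, smul_apply, smul_eq_mul, Function.comp]
    ring
  · filter_upwards [eventually_contDiffAt hf] with y h1
    exact dd_comp_real _ hh h1.differentiableAt_two

theorem dd_norm_sub_sq (a x w : Sp N) : dd w (fun y => ‖y - a‖ ^ 2) x = 2 * inner ℝ (x - a) w := by
  have h := ((hasFDerivAt_id x).sub_const a).norm_sq
  have h' : HasFDerivAt (fun y : Sp N => ‖y - a‖ ^ 2) _ x := h
  rw [dd, h'.fderiv]
  simp [inner_sub_left]

theorem contDiff_norm_sub_sq (a : Sp N) {n : WithTop ℕ∞} : ContDiff ℝ n fun y : Sp N => ‖y - a‖ ^ 2 :=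
  (contDiff_id.sub contDiff_const).norm_sq ℝ

theorem gradSq_norm_sub_sq (a x : Sp N) : gradSq (fun y => ‖y - a‖ ^ 2) x = 4 * ‖x - a‖ ^ 2 := by
  simp only [gradSq, dd_norm_sub_sq]
  rw [EuclideanSpace.norm_sq_eq, Finset.mul_sum]
  refine Finset.sum_congr rfl fun i _ => ?_
  simp [EuclideanSpace.inner_single_right, mul_pow]; norm_num

theorem lap_norm_sub_sq (a x : Sp N) : lap (fun y => ‖y - a‖ ^ 2) x = 2 * N := by
  rw [lap_eq_sum_dd (contDiff_norm_sub_sq a).contDiffAt]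
  have : ∀ i, dd (EuclideanSpace.single i 1) (dd (EuclideanSpace.single i 1)
      fun y : Sp N => ‖y - a‖ ^ 2) x = 2 := by
    intro i
    have e : dd (EuclideanSpace.single i 1) (fun y : Sp N => ‖y - a‖ ^ 2) =
        fun y => 2 * (inner ℝ (EuclideanSpace.single i 1) (y - a)) := by
      ext y; rw [dd_norm_sub_sq, real_inner_comm]
    have h : HasFDerivAt (fun y : Sp N => 2 * (inner ℝ (EuclideanSpace.single i (1 : ℝ)) (y - a)))
        ((2 : ℝ) • (innerSL ℝ (EuclideanSpace.single i (1 : ℝ)))) x := by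
      have := ((innerSL ℝ (EuclideanSpace.single i (1 : ℝ) : Sp N)).hasFDerivAt.comp x
        ((hasFDerivAt_id x).sub_const a)).const_mul (2 : ℝ)
      simpa using this
    rw [e, dd, h.fderiv]
    simp
  simp [this, mul_comm]

theorem continuousOn_lap {f : Sp N → ℝ} {U : Set (Sp N)} (hU : IsOpen U)
    (hf : ContDiffOn ℝ 2 f U) : ContinuousOn (lap f) U := by
  intro x hx
  have hx' := hf.contDiffAt (hU.mem_nhds hx)
  have h : ∀ᶠ y in nhds x, lap f y =
      ∑ i, dd (EuclideanSpace.single i 1) (dd (EuclideanSpace.single i 1) f) y := by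
    filter_upwards [eventually_contDiffAt hx'] with y hy using lap_eq_sum_dd hy
  refine ContinuousAt.continuousWithinAt (ContinuousAt.congr ?_ (h.mono fun y hy => hy.symm))
  refine tendsto_finsetSum _ fun i _ => ?_
  have h1 := contDiffAt_dd (EuclideanSpace.single i 1) hx'
  have h2 : ContDiffAt ℝ 0 (fderiv ℝ (dd (EuclideanSpace.single i 1) f)) x :=
    h1.fderiv_right (by norm_num)
  exact (h2.clm_apply contDiffAt_const).continuousAt

theorem integral_dd_eq_zero {F : Sp N → ℝ} (w : Sp N) (hF : ContDiff ℝ 1 F)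
    (hc : HasCompactSupport F) : ∫ x, dd w F x = 0 := by
  have hi : Integrable F := hF.continuous.integrable_of_hasCompactSupport hc
  have hi' : Integrable (dd w F) :=
    ((hF.continuous_fderiv one_ne_zero).clm_apply continuous_const).integrable_of_hasCompactSupport
      (HasCompactSupport.dd w hc)
  have := integral_mul_fderiv_eq_neg_fderiv_mul_of_integrable (μ := (volume : Measure (Sp N)))
    (f := fun _ => (1 : ℝ)) (g := F) (v := w) (by simp) (by simp only [one_mul]; exact hi')
    (by simpa using hi)
    (fun _ _ => differentiableAt_const _) (fun x _ => hF.differentiable one_ne_zero x)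
  simpa [dd] using this

theorem integral_lap_eq_zero {w : Sp N → ℝ} (hw : ContDiff ℝ 2 w) (hc : HasCompactSupport w) :
    ∫ x, lap w x = 0 := by
  have h1 : ∀ i : Fin N, ContDiff ℝ 1 (dd (EuclideanSpace.single i 1) w) := fun i =>
    (hw.fderiv_right (m := 1) (by norm_num)).clm_apply contDiff_const
  have hc1 := fun i : Fin N => HasCompactSupport.dd (EuclideanSpace.single i (1 : ℝ)) hc
  rw [funext fun x => lap_eq_sum_dd (hw.contDiffAt (x := x)), integral_finsetSum _ fun i _ => ?_]
  · exact Finset.sum_eq_zero fun i _ => integral_dd_eq_zero _ (h1 i) (hc1 i)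
  · exact (((h1 i).continuous_fderiv one_ne_zero).clm_apply
      continuous_const).integrable_of_hasCompactSupport (HasCompactSupport.dd _ (hc1 i))

/-- Green's identity, when one of the functions has compact support. -/
theorem integral_lap_mul_eq {w η : Sp N → ℝ} {U : Set (Sp N)} (hU : IsOpen U)
    (hw : ContDiffOn ℝ 2 w U) (hη : ContDiff ℝ 2 η) (hc : HasCompactSupport η)
    (hs : tsupport η ⊆ U) :
    ∫ x, lap w x * η x = ∫ x, w x * lap η x ∧ Integrable (fun x => lap w x * η x) ∧
      Integrable (fun x => w x * lap η x) := by
  have hz : ∀ x ∉ tsupport η, η =ᶠ[nhds x] fun _ => 0 := fun x hx =>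
    notMem_tsupport_iff_eventuallyEq.1 hx
  have hwa : ∀ x ∈ U, ContDiffAt ℝ 2 w x := fun x hx => hw.contDiffAt (hU.mem_nhds hx)
  have hηw : ∀ x ∈ tsupport η, ContDiffAt ℝ 2 w x := fun x hx => hwa x (hs hx)
  have cover : ∀ {P : Sp N → Prop}, (∀ x ∈ U, P x) → (∀ x ∉ tsupport η, P x) → ∀ x, P x :=
    fun h1 h2 x => by
      by_cases hx : x ∈ tsupport η
      · exact h1 x (hs hx)
      · exact h2 x hx
  have hlapz : ∀ x ∉ tsupport η, lap η =ᶠ[nhds x] fun _ => 0 := fun x hx => by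
    filter_upwards [(hz x hx).eventuallyEq_nhds] with y hy
    rw [lap_congr hy, lap_const]
  have hddz : ∀ (d : Sp N), ∀ x ∉ tsupport η, dd d η =ᶠ[nhds x] fun _ => 0 := fun d x hx => by
    filter_upwards [(hz x hx).eventuallyEq_nhds] with y hy
    rw [dd_congr d hy]; simp [dd]
  have cs : ∀ {F : Sp N → ℝ}, (∀ x ∉ tsupport η, F x = 0) → HasCompactSupport F := fun h =>
    HasCompactSupport.intro hc h
  have i1 : Integrable (fun x => lap w x * η x) := by
    refine Continuous.integrable_of_hasCompactSupport ?_ (cs fun x hx => by simp [(hz x hx).self_of_nhds])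
    refine continuous_iff_continuousAt.2 (cover (fun x hx => ?_) fun x hx => ?_)
    · exact ((continuousOn_lap hU hw).continuousAt (hU.mem_nhds hx)).mul hη.continuous.continuousAt
    · refine (continuousAt_const (y := (0 : ℝ))).congr ((hz x hx).mono fun y hy => ?_)
      simp [hy]
  have hlc : Continuous (lap η) := by
    rw [← continuousOn_univ]; exact continuousOn_lap isOpen_univ hη.contDiffOn
  have i2 : Integrable (fun x => w x * lap η x) := by
    refine Continuous.integrable_of_hasCompactSupport ?_
      (cs fun x hx => by simp [(hlapz x hx).self_of_nhds])
    refine continuous_iff_continuousAt.2 (cover (fun x hx => ?_) fun x hx => ?_)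
    · exact (hwa x hx).continuousAt.mul hlc.continuousAt
    · refine (continuousAt_const (y := (0 : ℝ))).congr ((hlapz x hx).mono fun y hy => ?_)
      simp [hy]
  refine ⟨?_, i1, i2⟩
  let F : Fin N → Sp N → ℝ := fun i x => w x * dd (EuclideanSpace.single i 1) η x -
    η x * dd (EuclideanSpace.single i 1) w x
  have hF0 : ∀ i, ∀ x ∉ tsupport η, F i =ᶠ[nhds x] fun _ => 0 := fun i x hx => by
    filter_upwards [hz x hx, hddz (EuclideanSpace.single i 1) x hx] with y h1 h2
    simp [F, h1, h2]
  have hF : ∀ i, ContDiff ℝ 1 (F i) := fun i => contDiff_iff_contDiffAt.2 <| by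
    refine cover (fun x hx => ?_) fun x hx => ?_
    · exact ((hwa x hx).of_le (by norm_num) |>.mul (contDiffAt_dd _ hη.contDiffAt)).sub
        ((hη.contDiffAt.of_le (by norm_num)).mul (contDiffAt_dd _ (hwa x hx)))
    · exact contDiffAt_const.congr_of_eventuallyEq (hF0 i x hx)
  have hFc : ∀ i, HasCompactSupport (F i) := fun i => cs fun x hx => (hF0 i x hx).self_of_nhds
  have key : ∀ x, w x * lap η x - lap w x * η x = ∑ i, dd (EuclideanSpace.single i 1) (F i) x := by
    refine cover (fun x hx => ?_) fun x hx => ?_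
    · have a1 := hwa x hx
      have a2 : ContDiffAt ℝ 2 η x := hη.contDiffAt
      rw [lap_eq_sum_dd a1, lap_eq_sum_dd a2, Finset.mul_sum, Finset.sum_mul,
        ← Finset.sum_sub_distrib]
      refine Finset.sum_congr rfl fun i _ => ?_
      have d1 := (contDiffAt_dd (EuclideanSpace.single i 1) a1).differentiableAt one_ne_zero
      have d2 := (contDiffAt_dd (EuclideanSpace.single i 1) a2).differentiableAt one_ne_zero
      have e : fderiv ℝ (F i) x = _ := fderiv_fun_sub (a1.differentiableAt_two.mul d2)
        (a2.differentiableAt_two.mul d1)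
      have e2 := fderiv_fun_mul a1.differentiableAt_two d2
      have e3 := fderiv_fun_mul a2.differentiableAt_two d1
      rw [dd, dd, dd, e, e2, e3]
      simp only [dd, sub_apply, add_apply, smul_apply, smul_eq_mul]
      ring
    · rw [(hz x hx).self_of_nhds, (hlapz x hx).self_of_nhds]
      have : ∀ i, dd (EuclideanSpace.single i 1) (F i) x = 0 := fun i => by
        rw [dd_congr _ (hF0 i x hx)]; simp [dd]
      simp [this]
  have := integral_sub i2 i1
  rw [funext key, integral_finsetSum _ fun i _ => ?_] at this
  · rw [Finset.sum_eq_zero fun i _ => integral_dd_eq_zero _ (hF i) (hFc i)] at this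
    linarith
  · exact (((hF i).continuous_fderiv one_ne_zero).clm_apply
      continuous_const).integrable_of_hasCompactSupport (HasCompactSupport.dd _ (hFc i))

end Laplacian

section ClosedCover

theorem le_of_frequently_slope_le {Y : ℝ → ℝ} {a b : ℝ} (hab : a ≤ b)
    (hY : ContinuousOn Y (Icc a b))
    (h : ∀ s ∈ Ico a b, ∀ ε > 0, ∃ᶠ t in 𝓝[>] s, Y t - Y s ≤ ε * (t - s)) : Y b ≤ Y a := by
  refine le_of_forall_pos_le_add fun ε hε => ?_
  have hpos : 0 < ε / (b - a + 1) := div_pos hε (by linarith)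
  have key := image_le_of_liminf_slope_right_lt_deriv_boundary (f := Y)
    (f' := fun _ => ε / (b - a + 1) / 2) hY (fun x hx r hr => ?_)
    (B := fun x => Y a + ε / (b - a + 1) * (x - a)) (B' := fun _ => ε / (b - a + 1))
    (by simp) (fun x => by
      simpa using ((((hasDerivAt_id x).sub_const a).const_mul (ε / (b - a + 1))).const_add (Y a)))
    (fun _ _ _ => by linarith) (right_mem_Icc.2 hab)
  · refine key.trans ?_
    have : ε / (b - a + 1) * (b - a) ≤ ε := by
      rw [div_mul_eq_mul_div, div_le_iff₀ (by linarith)]; nlinarith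
    linarith
  · refine ((h x hx _ (half_pos hpos)).and_eventually self_mem_nhdsWithin).mono fun t ht => ?_
    have ht' : 0 < t - x := sub_pos.2 ht.2
    rw [slope_def_field]
    refine lt_of_le_of_lt ?_ hr
    rw [div_le_iff₀ ht']; exact ht.1

theorem le_of_locally_antitone {Y : ℝ → ℝ} {a b : ℝ} (hab : a ≤ b)
    (hY : ContinuousOn Y (Icc a b))
    (h : ∀ s ∈ Ico a b, ∀ᶠ t in 𝓝[>] s, Y t ≤ Y s) : Y b ≤ Y a := by
  refine le_of_frequently_slope_le hab hY fun s hs ε hε => Filter.Eventually.frequently ?_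
  filter_upwards [h s hs, self_mem_nhdsWithin] with t ht ht'
  have : 0 ≤ ε * (t - s) := mul_nonneg hε.le (sub_nonneg.2 (le_of_lt ht'))
  linarith

/-- A continuous function whose upper right Dini derivatives along the members of a countable
closed cover are nonpositive is nonincreasing. -/
theorem le_of_closed_cover {Y : ℝ → ℝ} {a b : ℝ} (hab : a ≤ b) (hY : ContinuousOn Y (Icc a b))
    {F : ℕ → Set ℝ} (hF : ∀ k, IsClosed (F k)) (hcov : Icc a b ⊆ ⋃ k, F k)
    (hD : ∀ k, ∀ s ∈ F k, s ∈ Ico a b → ∀ ε > 0, ∀ᶠ t in 𝓝[>] s, t ∈ F k →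
      Y t - Y s ≤ ε * (t - s)) : Y b ≤ Y a := by
  set G : Set ℝ := {s | ∃ δ > 0, ∀ c d, c ∈ Icc a b → d ∈ Icc a b → c ∈ ball s δ → d ∈ ball s δ →
    c ≤ d → Y d ≤ Y c} with hG
  have hGo : IsOpen G := by
    rw [Metric.isOpen_iff]
    rintro s ⟨δ, hδ, h⟩
    refine ⟨δ / 2, by positivity, fun s' hs' => ⟨δ / 2, by positivity, fun c d hc hd hcb hdb =>
      h c d hc hd ?_ ?_⟩⟩
    · have := dist_triangle c s' s; rw [mem_ball] at *; linarith
    · have := dist_triangle d s' s; rw [mem_ball] at *; linarith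
  have hGr : ∀ s ∈ G, s ∈ Ico a b → ∀ᶠ t in 𝓝[>] s, Y t ≤ Y s := by
    rintro s ⟨δ, hδ, h⟩ hs
    have h1 : ∀ᶠ t in 𝓝[>] s, t ∈ ball s δ := nhdsWithin_le_nhds (ball_mem_nhds s hδ)
    have h2 : ∀ᶠ t in 𝓝[>] s, t ∈ Ioo s b := Ioo_mem_nhdsGT hs.2
    filter_upwards [h1, h2] with t h1 h2
    exact h s t ⟨hs.1, hs.2.le⟩ ⟨hs.1.trans h2.1.le, h2.2.le⟩ (mem_ball_self hδ) h1 h2.1.le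
  set P : Set ℝ := Icc a b \ G with hP
  have hPc : IsClosed P := isClosed_Icc.sdiff hGo
  by_cases hne : P.Nonempty
  · exfalso
    have : Nonempty P := hne.to_subtype
    have : CompleteSpace P := hPc.completeSpace_coe
    obtain ⟨k, ⟨x0, hx0P⟩, hx0⟩ := nonempty_interior_of_iUnion_of_closed
      (f := fun k => {x : P | (x : ℝ) ∈ F k}) (fun k => (hF k).preimage continuous_subtype_val)
      (by
        ext x
        simp only [mem_iUnion, mem_ofPred_eq, mem_univ, iff_true]
        simpa using hcov x.2.1)
    rw [mem_interior_iff_mem_nhds, Metric.mem_nhds_iff] at hx0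
    obtain ⟨δ, hδ, hsub⟩ := hx0
    have hPF : ∀ s ∈ P, s ∈ ball x0 δ → s ∈ F k := fun s hs hb =>
      hsub (show (⟨s, hs⟩ : P) ∈ ball (⟨x0, hx0P⟩ : P) δ from hb)
    refine hx0P.2 ⟨δ, hδ, fun c d hc hd hcb hdb hcd => ?_⟩
    have hYcd : ContinuousOn Y (Icc c d) := hY.mono (Icc_subset_Icc hc.1 hd.2)
    refine le_of_frequently_slope_le hcd hYcd fun s hs ε hε => ?_
    have hsab : s ∈ Ico a b := ⟨hc.1.trans hs.1, hs.2.trans_le hd.2⟩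
    have hball : ∀ t ∈ Icc c d, t ∈ ball x0 δ := fun t ht => by
      rw [Real.ball_eq_Ioo] at *
      exact ⟨hcb.1.trans_le ht.1, ht.2.trans_lt hdb.2⟩
    have hIoo : ∀ᶠ t in 𝓝[>] s, t ∈ Ioo s d := Ioo_mem_nhdsGT hs.2
    have pass : (∀ᶠ t in 𝓝[>] s, Y t ≤ Y s) → ∃ᶠ t in 𝓝[>] s, Y t - Y s ≤ ε * (t - s) := by
      intro h
      refine Filter.Eventually.frequently ?_
      filter_upwards [h, hIoo] with t ht ht'
      have : 0 ≤ ε * (t - s) := mul_nonneg hε.le (sub_nonneg.2 ht'.1.le)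
      linarith
    by_cases hsP : s ∈ P
    · by_cases hfr : ∃ᶠ t in 𝓝[>] s, t ∈ P
      · refine (hfr.and_eventually ((hD k s (hPF s hsP (hball s ⟨hs.1, hs.2.le⟩)) hsab ε hε).and
          hIoo)).mono fun t ht => ht.2.1 (hPF t ht.1 (hball t ⟨hs.1.trans ht.2.2.1.le, ht.2.2.2.le⟩))
      · apply pass
        rw [Filter.not_frequently] at hfr
        obtain ⟨e, he, hsub'⟩ := (mem_nhdsGT_iff_exists_Ioo_subset' hs.2).1 (hfr.and hIoo)
        have hanti : ∀ p q, s < p → p ≤ q → q < e → Y q ≤ Y p := by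
          intro p q hsp hpq hqe
          have hq := hsub' ⟨hsp.trans_le hpq, hqe⟩
          refine le_of_locally_antitone hpq (hYcd.mono (Icc_subset_Icc (hs.1.trans hsp.le)
            hq.2.2.le)) fun t ht => ?_
          have h1 := hsub' ⟨hsp.trans_le ht.1, ht.2.trans hqe⟩
          have hab' : t ∈ Ico a b := ⟨hsab.1.trans h1.2.1.le, h1.2.2.trans_le hd.2⟩
          refine hGr t ?_ hab'
          by_contra hcon
          exact h1.1 ⟨⟨hab'.1, hab'.2.le⟩, hcon⟩
        filter_upwards [Ioo_mem_nhdsGT (show s < e from he)] with t ht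
        have hcont : Filter.Tendsto Y (𝓝[>] s) (𝓝 (Y s)) := by
          have := hYcd s ⟨hs.1, hs.2.le⟩
          refine this.mono_left (nhdsWithin_le_iff.2 ?_)
          filter_upwards [hIoo] with q hq using ⟨hs.1.trans hq.1.le, hq.2.le⟩
        refine ge_of_tendsto hcont ?_
        filter_upwards [Ioo_mem_nhdsGT ht.1] with q hq
        exact hanti q t hq.1 hq.2.le ht.2
    · refine pass (hGr s ?_ hsab)
      by_contra hcon
      exact hsP ⟨⟨hsab.1, hsab.2.le⟩, hcon⟩
  · rw [not_nonempty_iff_eq_empty] at hne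
    refine le_of_locally_antitone hab hY fun s hs => hGr s ?_ hs
    by_contra hcon
    have : s ∈ P := ⟨⟨hs.1, hs.2.le⟩, hcon⟩
    rw [hne] at this; exact this

end ClosedCover

section TruncatedCube

theorem hasDerivAt_max_zero_pow (n : ℕ) (hn : 2 ≤ n) (x : ℝ) :
    HasDerivAt (fun x : ℝ => max x 0 ^ n) (n * max x 0 ^ (n - 1)) x := by
  rcases lt_trichotomy x 0 with h | h | h
  · rw [max_eq_right h.le, zero_pow (by omega), mul_zero]
    refine (hasDerivAt_const x (0 : ℝ)).congr_of_eventuallyEq ?_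
    filter_upwards [Iio_mem_nhds h] with y hy
    rw [max_eq_right (le_of_lt hy), zero_pow (by omega)]
  · subst h
    rw [max_self, zero_pow (by omega), mul_zero, hasDerivAt_iff_isLittleO]
    have h1 : (fun x : ℝ => x ^ n) =o[𝓝 0] fun x => x := by
      simpa using Asymptotics.isLittleO_pow_pow (𝕜 := ℝ) (show 1 < n by omega)
    refine (Asymptotics.IsBigO.of_bound 1 (Filter.Eventually.of_forall fun y => ?_)).trans_isLittleO
      (h1.trans_isBigO (Asymptotics.isBigO_of_le _ fun y => by simp))
    have : |max y 0| ≤ |y| := by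
      rw [abs_of_nonneg (le_max_right _ _)]; exact max_le (le_abs_self _) (abs_nonneg _)
    simp only [max_self, sub_zero, smul_zero, norm_eq_abs, one_mul, abs_pow,
      zero_pow (show n ≠ 0 by omega)]
    exact pow_le_pow_left₀ (abs_nonneg _) this n
  · rw [max_eq_left h.le]
    refine (hasDerivAt_pow n x).congr_of_eventuallyEq ?_
    filter_upwards [Ioi_mem_nhds h] with y hy
    rw [max_eq_left (le_of_lt hy)]

/-- The cube of the negative part. -/
noncomputable def negCube (x : ℝ) : ℝ := max (-x) 0 ^ 3

theorem hasDerivAt_negCube (x : ℝ) : HasDerivAt negCube (-(3 * max (-x) 0 ^ 2)) x := by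
  have := (hasDerivAt_max_zero_pow 3 (by norm_num) (-x)).comp x (hasDerivAt_neg x)
  refine this.congr_deriv ?_
  norm_num

theorem deriv_negCube : deriv negCube = fun x => -(3 * max (-x) 0 ^ 2) :=
  funext fun x => (hasDerivAt_negCube x).deriv

theorem hasDerivAt_deriv_negCube (x : ℝ) : HasDerivAt (deriv negCube) (6 * max (-x) 0) x := by
  have := (((hasDerivAt_max_zero_pow 2 (by norm_num) (-x)).comp x
    (hasDerivAt_neg x)).const_mul 3).neg
  rw [deriv_negCube]
  refine this.congr_deriv ?_
  norm_num; ring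

theorem contDiff_negCube : ContDiff ℝ 2 negCube := by
  have e : deriv (deriv negCube) = fun x => 6 * max (-x) 0 :=
    funext fun x => (hasDerivAt_deriv_negCube x).deriv
  rw [show (2 : WithTop ℕ∞) = 1 + 1 by norm_num, contDiff_succ_iff_deriv]
  refine ⟨fun x => (hasDerivAt_negCube x).differentiableAt, by simp, ?_⟩
  rw [contDiff_one_iff_deriv, e]
  exact ⟨fun x => (hasDerivAt_deriv_negCube x).differentiableAt, by fun_prop⟩

theorem negCube_eq_zero {x : ℝ} (hx : 0 ≤ x) : negCube x = 0 := by
  simp [negCube, max_eq_right (neg_nonpos.2 hx)]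

theorem negCube_nonneg (x : ℝ) : 0 ≤ negCube x := pow_nonneg (le_max_right _ _) 3

theorem abs_negCube_le {x M : ℝ} (h : |x| ≤ M) : |negCube x| ≤ M ^ 3 := by
  rw [abs_of_nonneg (negCube_nonneg x)]
  have : -x ≤ M := (neg_le_abs x).trans h
  exact pow_le_pow_left₀ (le_max_right _ _) (max_le this ((abs_nonneg _).trans h)) 3

theorem negCube_sub_le {x y M c : ℝ} (hx : |x| ≤ M) (hy : |y| ≤ M) (hc : 0 ≤ c)
    (h : x - c ≤ y) : negCube y - negCube x ≤ 3 * M ^ 2 * c := by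
  have hM : 0 ≤ M := (abs_nonneg _).trans hx
  unfold negCube
  have hx1 : 0 ≤ max (-x) 0 := le_max_right _ _
  have hy1 : 0 ≤ max (-y) 0 := le_max_right _ _
  have hx2 : max (-x) 0 ≤ M := max_le ((neg_le_abs x).trans hx) hM
  have hy2 : max (-y) 0 ≤ M := max_le ((neg_le_abs y).trans hy) hM
  have hxy : max (-y) 0 ≤ max (-x) 0 + c :=
    max_le (by linarith [le_max_left (-x) 0]) (by linarith)
  generalize max (-x) 0 = q at *
  generalize max (-y) 0 = p at *
  have e : p ^ 3 - q ^ 3 = (p - q) * (p ^ 2 + p * q + q ^ 2) := by ring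
  have s1 : p ^ 2 + p * q + q ^ 2 ≤ 3 * M ^ 2 := by nlinarith [mul_le_mul hy2 hx2 hx1 hM]
  have s0 : 0 ≤ p ^ 2 + p * q + q ^ 2 := by positivity
  rw [e]
  calc (p - q) * (p ^ 2 + p * q + q ^ 2) ≤ c * (p ^ 2 + p * q + q ^ 2) := by
        gcongr; linarith
    _ ≤ c * (3 * M ^ 2) := by gcongr
    _ = _ := by ring

end TruncatedCube

section Dominated

theorem eventually_setIntegral_le {α : Type*} [MeasurableSpace α] {μ : Measure α} {K : Set α}
    (hK : MeasurableSet K) (hKμ : μ K ≠ ⊤) {l : Filter ℝ} [l.IsCountablyGenerated]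
    {D : ℝ → α → ℝ} {L E : α → ℝ} {C : ℝ}
    (hD : ∀ᶠ t in l, IntegrableOn (D t) K μ) (hE : IntegrableOn E K μ)
    (hDC : ∀ᶠ t in l, ∀ x ∈ K, D t x ≤ C) (hEC : ∀ x ∈ K, |E x| ≤ C)
    (hlim : ∀ x ∈ K, Filter.Tendsto (fun t => D t x) l (𝓝 (L x)))
    (hLE : ∀ x ∈ K, L x ≤ E x) {ε : ℝ} (hε : 0 < ε) :
    ∀ᶠ t in l, ∫ x in K, D t x ∂μ ≤ (∫ x in K, E x ∂μ) + ε := by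
  have hT : Filter.Tendsto (fun t => ∫ x in K, max (D t x) (E x) ∂μ) l
      (𝓝 (∫ x in K, E x ∂μ)) := by
    refine tendsto_integral_filter_of_dominated_convergence (fun _ => C) ?_ ?_ ?_ ?_
    · filter_upwards [hD] with t ht using (ht.sup hE).aestronglyMeasurable
    · filter_upwards [hDC] with t ht
      refine (ae_restrict_iff' hK).2 (Filter.Eventually.of_forall fun x hx => ?_)
      rw [norm_eq_abs, abs_le]
      have := abs_le.1 (hEC x hx)
      exact ⟨this.1.trans (le_max_right _ _), max_le (ht x hx) this.2⟩
    · exact integrableOn_const hKμ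
    · refine (ae_restrict_iff' hK).2 (Filter.Eventually.of_forall fun x hx => ?_)
      have := (hlim x hx).max (tendsto_const_nhds (x := E x))
      rwa [max_eq_right (hLE x hx)] at this
  filter_upwards [hT.eventually (gt_mem_nhds (lt_add_of_pos_right _ hε)), hD] with t ht hDt
  refine le_trans ?_ ht.le
  exact integral_mono hDt (hDt.sup hE) fun x => le_max_left _ _

end Dominated

section MinimumPrinciple

variable {N : ℕ}

/-- `z` does not decrease faster than linearly in time, uniformly on `S`, after any given time. -/
def LowerLip (z : Sp N → ℝ → ℝ) (I : Set ℝ) (S : Set (Sp N)) : Prop :=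
  ∀ s ∈ I, ∃ C, ∀ y ∈ S, ∀ t ∈ I, s ≤ t → -(C * (t - s)) ≤ z y t - z y s

theorem LowerLip.mono {z : Sp N → ℝ → ℝ} {I J : Set ℝ} {S S' : Set (Sp N)} (h : LowerLip z I S)
    (hJ : J ⊆ I) (hS : S' ⊆ S) : LowerLip z J S' := fun s hs => by
  obtain ⟨C, hC⟩ := h s (hJ hs)
  exact ⟨C, fun y hy t ht => hC y (hS hy) t (hJ ht)⟩

theorem LowerLip.of_isCompact {z : Sp N → ℝ → ℝ} {I : Set ℝ} {K : Set (Sp N)} (hK : IsCompact K)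
    (h : ∀ x ∈ K, ∃ W ∈ 𝓝 x, LowerLip z I W) : LowerLip z I K := by
  refine hK.induction_on (p := fun S => LowerLip z I S) (fun s _ => ⟨0, by simp⟩)
    (fun S S' hSS' h => h.mono le_rfl hSS') (fun S S' h h' s hs => ?_) (fun x hx => ?_)
  · obtain ⟨C, hC⟩ := h s hs
    obtain ⟨C', hC'⟩ := h' s hs
    refine ⟨max C C', fun y hy t ht hst => ?_⟩
    have h0 : 0 ≤ t - s := sub_nonneg.2 hst
    rcases hy with hy | hy
    · have := hC y hy t ht hst
      have := mul_le_mul_of_nonneg_right (le_max_left C C') h0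
      linarith
    · have := hC' y hy t ht hst
      have := mul_le_mul_of_nonneg_right (le_max_right C C') h0
      linarith
  · obtain ⟨W, hW, hl⟩ := h x hx
    exact ⟨W, mem_nhdsWithin_of_mem_nhds hW, hl⟩

theorem nonneg_of_supersolution_aux {K₀ G : Set (Sp N)} (hK₀ : IsCompact K₀) (hG : IsOpen G)
    (hGK : G ⊆ K₀) {a b : ℝ} (hab : a ≤ b) {z z' : Sp N → ℝ → ℝ} {M : ℝ}
    (hx : ∀ s ∈ Icc a b, ContDiffOn ℝ 2 (fun x => z x s) G)
    (hxK : ∀ s ∈ Icc a b, ContinuousOn (fun x => z x s) K₀)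
    (ht : ∀ x ∈ K₀, ContinuousOn (z x) (Icc a b))
    (ht' : ∀ x ∈ G, ∀ s ∈ Ico a b, HasDerivWithinAt (z x) (z' x s) (Ioi s) s)
    (hM : ∀ x ∈ K₀, ∀ s ∈ Icc a b, |z x s| ≤ M)
    (hsup : ∀ x ∈ G, ∀ s ∈ Ico a b, lap (fun y => z y s) x ≤ z' x s)
    (hLB : ∀ x ∈ G, ∃ W ∈ 𝓝 x, LowerLip z (Icc a b) W)
    (h0 : ∀ x ∈ K₀, 0 ≤ z x a) (hb : ∀ x ∈ K₀, x ∉ G → ∀ s ∈ Icc a b, 0 < z x s) :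
    ∀ x ∈ K₀, 0 ≤ z x b := by
  have hM0 : ∀ x ∈ K₀, 0 ≤ M := fun x hx => (abs_nonneg _).trans (hM x hx a (left_mem_Icc.2 hab))
  have hGm := hG.measurableSet
  have hGμ : volume G ≠ ⊤ := ((measure_mono hGK).trans_lt hK₀.measure_lt_top).ne
  set Y : ℝ → ℝ := fun s => ∫ x in G, negCube (z x s) with hY
  have hmeas : ∀ s ∈ Icc a b, AEStronglyMeasurable (fun x => negCube (z x s))
      (volume.restrict G) := fun s hs =>
    (contDiff_negCube.continuous.comp_continuousOn (hx s hs).continuousOn).aestronglyMeasurable hGm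
  have hbound : ∀ s ∈ Icc a b, ∀ᵐ x ∂volume.restrict G, ‖negCube (z x s)‖ ≤ M ^ 3 := fun s hs =>
    (ae_restrict_iff' hGm).2 (Filter.Eventually.of_forall fun x hx =>
      abs_negCube_le (hM x (hGK hx) s hs))
  have hInt : ∀ s ∈ Icc a b, IntegrableOn (fun x => negCube (z x s)) G := fun s hs =>
    (integrableOn_const (C := M ^ 3) hGμ).mono' (hmeas s hs) (hbound s hs)
  have hYc : ContinuousOn Y (Icc a b) :=
    continuousOn_of_dominated hmeas hbound (integrableOn_const hGμ)
      ((ae_restrict_iff' hGm).2 (Filter.Eventually.of_forall fun x hx =>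
        contDiff_negCube.continuous.comp_continuousOn (ht x (hGK hx))))
  set K : ℕ → Set (Sp N) := fun k => K₀ \ thickening (1 / ((k : ℝ) + 1)) Gᶜ with hK
  have hKc : ∀ k, IsCompact (K k) := fun k => hK₀.diff isOpen_thickening
  have hKG : ∀ k, K k ⊆ G := fun k x hx => by
    by_contra hcon
    exact hx.2 (self_subset_thickening (by positivity) _ hcon)
  set F : ℕ → Set ℝ := fun k => {s | s ∈ Icc a b ∧ ∀ x ∈ K₀ \ K k, 0 ≤ z x s} with hF
  have hFc : ∀ k, IsClosed (F k) := fun k => by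
    have : F k = Icc a b ∩ ⋂ x ∈ K₀ \ K k, (Icc a b ∩ z x ⁻¹' Ici 0) := by
      ext s
      simp only [hF, mem_ofPred_eq, mem_inter_iff, mem_iInter, mem_preimage, mem_Ici]
      exact ⟨fun h => ⟨h.1, fun x hx => ⟨h.1, h.2 x hx⟩⟩, fun h => ⟨h.1, fun x hx => (h.2 x hx).2⟩⟩
    rw [this]
    exact isClosed_Icc.inter (isClosed_biInter fun x hx =>
      (ht x hx.1).preimage_isClosed_of_isClosed isClosed_Icc isClosed_Ici)
  have hcov : Icc a b ⊆ ⋃ k, F k := fun s hs => by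
    have hLc : IsCompact (K₀ ∩ (fun x => z x s) ⁻¹' Iic 0) :=
      hK₀.of_isClosed_subset ((hxK s hs).preimage_isClosed_of_isClosed hK₀.isClosed isClosed_Iic)
        inter_subset_left
    obtain ⟨δ, hδ, hsub⟩ := hLc.exists_thickening_subset_open hG fun x hx => by
      by_contra hcon
      exact absurd (hb x hx.1 hcon s hs) (not_lt.2 hx.2)
    obtain ⟨k, hk⟩ := exists_nat_one_div_lt hδ
    refine mem_iUnion.2 ⟨k, hs, fun x hx => ?_⟩
    by_contra hcon
    refine hx.2 ⟨hx.1, fun hth => ?_⟩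
    obtain ⟨y, hy, hxy⟩ := mem_thickening_iff.1 hth
    refine hy (hsub (mem_thickening_iff.2 ⟨x, ⟨hx.1, (not_le.1 hcon).le⟩, ?_⟩))
    rw [dist_comm]; exact hxy.trans hk
  have hYK : ∀ k, ∀ s ∈ F k, Y s = ∫ x in K k, negCube (z x s) := fun k s hs =>
    setIntegral_eq_of_subset_of_forall_sdiff_eq_zero hGm (hKG k) fun x hx =>
      negCube_eq_zero (hs.2 x ⟨hGK hx.1, hx.2⟩)
  have hD : ∀ k, ∀ s ∈ F k, s ∈ Ico a b → ∀ ε > 0, ∀ᶠ t in 𝓝[>] s, t ∈ F k →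
      Y t - Y s ≤ ε * (t - s) := by
    intro k s hs hsab ε hε
    have hsI : s ∈ Icc a b := ⟨hsab.1, hsab.2.le⟩
    set W : Sp N → ℝ := G.indicator fun x => negCube (z x s) with hW
    have hWG : ∀ x ∈ G, W =ᶠ[𝓝 x] fun y => negCube (z y s) := fun x hx => by
      filter_upwards [hG.mem_nhds hx] with y hy using indicator_of_mem hy _
    have hW0 : ∀ x ∉ K k, W x = 0 := fun x hx => by
      by_cases hxG : x ∈ G
      · rw [hW, indicator_of_mem hxG, negCube_eq_zero (hs.2 x ⟨hGK hxG, hx⟩)]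
      · exact indicator_of_notMem hxG _
    have hW0' : ∀ x ∉ K k, W =ᶠ[𝓝 x] fun _ => 0 := fun x hx => by
      filter_upwards [(hKc k).isClosed.isOpen_compl.mem_nhds hx] with y hy using hW0 y hy
    have hzat : ∀ x ∈ G, ContDiffAt ℝ 2 (fun y => z y s) x := fun x hx' =>
      (hx s hsI).contDiffAt (hG.mem_nhds hx')
    have hWc : ContDiff ℝ 2 W := contDiff_iff_contDiffAt.2 fun x => by
      by_cases hxK : x ∈ K k
      · exact (contDiff_negCube.contDiffAt.comp x (hzat x (hKG k hxK))).congr_of_eventuallyEq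
          (hWG x (hKG k hxK))
      · exact contDiffAt_const.congr_of_eventuallyEq (hW0' x hxK)
    have hlapc : Continuous (lap W) := by
      rw [← continuousOn_univ]; exact continuousOn_lap isOpen_univ hWc.contDiffOn
    have hlapint : ∫ x in K k, lap W x = 0 := by
      rw [setIntegral_eq_integral_of_forall_compl_eq_zero fun x hx => by
        rw [lap_congr (hW0' x hx), lap_const]]
      exact integral_lap_eq_zero hWc (HasCompactSupport.intro (hKc k) hW0)
    obtain ⟨C₁, hC₁⟩ := (hKc k).exists_bound_of_continuousOn hlapc.continuousOn
    obtain ⟨C₂, hC₂⟩ := LowerLip.of_isCompact (hKc k) (fun x hx => hLB x (hKG k hx)) s hsI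
    have hKint : ∀ t ∈ Icc a b, IntegrableOn (fun x => negCube (z x t)) (K k) := fun t ht =>
      (hInt t ht).mono_set (hKG k)
    have hIoo : ∀ᶠ t in 𝓝[>] s, t ∈ Ioo s b := Ioo_mem_nhdsGT hsab.2
    have key := eventually_setIntegral_le (μ := (volume : Measure (Sp N))) (K := K k)
      (hKc k).measurableSet (hKc k).measure_lt_top.ne (l := 𝓝[>] s)
      (D := fun t x => (negCube (z x t) - negCube (z x s)) / (t - s))
      (L := fun x => -(3 * max (-(z x s)) 0 ^ 2) * z' x s) (E := lap W)
      (C := max (3 * M ^ 2 * max C₂ 0) C₁)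
      (by
        filter_upwards [hIoo] with t ht
        exact ((hKint t ⟨hsab.1.trans ht.1.le, ht.2.le⟩).sub (hKint s hsI)).div_const _)
      (hlapc.continuousOn.integrableOn_compact (hKc k))
      (by
        filter_upwards [hIoo] with t ht x hx
        have htI : t ∈ Icc a b := ⟨hsab.1.trans ht.1.le, ht.2.le⟩
        have hts : 0 < t - s := sub_pos.2 ht.1
        refine le_trans ?_ (le_max_left _ _)
        rw [div_le_iff₀ hts]
        have h1 := hC₂ x hx t htI ht.1.le
        have h2 := mul_le_mul_of_nonneg_right (le_max_left C₂ 0) hts.le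
        refine (negCube_sub_le (hM x (hGK (hKG k hx)) s hsI) (hM x (hGK (hKG k hx)) t htI)
          (c := max C₂ 0 * (t - s)) (mul_nonneg (le_max_right _ _) hts.le) (by linarith)).trans
          (le_of_eq (by ring)))
      (fun x hx => (hC₁ x hx).trans (le_max_right _ _))
      (fun x hx => by
        have h1 := (hasDerivAt_negCube (z x s)).comp_hasDerivWithinAt s
          (ht' x (hKG k hx) s hsab)
        rw [hasDerivWithinAt_iff_tendsto_slope' (by simp)] at h1
        refine h1.congr fun t => ?_
        rw [slope_def_field]; rfl)
      (fun x hx => by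
        have hxG := hKG k hx
        rw [lap_congr (hWG x hxG), lap_comp contDiff_negCube (hzat x hxG),
          (hasDerivAt_deriv_negCube _).deriv, deriv_negCube]
        have h1 : 0 ≤ 6 * max (-z x s) 0 * gradSq (fun y => z y s) x :=
          mul_nonneg (by positivity) (Finset.sum_nonneg fun _ _ => sq_nonneg _)
        have h2 := mul_le_mul_of_nonneg_left (hsup x hxG s hsab)
          (show 0 ≤ 3 * max (-z x s) 0 ^ 2 by positivity)
        linarith)
      hε
    filter_upwards [key, hIoo] with t hkey ht htF
    have hts : 0 < t - s := sub_pos.2 ht.1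
    rw [hlapint, zero_add, integral_div, div_le_iff₀ hts,
      integral_sub (hKint t ⟨hsab.1.trans ht.1.le, ht.2.le⟩) (hKint s hsI)] at hkey
    rw [hYK k t htF, hYK k s hs]
    exact hkey
  have hYb : Y b ≤ Y a := le_of_closed_cover hab hYc hFc hcov hD
  have hYa : Y a = 0 := by
    rw [hY]
    exact setIntegral_eq_zero_of_forall_eq_zero fun x hx => negCube_eq_zero (h0 x (hGK hx))
  have hbI : b ∈ Icc a b := right_mem_Icc.2 hab
  intro x hxK₀
  by_cases hxG : x ∈ G
  · by_contra hcon
    rw [not_le] at hcon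
    have hcx : ContinuousAt (fun y => negCube (z y b)) x :=
      (contDiff_negCube.continuous.continuousAt).comp
        ((hx b hbI).continuousOn.continuousAt (hG.mem_nhds hxG))
    have hposx : 0 < negCube (z x b) := pow_pos (lt_max_of_lt_left (neg_pos.2 hcon)) 3
    have hnear := hcx.eventually (lt_mem_nhds hposx)
    have hz0 : Y b = 0 := le_antisymm (hYb.trans hYa.le)
      (setIntegral_nonneg hGm fun y _ => negCube_nonneg _)
    rw [hY] at hz0
    have hae := (setIntegral_eq_zero_iff_of_nonneg_ae (s := G)
      (Filter.Eventually.of_forall fun y => negCube_nonneg (z y b)) (hInt b hbI)).1 hz0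
    rw [Filter.EventuallyEq, ae_restrict_iff' hGm] at hae
    have hmem : {y | y ∈ G ∧ 0 < negCube (z y b)} ∈ 𝓝 x :=
      Filter.inter_mem (hG.mem_nhds hxG) hnear
    have hpos : 0 < volume {y | y ∈ G ∧ 0 < negCube (z y b)} := Measure.measure_pos_of_mem_nhds _ hmem
    refine hpos.ne' (measure_mono_null (fun y hy => ?_) (ae_iff.1 hae))
    simp only [mem_ofPred_eq, Classical.not_imp]
    exact ⟨hy.1, hy.2.ne'⟩
  · exact (hb x hxK₀ hxG b hbI).le

theorem nonneg_of_supersolution {K₀ G : Set (Sp N)} (hK₀ : IsCompact K₀) (hG : IsOpen G)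
    (hGK : G ⊆ K₀) {a b : ℝ} (hab : a ≤ b) {z z' : Sp N → ℝ → ℝ} {M : ℝ}
    (hx : ∀ s ∈ Icc a b, ContDiffOn ℝ 2 (fun x => z x s) G)
    (hxK : ∀ s ∈ Icc a b, ContinuousOn (fun x => z x s) K₀)
    (ht : ∀ x ∈ K₀, ContinuousOn (z x) (Icc a b))
    (ht' : ∀ x ∈ G, ∀ s ∈ Ico a b, HasDerivWithinAt (z x) (z' x s) (Ioi s) s)
    (hM : ∀ x ∈ K₀, ∀ s ∈ Icc a b, |z x s| ≤ M)
    (hsup : ∀ x ∈ G, ∀ s ∈ Ico a b, lap (fun y => z y s) x ≤ z' x s)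
    (hLB : ∀ x ∈ G, ∃ W ∈ 𝓝 x, LowerLip z (Icc a b) W)
    (h0 : ∀ x ∈ K₀, 0 ≤ z x a) (hb : ∀ x ∈ K₀, x ∉ G → ∀ s ∈ Icc a b, 0 ≤ z x s) :
    ∀ x ∈ K₀, 0 ≤ z x b := by
  intro x hxK₀
  refine le_of_forall_pos_le_add fun ε hε => ?_
  refine nonneg_of_supersolution_aux hK₀ hG hGK hab (z := fun x s => z x s + ε) (z' := z')
    (M := M + ε) (fun s hs => (hx s hs).add contDiffOn_const)
    (fun s hs => (hxK s hs).add continuousOn_const) (fun x hx => (ht x hx).add continuousOn_const)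
    (fun x hx s hs => (ht' x hx s hs).add_const ε)
    (fun x hx s hs => ?_) (fun y hy s hs => ?_) (fun y hy => ?_) (fun y hy => ?_)
    (fun y hy hyG s hs => ?_) x hxK₀
  · exact (abs_add_le _ _).trans (add_le_add (hM x hx s hs) (abs_of_pos hε).le)
  · rw [lap_add ((hx s (Ico_subset_Icc_self hs)).contDiffAt (hG.mem_nhds hy)) contDiffAt_const,
      lap_const, add_zero]
    exact hsup y hy s hs
  · obtain ⟨W, hW, h⟩ := hLB y hy
    refine ⟨W, hW, fun s hs => ?_⟩
    obtain ⟨C, hC⟩ := h s hs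
    exact ⟨C, fun y hy t ht hst => by linarith [hC y hy t ht hst]⟩
  · linarith [h0 y hy]
  · linarith [hb y hy hyG s hs]

end MinimumPrinciple

section SuperSolution

variable {N : ℕ}

/-- A bounded function of class `C²` in space and `C¹` in time, separately, which satisfies
`∂ₜv ≥ Δv + g` on `U × [a, b]`. -/
structure SuperSol (U : Set (Sp N)) (a b : ℝ) (v v' g : Sp N → ℝ → ℝ) (M K : ℝ) : Prop where
  space : ∀ t ∈ Icc a b, ContDiffOn ℝ 2 (fun x => v x t) U
  time : ∀ x ∈ U, ∀ t ∈ Icc a b, HasDerivAt (v x) (v' x t) t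
  lip : ∀ x ∈ U, ∃ L, ∀ s ∈ Icc a b, ∀ t ∈ Icc a b, |v x t - v x s| ≤ L * |t - s|
  bdd : ∀ x ∈ U, ∀ t ∈ Icc a b, |v x t| ≤ M
  gbdd : ∀ x ∈ U, ∀ t ∈ Icc a b, |g x t| ≤ K
  gspace : ∀ t ∈ Icc a b, ContinuousOn (fun x => g x t) U
  gtime : ∀ x ∈ U, ContinuousOn (g x) (Icc a b)
  sup : ∀ x ∈ U, ∀ t ∈ Icc a b, lap (fun y => v y t) x + g x t ≤ v' x t

theorem SuperSol.lowerLip_of_lipschitz {U : Set (Sp N)} {a b : ℝ} {v v' g : Sp N → ℝ → ℝ}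
    {M K : ℝ} (hv : SuperSol U a b v v' g M K) (hU : IsOpen U) {c : Sp N} {δ L : ℝ} (hδ : 0 < δ)
    (hL : 0 ≤ L) (hsub : closedBall c δ ⊆ U) {O : Set (Sp N)} (hO : IsOpen O)
    (hOLB : ∀ x ∈ O, ∃ W ∈ 𝓝 x, LowerLip v (Icc a b) W)
    (hOL : ∀ x ∈ ball c δ, x ∉ O → ∀ s ∈ Icc a b, ∀ t ∈ Icc a b, |v x t - v x s| ≤ L * |t - s|) :
    LowerLip v (Icc a b) (ball c (δ / 4)) := by
  intro t₁ ht₁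
  have hcU : c ∈ U := hsub (mem_closedBall_self hδ.le)
  have hM : 0 ≤ M := (abs_nonneg _).trans (hv.bdd c hcU t₁ ht₁)
  have hK : 0 ≤ K := (abs_nonneg _).trans (hv.gbdd c hcU t₁ ht₁)
  obtain ⟨C₀, hC₀⟩ := (isCompact_closedBall c δ).exists_bound_of_continuousOn
    ((continuousOn_lap hU (hv.space t₁ ht₁)).mono hsub)
  have hC₀' : 0 ≤ C₀ := (norm_nonneg _).trans (hC₀ c (mem_closedBall_self hδ.le))
  set C₁ := L + K + C₀ with hC₁
  have hC₁0 : 0 ≤ C₁ := by positivity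
  set C₂ := 2 * M / (δ / 2) ^ 2 with hC₂
  have hC₂0 : 0 ≤ C₂ := by positivity
  have hC₂δ : C₂ * (δ / 2) ^ 2 = 2 * M := by rw [hC₂]; field_simp
  refine ⟨C₁ + C₂ * (2 * N), fun y hy s hs hst => ?_⟩
  set K₀ := closedBall y (δ / 2) with hK₀
  have hK₀c : K₀ ⊆ ball c δ := fun x hx => by
    have := dist_triangle x y c
    rw [mem_ball] at *
    rw [hK₀, mem_closedBall] at hx
    linarith
  have hK₀U : K₀ ⊆ U := (hK₀c.trans ball_subset_closedBall).trans hsub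
  set G := O ∩ ball y (δ / 2) with hG
  have hGo : IsOpen G := hO.inter isOpen_ball
  have hGK : G ⊆ K₀ := inter_subset_right.trans ball_subset_closedBall
  have hIsub : Icc t₁ s ⊆ Icc a b := Icc_subset_Icc ht₁.1 hs.2
  have hnorm : ∀ x ∈ K₀, ‖x - y‖ ^ 2 ≤ (δ / 2) ^ 2 := fun x hx => by
    rw [hK₀, mem_closedBall, dist_eq_norm] at hx; gcongr
  have hcd : ∀ σ ∈ Icc a b, ∀ x ∈ U, ContDiffAt ℝ 2 (fun x => v x σ) x := fun σ hσ x hx =>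
    (hv.space σ hσ).contDiffAt (hU.mem_nhds hx)
  have key := nonneg_of_supersolution (isCompact_closedBall y (δ / 2)) hGo hGK hst
    (z := fun x σ => (v x σ + (-1) * v x t₁) + (C₂ * ‖x - y‖ ^ 2 + (C₁ + C₂ * (2 * N)) * (σ - t₁)))
    (z' := fun x σ => v' x σ + (C₁ + C₂ * (2 * N)))
    (M := 2 * M + (2 * M + (C₁ + C₂ * (2 * N)) * (s - t₁)))
    (fun σ hσ x hx => ContDiffAt.contDiffWithinAt
      (((hcd σ (hIsub hσ) x (hK₀U (hGK hx))).add
        (contDiffAt_const.mul (hcd t₁ ht₁ x (hK₀U (hGK hx))))).add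
        ((contDiffAt_const.mul (contDiff_norm_sub_sq y).contDiffAt).add contDiffAt_const)))
    (fun σ hσ => ((((hv.space σ (hIsub hσ)).continuousOn.mono hK₀U).add
        (continuousOn_const.mul ((hv.space t₁ ht₁).continuousOn.mono hK₀U))).add
        (Continuous.continuousOn (by fun_prop))))
    (fun x hx => (ContinuousOn.add (f := v x) (fun σ hσ =>
        (hv.time x (hK₀U hx) σ (hIsub hσ)).continuousAt.continuousWithinAt)
        continuousOn_const).add (Continuous.continuousOn (by fun_prop)))
    (fun x hx σ hσ => ?_) (fun x hx σ hσ => ?_) (fun x hx σ hσ => ?_) (fun x hx => ?_)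
    (fun x hx => ?_) (fun x hx hxG σ hσ => ?_) y (mem_closedBall_self (by positivity))
  · simp only [sub_self, norm_zero] at key
    linarith
  · have h1 := (hv.time x (hK₀U (hGK hx)) σ (hIsub (Ico_subset_Icc_self hσ)))
    have h2 : HasDerivAt (fun σ => C₂ * ‖x - y‖ ^ 2 + (C₁ + C₂ * (2 * N)) * (σ - t₁))
        (C₁ + C₂ * (2 * N)) σ := by
      simpa using ((((hasDerivAt_id σ).sub_const t₁).const_mul
        (C₁ + C₂ * (2 * N))).const_add (C₂ * ‖x - y‖ ^ 2))
    exact ((h1.add_const ((-1) * v x t₁)).add h2).hasDerivWithinAt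
  · have b1 := hv.bdd x (hK₀U hx) σ (hIsub hσ)
    have b2 := hv.bdd x (hK₀U hx) t₁ ht₁
    have hnn : 0 ≤ σ - t₁ := sub_nonneg.2 hσ.1
    have b3 : (C₁ + C₂ * (2 * N)) * (σ - t₁) ≤ (C₁ + C₂ * (2 * N)) * (s - t₁) := by
      gcongr; exact hσ.2
    have b4 : C₂ * ‖x - y‖ ^ 2 ≤ 2 * M := by
      rw [← hC₂δ]; exact mul_le_mul_of_nonneg_left (hnorm x hx) hC₂0
    have b5 : 0 ≤ C₂ * ‖x - y‖ ^ 2 := by positivity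
    have b6 : 0 ≤ (C₁ + C₂ * (2 * N)) * (σ - t₁) := by positivity
    rw [abs_le] at *
    constructor <;> linarith
  · have hxU := hK₀U (hGK hx)
    have hσ' := hIsub (Ico_subset_Icc_self hσ)
    have h1 := hcd σ hσ' x hxU
    have h2 : ContDiffAt ℝ 2 (fun x => (-1) * v x t₁) x := contDiffAt_const.mul (hcd t₁ ht₁ x hxU)
    have h3 : ContDiffAt ℝ 2 (fun x => C₂ * ‖x - y‖ ^ 2) x :=
      contDiffAt_const.mul (contDiff_norm_sub_sq y).contDiffAt
    rw [lap_add (f := fun x => v x σ + (-1) * v x t₁)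
      (g := fun x => C₂ * ‖x - y‖ ^ 2 + (C₁ + C₂ * (2 * N)) * (σ - t₁)) (h1.add h2)
      (h3.add contDiffAt_const), lap_add h1 h2, lap_add h3 contDiffAt_const, lap_const,
      lap_const_mul _ (hcd t₁ ht₁ x hxU), lap_const_mul _ (contDiff_norm_sub_sq y).contDiffAt,
      lap_norm_sub_sq]
    have e1 := hv.sup x hxU σ hσ'
    have e2 := (abs_le.1 (hv.gbdd x hxU σ hσ')).1
    have e3 := (abs_le.1 (hC₀ x (ball_subset_closedBall (hK₀c (hGK hx))))).1
    linarith
  · obtain ⟨W, hW, h⟩ := hOLB x hx.1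
    refine ⟨W, hW, fun σ hσ => ?_⟩
    obtain ⟨C, hC⟩ := h σ (hIsub hσ)
    refine ⟨C, fun w hw t ht hσt => ?_⟩
    have e1 := hC w hw t (hIsub ht) hσt
    have e2 : (C₁ + C₂ * (2 * N)) * (σ - t₁) ≤ (C₁ + C₂ * (2 * N)) * (t - t₁) := by
      gcongr
    linarith
  · have : 0 ≤ C₂ * ‖x - y‖ ^ 2 := by positivity
    simp only [sub_self, mul_zero]
    linarith
  · have hnn : 0 ≤ σ - t₁ := sub_nonneg.2 hσ.1
    have b5 : 0 ≤ C₂ * ‖x - y‖ ^ 2 := by positivity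
    have b7 : 0 ≤ C₂ * (2 * N) * (σ - t₁) := by positivity
    by_cases hxO : x ∈ O
    · have hxb : ¬ dist x y < δ / 2 := fun h => hxG ⟨hxO, h⟩
      have hxn : δ / 2 ≤ ‖x - y‖ := by rw [← dist_eq_norm]; exact not_lt.1 hxb
      have b4 : 2 * M ≤ C₂ * ‖x - y‖ ^ 2 := by
        rw [← hC₂δ]; gcongr
      have b1 := (abs_le.1 (hv.bdd x (hK₀U hx) σ (hIsub hσ))).1
      have b2 := (abs_le.1 (hv.bdd x (hK₀U hx) t₁ ht₁)).2
      have b6 : 0 ≤ C₁ * (σ - t₁) := by positivity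
      linarith
    · have e1 := (abs_le.1 (hOL x (hK₀c hx) hxO t₁ ht₁ σ (hIsub hσ))).1
      rw [abs_of_nonneg hnn] at e1
      have e2 : L * (σ - t₁) ≤ C₁ * (σ - t₁) := by
        gcongr; rw [hC₁]; linarith
      linarith

theorem SuperSol.exists_lowerLip {U : Set (Sp N)} {a b : ℝ} {v v' g : Sp N → ℝ → ℝ}
    {M K : ℝ} (hv : SuperSol U a b v v' g M K) (hU : IsOpen U) :
    ∀ x ∈ U, ∃ W ∈ 𝓝 x, LowerLip v (Icc a b) W := by
  by_contra! hcon
  obtain ⟨x₀, hx₀U, hx₀⟩ := hcon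
  set O : Set (Sp N) := {x | ∃ W ∈ 𝓝 x, LowerLip v (Icc a b) W} with hOdef
  have hO : IsOpen O := by
    rw [isOpen_iff_mem_nhds]
    rintro x ⟨W, hW, h⟩
    obtain ⟨V, hVW, hVo, hxV⟩ := _root_.mem_nhds_iff.1 hW
    filter_upwards [hVo.mem_nhds hxV] with y hy
    exact ⟨W, Filter.mem_of_superset (hVo.mem_nhds hy) hVW, h⟩
  set X : Set (Sp N) := U ∩ Oᶜ with hX
  have hXl : IsLocallyClosed X := hU.isLocallyClosed.inter hO.isClosed_compl.isLocallyClosed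
  have : LocallyCompactSpace X := hXl.locallyCompactSpace
  have : Nonempty X := ⟨⟨x₀, hx₀U, fun ⟨W, hW, h⟩ => hx₀ W hW h⟩⟩
  obtain ⟨n, ⟨c, hcX⟩, hc⟩ := nonempty_interior_of_iUnion_of_closed
    (f := fun n : ℕ => {x : X | ∀ s ∈ Icc a b, ∀ t ∈ Icc a b, |v x t - v x s| ≤ n * |t - s|})
    (fun n => by
      simp only [ofPred_forall]
      refine isClosed_biInter fun s hs => isClosed_biInter fun t ht => ?_
      have hcont : ∀ t ∈ Icc a b, Continuous fun x : X => v x t := fun t ht =>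
        ((hv.space t ht).continuousOn.mono inter_subset_left).comp_continuous
          continuous_subtype_val fun x => x.2
      exact isClosed_le ((hcont t ht).sub (hcont s hs)).abs continuous_const)
    (by
      ext x
      simp only [mem_iUnion, mem_ofPred_eq, mem_univ, iff_true]
      obtain ⟨L, hL⟩ := hv.lip x x.2.1
      obtain ⟨n, hn⟩ := exists_nat_ge L
      exact ⟨n, fun s hs t ht => (hL s hs t ht).trans (by gcongr)⟩)
  rw [mem_interior_iff_mem_nhds, Metric.mem_nhds_iff] at hc
  obtain ⟨δ₁, hδ₁, h₁⟩ := hc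
  obtain ⟨δ₂, hδ₂, h₂⟩ := Metric.nhds_basis_closedBall.mem_iff.1 (hU.mem_nhds hcX.1)
  have hδ : 0 < min δ₁ δ₂ := lt_min hδ₁ hδ₂
  have hsub : closedBall c (min δ₁ δ₂) ⊆ U := (closedBall_subset_closedBall (min_le_right _ _)).trans h₂
  refine hcX.2 ⟨ball c (min δ₁ δ₂ / 4), ball_mem_nhds _ (by positivity),
    hv.lowerLip_of_lipschitz hU hδ (L := n) (by positivity) hsub hO (fun x hx => hx)
      fun x hx hxO => ?_⟩
  have hxX : x ∈ X := ⟨hsub (ball_subset_closedBall hx), hxO⟩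
  exact h₁ (show (⟨x, hxX⟩ : X) ∈ ball (⟨c, hcX⟩ : X) δ₁ from
    ball_subset_ball (min_le_left _ _) hx)

end SuperSolution

section Slices

variable {N : ℕ}

/-- The backward heat operator applied to a function of space and time. -/
noncomputable def heatAdj (ψ : Sp N × ℝ → ℝ) (x : Sp N) (t : ℝ) : ℝ :=
  deriv (fun s => ψ (x, s)) t + lap (fun y => ψ (y, t)) x

theorem hasDerivAt_slice {ψ : Sp N × ℝ → ℝ} {x : Sp N} {t : ℝ} (h : DifferentiableAt ℝ ψ (x, t)) :
    HasDerivAt (fun s => ψ (x, s)) (dd (timeDir N) ψ (x, t)) t := by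
  have := (h.hasFDerivAt.comp t (hasFDerivAt_prodMk_right (𝕜 := ℝ) x t)).hasDerivAt
  refine HasDerivAt.congr_deriv (f := fun s => ψ (x, s)) this ?_
  simp [dd, timeDir]

theorem dd_slice {ψ : Sp N × ℝ → ℝ} {x : Sp N} {t : ℝ} (h : DifferentiableAt ℝ ψ (x, t))
    (w : Sp N) : dd w (fun y => ψ (y, t)) x = dd (w, 0) ψ (x, t) := by
  have e : fderiv ℝ (fun y => ψ (y, t)) x = _ :=
    (h.hasFDerivAt.comp x (hasFDerivAt_prodMk_left (𝕜 := ℝ) x t)).fderiv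
  rw [dd, e]
  simp [dd]

theorem contDiffAt_slice {ψ : Sp N × ℝ → ℝ} {x : Sp N} {t : ℝ} (h : ContDiffAt ℝ 2 ψ (x, t)) :
    ContDiffAt ℝ 2 (fun y => ψ (y, t)) x :=
  ContDiffAt.comp x (f := fun y : Sp N => (y, t)) h (contDiffAt_id.prodMk contDiffAt_const)

theorem lap_slice {ψ : Sp N × ℝ → ℝ} {x : Sp N} {t : ℝ} (h : ContDiffAt ℝ 2 ψ (x, t)) :
    lap (fun y => ψ (y, t)) x =
      ∑ i, dd (spaceDir N i) (dd (spaceDir N i) ψ) (x, t) := by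
  rw [lap_eq_sum_dd (contDiffAt_slice h)]
  refine Finset.sum_congr rfl fun i _ => ?_
  have h1 : ContDiffAt ℝ 1 (dd (spaceDir N i) ψ) (x, t) :=
    (h.fderiv_right (m := 1) (by norm_num)).clm_apply contDiffAt_const
  have h2 : ∀ᶠ y in 𝓝 x, ContDiffAt ℝ 2 ψ (y, t) :=
    (show ContinuousAt (fun y : Sp N => (y, t)) x by fun_prop).eventually (h.eventually (by simp))
  rw [dd_congr (g := fun y => dd (spaceDir N i) ψ (y, t)),
    dd_slice (h1.differentiableAt one_ne_zero)]
  · rfl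
  · filter_upwards [h2] with y hy
    exact dd_slice (hy.differentiableAt two_ne_zero) _

theorem heatAdj_eq {ψ : Sp N × ℝ → ℝ} {x : Sp N} {t : ℝ} (h : ContDiffAt ℝ 2 ψ (x, t)) :
    heatAdj ψ x t = dd (timeDir N) ψ (x, t) +
      ∑ i, dd (spaceDir N i) (dd (spaceDir N i) ψ) (x, t) := by
  rw [heatAdj, (hasDerivAt_slice (h.differentiableAt two_ne_zero)).deriv, lap_slice h]

theorem continuousAt_dd_prod {ψ : Sp N × ℝ → ℝ} {z : Sp N × ℝ} (h : ContDiffAt ℝ 2 ψ z)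
    (w : Sp N × ℝ) : ContinuousAt (dd w ψ) z :=
  ((h.fderiv_right (m := 1) (by norm_num)).clm_apply contDiffAt_const).continuousAt

theorem continuousAt_dd_dd_prod {ψ : Sp N × ℝ → ℝ} {z : Sp N × ℝ} (h : ContDiffAt ℝ 2 ψ z)
    (w : Sp N × ℝ) : ContinuousAt (dd w (dd w ψ)) z := by
  have h1 : ContDiffAt ℝ 1 (dd w ψ) z :=
    (h.fderiv_right (m := 1) (by norm_num)).clm_apply contDiffAt_const
  exact ((h1.fderiv_right (m := 0) (by norm_num)).clm_apply contDiffAt_const).continuousAt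

theorem continuousAt_heatAdj {ψ : Sp N × ℝ → ℝ} {z : Sp N × ℝ} (h : ContDiffAt ℝ 2 ψ z) :
    ContinuousAt (fun z : Sp N × ℝ => heatAdj ψ z.1 z.2) z := by
  have e : (fun z : Sp N × ℝ => heatAdj ψ z.1 z.2) =ᶠ[𝓝 z] fun z => dd (timeDir N) ψ z +
      ∑ i, dd (spaceDir N i) (dd (spaceDir N i) ψ) z := by
    filter_upwards [h.eventually (by simp)] with y hy using heatAdj_eq hy
  refine ContinuousAt.congr ?_ e.symm
  exact (continuousAt_dd_prod h _).add
    (tendsto_finsetSum _ fun i _ => continuousAt_dd_dd_prod h _)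

end Slices

section WeakForm

variable {N : ℕ}

theorem continuousOn_setIntegral {K : Set (Sp N)} (hK : IsCompact K) {I : Set ℝ}
    {F : Sp N → ℝ → ℝ} {C : ℝ} (hx : ∀ t ∈ I, ContinuousOn (fun x => F x t) K)
    (ht : ∀ x ∈ K, ContinuousOn (F x) I) (hC : ∀ x ∈ K, ∀ t ∈ I, |F x t| ≤ C) :
    ContinuousOn (fun t => ∫ x in K, F x t) I := by
  refine continuousOn_of_dominated (bound := fun _ => C)
    (fun t h => (hx t h).aestronglyMeasurable hK.measurableSet) (fun t h => ?_)
    (integrableOn_const hK.measure_lt_top.ne) ?_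
  · exact (ae_restrict_iff' hK.measurableSet).2
      (Filter.Eventually.of_forall fun x hx => hC x hx t h)
  · exact (ae_restrict_iff' hK.measurableSet).2 (Filter.Eventually.of_forall fun x hx => ht x hx)

/-- A separately smooth bounded supersolution is a supersolution in the weak sense. -/
theorem SuperSol.weak {U : Set (Sp N)} {a b : ℝ} {v v' g : Sp N → ℝ → ℝ}
    {M K : ℝ} (hv : SuperSol U a b v v' g M K) (hU : IsOpen U) (hab : a ≤ b)
    {S : Set (Sp N)} (hS : IsCompact S) (hSU : S ⊆ U) {ψ : Sp N × ℝ → ℝ}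
    (hψ : ∀ x, ∀ t ∈ Icc a b, ContDiffAt ℝ 2 ψ (x, t))
    (hψ0 : ∀ x, ∀ t ∈ Icc a b, 0 ≤ ψ (x, t))
    (hψS : ∀ x ∉ S, ∀ t ∈ Icc a b, ψ (x, t) = 0) :
    ∫ t in a..b, ∫ x in S, (v x t * heatAdj ψ x t + g x t * ψ (x, t)) ≤
      (∫ x in S, v x b * ψ (x, b)) - ∫ x in S, v x a * ψ (x, a) := by
  have hcont : ∀ {F : Sp N × ℝ → ℝ}, (∀ x, ∀ t ∈ Icc a b, ContinuousAt F (x, t)) →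
      (∀ t ∈ Icc a b, Continuous fun x => F (x, t)) ∧
      (∀ x, ContinuousOn (fun t => F (x, t)) (Icc a b)) ∧
      ∃ C, ∀ x ∈ S, ∀ t ∈ Icc a b, |F (x, t)| ≤ C := by
    intro F hF
    refine ⟨fun t ht => continuous_iff_continuousAt.2 fun x =>
      ContinuousAt.comp (f := fun x : Sp N => (x, t)) (hF x t ht) (by fun_prop), fun x t ht =>
      (ContinuousAt.comp (f := fun t : ℝ => (x, t)) (hF x t ht) (by fun_prop)).continuousWithinAt, ?_⟩
    obtain ⟨C, hC⟩ := (hS.prod isCompact_Icc).exists_bound_of_continuousOn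
      (fun z hz => (hF z.1 z.2 hz.2).continuousWithinAt)
    exact ⟨C, fun x hx t ht => hC (x, t) ⟨hx, ht⟩⟩
  obtain ⟨ψx, ψt, Cψ, hCψ⟩ := hcont fun x t ht => (hψ x t ht).continuousAt
  obtain ⟨-, -, Cτ, hCτ⟩ := hcont fun x t ht => continuousAt_dd_prod (hψ x t ht) (timeDir N)
  obtain ⟨Θx, Θt, CΘ, hCΘ⟩ := hcont fun x t ht => continuousAt_heatAdj (hψ x t ht)
  have hτ : ∀ x, ∀ t ∈ Icc a b, HasDerivAt (fun s => ψ (x, s)) (dd (timeDir N) ψ (x, t)) t :=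
    fun x t ht => hasDerivAt_slice ((hψ x t ht).differentiableAt two_ne_zero)
  have hvx : ∀ t ∈ Icc a b, ContinuousOn (fun x => v x t) S := fun t ht =>
    (hv.space t ht).continuousOn.mono hSU
  have hvt : ∀ x ∈ S, ContinuousOn (v x) (Icc a b) := fun x hx t ht =>
    (hv.time x (hSU hx) t ht).continuousAt.continuousWithinAt
  have hgx : ∀ t ∈ Icc a b, ContinuousOn (fun x => g x t) S := fun t ht =>
    (hv.gspace t ht).mono hSU
  rcases S.eq_empty_or_nonempty with rfl | ⟨x₁, hx₁⟩
  · simp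
  have haI : a ∈ Icc a b := left_mem_Icc.2 hab
  have hM : 0 ≤ M := (abs_nonneg _).trans (hv.bdd x₁ (hSU hx₁) a haI)
  have hK : 0 ≤ K := (abs_nonneg _).trans (hv.gbdd x₁ (hSU hx₁) a haI)
  have hCψ0 : 0 ≤ Cψ := (abs_nonneg _).trans (hCψ x₁ hx₁ a haI)
  have hCτ0 : 0 ≤ Cτ := (abs_nonneg _).trans (hCτ x₁ hx₁ a haI)
  set y : ℝ → ℝ := fun t => ∫ x in S, v x t * ψ (x, t) with hy
  set e : ℝ → ℝ := fun t => ∫ x in S, (v x t * heatAdj ψ x t + g x t * ψ (x, t)) with he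
  have hyc : ContinuousOn y (Icc a b) := continuousOn_setIntegral hS (C := M * Cψ)
    (fun t ht => (hvx t ht).mul (ψx t ht).continuousOn)
    (fun x hx => (hvt x hx).mul (ψt x))
    (fun x hx t ht => by
      rw [abs_mul]; exact mul_le_mul (hv.bdd x (hSU hx) t ht) (hCψ x hx t ht) (abs_nonneg _) hM)
  have hec : ContinuousOn e (Icc a b) := continuousOn_setIntegral hS (C := M * CΘ + K * Cψ)
    (fun t ht => ((hvx t ht).mul (Θx t ht).continuousOn).add
      ((hgx t ht).mul (ψx t ht).continuousOn))
    (fun x hx => ((hvt x hx).mul (Θt x)).add ((hv.gtime x (hSU hx)).mul (ψt x)))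
    (fun x hx t ht => by
      refine (abs_add_le _ _).trans (add_le_add ?_ ?_)
      · rw [abs_mul]
        exact mul_le_mul (hv.bdd x (hSU hx) t ht) (hCΘ x hx t ht) (abs_nonneg _) hM
      · rw [abs_mul]
        exact mul_le_mul (hv.gbdd x (hSU hx) t ht) (hCψ x hx t ht) (abs_nonneg _) hK)
  have hψint : ∀ t ∈ Icc a b, IntegrableOn (fun x => v x t * ψ (x, t)) S := fun t ht =>
    ((hvx t ht).mul (ψx t ht).continuousOn).integrableOn_compact hS
  have slope : ∀ s ∈ Ico a b, ∀ ε > 0, ∀ᶠ t in 𝓝[>] s, (e s - ε) * (t - s) ≤ y t - y s := by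
    intro s hsab ε hε
    have hs : s ∈ Icc a b := Ico_subset_Icc_self hsab
    have hη : ContDiff ℝ 2 fun x => ψ (x, s) :=
      contDiff_iff_contDiffAt.2 fun x => contDiffAt_slice (hψ x s hs)
    have hη0 : ∀ x ∉ S, (fun x => ψ (x, s)) =ᶠ[𝓝 x] fun _ => 0 := fun x hx => by
      filter_upwards [hS.isClosed.isOpen_compl.mem_nhds hx] with y hy using hψS y hy s hs
    have hηc : HasCompactSupport fun x => ψ (x, s) :=
      HasCompactSupport.intro hS fun x hx => hψS x hx s hs
    have hηS : tsupport (fun x => ψ (x, s)) ⊆ S := closure_minimal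
      (fun x hx => by by_contra hcon; exact hx (hψS x hcon s hs)) hS.isClosed
    obtain ⟨hgreen, -, -⟩ := integral_lap_mul_eq hU (hv.space s hs) hη hηc (hηS.trans hSU)
    have hlapη : Continuous (lap fun x => ψ (x, s)) := by
      rw [← continuousOn_univ]; exact continuousOn_lap isOpen_univ hη.contDiffOn
    have g1 : ∫ x in S, lap (fun x => v x s) x * ψ (x, s) = _ :=
      setIntegral_eq_integral_of_forall_compl_eq_zero fun x hx => by rw [hψS x hx s hs, mul_zero]
    have g2 : ∫ x in S, v x s * lap (fun x => ψ (x, s)) x = _ :=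
      setIntegral_eq_integral_of_forall_compl_eq_zero fun x hx => by
        rw [lap_congr (hη0 x hx), lap_const, mul_zero]
    rw [← g1, ← g2] at hgreen
    have hτx : Continuous fun x => dd (timeDir N) ψ (x, s) :=
      (hcont fun x t ht => continuousAt_dd_prod (hψ x t ht) (timeDir N)).1 s hs
    have hlv : ContinuousOn (lap fun x => v x s) S := (continuousOn_lap hU (hv.space s hs)).mono hSU
    set E : Sp N → ℝ := fun x => -(lap (fun x => v x s) x * ψ (x, s) + (g x s * ψ (x, s) +
      v x s * dd (timeDir N) ψ (x, s))) with hE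
    have hEc : ContinuousOn E S := ((hlv.mul (ψx s hs).continuousOn).add
      (((hgx s hs).mul (ψx s hs).continuousOn).add ((hvx s hs).mul hτx.continuousOn))).neg
    obtain ⟨C₁, hC₁⟩ := hS.exists_bound_of_continuousOn hEc
    obtain ⟨C₂, hC₂⟩ := LowerLip.of_isCompact hS
      (fun x hx => hv.exists_lowerLip hU x (hSU hx)) s hs
    have hIntE : ∫ x in S, E x = -e s := by
      have i1 : IntegrableOn (fun x => lap (fun x => v x s) x * ψ (x, s)) S :=
        (hlv.mul (ψx s hs).continuousOn).integrableOn_compact hS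
      have i2 : IntegrableOn (fun x => g x s * ψ (x, s)) S :=
        ((hgx s hs).mul (ψx s hs).continuousOn).integrableOn_compact hS
      have i3 : IntegrableOn (fun x => v x s * dd (timeDir N) ψ (x, s)) S :=
        ((hvx s hs).mul hτx.continuousOn).integrableOn_compact hS
      have i4 : IntegrableOn (fun x => v x s * lap (fun x => ψ (x, s)) x) S :=
        ((hvx s hs).mul hlapη.continuousOn).integrableOn_compact hS
      have i23 : IntegrableOn (fun x => g x s * ψ (x, s) + v x s * dd (timeDir N) ψ (x, s)) S :=
        i2.add i3
      rw [hE, integral_neg, integral_add i1 i23, hgreen, ← integral_add i4 i23]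
      congr 1
      refine setIntegral_congr_fun hS.measurableSet fun x hx => ?_
      simp only [heatAdj, (hτ x s hs).deriv]
      ring
    have hIoo : ∀ᶠ t in 𝓝[>] s, t ∈ Ioo s b := Ioo_mem_nhdsGT hsab.2
    have key := eventually_setIntegral_le (μ := (volume : Measure (Sp N))) (K := S)
      hS.measurableSet hS.measure_lt_top.ne (l := 𝓝[>] s)
      (D := fun t x => -((v x t * ψ (x, t) - v x s * ψ (x, s)) / (t - s)))
      (L := fun x => -(v' x s * ψ (x, s) + v x s * dd (timeDir N) ψ (x, s))) (E := E)
      (C := max (max C₂ 0 * Cψ + M * Cτ) C₁)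
      (by
        filter_upwards [hIoo] with t ht
        exact (((hψint t ⟨hsab.1.trans ht.1.le, ht.2.le⟩).sub (hψint s hs)).div_const _).neg)
      (hEc.integrableOn_compact hS)
      (by
        filter_upwards [hIoo] with t ht x hx
        have htI : t ∈ Icc a b := ⟨hsab.1.trans ht.1.le, ht.2.le⟩
        have hts : 0 < t - s := sub_pos.2 ht.1
        refine le_trans ?_ (le_max_left _ _)
        rw [← neg_div, div_le_iff₀ hts]
        have h1 := hC₂ x hx t htI ht.1.le
        have h2 := mul_le_mul_of_nonneg_right (le_max_left C₂ 0) hts.le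
        have h3 : -(max C₂ 0 * (t - s)) * ψ (x, t) ≤ (v x t - v x s) * ψ (x, t) :=
          mul_le_mul_of_nonneg_right (by linarith) (hψ0 x t htI)
        have h4 : (max C₂ 0 * (t - s)) * ψ (x, t) ≤ (max C₂ 0 * (t - s)) * Cψ :=
          mul_le_mul_of_nonneg_left ((le_abs_self _).trans (hCψ x hx t htI))
            (mul_nonneg (le_max_right _ _) hts.le)
        have h5 : |ψ (x, t) - ψ (x, s)| ≤ Cτ * |t - s| :=
          (convex_Icc a b).norm_image_sub_le_of_norm_hasDerivWithin_le
            (fun q hq => (hτ x q hq).hasDerivWithinAt) (fun q hq => hCτ x hx q hq) hs htI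
        rw [abs_of_pos hts] at h5
        have h6 : |v x s * (ψ (x, t) - ψ (x, s))| ≤ M * (Cτ * (t - s)) := by
          rw [abs_mul]
          exact mul_le_mul (hv.bdd x (hSU hx) s hs) h5 (abs_nonneg _) hM
        have h7 := (abs_le.1 h6).1
        linarith)
      (fun x hx => (hC₁ x hx).trans (le_max_right _ _))
      (fun x hx => by
        have h1 := ((hv.time x (hSU hx) s hs).fun_mul (hτ x s hs)).hasDerivWithinAt (s := Ioi s)
        rw [hasDerivWithinAt_iff_tendsto_slope' (by simp)] at h1
        refine h1.neg.congr fun t => ?_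
        rw [slope_def_field])
      (fun x hx => by
        have h1 := mul_le_mul_of_nonneg_right (hv.sup x (hSU hx) s hs) (hψ0 x s hs)
        simp only [hE]
        linarith)
      hε
    filter_upwards [key, hIoo] with t hkey ht
    have hts : 0 < t - s := sub_pos.2 ht.1
    rw [hIntE, integral_neg, integral_div,
      integral_sub (hψint t ⟨hsab.1.trans ht.1.le, ht.2.le⟩) (hψint s hs), ← neg_div,
      div_le_iff₀ hts] at hkey
    change -(y t - y s) ≤ _ at hkey
    linarith
  set e' : ℝ → ℝ := IccExtend hab (fun t => e t) with he'
  have he'c : Continuous e' := (continuousOn_iff_continuous_domRestrict.1 hec).Icc_extend'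
  have he'e : ∀ t ∈ Icc a b, e' t = e t := fun t ht => IccExtend_of_mem hab _ ht
  have hprim : ∀ s, HasDerivAt (fun t => ∫ q in a..t, e' q) (e' s) s := fun s =>
    (he'c.integral_hasStrictDerivAt a s).hasDerivAt
  have hfin := le_of_frequently_slope_le (Y := fun t => (∫ q in a..t, e' q) - y t) hab
    (ContinuousOn.sub (f := fun t => ∫ q in a..t, e' q)
      (fun t _ => (hprim t).continuousAt.continuousWithinAt) hyc)
    (fun s hs ε hε => Filter.Eventually.frequently (by
      have h1 := (hprim s).hasDerivWithinAt (s := Ioi s)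
      rw [hasDerivWithinAt_iff_tendsto_slope' (by simp)] at h1
      filter_upwards [h1.eventually (gt_mem_nhds (lt_add_of_pos_right (e' s) (half_pos hε))),
        slope s hs (ε / 2) (half_pos hε), self_mem_nhdsWithin] with t h1 h2 h3
      have hts : 0 < t - s := sub_pos.2 h3
      rw [slope_def_field, div_lt_iff₀ hts, he'e s (Ico_subset_Icc_self hs)] at h1
      linarith))
  simp only [intervalIntegral.integral_same, zero_sub] at hfin
  have hcongr : ∫ t in a..b, e t = ∫ t in a..b, e' t :=
    intervalIntegral.integral_congr fun t ht => by
      rw [uIcc_of_le hab] at ht; exact (he'e t ht).symm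
  change ∫ t in a..b, e t ≤ y b - y a
  rw [hcongr]; linarith

end WeakForm

section HeatAdjoint

variable {N : ℕ}

theorem heatAdj_congr {f g : Sp N × ℝ → ℝ} {x : Sp N} {t : ℝ} (h : f =ᶠ[𝓝 (x, t)] g) :
    heatAdj f x t = heatAdj g x t := by
  have h1 : (fun s => f (x, s)) =ᶠ[𝓝 t] fun s => g (x, s) :=
    (show ContinuousAt (fun s : ℝ => (x, s)) t by fun_prop).eventually h
  have h2 : (fun y => f (y, t)) =ᶠ[𝓝 x] fun y => g (y, t) :=
    (show ContinuousAt (fun y : Sp N => (y, t)) x by fun_prop).eventually h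
  rw [heatAdj, heatAdj, h1.deriv_eq, lap_congr h2]

theorem heatAdj_mul {f g : Sp N × ℝ → ℝ} {x : Sp N} {t : ℝ} (hf : ContDiffAt ℝ 2 f (x, t))
    (hg : ContDiffAt ℝ 2 g (x, t)) :
    heatAdj (fun z => f z * g z) x t = f (x, t) * heatAdj g x t + g (x, t) * heatAdj f x t +
      2 * gradDot (fun y => f (y, t)) (fun y => g (y, t)) x := by
  have h1 := hasDerivAt_slice (hf.differentiableAt two_ne_zero)
  have h2 := hasDerivAt_slice (hg.differentiableAt two_ne_zero)
  rw [heatAdj, heatAdj, heatAdj, (h1.fun_mul h2).deriv, h1.deriv, h2.deriv,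
    lap_mul (contDiffAt_slice hf) (contDiffAt_slice hg)]
  ring

theorem heatAdj_comp {h : ℝ → ℝ} {f : Sp N × ℝ → ℝ} {x : Sp N} {t : ℝ} (hh : ContDiff ℝ 2 h)
    (hf : ContDiffAt ℝ 2 f (x, t)) :
    heatAdj (fun z => h (f z)) x t = deriv h (f (x, t)) * heatAdj f x t +
      deriv (deriv h) (f (x, t)) * gradSq (fun y => f (y, t)) x := by
  have h1 := hasDerivAt_slice (hf.differentiableAt two_ne_zero)
  have h2 : HasDerivAt (fun s => h (f (x, s))) _ t :=
    (hh.differentiable two_ne_zero (f (x, t))).hasDerivAt.comp t h1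
  rw [heatAdj, heatAdj, h2.deriv, h1.deriv, lap_comp hh (contDiffAt_slice hf)]
  ring

theorem gradSq_nonneg (f : Sp N → ℝ) (x : Sp N) : 0 ≤ gradSq f x :=
  Finset.sum_nonneg fun _ _ => sq_nonneg _

end HeatAdjoint

section Gaussian

variable {N : ℕ}

/-- The backward heat kernel with pole at `(a, d)`, up to normalisation. -/
noncomputable def gauss (a : Sp N) (d : ℝ) (z : Sp N × ℝ) : ℝ :=
  (d - z.2) ^ (-(N / 2 : ℝ)) * exp (-(‖z.1 - a‖ ^ 2 / (4 * (d - z.2))))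

theorem gauss_pos (a : Sp N) {d : ℝ} {z : Sp N × ℝ} (h : z.2 < d) : 0 < gauss a d z :=
  mul_pos (rpow_pos_of_pos (sub_pos.2 h) _) (exp_pos _)

theorem contDiffAt_gauss (a : Sp N) {d : ℝ} {z : Sp N × ℝ} (h : z.2 < d) {n : WithTop ℕ∞} :
    ContDiffAt ℝ n (gauss a d) z := by
  have h0 : d - z.2 ≠ 0 := (sub_pos.2 h).ne'
  have h1 : ContDiffAt ℝ n (fun z : Sp N × ℝ => d - z.2) z := contDiffAt_const.sub contDiffAt_snd
  have h2 : ContDiffAt ℝ n (fun z : Sp N × ℝ => ‖z.1 - a‖ ^ 2) z :=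
    (contDiffAt_fst.sub contDiffAt_const).norm_sq ℝ
  exact (h1.rpow_const_of_ne h0).mul
    ((h2.div (contDiffAt_const.mul h1) (by positivity)).neg.exp)

theorem dd_gauss (a : Sp N) {d : ℝ} {x : Sp N} {t : ℝ} (w : Sp N) :
    dd w (fun y => gauss a d (y, t)) x =
      -(inner ℝ (x - a) w / (2 * (d - t))) * gauss a d (x, t) := by
  set h : ℝ → ℝ := fun q => (d - t) ^ (-(N / 2 : ℝ)) * exp (-(q / (4 * (d - t)))) with hh
  have hd : ∀ q, HasDerivAt h (-(1 / (4 * (d - t))) * h q) q := fun q => by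
    have h1 : HasDerivAt h _ q := (((hasDerivAt_id q).div_const (4 * (d - t))).neg.exp).const_mul
      ((d - t) ^ (-(N / 2 : ℝ)))
    refine h1.congr_deriv ?_
    simp only [hh, id, Pi.neg_apply]; ring
  have hc : ContDiff ℝ 2 h := by
    exact contDiff_const.mul ((contDiff_id.div_const _).neg.exp)
  have := dd_comp_real (f := fun y => ‖y - a‖ ^ 2) (x := x) w hc
    ((contDiff_norm_sub_sq a (n := 2)).differentiable two_ne_zero x)
  rw [dd_norm_sub_sq, (hd _).deriv] at this
  change dd w (fun y => h (‖y - a‖ ^ 2)) x = _ * h (‖x - a‖ ^ 2)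
  rw [this]
  generalize h (‖x - a‖ ^ 2) = q
  generalize d - t = τ
  ring

theorem heatAdj_gauss (a : Sp N) {d : ℝ} {x : Sp N} {t : ℝ} (ht : t < d) :
    heatAdj (gauss a d) x t = 0 := by
  have hτ : 0 < d - t := sub_pos.2 ht
  set h : ℝ → ℝ := fun q => (d - t) ^ (-(N / 2 : ℝ)) * exp (-(q / (4 * (d - t)))) with hh
  have hd : ∀ q, HasDerivAt h (-(1 / (4 * (d - t))) * h q) q := fun q => by
    have h1 : HasDerivAt h _ q := (((hasDerivAt_id q).div_const (4 * (d - t))).neg.exp).const_mul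
      ((d - t) ^ (-(N / 2 : ℝ)))
    refine h1.congr_deriv ?_
    simp only [hh, id, Pi.neg_apply]; ring
  have hc : ContDiff ℝ 2 h := contDiff_const.mul ((contDiff_id.div_const _).neg.exp)
  have hd1 : deriv h = fun q => -(1 / (4 * (d - t))) * h q := funext fun q => (hd q).deriv
  have hd2 : ∀ q, deriv (deriv h) q = -(1 / (4 * (d - t))) * (-(1 / (4 * (d - t))) * h q) := by
    intro q
    rw [hd1]
    exact ((hd q).const_mul _).deriv
  have hl := lap_comp (f := fun y => ‖y - a‖ ^ 2) (x := x) hc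
    (contDiff_norm_sub_sq a (n := 2)).contDiffAt
  rw [gradSq_norm_sub_sq, lap_norm_sub_sq, hd2, hd1] at hl
  have hs : HasDerivAt (fun s : ℝ => d - s) (-1) t := (hasDerivAt_id t).const_sub d
  have h1 : HasDerivAt (fun s : ℝ => gauss a d (x, s)) _ t :=
    (hs.rpow_const (p := -(N / 2 : ℝ)) (Or.inl hτ.ne')).mul
      (((hasDerivAt_const t (‖x - a‖ ^ 2)).fun_div (hs.const_mul 4) (by positivity)).neg.exp)
  have e2 : (d - t) ^ (-(N / 2 : ℝ) - 1) = (d - t) ^ (-(N / 2 : ℝ)) / (d - t) := rpow_sub_one hτ.ne' _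
  rw [heatAdj, h1.deriv]
  change _ + lap (fun y => h (‖y - a‖ ^ 2)) x = 0
  rw [hl, e2]
  simp only [hh, Pi.neg_apply]
  field_simp
  ring

theorem exists_rpow_mul_exp_le (s : ℝ) (hs : 0 ≤ s) {b : ℝ} (hb : 0 < b) :
    ∃ C, 0 < C ∧ ∀ y : ℝ, 0 ≤ y → y ^ s * exp (-b * y) ≤ C := by
  have h := tendsto_rpow_mul_exp_neg_mul_atTop_nhds_zero s b hb
  obtain ⟨n, hn⟩ := Filter.eventually_atTop.1 (h.eventually (gt_mem_nhds one_pos))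
  refine ⟨max 1 (|n| ^ s), lt_max_of_lt_left one_pos, fun y hy => ?_⟩
  rcases le_total n y with h1 | h1
  · exact (hn y h1).le.trans (le_max_left _ _)
  · refine le_trans ?_ (le_max_right _ _)
    calc y ^ s * exp (-b * y) ≤ |n| ^ s * 1 := by
          refine mul_le_mul (rpow_le_rpow hy (h1.trans (le_abs_self _)) hs) ?_ (exp_pos _).le
            (by positivity)
          rw [exp_le_one_iff]; nlinarith
      _ = _ := mul_one _

theorem exists_rpow_neg_mul_exp_le (s : ℝ) (hs : 0 ≤ s) {η : ℝ} (hη : 0 < η) :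
    ∃ C, 0 < C ∧ ∀ τ q : ℝ, 0 < τ → 0 ≤ q → (η ≤ q ∨ η ≤ τ) →
      τ ^ (-s) * exp (-(q / (4 * τ))) ≤ C := by
  obtain ⟨C, hC, h⟩ := exists_rpow_mul_exp_le s hs (b := η / 4) (by positivity)
  refine ⟨max C (η ^ (-s)), lt_max_of_lt_left hC, fun τ q hτ hq hor => ?_⟩
  rcases hor with h1 | h1
  · refine le_trans ?_ ((h τ⁻¹ (by positivity)).trans (le_max_left _ _))
    rw [inv_rpow hτ.le, ← rpow_neg hτ.le]
    refine mul_le_mul_of_nonneg_left (exp_le_exp.2 ?_) (by positivity)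
    rw [neg_mul, neg_le_neg_iff, div_mul_eq_mul_div, ← div_eq_mul_inv, div_div, mul_comm τ 4]
    gcongr
  · refine le_trans ?_ (le_max_right _ _)
    calc τ ^ (-s) * exp (-(q / (4 * τ))) ≤ η ^ (-s) * 1 := by
          refine mul_le_mul (rpow_le_rpow_of_nonpos hη h1 (by linarith)) ?_ (exp_pos _).le
            (by positivity)
          rw [exp_le_one_iff, neg_nonpos]; positivity
      _ = _ := mul_one _

end Gaussian

section MeanValue

variable {N : ℕ}

theorem exists_abs_gauss_le (η : ℝ) (hη : 0 < η) : ∃ C, 0 < C ∧ ∀ (d t : ℝ) (x : Sp N),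
    t < d → ‖x‖ ≤ 1 → (η ≤ ‖x‖ ∨ η ≤ d - t) → gauss 0 d (x, t) ≤ C ∧
      ∀ i, |dd (EuclideanSpace.single i 1) (fun y => gauss 0 d (y, t)) x| ≤ C := by
  obtain ⟨C₁, hC₁, h₁⟩ := exists_rpow_neg_mul_exp_le (N / 2 : ℝ) (by positivity)
    (η := min (η ^ 2) η) (by positivity)
  obtain ⟨C₂, hC₂, h₂⟩ := exists_rpow_neg_mul_exp_le (N / 2 + 1 : ℝ) (by positivity)
    (η := min (η ^ 2) η) (by positivity)
  refine ⟨max C₁ C₂, lt_max_of_lt_left hC₁, fun d t x ht hx hor => ?_⟩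
  have hτ : 0 < d - t := sub_pos.2 ht
  have hor' : min (η ^ 2) η ≤ ‖x‖ ^ 2 ∨ min (η ^ 2) η ≤ d - t :=
    hor.imp (fun h => (min_le_left _ _).trans (by gcongr)) fun h => (min_le_right _ _).trans h
  have hg := gauss_pos (0 : Sp N) (z := (x, t)) ht
  constructor
  · have := h₁ (d - t) (‖x‖ ^ 2) hτ (by positivity) hor'
    simpa [gauss] using Or.inl this
  · intro i
    refine le_trans ?_ (le_max_right _ _)
    refine le_trans ?_ (h₂ (d - t) (‖x‖ ^ 2) hτ (by positivity) hor')
    have e : (d - t) ^ (-(N / 2 + 1 : ℝ)) = (d - t) ^ (-(N / 2 : ℝ)) / (d - t) := by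
      rw [neg_add', rpow_sub_one hτ.ne']
    rw [dd_gauss, abs_mul, abs_of_pos hg, abs_neg, abs_div, abs_of_pos (by positivity : 0 < 2 * (d - t)), e]
    have hi : |inner ℝ (x - 0) (EuclideanSpace.single i (1 : ℝ))| ≤ 1 := by
      refine (abs_real_inner_le_norm _ _).trans ?_
      simpa using hx
    have : gauss 0 d (x, t) / (d - t) =
        (d - t) ^ (-(N / 2 : ℝ)) / (d - t) * exp (-(‖x‖ ^ 2 / (4 * (d - t)))) := by
      simp [gauss]; ring
    rw [← this, div_mul_eq_mul_div, div_le_div_iff₀ (by positivity) hτ]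
    nlinarith [mul_le_mul_of_nonneg_right hi hg.le, mul_pos hg hτ]

/-- A cutoff in space and time with an exponential weight in time. -/
theorem exists_weighted_cutoff (N : ℕ) (Λ : ℝ) : ∃ χ : Sp N × ℝ → ℝ, ContDiff ℝ 2 χ ∧ (∀ z, 0 ≤ χ z) ∧
    (∀ x t, 1 ≤ ‖x‖ → χ (x, t) = 0) ∧ (∀ x, χ (x, -1) = 0) ∧
    (∀ x, ‖x‖ ≤ 1 / 2 → χ (x, 0) = 1) ∧
    ∀ x t, ‖x‖ < 1 / 2 → |t| < 1 / 2 → heatAdj χ x t + Λ * χ (x, t) = 0 ∧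
      ∀ i, dd (EuclideanSpace.single i 1) (fun y => χ (y, t)) x = 0 := by
  let b : ContDiffBump (0 : Sp N × ℝ) := ⟨1 / 2, 3 / 4, by norm_num, by norm_num⟩
  have hc : ContDiff ℝ 2 fun z : Sp N × ℝ => exp (-Λ * z.2) :=
    (contDiff_const.mul contDiff_snd).exp
  have hz : ∀ x t, 3 / 4 ≤ ‖x‖ ∨ 3 / 4 ≤ |t| → b (x, t) = 0 := fun x t h => by
    refine b.zero_of_le_dist ?_
    rw [dist_zero_right, Prod.norm_mk]
    exact le_max_iff.2 h
  refine ⟨fun z => exp (-Λ * z.2) * b z, hc.mul b.contDiff,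
    fun z => mul_nonneg (exp_pos _).le b.nonneg, fun x t hx => ?_, fun x => ?_, fun x hx => ?_,
    fun x t hx ht => ?_⟩
  · simp only [hz x t (Or.inl (by linarith)), mul_zero]
  · simp only [hz x (-1) (Or.inr (by norm_num)), mul_zero]
  · change exp (-Λ * 0) * b (x, 0) = 1
    rw [b.one_of_mem_closedBall]
    · simp
    · rw [mem_closedBall, dist_zero_right, Prod.norm_mk]
      simpa [b] using hx
  · have hm : (x, t) ∈ ball (0 : Sp N × ℝ) (1 / 2) := by
      rw [mem_ball, dist_zero_right, Prod.norm_mk]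
      exact max_lt hx ht
    have he : (fun z : Sp N × ℝ => exp (-Λ * z.2) * b z) =ᶠ[𝓝 (x, t)] fun z => exp (-Λ * z.2) := by
      filter_upwards [isOpen_ball.mem_nhds hm] with z hz
      rw [b.one_of_mem_closedBall (ball_subset_closedBall hz), mul_one]
    have he2 : (fun y : Sp N => exp (-Λ * t) * b (y, t)) =ᶠ[𝓝 x] fun y => exp (-Λ * t) :=
      (show ContinuousAt (fun y : Sp N => (y, t)) x by fun_prop).eventually he
    constructor
    · have e3 : exp (-Λ * t) * b (x, t) = exp (-Λ * t) := he.eq_of_nhds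
      rw [heatAdj_congr he, heatAdj]
      simp only [lap_const, e3]
      have : HasDerivAt (fun s : ℝ => exp (-Λ * s)) _ t := ((hasDerivAt_id t).const_mul (-Λ)).exp
      rw [this.deriv]
      simp; ring
    · intro i
      rw [dd_congr _ he2]
      simp [dd]

theorem exists_meanValue_kernel (N : ℕ) (Λ : ℝ) : ∃ C, 0 < C ∧ ∃ χ : Sp N × ℝ → ℝ,
    ContDiff ℝ 2 χ ∧ (∀ z, 0 ≤ χ z) ∧ (∀ x t, 1 ≤ ‖x‖ → χ (x, t) = 0) ∧
    (∀ x, χ (x, -1) = 0) ∧ (∀ x, ‖x‖ ≤ 1 / 2 → χ (x, 0) = 1) ∧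
    ∀ d x t, 0 < d → ‖x‖ ≤ 1 → t ∈ Icc (-1 : ℝ) 0 →
      |heatAdj (fun z => gauss 0 d z * χ z) x t + Λ * (gauss 0 d (x, t) * χ (x, t))| ≤ C := by
  obtain ⟨χ, hχ, hχ0, hχ1, hχt, hχ2, hχ3⟩ := exists_weighted_cutoff N Λ
  obtain ⟨C₁, hC₁, h₁⟩ := exists_abs_gauss_le (N := N) (1 / 2) (by norm_num)
  have hK : IsCompact (closedBall (0 : Sp N) 1 ×ˢ Icc (-1 : ℝ) 0) :=
    (isCompact_closedBall _ _).prod isCompact_Icc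
  obtain ⟨C₂, hC₂⟩ := hK.exists_bound_of_continuousOn
    (f := fun z : Sp N × ℝ => heatAdj χ z.1 z.2 + Λ * χ z)
    (fun z _ => ((continuousAt_heatAdj hχ.contDiffAt).add
      (continuousAt_const.mul hχ.continuous.continuousAt)).continuousWithinAt)
  have hdd : ∀ i : Fin N, ∃ C, ∀ z ∈ closedBall (0 : Sp N) 1 ×ˢ Icc (-1 : ℝ) 0,
      ‖dd (spaceDir N i) χ z‖ ≤ C := fun i =>
    hK.exists_bound_of_continuousOn
      (fun z _ => (continuousAt_dd_prod hχ.contDiffAt _).continuousWithinAt)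
  choose D hD using hdd
  refine ⟨C₁ * |C₂| + 2 * ∑ i, C₁ * |D i| + 1, by positivity, χ, hχ, hχ0, hχ1, hχt, hχ2,
    fun d x t hd hx ht => ?_⟩
  have htd : t < d := ht.2.trans_lt hd
  have hg := contDiffAt_gauss (0 : Sp N) (z := (x, t)) htd (n := 2)
  have hz : (x, t) ∈ closedBall (0 : Sp N) 1 ×ˢ Icc (-1 : ℝ) 0 := ⟨by simpa using hx, ht⟩
  have hpos := gauss_pos (0 : Sp N) (z := (x, t)) htd
  rw [heatAdj_mul hg hχ.contDiffAt, heatAdj_gauss _ htd]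
  have e : gauss 0 d (x, t) * heatAdj χ x t + χ (x, t) * 0 +
      2 * gradDot (fun y => gauss 0 d (y, t)) (fun y => χ (y, t)) x +
      Λ * (gauss 0 d (x, t) * χ (x, t)) = gauss 0 d (x, t) * (heatAdj χ x t + Λ * χ (x, t)) +
      2 * gradDot (fun y => gauss 0 d (y, t)) (fun y => χ (y, t)) x := by ring
  rw [e]
  by_cases hin : ‖x‖ < 1 / 2 ∧ |t| < 1 / 2
  · obtain ⟨h3, h4⟩ := hχ3 x t hin.1 hin.2
    rw [h3, gradDot]
    simp only [h4, mul_zero, Finset.sum_const_zero, add_zero, abs_zero]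
    positivity
  · have hor : 1 / 2 ≤ ‖x‖ ∨ 1 / 2 ≤ d - t := by
      rw [not_and_or, not_lt, not_lt, abs_of_nonpos ht.2] at hin
      exact hin.imp id fun h => by linarith
    obtain ⟨h3, h4⟩ := h₁ d t x htd hx hor
    have h5 : |gauss 0 d (x, t) * (heatAdj χ x t + Λ * χ (x, t))| ≤ C₁ * |C₂| := by
      rw [abs_mul, abs_of_pos hpos]
      exact mul_le_mul h3 ((hC₂ _ hz).trans (le_abs_self _)) (abs_nonneg _) hC₁.le
    have h6 : |gradDot (fun y => gauss 0 d (y, t)) (fun y => χ (y, t)) x| ≤ ∑ i, C₁ * |D i| := by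
      refine (Finset.abs_sum_le_sum_abs _ _).trans (Finset.sum_le_sum fun i _ => ?_)
      rw [abs_mul]
      refine mul_le_mul (h4 i) ?_ (abs_nonneg _) hC₁.le
      rw [dd_slice (hχ.differentiable two_ne_zero _)]
      exact (hD i _ hz).trans (le_abs_self _)
    refine (abs_add_le _ _).trans ?_
    rw [abs_mul 2, abs_two]
    linarith

/-- The local maximum principle for subsolutions. -/
theorem exists_meanValue (N : ℕ) (Λ : ℝ) : ∃ C, 0 < C ∧ ∀ (U : Set (Sp N)) (s s' : Sp N → ℝ → ℝ)
    (M K : ℝ), IsOpen U → closedBall 0 1 ⊆ U →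
    SuperSol U (-1) 0 (fun x t => -s x t) s' (fun x t => -Λ * s x t) M K →
    (∀ x ∈ U, ∀ t ∈ Icc (-1 : ℝ) 0, 0 ≤ s x t) →
    s 0 0 ≤ C * ∫ t in (-1 : ℝ)..0, ∫ x in closedBall 0 1, s x t := by
  obtain ⟨C, hC, χ, hχ, hχ0, hχ1, hχt, hχ2, hχ3⟩ := exists_meanValue_kernel N Λ
  set V := volume.real (closedBall (0 : Sp N) 1) with hV
  have hVpos : 0 < V := ENNReal.toReal_pos
    (measure_closedBall_pos _ _ one_pos).ne' measure_closedBall_lt_top.ne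
  refine ⟨2 * C / (exp (-(1 / 4)) * V), by positivity, fun U s s' M K hU hsub hs hs0 => ?_⟩
  have h0U : (0 : Sp N) ∈ U := hsub (mem_closedBall_self zero_le_one)
  have h01 : (0 : ℝ) ∈ Icc (-1 : ℝ) 0 := by simp
  have hsx : ∀ t ∈ Icc (-1 : ℝ) 0, ContinuousOn (fun x => s x t) U := fun t ht =>
    (hs.space t ht).continuousOn.neg.congr fun x _ => (neg_neg (s x t)).symm
  have hst : ∀ x ∈ U, ContinuousOn (s x) (Icc (-1 : ℝ) 0) := fun x hx t ht =>
    ((hs.time x hx t ht).continuousAt.neg.congr (Filter.Eventually.of_forall fun t =>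
      neg_neg (s x t))).continuousWithinAt
  have hsM : ∀ x ∈ U, ∀ t ∈ Icc (-1 : ℝ) 0, |s x t| ≤ M := fun x hx t ht => by
    simpa using hs.bdd x hx t ht
  have hcB := isCompact_closedBall (0 : Sp N) 1
  have hFc : ContinuousOn (fun t => ∫ x in closedBall (0 : Sp N) 1, s x t) (Icc (-1 : ℝ) 0) :=
    continuousOn_setIntegral hcB (fun t ht => (hsx t ht).mono hsub)
      (fun x hx => hst x (hsub hx)) fun x hx => hsM x (hsub hx)
  have hFi : IntervalIntegrable (fun t => ∫ x in closedBall (0 : Sp N) 1, s x t) volume (-1) 0 :=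
    ContinuousOn.intervalIntegrable (by rwa [uIcc_of_le (by norm_num)])
  have hF0 : 0 ≤ ∫ t in (-1 : ℝ)..0, ∫ x in closedBall (0 : Sp N) 1, s x t :=
    intervalIntegral.integral_nonneg (by norm_num) fun t ht =>
      setIntegral_nonneg measurableSet_closedBall fun x hx => hs0 x (hsub hx) t ht
  rcases (hs0 0 h0U 0 h01).eq_or_lt with h | hpos
  · rw [← h]; positivity
  obtain ⟨η, hη, hη'⟩ := Metric.continuousAt_iff.1 ((hsx 0 h01).continuousAt (hU.mem_nhds h0U))
    (s 0 0 / 2) (by positivity)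
  set ρ := min (η / 2) (1 / 2) with hρ
  have hρ0 : 0 < ρ := by positivity
  set d := ρ ^ 2 with hd
  have hd0 : 0 < d := by positivity
  set ψ : Sp N × ℝ → ℝ := fun z => gauss 0 d z * χ z with hψ
  have hψc : ∀ x, ∀ t ∈ Icc (-1 : ℝ) 0, ContDiffAt ℝ 2 ψ (x, t) := fun x t ht =>
    (contDiffAt_gauss _ (ht.2.trans_lt hd0)).mul hχ.contDiffAt
  have hψ0 : ∀ x, ∀ t ∈ Icc (-1 : ℝ) 0, 0 ≤ ψ (x, t) := fun x t ht =>
    mul_nonneg (gauss_pos _ (ht.2.trans_lt hd0)).le (hχ0 _)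
  have key := hs.weak hU (by norm_num) hcB hsub hψc hψ0 (fun x hx t ht => by
    rw [hψ]; simp only
    rw [hχ1 x t, mul_zero]
    rw [mem_closedBall, dist_zero_right, not_le] at hx
    exact hx.le)
  have hψs : ∀ t ∈ Icc (-1 : ℝ) 0, Continuous fun x => ψ (x, t) := fun t ht =>
    continuous_iff_continuousAt.2 fun x => (contDiffAt_slice (hψc x t ht)).continuousAt
  have hψH : ∀ t ∈ Icc (-1 : ℝ) 0, Continuous fun x => heatAdj ψ x t := fun t ht =>
    continuous_iff_continuousAt.2 fun x =>
      ContinuousAt.comp (f := fun x : Sp N => (x, t)) (continuousAt_heatAdj (hψc x t ht))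
        (by fun_prop)
  have hbd : ∀ x ∈ closedBall (0 : Sp N) 1, ∀ t ∈ Icc (-1 : ℝ) 0,
      |heatAdj ψ x t + Λ * ψ (x, t)| ≤ C := fun x hx t ht =>
    hχ3 d x t hd0 (by simpa using hx) ht
  have hint : ∀ t ∈ Icc (-1 : ℝ) 0, -C * (∫ x in closedBall (0 : Sp N) 1, s x t) ≤
      ∫ x in closedBall 0 1, (-s x t * heatAdj ψ x t + -Λ * s x t * ψ (x, t)) := fun t ht => by
    have hsc := (hsx t ht).mono hsub
    rw [← integral_const_mul]
    refine setIntegral_mono_on ((continuousOn_const.mul hsc).integrableOn_compact hcB)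
      (ContinuousOn.integrableOn_compact hcB ?_) measurableSet_closedBall fun x hx => ?_
    · exact (hsc.neg.mul (hψH t ht).continuousOn).add
        ((continuousOn_const.mul hsc).mul (hψs t ht).continuousOn)
    · have h1 := (abs_le.1 (hbd x hx t ht)).2
      have h2 := mul_le_mul_of_nonneg_left h1 (hs0 x (hsub hx) t ht)
      linarith
  have hEc : ContinuousOn (fun t => ∫ x in closedBall (0 : Sp N) 1,
      (-s x t * heatAdj ψ x t + -Λ * s x t * ψ (x, t))) (Icc (-1 : ℝ) 0) := by
    refine continuousOn_setIntegral (C := M * C) hcB (fun t ht => ?_) (fun x hx => ?_)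
      fun x hx t ht => ?_
    · have hsc := (hsx t ht).mono hsub
      exact (hsc.neg.mul (hψH t ht).continuousOn).add
        ((continuousOn_const.mul hsc).mul (hψs t ht).continuousOn)
    · have h1 := hst x (hsub hx)
      have h2 : ContinuousOn (fun t => ψ (x, t)) (Icc (-1 : ℝ) 0) := fun t ht =>
        (hasDerivAt_slice ((hψc x t ht).differentiableAt two_ne_zero)).continuousAt.continuousWithinAt
      have h3 : ContinuousOn (fun t => heatAdj ψ x t) (Icc (-1 : ℝ) 0) := fun t ht =>
        (ContinuousAt.comp (f := fun t : ℝ => (x, t)) (continuousAt_heatAdj (hψc x t ht))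
          (by fun_prop)).continuousWithinAt
      exact (h1.neg.mul h3).add ((continuousOn_const.mul h1).mul h2)
    · have e : -s x t * heatAdj ψ x t + -Λ * s x t * ψ (x, t) =
          -(s x t * (heatAdj ψ x t + Λ * ψ (x, t))) := by ring
      rw [e, abs_neg, abs_mul]
      exact mul_le_mul (hsM x (hsub hx) t ht) (hbd x hx t ht) (abs_nonneg _)
        ((abs_nonneg _).trans (hsM x (hsub hx) t ht))
  have hlow : -C * (∫ t in (-1 : ℝ)..0, ∫ x in closedBall (0 : Sp N) 1, s x t) ≤
      ∫ t in (-1 : ℝ)..0, ∫ x in closedBall (0 : Sp N) 1,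
        (-s x t * heatAdj ψ x t + -Λ * s x t * ψ (x, t)) := by
    rw [← intervalIntegral.integral_const_mul]
    exact intervalIntegral.integral_mono_on (by norm_num) (hFi.const_mul _)
      (ContinuousOn.intervalIntegrable (by rwa [uIcc_of_le (by norm_num)])) hint
  have hzero : ∫ x in closedBall (0 : Sp N) 1, -s x (-1) * ψ (x, -1) = 0 := by
    simp [hψ, hχt]
  rw [hzero, sub_zero] at key
  have hρ1 : ρ ≤ 1 / 2 := min_le_right _ _
  have hρη : ρ < η := (min_le_left _ _).trans_lt (by linarith)
  have hball : closedBall (0 : Sp N) ρ ⊆ closedBall 0 1 := closedBall_subset_closedBall (by linarith)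
  have hfi : IntegrableOn (fun x => s x 0 * ψ (x, 0)) (closedBall (0 : Sp N) 1) :=
    (((hsx 0 h01).mono hsub).mul (hψs 0 h01).continuousOn).integrableOn_compact hcB
  have hmain : s 0 0 / 2 * (exp (-(1 / 4)) * V) ≤ ∫ x in closedBall (0 : Sp N) 1, s x 0 * ψ (x, 0) := by
    calc s 0 0 / 2 * (exp (-(1 / 4)) * V)
        = ∫ x in closedBall (0 : Sp N) ρ, s 0 0 / 2 * (d ^ (-(N / 2 : ℝ)) * exp (-(1 / 4))) := by
          rw [setIntegral_const, Measure.addHaar_real_closedBall' _ _ hρ0.le, smul_eq_mul,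
            finrank_euclideanSpace_fin, ← hV]
          have : ρ ^ N * d ^ (-(N / 2 : ℝ)) = 1 := by
            rw [hd, ← rpow_natCast, ← rpow_natCast ρ 2, ← rpow_mul hρ0.le, ← rpow_add hρ0]
            norm_num
            ring_nf; simp
          linear_combination (-(s 0 0 / 2 * exp (-(1 / 4)) * V)) * this
      _ ≤ ∫ x in closedBall (0 : Sp N) ρ, s x 0 * ψ (x, 0) := by
          refine setIntegral_mono_on (integrableOn_const measure_closedBall_lt_top.ne)
            (hfi.mono_set hball) measurableSet_closedBall fun x hx => ?_
          have hxρ : ‖x‖ ≤ ρ := by simpa using hx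
          have h1 := hη' (show dist x 0 < η by rw [dist_zero_right]; linarith)
          rw [dist_eq, abs_lt] at h1
          refine mul_le_mul (by linarith) ?_ (by positivity) (hs0 x (hsub (hball hx)) 0 h01)
          simp only [hψ]
          rw [hχ2 x (hxρ.trans hρ1), mul_one, gauss]
          simp only [sub_zero]
          refine mul_le_mul_of_nonneg_left (exp_le_exp.2 (neg_le_neg ?_)) (by positivity)
          rw [div_le_div_iff₀ (by positivity) (by norm_num)]
          have : ‖x‖ ^ 2 ≤ d := by rw [hd]; gcongr
          linarith
      _ ≤ _ := setIntegral_mono_set hfi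
          ((ae_restrict_iff' measurableSet_closedBall).2 (Filter.Eventually.of_forall fun x hx =>
            mul_nonneg (hs0 x (hsub hx) 0 h01) (hψ0 x 0 h01))) hball.eventuallyLE
  have hneg : ∫ x in closedBall (0 : Sp N) 1, -s x 0 * ψ (x, 0) =
      -∫ x in closedBall (0 : Sp N) 1, s x 0 * ψ (x, 0) := by
    rw [← integral_neg]
    exact integral_congr_ae (Filter.Eventually.of_forall fun x => by simp)
  rw [hneg] at key
  rw [div_mul_eq_mul_div, le_div_iff₀ (by positivity)]
  linarith

end MeanValue

section Hinge

/-- A smooth convex function vanishing exactly on the negative half-line, of slope at most one. -/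
noncomputable def hinge (s : ℝ) : ℝ := ∫ y in (0 : ℝ)..s, smoothTransition y

theorem hasDerivAt_hinge (s : ℝ) : HasDerivAt hinge (smoothTransition s) s :=
  (smoothTransition.continuous.integral_hasStrictDerivAt 0 s).hasDerivAt

theorem deriv_hinge : deriv hinge = smoothTransition := funext fun s => (hasDerivAt_hinge s).deriv

theorem contDiff_hinge : ContDiff ℝ 2 hinge := by
  rw [show (2 : WithTop ℕ∞) = 1 + 1 by norm_num, contDiff_succ_iff_deriv, deriv_hinge]
  exact ⟨fun s => (hasDerivAt_hinge s).differentiableAt, by simp,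
    smoothTransition.contDiff⟩

theorem monotone_hinge : Monotone hinge :=
  monotone_of_deriv_nonneg (contDiff_hinge.differentiable two_ne_zero) fun s => by
    rw [deriv_hinge]; exact smoothTransition.nonneg s

theorem hinge_zero : hinge 0 = 0 := by simp [hinge]

theorem hinge_of_nonpos {s : ℝ} (hs : s ≤ 0) : hinge s = 0 := by
  rw [hinge, intervalIntegral.integral_symm, neg_eq_zero,
    intervalIntegral.integral_congr (g := fun _ => (0 : ℝ)), intervalIntegral.integral_zero]
  intro y hy
  rw [uIcc_of_le hs] at hy
  exact smoothTransition.zero_of_nonpos hy.2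

theorem hinge_nonneg (s : ℝ) : 0 ≤ hinge s := by
  rcases le_total s 0 with h | h
  · rw [hinge_of_nonpos h]
  · rw [← hinge_zero]; exact monotone_hinge h

theorem hinge_le {s : ℝ} (hs : 0 ≤ s) : hinge s ≤ s := by
  calc hinge s ≤ ∫ _ in (0 : ℝ)..s, (1 : ℝ) :=
        intervalIntegral.integral_mono_on hs (smoothTransition.continuous.intervalIntegrable _ _)
          (continuous_const.intervalIntegrable _ _) fun y _ => smoothTransition.le_one y
    _ = s := by simp

theorem hinge_pos {s : ℝ} (hs : 0 < s) : 0 < hinge s :=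
  intervalIntegral.intervalIntegral_pos_of_pos_on
    (smoothTransition.continuous.intervalIntegrable _ _)
    (fun _ hx => smoothTransition.pos_of_pos hx.1) hs

end Hinge

section WeakHarnack

variable {N : ℕ}

theorem SuperSol.mono_time {U : Set (Sp N)} {a b c d : ℝ} {v v' g : Sp N → ℝ → ℝ} {M K : ℝ}
    (hv : SuperSol U a b v v' g M K) (hac : a ≤ c) (hdb : d ≤ b) : SuperSol U c d v v' g M K := by
  have h : Icc c d ⊆ Icc a b := Icc_subset_Icc hac hdb
  exact ⟨fun t ht => hv.space t (h ht), fun x hx t ht => hv.time x hx t (h ht),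
    fun x hx => (hv.lip x hx).imp fun L hL s hs t ht => hL s (h hs) t (h ht),
    fun x hx t ht => hv.bdd x hx t (h ht), fun x hx t ht => hv.gbdd x hx t (h ht),
    fun t ht => hv.gspace t (h ht), fun x hx => (hv.gtime x hx).mono h,
    fun x hx t ht => hv.sup x hx t (h ht)⟩

theorem integral_gauss (a : Sp N) {d t : ℝ} (h : t < d) :
    Integrable (fun x => gauss a d (x, t)) ∧
      ∫ x, gauss a d (x, t) = (4 * π) ^ (N / 2 : ℝ) := by
  have hτ : 0 < d - t := sub_pos.2 h
  have e : ∀ x : Sp N, gauss a d (x, t) =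
      (d - t) ^ (-(N / 2 : ℝ)) * exp (-(1 / (4 * (d - t))) * ‖x - a‖ ^ 2) := fun x => by
    simp only [gauss]; congr 2; ring
  have hi : ∫ x, gauss a d (x, t) = (4 * π) ^ (N / 2 : ℝ) := by
    simp only [e]
    rw [integral_const_mul, integral_sub_right_eq_self (μ := (volume : Measure (Sp N)))
      (fun y : Sp N => exp (-(1 / (4 * (d - t))) * ‖y‖ ^ 2)) a,
      GaussianFourier.integral_rexp_neg_mul_sq_norm (by positivity), finrank_euclideanSpace_fin,
      rpow_neg hτ.le, show π / (1 / (4 * (d - t))) = (4 * π) * (d - t) by field_simp,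
      mul_rpow (by positivity) hτ.le]
    field_simp
  refine ⟨?_, hi⟩
  by_contra hc
  rw [integral_undef hc] at hi
  exact (by positivity : (0 : ℝ) < (4 * π) ^ (N / 2 : ℝ)).ne hi

theorem exists_radius_gauss_le (N : ℕ) (T : ℝ) {κ : ℝ} (hκ : 0 < κ) : ∃ R, 0 < R ∧
    ∀ (a x : Sp N) (d t : ℝ), t < d → d - t ≤ T → R ≤ ‖x - a‖ → gauss a d (x, t) ≤ κ := by
  obtain ⟨C, hC, h⟩ := exists_rpow_neg_mul_exp_le (N / 2 : ℝ) (by positivity) one_pos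
  set Q := max 2 (8 * T * (-log (κ / C))) with hQ
  have hQ2 : 2 ≤ Q := le_max_left _ _
  refine ⟨Q, by linarith, fun a x d t htd hT hx => ?_⟩
  have hτ : 0 < d - t := sub_pos.2 htd
  have hq : Q ≤ ‖x - a‖ ^ 2 := by nlinarith
  have h1 := h (d - t) (‖x - a‖ ^ 2 / 2) hτ (by positivity) (Or.inl (by linarith))
  have e : gauss a d (x, t) = (d - t) ^ (-(N / 2 : ℝ)) * exp (-(‖x - a‖ ^ 2 / 2 / (4 * (d - t)))) *
      exp (-(‖x - a‖ ^ 2 / (8 * (d - t)))) := by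
    rw [mul_assoc, ← exp_add, gauss]
    congr 2
    field_simp
    ring
  have h2 : exp (-(‖x - a‖ ^ 2 / (8 * (d - t)))) ≤ κ / C := by
    rw [← le_log_iff_exp_le (by positivity), neg_le, le_div_iff₀ (by positivity)]
    rcases le_total (-log (κ / C)) 0 with h3 | h3
    · exact (mul_nonpos_of_nonpos_of_nonneg h3 (by positivity)).trans (by positivity)
    · have h4 : 8 * T * (-log (κ / C)) ≤ ‖x - a‖ ^ 2 := (le_max_right _ _).trans hq
      nlinarith
  rw [e]
  calc _ ≤ C * (κ / C) := mul_le_mul h1 h2 (exp_pos _).le hC.le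
    _ = κ := by field_simp

theorem exists_time_gauss_le (N : ℕ) {η κ : ℝ} (hη : 0 < η) (hκ : 0 < κ) : ∃ δ, 0 < δ ∧ δ ≤ 1 ∧
    ∀ (a x : Sp N) (t : ℝ), η ≤ ‖x - a‖ → gauss a (t + δ) (x, t) ≤ κ := by
  obtain ⟨C, hC, h⟩ := exists_rpow_neg_mul_exp_le (N / 2 + 1 : ℝ) (by positivity)
    (η := η ^ 2) (by positivity)
  refine ⟨min 1 (κ / C), by positivity, min_le_left _ _, fun a x t hx => ?_⟩
  set δ := min 1 (κ / C) with hδ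
  have hδ0 : 0 < δ := by positivity
  have h1 := h δ (‖x - a‖ ^ 2) hδ0 (by positivity) (Or.inl (by gcongr))
  have e : δ ^ (-(N / 2 + 1 : ℝ)) = δ ^ (-(N / 2 : ℝ)) / δ := by
    rw [neg_add', rpow_sub_one hδ0.ne']
  rw [e, div_mul_eq_mul_div, div_le_iff₀ hδ0] at h1
  simp only [gauss, add_sub_cancel_left]
  refine h1.trans ?_
  calc C * δ ≤ C * (κ / C) := by gcongr; exact min_le_right _ _
    _ = κ := by field_simp

/-- The weak Harnack inequality for nonnegative supersolutions of the heat equation. -/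
theorem exists_weakHarnack (N : ℕ) : ∃ R C, 1 ≤ R ∧ 0 < C ∧ ∀ (U : Set (Sp N))
    (w w' : Sp N → ℝ → ℝ) (M K : ℝ), IsOpen U → closedBall 0 R ⊆ U →
    SuperSol U (-1) 1 w w' (fun _ _ => 0) M K →
    (∀ x ∈ U, ∀ t ∈ Icc (-1 : ℝ) 1, 0 ≤ w x t) →
    ∀ xs : Sp N, ‖xs‖ ≤ 4 → ∀ t ∈ Icc (-1 : ℝ) 0, ∫ x in closedBall 0 1, w x t ≤ C * w xs 1 := by
  set κ : ℝ := 3 ^ (-(N / 2 : ℝ)) * exp (-(25 / 4)) / 2 with hκ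
  have hκ0 : 0 < κ := by positivity
  obtain ⟨R₀, hR₀, hR⟩ := exists_radius_gauss_le N 3 hκ0
  have hH := hinge_pos hκ0
  have hG0 : (0 : ℝ) < (4 * π) ^ (N / 2 : ℝ) := by positivity
  refine ⟨R₀ + 4, (4 * π) ^ (N / 2 : ℝ) / hinge κ, by linarith, by positivity,
    fun U w w' M K hU hsub hw hw0 xs hxs t ht => ?_⟩
  have ht1 : t ∈ Icc (-1 : ℝ) 1 := ⟨ht.1, ht.2.trans zero_le_one⟩
  have h11 : (1 : ℝ) ∈ Icc (-1 : ℝ) 1 := by simp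
  have ht1' : t ≤ 1 := ht1.2
  have hxsU : xs ∈ U := hsub (by rw [mem_closedBall, dist_zero_right]; linarith)
  have hcB := isCompact_closedBall (0 : Sp N) (R₀ + 4)
  have hwc : ∀ s ∈ Icc (-1 : ℝ) 1, ContinuousOn (fun x => w x s) U := fun s hs =>
    (hw.space s hs).continuousOn
  rw [div_mul_eq_mul_div, le_div_iff₀ hH]
  refine le_of_forall_pos_le_add fun ε' hε' => ?_
  set ε := ε' / (4 * π) ^ (N / 2 : ℝ) with hε
  have hε0 : 0 < ε := by positivity
  obtain ⟨η, hη, hη'⟩ := Metric.continuousAt_iff.1 ((hwc 1 h11).continuousAt (hU.mem_nhds hxsU))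
    ε hε0
  obtain ⟨δ, hδ, hδ1, hδη⟩ := exists_time_gauss_le N hη hκ0
  set ψ : Sp N × ℝ → ℝ := fun z => hinge (gauss xs (1 + δ) z - κ) with hψ
  have hlt : ∀ s ∈ Icc t 1, s < 1 + δ := fun s hs => hs.2.trans_lt (by linarith)
  have hgc : ∀ x, ∀ s ∈ Icc t 1, ContDiffAt ℝ 2 (gauss xs (1 + δ)) (x, s) := fun x s hs =>
    contDiffAt_gauss _ (hlt s hs)
  have hhc : ContDiff ℝ 2 fun y => hinge (y - κ) := contDiff_hinge.comp (contDiff_id.sub contDiff_const)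
  have hψc : ∀ x, ∀ s ∈ Icc t 1, ContDiffAt ℝ 2 ψ (x, s) := fun x s hs =>
    hhc.contDiffAt.comp (x, s) (hgc x s hs)
  have hψ0 : ∀ z, 0 ≤ ψ z := fun z => hinge_nonneg _
  have key := (hw.mono_time ht.1 le_rfl).weak hU ht1' hcB hsub hψc (fun x s _ => hψ0 _)
    (fun x hx s hs => hinge_of_nonpos (sub_nonpos.2 (hR _ _ _ _ (hlt s hs)
      (by linarith [hs.1, ht.1]) (by
        rw [mem_closedBall, dist_zero_right, not_le] at hx
        have := norm_sub_norm_le x xs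
        linarith))))
  have hd1 : ∀ y, HasDerivAt (fun y => hinge (y - κ)) (smoothTransition (y - κ)) y := fun y =>
    HasDerivAt.comp_sub_const y κ (hasDerivAt_hinge (y - κ))
  have hd2 : deriv (fun y => hinge (y - κ)) = fun y => smoothTransition (y - κ) :=
    funext fun y => (hd1 y).deriv
  have hmono : Monotone fun y => smoothTransition (y - κ) := fun y z h =>
    smoothTransition.monotone (sub_le_sub_right h κ)
  have hheat : ∀ x, ∀ s ∈ Icc t 1, 0 ≤ heatAdj ψ x s := fun x s hs => by
    have := heatAdj_comp hhc (hgc x s hs)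
    rw [heatAdj_gauss _ (hlt s hs), mul_zero, zero_add, hd2] at this
    rw [hψ, this]
    exact mul_nonneg hmono.deriv_nonneg (gradSq_nonneg _ _)
  have hleft : 0 ≤ ∫ s in t..1, ∫ x in closedBall (0 : Sp N) (R₀ + 4),
      (w x s * heatAdj ψ x s + 0 * ψ (x, s)) :=
    intervalIntegral.integral_nonneg ht1' fun s hs =>
      setIntegral_nonneg measurableSet_closedBall fun x hx => by
        rw [zero_mul, add_zero]
        exact mul_nonneg (hw0 x (hsub hx) s ⟨ht.1.trans hs.1, hs.2⟩) (hheat x s hs)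
  have hψs : ∀ s ∈ Icc t 1, Continuous fun x => ψ (x, s) := fun s hs =>
    continuous_iff_continuousAt.2 fun x => (contDiffAt_slice (hψc x s hs)).continuousAt
  have htt : t ∈ Icc t 1 := ⟨le_rfl, ht1'⟩
  have h1t : (1 : ℝ) ∈ Icc t 1 := ⟨ht1', le_rfl⟩
  have hfi : ∀ s ∈ Icc t 1, IntegrableOn (fun x => w x s * ψ (x, s)) (closedBall (0 : Sp N) (R₀ + 4)) :=
    fun s hs => (((hwc s ⟨ht.1.trans hs.1, hs.2⟩).mono hsub).mul
      (hψs s hs).continuousOn).integrableOn_compact hcB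
  have hball : closedBall (0 : Sp N) 1 ⊆ closedBall 0 (R₀ + 4) :=
    closedBall_subset_closedBall (by linarith)
  have hlow : (∫ x in closedBall (0 : Sp N) 1, w x t) * hinge κ ≤
      ∫ x in closedBall (0 : Sp N) (R₀ + 4), w x t * ψ (x, t) := by
    calc (∫ x in closedBall (0 : Sp N) 1, w x t) * hinge κ
        = ∫ x in closedBall (0 : Sp N) 1, w x t * hinge κ := (integral_mul_const _ _).symm
      _ ≤ ∫ x in closedBall (0 : Sp N) 1, w x t * ψ (x, t) := by
          refine setIntegral_mono_on ((((hwc t ht1).mono (hball.trans hsub)).mul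
            continuousOn_const).integrableOn_compact (isCompact_closedBall _ _))
            ((hfi t htt).mono_set hball) measurableSet_closedBall fun x hx => ?_
          refine mul_le_mul_of_nonneg_left (monotone_hinge ?_) (hw0 x (hsub (hball hx)) t ht1)
          have hx1 : ‖x‖ ≤ 1 := by simpa using hx
          have h5 : ‖x - xs‖ ^ 2 ≤ 25 := by
            have := norm_sub_le x xs
            nlinarith [norm_nonneg (x - xs)]
          have hτ : 1 ≤ 1 + δ - t := by linarith [ht.2]
          have hτ3 : 1 + δ - t ≤ 3 := by linarith [ht.1]
          have : 2 * κ ≤ gauss xs (1 + δ) (x, t) := by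
            rw [hκ, gauss, mul_div_cancel₀ _ two_ne_zero]
            refine mul_le_mul (rpow_le_rpow_of_nonpos (by linarith) hτ3
              (neg_nonpos.2 (by positivity))) (exp_le_exp.2 (neg_le_neg ?_)) (exp_pos _).le
              (rpow_nonneg (by simp only; linarith) _)
            simp only
            rw [div_le_div_iff₀ (by linarith) (by norm_num)]
            nlinarith
          linarith
      _ ≤ _ := setIntegral_mono_set (hfi t htt)
          ((ae_restrict_iff' measurableSet_closedBall).2 (Filter.Eventually.of_forall fun x hx =>
            mul_nonneg (hw0 x (hsub hx) t ht1) (hψ0 _))) hball.eventuallyLE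
  have hgi := integral_gauss xs (show (1 : ℝ) < 1 + δ by linarith)
  have hw1 : 0 ≤ w xs 1 := hw0 xs hxsU 1 h11
  have hup : ∫ x in closedBall (0 : Sp N) (R₀ + 4), w x 1 * ψ (x, 1) ≤
      (w xs 1 + ε) * (4 * π) ^ (N / 2 : ℝ) := by
    calc ∫ x in closedBall (0 : Sp N) (R₀ + 4), w x 1 * ψ (x, 1)
        ≤ ∫ x in closedBall (0 : Sp N) (R₀ + 4), (w xs 1 + ε) * gauss xs (1 + δ) (x, 1) := by
          refine setIntegral_mono_on (hfi 1 h1t) (hgi.1.const_mul _).integrableOn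
            measurableSet_closedBall fun x hx => ?_
          have hgp := gauss_pos xs (z := (x, (1 : ℝ))) (show (1 : ℝ) < 1 + δ by linarith)
          rcases lt_or_ge (dist x xs) η with h | h
          · have h1 := hη' h
            rw [dist_eq, abs_lt] at h1
            refine mul_le_mul (by linarith) ?_ (hψ0 _) (by linarith)
            rcases le_total (gauss xs (1 + δ) (x, 1)) κ with h2 | h2
            · rw [hψ]; simp only
              rw [hinge_of_nonpos (sub_nonpos.2 h2)]; exact hgp.le
            · exact (hinge_le (sub_nonneg.2 h2)).trans (by linarith)
          · rw [dist_eq_norm] at h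
            rw [hψ]; simp only
            rw [hinge_of_nonpos (sub_nonpos.2 (hδη xs x 1 h)), mul_zero]
            positivity
      _ ≤ ∫ x, (w xs 1 + ε) * gauss xs (1 + δ) (x, 1) :=
          setIntegral_le_integral (hgi.1.const_mul _) (Filter.Eventually.of_forall fun x =>
            mul_nonneg (by linarith) (gauss_pos xs (by simp only; linarith)).le)
      _ = _ := by rw [integral_const_mul, hgi.2]
  have e : ε * (4 * π) ^ (N / 2 : ℝ) = ε' := by rw [hε]; field_simp
  linarith

end WeakHarnack

section Mollify

variable {N m : ℕ}

/-- Convolution with a kernel on space-time. -/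
noncomputable def mollify (φ g : Sp N × ℝ → ℝ) (z : Sp N × ℝ) : ℝ := ∫ y, g y * φ (z - y)

theorem mollify_eq (φ g : Sp N × ℝ → ℝ) :
    mollify φ g = convolution g φ (ContinuousLinearMap.lsmul ℝ ℝ) volume := rfl

theorem contDiff_mollify {φ g : Sp N × ℝ → ℝ} (hφ : ContDiff ℝ ∞ φ) (hc : HasCompactSupport φ)
    (hg : LocallyIntegrable g) : ContDiff ℝ ∞ (mollify φ g) := by
  rw [mollify_eq]
  exact hc.contDiff_convolution_right _ hg hφ

theorem dd_mollify {φ g : Sp N × ℝ → ℝ} (hφ : ContDiff ℝ 1 φ) (hc : HasCompactSupport φ)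
    (hg : LocallyIntegrable g) (w : Sp N × ℝ) : dd w (mollify φ g) = mollify (dd w φ) g := by
  ext z
  have h := (hc.hasFDerivAt_convolution_right (ContinuousLinearMap.lsmul ℝ ℝ) hg hφ z).fderiv
  rw [dd, mollify_eq, h]
  rw [convolution_precompR_apply _ hg (hc.fderiv ℝ) (hφ.continuous_fderiv one_ne_zero)]
  rfl

theorem locallyIntegrable_of_bounded {g : Sp N × ℝ → ℝ} (hg : Measurable g) {K : ℝ}
    (hK : ∀ z, |g z| ≤ K) : LocallyIntegrable g :=
  (memLp_top_of_bound hg.aestronglyMeasurable K (Filter.Eventually.of_forall hK)).locallyIntegrable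
    le_top

theorem mollify_bound {φ g : Sp N × ℝ → ℝ} (hφ : Continuous φ) (hc : HasCompactSupport φ)
    (hφ0 : ∀ z, 0 ≤ φ z) (hφ1 : ∫ z, φ z = 1) {K : ℝ}
    (hK : ∀ z, |g z| ≤ K) (z : Sp N × ℝ) : |mollify φ g z| ≤ K := by
  have hi : Integrable fun y => φ (z - y) :=
    (hφ.integrable_of_hasCompactSupport hc).comp_sub_left z
  calc |mollify φ g z| ≤ ∫ y, K * φ (z - y) := by
        refine norm_integral_le_of_norm_le (f := fun y => g y * φ (z - y)) (hi.const_mul K)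
          (Filter.Eventually.of_forall fun y => ?_)
        rw [norm_eq_abs, abs_mul, abs_of_nonneg (hφ0 _)]
        exact mul_le_mul_of_nonneg_right (hK y) (hφ0 _)
    _ = K := by
        rw [integral_const_mul, integral_sub_left_eq_self φ volume z, hφ1, mul_one]

/-- Bounded functions on space-time which solve the system weakly near the points of a ball. -/
structure WeakSol (r : ℝ) (β : Fin m → Fin m → ℝ) (A R : ℝ) (u : Fin m → Sp N × ℝ → ℝ) : Prop where
  meas : ∀ k, Measurable (u k)
  nonneg : ∀ k z, 0 ≤ u k z
  le : ∀ k z, u k z ≤ A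
  weak : ∀ k, ∀ z ∈ closedBall 0 R, ∀ φ : Sp N × ℝ → ℝ, ContDiff ℝ ∞ φ → (∀ y, 0 ≤ φ y) →
    (∀ y, 1 ≤ ‖y‖ → φ y = 0) →
    ∫ y, u k y * (dd (timeDir N) φ (z - y) -
      ∑ i, dd (spaceDir N i) (dd (spaceDir N i) φ) (z - y)) =
    ∫ y, src r β (fun j => u j y) k * φ (z - y)

theorem abs_src_le {r : ℝ} (hr : 0 < r) {β : Fin m → Fin m → ℝ} {a : Fin m → ℝ} {A : ℝ}
    (h0 : ∀ i, 0 ≤ a i) (hA : ∀ i, a i ≤ A) (k : Fin m) :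
    |src r β a k| ≤ (∑ i, ∑ j, |β i j|) * (A ^ r * A ^ (r + 1)) := by
  have hA0 : 0 ≤ A := (h0 k).trans (hA k)
  calc |src r β a k| ≤ ∑ j, |β k j| * (A ^ r * A ^ (r + 1)) := by
        refine (Finset.abs_sum_le_sum_abs _ _).trans (Finset.sum_le_sum fun j _ => ?_)
        rw [mul_assoc, abs_mul, abs_of_nonneg (mul_nonneg (rpow_nonneg (h0 k) _)
          (rpow_nonneg (h0 j) _))]
        refine mul_le_mul_of_nonneg_left (mul_le_mul (rpow_le_rpow (h0 k) (hA k) hr.le)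
          (rpow_le_rpow (h0 j) (hA j) (by linarith)) (rpow_nonneg (h0 j) _)
          (rpow_nonneg hA0 _)) (abs_nonneg _)
    _ = (∑ j, |β k j|) * (A ^ r * A ^ (r + 1)) := (Finset.sum_mul _ _ _).symm
    _ ≤ _ := mul_le_mul_of_nonneg_right
        (Finset.single_le_sum (f := fun i => ∑ j, |β i j|)
          (fun i _ => Finset.sum_nonneg fun j _ => abs_nonneg _) (Finset.mem_univ k))
        (mul_nonneg (rpow_nonneg hA0 _) (rpow_nonneg hA0 _))

theorem continuous_src {r : ℝ} (hr : 0 < r) (β : Fin m → Fin m → ℝ) (k : Fin m) :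
    Continuous fun a : Fin m → ℝ => src r β a k := by
  refine continuous_finsetSum _ fun j _ => ?_
  exact (continuous_const.mul ((continuous_apply k).rpow_const fun _ => Or.inr hr.le)).mul
    ((continuous_apply j).rpow_const fun _ => Or.inr (by linarith))

theorem tendsto_src {r : ℝ} (hr : 0 < r) (β : Fin m → Fin m → ℝ) (k : Fin m)
    {a : ℕ → Fin m → ℝ} {c : Fin m → ℝ}
    (h : ∀ j, Filter.Tendsto (fun n => a n j) Filter.atTop (𝓝 (c j))) :
    Filter.Tendsto (fun n => src r β (a n) k) Filter.atTop (𝓝 (src r β c k)) :=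
  ((continuous_src hr β k).tendsto c).comp (tendsto_pi_nhds.2 h)

theorem WeakSol.energy_le {r : ℝ} (hr : 0 < r) {β : Fin m → Fin m → ℝ}
    {A R ε C : ℝ} {u : Fin m → Sp N × ℝ → ℝ} (hu : WeakSol r β A R u) (hA : 0 < A)
    (hE : ∀ v : Fin m → EuclideanSpace ℝ (Fin N) × ℝ → ℝ, (∀ k, ContDiff ℝ ∞ (v k)) →
      (∀ k z, 0 < v k z) → (∀ k, ∀ z ∈ closedBall 0 R, v k z ≤ A + 1) →
      ∫ z in closedBall 0 1, ∑ k, (v k z ^ (2 * r + 1)) ^ 2 ≤ ε + C * errInt r β v R) :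
    ∫ z in closedBall 0 1, ∑ k, (u k z ^ (2 * r + 1)) ^ 2 ≤ ε := by
  let b : ℕ → ContDiffBump (0 : Sp N × ℝ) := fun n =>
    ⟨1 / (n + 2) / 2, 1 / (n + 2), by positivity, half_lt_self (by positivity)⟩
  set φ : ℕ → Sp N × ℝ → ℝ := fun n => (b n).normed volume with hφ
  have hφs : ∀ n, ContDiff ℝ ∞ (φ n) := fun n => (b n).contDiff_normed
  have hφc : ∀ n, HasCompactSupport (φ n) := fun n => (b n).hasCompactSupport_normed
  have hφ0 : ∀ n z, 0 ≤ φ n z := fun n z => (b n).nonneg_normed z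
  have hφ1 : ∀ n, ∫ z, φ n z = 1 := fun n => (b n).integral_normed
  have hφz : ∀ n y, 1 ≤ ‖y‖ → φ n y = 0 := fun n y hy => by
    have h1 : (1 : ℝ) / (n + 2) ≤ 1 := by
      rw [div_le_one (by positivity)]
      have : (0 : ℝ) ≤ n := n.cast_nonneg
      linarith
    have h2 : y ∉ Function.support (φ n) := by
      rw [hφ, ContDiffBump.support_normed_eq, mem_ball, dist_zero_right, not_lt]
      exact h1.trans hy
    simpa using h2
  have hlim : ∀ {g : Sp N × ℝ → ℝ}, LocallyIntegrable g →
      ∀ᵐ z, Filter.Tendsto (fun n => mollify (φ n) g z) Filter.atTop (𝓝 (g z)) := by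
    intro g hg
    have h := ContDiffBump.ae_convolution_tendsto_right_of_locallyIntegrable (φ := b)
      (l := Filter.atTop) (K := 2) (μ := (volume : Measure (Sp N × ℝ))) (g := g)
      ?_ (Filter.Eventually.of_forall fun n => ?_) hg
    · filter_upwards [h] with z hz
      refine hz.congr fun n => ?_
      rw [convolution_lsmul_swap]
      exact integral_congr_ae (Filter.Eventually.of_forall fun y => mul_comm _ _)
    · have := tendsto_one_div_add_atTop_nhds_zero_nat (𝕜 := ℝ)
      have h2 := (Filter.tendsto_add_atTop_iff_nat 1).2 this
      refine h2.congr fun n => ?_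
      simp only [b]; push_cast; ring
    · simp only [b]; linarith
  have hum : ∀ k, Measurable (u k) := hu.meas
  set f : Fin m → Sp N × ℝ → ℝ := fun k z => src r β (fun j => u j z) k with hf
  have hfm : ∀ k, Measurable (f k) := fun k =>
    (continuous_src hr β k).measurable.comp (measurable_pi_lambda _ hum)
  set Kf := (∑ i, ∑ j, |β i j|) * ((A + 1) ^ r * (A + 1) ^ (r + 1)) with hKf
  have hfK : ∀ k z, |f k z| ≤ Kf := fun k z =>
    abs_src_le hr (fun j => hu.nonneg j z) (fun j => (hu.le j z).trans (by linarith)) k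
  have huA : ∀ k z, |u k z| ≤ A := fun k z => abs_le.2 ⟨by linarith [hu.nonneg k z], hu.le k z⟩
  have hul := fun k => locallyIntegrable_of_bounded (hum k) (huA k)
  have hfl := fun k => locallyIntegrable_of_bounded (hfm k) (hfK k)
  set v : ℕ → Fin m → Sp N × ℝ → ℝ := fun n k z => mollify (φ n) (u k) z + 1 / (n + 1) with hv
  have hvs : ∀ n k, ContDiff ℝ ∞ (v n k) := fun n k =>
    (contDiff_mollify (hφs n) (hφc n) (hul k)).add contDiff_const
  have hm0 : ∀ n k z, 0 ≤ mollify (φ n) (u k) z := fun n k z =>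
    integral_nonneg fun y => mul_nonneg (hu.nonneg k y) (hφ0 n _)
  have hvpos : ∀ n k z, 0 < v n k z := fun n k z => add_pos_of_nonneg_of_pos (hm0 n k z)
    (by positivity)
  have hvA : ∀ n k z, v n k z ≤ A + 1 := fun n k z => by
    refine add_le_add ((le_abs_self _).trans
      (mollify_bound (hφs n).continuous (hφc n) (hφ0 n) (hφ1 n) (huA k) z)) ?_
    rw [div_le_one (by positivity)]
    have : (0 : ℝ) ≤ n := n.cast_nonneg
    linarith
  have hvlim : ∀ᵐ z, ∀ k, Filter.Tendsto (fun n => v n k z) Filter.atTop (𝓝 (u k z)) := by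
    rw [ae_all_iff]
    intro k
    filter_upwards [hlim (hul k)] with z hz
    have h := hz.add (tendsto_one_div_add_atTop_nhds_zero_nat (𝕜 := ℝ))
    rw [add_zero] at h
    exact h
  have hdef : ∀ n k, ∀ z ∈ closedBall 0 R, defect r β (spaceDir N) (timeDir N) (v n) k z =
      mollify (φ n) (f k) z - src r β (fun j => v n j z) k := by
    intro n k z hz
    have hdv : ∀ w, dd w (v n k) = mollify (dd w (φ n)) (u k) := fun w => by
      rw [← dd_mollify ((hφs n).of_le (by exact_mod_cast le_top)) (hφc n) (hul k)]
      ext y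
      simp [hv, dd]
    have hs1 : ∀ w, ContDiff ℝ ∞ (dd w (φ n)) := fun w => contDiff_dd w (hφs n)
    have hc1 : ∀ w, HasCompactSupport (dd w (φ n)) := fun w => HasCompactSupport.dd w (hφc n)
    have hddv : ∀ w, dd w (dd w (v n k)) = mollify (dd w (dd w (φ n))) (u k) := fun w => by
      rw [hdv, dd_mollify ((hs1 w).of_le (by exact_mod_cast le_top)) (hc1 w) (hul k)]
    have hint : ∀ g : Sp N × ℝ → ℝ, Continuous g → HasCompactSupport g →
        Integrable fun y => u k y * g (z - y) := fun g hg hgc => by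
      refine ((hg.integrable_of_hasCompactSupport hgc).comp_sub_left z).bdd_mul (c := A)
        (hum k).aestronglyMeasurable ?_
      exact Filter.Eventually.of_forall (huA k)
    have hw := hu.weak k z hz (φ n) (hφs n) (hφ0 n) (hφz n)
    have e : ∫ y, u k y * (dd (timeDir N) (φ n) (z - y) -
        ∑ i, dd (spaceDir N i) (dd (spaceDir N i) (φ n)) (z - y)) =
        mollify (dd (timeDir N) (φ n)) (u k) z -
          ∑ i, mollify (dd (spaceDir N i) (dd (spaceDir N i) (φ n))) (u k) z := by
      simp only [mul_sub, Finset.mul_sum]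
      rw [integral_sub (hint _ (hs1 _).continuous (hc1 _)) (integrable_finsetSum _ fun i _ =>
        hint _ (contDiff_dd _ (hs1 _)).continuous (HasCompactSupport.dd _ (hc1 _))),
        integral_finsetSum _ fun i _ =>
          hint _ (contDiff_dd _ (hs1 _)).continuous (HasCompactSupport.dd _ (hc1 _))]
      rfl
    rw [e] at hw
    rw [defect]
    simp only [hddv]
    rw [hdv, hw]
    rfl
  have hdlim : ∀ᵐ z, z ∈ closedBall 0 R → ∀ k, Filter.Tendsto
      (fun n => defect r β (spaceDir N) (timeDir N) (v n) k z) Filter.atTop (𝓝 0) := by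
    filter_upwards [hvlim, ae_all_iff.2 fun k => hlim (hfl k)] with z h1 h2 hz k
    have h3 : Filter.Tendsto (fun n => src r β (fun j => v n j z) k) Filter.atTop (𝓝 (f k z)) :=
      tendsto_src hr β k (a := fun n j => v n j z) (c := fun j => u j z) h1
    have h4 := (h2 k).sub h3
    rw [sub_self] at h4
    exact h4.congr fun n => (hdef n k z hz).symm
  have hdb : ∀ n k, ∀ z ∈ closedBall 0 R,
      |defect r β (spaceDir N) (timeDir N) (v n) k z| ≤ Kf + Kf := fun n k z hz => by
    rw [hdef n k z hz]
    exact (abs_sub _ _).trans (add_le_add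
      (mollify_bound (hφs n).continuous (hφc n) (hφ0 n) (hφ1 n) (hfK k) z)
      (abs_src_le hr (fun j => (hvpos n j z).le) (fun j => hvA n j z) k))
  have herr : Filter.Tendsto (fun n => errInt r β (v n) R) Filter.atTop (𝓝 0) := by
    have := tendsto_integral_of_dominated_convergence
      (μ := (volume : Measure (Sp N × ℝ)).restrict (closedBall 0 R))
      (F := fun n z => ∑ k, (|defect r β (spaceDir N) (timeDir N) (v n) k z|
        + defect r β (spaceDir N) (timeDir N) (v n) k z ^ 2)) (f := fun _ => 0)
      (fun _ => ∑ _k : Fin m, ((Kf + Kf) + (Kf + Kf) ^ 2)) (fun n => ?_)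
      (continuous_const.continuousOn.integrableOn_compact (isCompact_closedBall _ _)) (fun n => ?_) ?_
    · simpa [errInt] using this
    · refine (continuous_finsetSum _ fun k _ => ?_).aestronglyMeasurable
      have h := continuous_defect (r := r) (β := β) (spaceDir N) (timeDir N) (hvs n) (hvpos n) k
      exact h.abs.add (h.pow 2)
    · refine (ae_restrict_iff' measurableSet_closedBall).2 (Filter.Eventually.of_forall fun z hz => ?_)
      rw [norm_eq_abs, abs_of_nonneg (Finset.sum_nonneg fun k _ => by positivity)]
      refine Finset.sum_le_sum fun k _ => add_le_add (hdb n k z hz) ?_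
      rw [← sq_abs]
      exact pow_le_pow_left₀ (abs_nonneg _) (hdb n k z hz) 2
    · refine (ae_restrict_iff' measurableSet_closedBall).2 ?_
      filter_upwards [hdlim] with z hz hzR
      have h1 : Filter.Tendsto (fun n => ∑ k, (|defect r β (spaceDir N) (timeDir N) (v n) k z|
        + defect r β (spaceDir N) (timeDir N) (v n) k z ^ 2)) Filter.atTop
          (𝓝 (∑ _k : Fin m, (|(0 : ℝ)| + 0 ^ 2))) :=
        tendsto_finsetSum _ fun k _ => (hz hzR k).abs.add ((hz hzR k).pow 2)
      simpa using h1
  have hen : Filter.Tendsto (fun n => ∫ z in closedBall 0 1, ∑ k, (v n k z ^ (2 * r + 1)) ^ 2)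
      Filter.atTop (𝓝 (∫ z in closedBall 0 1, ∑ k, (u k z ^ (2 * r + 1)) ^ 2)) := by
    refine tendsto_integral_of_dominated_convergence
      (fun _ => ∑ _k : Fin m, ((A + 1) ^ (2 * r + 1)) ^ 2) (fun n => ?_)
      (continuous_const.continuousOn.integrableOn_compact (isCompact_closedBall _ _)) (fun n => ?_) ?_
    · refine (continuous_finsetSum _ fun k _ => ?_).aestronglyMeasurable
      exact ((hvs n k).continuous.rpow_const fun z => Or.inr (by linarith)).pow 2
    · refine Filter.Eventually.of_forall fun z => ?_
      rw [norm_eq_abs, abs_of_nonneg (Finset.sum_nonneg fun k _ => by positivity)]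
      refine Finset.sum_le_sum fun k _ => ?_
      exact pow_le_pow_left₀ (rpow_nonneg (hvpos n k z).le _)
        (rpow_le_rpow (hvpos n k z).le (hvA n k z) (by linarith)) 2
    · refine ae_restrict_of_ae ?_
      filter_upwards [hvlim] with z hz
      exact tendsto_finsetSum _ fun k _ =>
        ((hz k).rpow_const (Or.inr (by linarith))).pow 2
  have hfin := le_of_tendsto_of_tendsto' hen ((herr.const_mul C).const_add ε)
    fun n => hE (v n) (hvs n) (hvpos n) fun k z _ => hvA n k z
  simpa using hfin

end Mollify

section Solutions

variable {N m : ℕ} {r : ℝ} {β : Fin m → Fin m → ℝ}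

/-- Nonnegative classical solutions of the system on `U × I`. -/
structure Sol (r : ℝ) (β : Fin m → Fin m → ℝ) (U : Set (Sp N)) (I : Set ℝ)
    (u : Fin m → Sp N → ℝ → ℝ) : Prop where
  space : ∀ i, ∀ t ∈ I, ContDiffOn ℝ 2 (fun x => u i x t) U
  time : ∀ i, ∀ x ∈ U, ContDiffOn ℝ 1 (fun s => u i x s) I
  nonneg : ∀ i, ∀ x ∈ U, ∀ t ∈ I, 0 ≤ u i x t
  eq : ∀ i, ∀ x ∈ U, ∀ t ∈ I, deriv (fun s => u i x s) t - lap (fun y => u i y t) x =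
    src r β (fun j => u j x t) i

theorem Sol.mono {U V : Set (Sp N)} {I J : Set ℝ} {u : Fin m → Sp N → ℝ → ℝ}
    (h : Sol r β U I u) (hV : V ⊆ U) (hJ : J ⊆ I) : Sol r β V J u :=
  ⟨fun i t ht => (h.space i t (hJ ht)).mono hV, fun i x hx => (h.time i x (hV hx)).mono hJ,
    fun i x hx t ht => h.nonneg i x (hV hx) t (hJ ht), fun i x hx t ht => h.eq i x (hV hx) t (hJ ht)⟩

theorem fderiv_comp_affine {F : Type*} [NormedAddCommGroup F] [NormedSpace ℝ F] (f : Sp N → F)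
    (a : Sp N) (c : ℝ) : fderiv ℝ (fun x => f (a + c • x)) = fun x => c • fderiv ℝ f (a + c • x) := by
  ext1 x
  have h := fderiv_comp_smul (𝕜 := ℝ) (f := fun y => f (a + y)) (x := x) c
  rw [h, fderiv_comp_add_left]

theorem lap_comp_affine (f : Sp N → ℝ) (a x : Sp N) {c : ℝ} (hc : c ≠ 0) :
    lap (fun y => f (a + c • y)) x = c ^ 2 * lap f (a + c • x) := by
  rw [lap, lap, Finset.mul_sum]
  refine Finset.sum_congr rfl fun i _ => ?_
  rw [iteratedFDeriv_two_apply, iteratedFDeriv_two_apply, fderiv_comp_affine]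
  let _ := invertibleOfNonzero hc
  have h : fderiv ℝ (fun y => c • fderiv ℝ f (a + c • y)) x = _ :=
    fderiv_const_smul_of_invertible (𝕜 := ℝ) (x := x) (f := fun y => fderiv ℝ f (a + c • y)) c
  rw [h, fderiv_comp_affine]
  simp only [_root_.smul_apply, smul_eq_mul]
  ring

theorem src_smul (hr : 0 < r) {c : ℝ} (hc : 0 ≤ c) {a : Fin m → ℝ} (ha : ∀ i, 0 ≤ a i) (i : Fin m) :
    src r β (fun j => c * a j) i = c ^ (2 * r + 1) * src r β a i := by
  rw [src, src, Finset.mul_sum]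
  refine Finset.sum_congr rfl fun j _ => ?_
  have e : c ^ (2 * r + 1) = c ^ r * c ^ (r + 1) := by
    rw [← rpow_add_of_nonneg hc hr.le (by linarith)]
    ring_nf
  rw [mul_rpow hc (ha i), mul_rpow hc (ha j), e]
  ring

theorem Sol.rescale (hr : 0 < r) {U : Set (Sp N)} {I : Set ℝ} {u : Fin m → Sp N → ℝ → ℝ}
    (h : Sol r β U I u) (hU : IsOpen U) {V : Set (Sp N)} {J : Set ℝ} {c : ℝ} (hc : 0 < c) (a : Sp N) (b : ℝ)
    (hV : ∀ x ∈ V, a + c • x ∈ U) (hJ : ∀ t ∈ J, b + c ^ 2 * t ∈ I) :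
    Sol r β V J fun i x t => c ^ (1 / r) * u i (a + c • x) (b + c ^ 2 * t) := by
  have hc' : 0 < c ^ (1 / r) := rpow_pos_of_pos hc _
  refine ⟨fun i t ht => ?_, fun i x hx => ?_, fun i x hx t ht =>
    mul_nonneg hc'.le (h.nonneg i _ (hV x hx) _ (hJ t ht)), fun i x hx t ht => ?_⟩
  · exact contDiffOn_const.mul ((h.space i _ (hJ t ht)).comp (f := fun x : Sp N => a + c • x)
      (contDiff_const.add (contDiff_id.const_smul c)).contDiffOn fun x hx => hV x hx)
  · exact contDiffOn_const.mul ((h.time i _ (hV x hx)).comp (f := fun t : ℝ => b + c ^ 2 * t)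
      (contDiff_const.add (contDiff_const.mul contDiff_id)).contDiffOn fun t ht => hJ t ht)
  · have h1 : deriv (fun s => c ^ (1 / r) * u i (a + c • x) (b + c ^ 2 * s)) t =
        c ^ (1 / r) * (c ^ 2 * deriv (fun s => u i (a + c • x) s) (b + c ^ 2 * t)) := by
      have e := deriv_comp_mul_left (c ^ 2) (fun s => u i (a + c • x) (b + s)) t
      rw [deriv_comp_const_add] at e
      rw [deriv_const_mul_field, e, smul_eq_mul]
    have h2 : lap (fun y => c ^ (1 / r) * u i (a + c • y) (b + c ^ 2 * t)) x =
        c ^ (1 / r) * (c ^ 2 * lap (fun y => u i y (b + c ^ 2 * t)) (a + c • x)) := by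
      rw [← lap_comp_affine (fun y => u i y (b + c ^ 2 * t)) a x hc.ne']
      refine lap_const_mul _ (ContDiffAt.comp x (f := fun x : Sp N => a + c • x)
        ((h.space i _ (hJ t ht)).contDiffAt (hU.mem_nhds (hV x hx)))
        (contDiff_const.add (contDiff_id.const_smul c)).contDiffAt)
    rw [h1, h2, src_smul hr hc'.le fun j => h.nonneg j _ (hV x hx) _ (hJ t ht),
      ← h.eq i _ (hV x hx) _ (hJ t ht)]
    have h3 : (c ^ (1 / r)) ^ (2 * r + 1) = c ^ (1 / r) * c ^ 2 := by
      rw [← rpow_mul hc.le, ← rpow_natCast, ← rpow_add hc]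
      congr 1
      field_simp
      push_cast
      ring
    rw [h3]
    ring

theorem lap_sum_mul {f : Fin m → Sp N → ℝ} {x : Sp N} (c : Fin m → ℝ)
    (hf : ∀ i, ContDiffAt ℝ 2 (f i) x) :
    lap (fun y => ∑ i, c i * f i y) x = ∑ i, c i * lap (f i) x := by
  have H : ∀ s : Finset (Fin m), ContDiffAt ℝ 2 (fun y => ∑ i ∈ s, c i * f i y) x ∧
      lap (fun y => ∑ i ∈ s, c i * f i y) x = ∑ i ∈ s, c i * lap (f i) x := by
    intro s
    refine ⟨ContDiffAt.sum fun i _ => contDiffAt_const.mul (hf i), ?_⟩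
    induction s using Finset.induction_on with
    | empty => simp [lap_const]
    | insert a s ha ih =>
      simp only [Finset.sum_insert ha]
      rw [lap_add (contDiffAt_const.mul (hf a))
        (ContDiffAt.sum fun i _ => contDiffAt_const.mul (hf i)), lap_const_mul _ (hf a), ih]
  exact (H Finset.univ).2

theorem continuousOn_src {X : Type*} [TopologicalSpace X] (hr : 0 < r) {f : Fin m → X → ℝ}
    {S : Set X} (hf : ∀ j, ContinuousOn (f j) S) (k : Fin m) :
    ContinuousOn (fun x => src r β (fun j => f j x) k) S :=
  continuousOn_finsetSum _ fun j _ => (continuousOn_const.mul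
    ((hf k).rpow_const fun _ _ => Or.inr hr.le)).mul
      ((hf j).rpow_const fun _ _ => Or.inr (by linarith))

theorem Sol.superSol (hr : 0 < r) {U : Set (Sp N)} {I : Set ℝ} {u : Fin m → Sp N → ℝ → ℝ}
    (h : Sol r β U I u) (hU : IsOpen U) (hI : IsOpen I) {a b A : ℝ} (hab : Icc a b ⊆ I)
    (hA : ∀ i, ∀ x ∈ U, ∀ t ∈ Icc a b, u i x t ≤ A) (c : Fin m → ℝ) :
    SuperSol U a b (fun x t => ∑ i, c i * u i x t) (fun x t => ∑ i, c i * deriv (u i x) t)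
      (fun x t => ∑ i, c i * src r β (fun j => u j x t) i) (∑ i, |c i| * A)
      (∑ k, |c k| * ((∑ i, ∑ j, |β i j|) * (A ^ r * A ^ (r + 1)))) := by
  have hder : ∀ i, ∀ x ∈ U, ∀ t ∈ I, HasDerivAt (u i x) (deriv (u i x) t) t := fun i x hx t ht =>
    ((((h.time i x hx).contDiffAt (hI.mem_nhds ht)).differentiableAt one_ne_zero)).hasDerivAt
  have hspc : ∀ i, ∀ t ∈ Icc a b, ContinuousOn (fun x => u i x t) U := fun i t ht =>
    (h.space i t (hab ht)).continuousOn
  have htc : ∀ i, ∀ x ∈ U, ContinuousOn (u i x) (Icc a b) := fun i x hx =>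
    (h.time i x hx).continuousOn.mono hab
  refine ⟨fun t ht => ContDiffOn.sum fun i _ => contDiffOn_const.mul (h.space i t (hab ht)),
    fun x hx t ht => HasDerivAt.fun_sum fun i _ => (hder i x hx t (hab ht)).const_mul _,
    fun x hx => ?_, fun x hx t ht => ?_, fun x hx t ht => ?_, fun t ht => ?_, fun x hx => ?_,
    fun x hx t ht => ?_⟩
  · have hL : ∀ i, ∃ L, ∀ s ∈ Icc a b, ∀ t ∈ Icc a b, |u i x t - u i x s| ≤ L * |t - s| := by
      intro i
      obtain ⟨L, hL⟩ := isCompact_Icc.exists_bound_of_continuousOn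
        (((h.time i x hx).continuousOn_deriv_of_isOpen hI le_rfl).mono hab)
      refine ⟨L, fun s hs t ht => ?_⟩
      have := (convex_Icc a b).norm_image_sub_le_of_norm_deriv_le (f := u i x) (C := L)
        (fun y hy => (hder i x hx y (hab hy)).differentiableAt) hL hs ht
      simpa only [norm_eq_abs] using this
    choose L hL using hL
    refine ⟨∑ i, |c i| * L i, fun s hs t ht => ?_⟩
    have e : ∑ i, c i * u i x t - ∑ i, c i * u i x s = ∑ i, c i * (u i x t - u i x s) := by
      simp only [mul_sub, Finset.sum_sub_distrib]
    change |∑ i, c i * u i x t - ∑ i, c i * u i x s| ≤ _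
    rw [e, Finset.sum_mul]
    refine (Finset.abs_sum_le_sum_abs _ _).trans (Finset.sum_le_sum fun i _ => ?_)
    rw [abs_mul, mul_assoc]
    exact mul_le_mul_of_nonneg_left (hL i s hs t ht) (abs_nonneg _)
  · refine (Finset.abs_sum_le_sum_abs _ _).trans (Finset.sum_le_sum fun i _ => ?_)
    rw [abs_mul, abs_of_nonneg (h.nonneg i x hx t (hab ht))]
    exact mul_le_mul_of_nonneg_left (hA i x hx t ht) (abs_nonneg _)
  · refine (Finset.abs_sum_le_sum_abs _ _).trans (Finset.sum_le_sum fun i _ => ?_)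
    rw [abs_mul]
    exact mul_le_mul_of_nonneg_left (abs_src_le hr (fun j => h.nonneg j x hx t (hab ht))
      (fun j => hA j x hx t ht) i) (abs_nonneg _)
  · exact continuousOn_finsetSum _ fun i _ => continuousOn_const.mul
      (continuousOn_src hr (fun j => hspc j t ht) i)
  · exact continuousOn_finsetSum _ fun i _ => continuousOn_const.mul
      (continuousOn_src hr (fun j => htc j x hx) i)
  · rw [lap_sum_mul c fun i => (h.space i t (hab ht)).contDiffAt (hU.mem_nhds hx),
      ← Finset.sum_add_distrib]
    refine Finset.sum_le_sum fun i _ => ?_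
    rw [← mul_add, ← h.eq i x hx t (hab ht), add_sub_cancel]

theorem SuperSol.of_le {U : Set (Sp N)} {a b : ℝ} {v v' g f : Sp N → ℝ → ℝ} {M K K' : ℝ}
    (hv : SuperSol U a b v v' g M K) (hle : ∀ x ∈ U, ∀ t ∈ Icc a b, f x t ≤ g x t)
    (hb : ∀ x ∈ U, ∀ t ∈ Icc a b, |f x t| ≤ K') (hs : ∀ t ∈ Icc a b, ContinuousOn (fun x => f x t) U)
    (ht : ∀ x ∈ U, ContinuousOn (f x) (Icc a b)) : SuperSol U a b v v' f M K' :=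
  ⟨hv.space, hv.time, hv.lip, hv.bdd, hb, hs, ht, fun x hx t ht =>
    (add_le_add_right (hle x hx t ht) _).trans (hv.sup x hx t ht)⟩

theorem SuperSol.mono {U V : Set (Sp N)} {a b : ℝ} {v v' g : Sp N → ℝ → ℝ} {M K : ℝ}
    (hv : SuperSol U a b v v' g M K) (h : V ⊆ U) : SuperSol V a b v v' g M K :=
  ⟨fun t ht => (hv.space t ht).mono h, fun x hx => hv.time x (h hx), fun x hx => hv.lip x (h hx),
    fun x hx => hv.bdd x (h hx), fun x hx => hv.gbdd x (h hx), fun t ht => (hv.gspace t ht).mono h,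
    fun x hx => hv.gtime x (h hx), fun x hx => hv.sup x (h hx)⟩

theorem sum_src_le (hr : 0 < r) {a : Fin m → ℝ} {A : ℝ} (h0 : ∀ i, 0 ≤ a i) (hA : ∀ i, a i ≤ A) :
    ∑ i, src r β a i ≤ (∑ i, ∑ j, |β i j|) * (A ^ r * A ^ r) * ∑ j, a j := by
  rw [Finset.sum_mul, Finset.sum_mul]
  refine Finset.sum_le_sum fun i _ => ?_
  rw [Finset.sum_mul, Finset.sum_mul]
  refine Finset.sum_le_sum fun j _ => ?_
  have hA0 : 0 ≤ A := (h0 i).trans (hA i)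
  have e : a j ^ (r + 1) = a j ^ r * a j := by
    rw [rpow_add_of_nonneg (h0 j) hr.le zero_le_one, rpow_one]
  rw [e, mul_assoc, mul_assoc, ← mul_assoc (a i ^ r)]
  refine mul_le_mul (le_abs_self _) ?_ (by have := h0 i; have := h0 j; positivity) (abs_nonneg _)
  refine mul_le_mul (mul_le_mul (rpow_le_rpow (h0 i) (hA i) hr.le) (rpow_le_rpow (h0 j) (hA j) hr.le)
    (rpow_nonneg (h0 j) _) (rpow_nonneg hA0 _))
    (Finset.single_le_sum (fun k _ => h0 k) (Finset.mem_univ j)) (h0 j) (by positivity)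

theorem Sol.superSol_neg_sum (hr : 0 < r) {U : Set (Sp N)} {I : Set ℝ} {u : Fin m → Sp N → ℝ → ℝ}
    (h : Sol r β U I u) (hU : IsOpen U) (hI : IsOpen I) {a b A : ℝ} (hab : Icc a b ⊆ I)
    (hA : ∀ i, ∀ x ∈ U, ∀ t ∈ Icc a b, u i x t ≤ A) :
    ∃ s' M K, SuperSol U a b (fun x t => -∑ i, u i x t) s'
      (fun x t => -((∑ i, ∑ j, |β i j|) * (A ^ r * A ^ r)) * ∑ i, u i x t) M K := by
  have h1 := h.superSol hr hU hI hab hA fun _ => -1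
  simp only [neg_mul, one_mul, Finset.sum_neg_distrib] at h1 ⊢
  refine ⟨_, _, (∑ i, ∑ j, |β i j|) * (A ^ r * A ^ r) * ∑ _i : Fin m, A, h1.of_le
    (fun x hx t ht => neg_le_neg (sum_src_le hr (fun j => h.nonneg j x hx t (hab ht))
      fun j => hA j x hx t ht)) (fun x hx t ht => ?_) (fun t ht => ?_) fun x hx => ?_⟩
  · have h0 : ∀ j, 0 ≤ u j x t := fun j => h.nonneg j x hx t (hab ht)
    have hc : 0 ≤ (∑ i, ∑ j, |β i j|) * (A ^ r * A ^ r) :=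
      mul_nonneg (Finset.sum_nonneg fun i _ => Finset.sum_nonneg fun j _ => abs_nonneg _)
        (mul_self_nonneg _)
    rw [abs_neg, abs_of_nonneg (mul_nonneg hc (Finset.sum_nonneg fun j _ => h0 j))]
    exact mul_le_mul_of_nonneg_left (Finset.sum_le_sum fun j _ => hA j x hx t ht) hc
  · exact (continuousOn_const.mul (continuousOn_finsetSum _ fun i _ =>
      (h.space i t (hab ht)).continuousOn)).neg
  · exact (continuousOn_const.mul (continuousOn_finsetSum _ fun i _ =>
      (h.time i x hx).continuousOn.mono hab)).neg

end Solutions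

section WeakSolutions

variable {N m : ℕ} {r : ℝ} {β : Fin m → Fin m → ℝ}

theorem dd_const_sub {φ : Sp N × ℝ → ℝ} (hφ : ContDiff ℝ 1 φ) (z w : Sp N × ℝ) :
    dd w (fun y => φ (z - y)) = fun y => -dd w φ (z - y) := by
  ext y
  have h : fderiv ℝ (fun y => φ (z - y)) y = _ :=
    (((hφ.differentiable one_ne_zero (z - y)).hasFDerivAt).comp y
      ((hasFDerivAt_id (𝕜 := ℝ) y).const_sub z)).fderiv
  rw [dd, h]
  simp [dd]

theorem heatAdj_const_sub {φ : Sp N × ℝ → ℝ} (hφ : ContDiff ℝ ∞ φ) (z : Sp N × ℝ) (x : Sp N) (t : ℝ) :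
    heatAdj (fun y => φ (z - y)) x t = -dd (timeDir N) φ (z - (x, t)) +
      ∑ i, dd (spaceDir N i) (dd (spaceDir N i) φ) (z - (x, t)) := by
  have h1 : ∀ {f : Sp N × ℝ → ℝ}, ContDiff ℝ ∞ f → ContDiff ℝ 1 f := fun h =>
    h.of_le (by exact_mod_cast le_top)
  have h2 : ContDiff ℝ 2 φ := (by exact_mod_cast contDiff_infty.1 hφ 2)
  have h4 : ContDiffAt ℝ 2 (fun y => φ (z - y)) (x, t) :=
    (h2.comp (contDiff_const.sub contDiff_id)).contDiffAt
  rw [heatAdj_eq h4, dd_const_sub (h1 hφ)]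
  congr 1
  refine Finset.sum_congr rfl fun i _ => ?_
  have h3 : (fun y => -dd (spaceDir N i) φ (z - y)) =
      fun y => (fun q => -dd (spaceDir N i) φ q) (z - y) := rfl
  rw [dd_const_sub (h1 hφ), h3, dd_const_sub (h1 (contDiff_dd _ hφ).neg)]
  simp only [dd]
  rw [fderiv_fun_neg]
  simp only [_root_.neg_apply, neg_neg]
  rfl

theorem dd_eq_zero_of_far {φ : Sp N × ℝ → ℝ} (h : ∀ y, 1 < ‖y‖ → φ y = 0) (w : Sp N × ℝ) {y : Sp N × ℝ}
    (hy : 1 < ‖y‖) : dd w φ y = 0 := by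
  have e : φ =ᶠ[𝓝 y] fun _ => 0 := by
    filter_upwards [(isOpen_lt continuous_const continuous_norm).mem_nhds hy] with q hq using h q hq
  rw [dd, e.fderiv_eq]
  simp

theorem setIntegral_prod_time {S : Set (Sp N)} {a b : ℝ} (hab : a ≤ b) {F : Sp N × ℝ → ℝ}
    (hF : IntegrableOn F (S ×ˢ Icc a b)) :
    ∫ z in S ×ˢ Icc a b, F z = ∫ t in a..b, ∫ x in S, F (x, t) := by
  rw [IntegrableOn, Measure.volume_eq_prod, ← Measure.prod_restrict] at hF
  rw [Measure.volume_eq_prod, ← Measure.prod_restrict, integral_prod_symm _ hF,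
    intervalIntegral.integral_of_le hab, integral_Icc_eq_integral_Ioc]

/-- The extension of a function by truncating the space variable and clamping time. -/
noncomputable def clampExt (R : ℝ) (u : Sp N → ℝ → ℝ) (z : Sp N × ℝ) : ℝ :=
  (closedBall (0 : Sp N) R).indicator (fun x => u x (max (-R) (min z.2 R))) z.1

theorem clamp_mem {R : ℝ} (hR : 0 ≤ R) (t : ℝ) : max (-R) (min t R) ∈ Icc (-R) R :=
  ⟨le_max_left _ _, max_le (by linarith) (min_le_right _ _)⟩

theorem clampExt_of_mem {R : ℝ} {u : Sp N → ℝ → ℝ} {x : Sp N} {t : ℝ} (hx : x ∈ closedBall (0 : Sp N) R)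
    (ht : t ∈ Icc (-R) R) : clampExt R u (x, t) = u x t := by
  simp only [clampExt, indicator_of_mem hx]
  rw [min_eq_left ht.2, max_eq_right ht.1]

theorem measurable_clampExt {R : ℝ} (hR : 0 ≤ R) {u : Sp N → ℝ → ℝ}
    (hx : ∀ t ∈ Icc (-R) R, ContinuousOn (fun x => u x t) (closedBall 0 R))
    (ht : ∀ x ∈ closedBall (0 : Sp N) R, ContinuousOn (u x) (Icc (-R) R)) :
    Measurable (clampExt R u) := by
  have hcl : Continuous fun t : ℝ => max (-R) (min t R) := by fun_prop
  have h1 : ∀ x, Continuous fun t => clampExt R u (x, t) := fun x => by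
    by_cases h : x ∈ closedBall (0 : Sp N) R
    · have e : (fun t => clampExt R u (x, t)) = fun t => u x (max (-R) (min t R)) := by
        ext t; simp only [clampExt, indicator_of_mem h]
      rw [e]
      exact (ht x h).comp_continuous hcl fun t => clamp_mem hR t
    · have e : (fun t => clampExt R u (x, t)) = fun t => 0 := by
        ext t; simp only [clampExt, indicator_of_notMem h]
      rw [e]
      exact continuous_const
  have h2 : ∀ t, Measurable fun x => clampExt R u (x, t) := fun t => by
    classical
    have h := (hx _ (clamp_mem hR t)).measurable_piecewise
      (continuousOn_const (c := (0 : ℝ))) measurableSet_closedBall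
    rw [show (fun _ : Sp N => (0 : ℝ)) = 0 from rfl, piecewise_eq_indicator] at h
    exact h
  have h3 := measurable_uncurry_of_continuous_of_measurable
    (u := fun (t : ℝ) (x : Sp N) => clampExt R u (x, t)) h1 h2
  have e : clampExt R u =
      (Function.uncurry fun (t : ℝ) (x : Sp N) => clampExt R u (x, t)) ∘ Prod.swap := by
    ext z
    rfl
  rw [e]
  exact h3.comp measurable_swap

theorem Sol.weakSol (hr : 0 < r) {R A : ℝ} (hR : 0 ≤ R) (hA : 0 ≤ A) {u : Fin m → Sp N → ℝ → ℝ}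
    (h : Sol r β (ball 0 (R + 3)) (Ioo (-(R + 3)) (R + 3)) u)
    (hu : ∀ i, ∀ x ∈ ball (0 : Sp N) (R + 3), ∀ t ∈ Ioo (-(R + 3)) (R + 3), u i x t ≤ A) :
    WeakSol r β A R fun i => clampExt (R + 2) (u i) := by
  have hR2 : 0 ≤ R + 2 := by linarith
  have hsub : closedBall (0 : Sp N) (R + 2) ⊆ ball 0 (R + 3) := closedBall_subset_ball (by linarith)
  have hIcc : Icc (-(R + 2)) (R + 2) ⊆ Ioo (-(R + 3)) (R + 3) := fun t ht =>
    ⟨by linarith [ht.1], by linarith [ht.2]⟩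
  have hmeas : ∀ k, Measurable (clampExt (R + 2) (u k)) := fun k => measurable_clampExt hR2
    (fun t ht => ((h.space k t (hIcc ht)).continuousOn).mono hsub)
    (fun x hx => ((h.time k x (hsub hx)).continuousOn).mono hIcc)
  have h0 : ∀ k z, 0 ≤ clampExt (R + 2) (u k) z := fun k z =>
    indicator_nonneg (fun x hx => h.nonneg k x (hsub hx) _ (hIcc (clamp_mem hR2 _))) _
  have hle : ∀ k z, clampExt (R + 2) (u k) z ≤ A := fun k z => by
    by_cases hz : z.1 ∈ closedBall (0 : Sp N) (R + 2)
    · simp only [clampExt, indicator_of_mem hz]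
      exact hu k _ (hsub hz) _ (hIcc (clamp_mem hR2 _))
    · simpa only [clampExt, indicator_of_notMem hz] using hA
  refine ⟨hmeas, h0, hle, fun k z hz φ hφ hφ0 hφ1 => ?_⟩
  set S := closedBall (0 : Sp N) (R + 2) with hS
  set f : Fin m → Sp N × ℝ → ℝ := fun k z => src r β (fun j => clampExt (R + 2) (u j) z) k with hf
  set D : Sp N × ℝ → ℝ := fun y => dd (timeDir N) φ y -
    ∑ i, dd (spaceDir N i) (dd (spaceDir N i) φ) y with hD
  set F : Sp N × ℝ → ℝ := fun y => clampExt (R + 2) (u k) y * D (z - y) - f k y * φ (z - y) with hF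
  have hfm : Measurable (f k) :=
    (continuous_src hr β k).measurable.comp (measurable_pi_lambda _ hmeas)
  have hD0 : ∀ y, 1 < ‖y‖ → D y = 0 := fun y hy => by
    have h1 := dd_eq_zero_of_far (fun y hy => hφ1 y hy.le)
    simp only [hD, h1 _ hy, dd_eq_zero_of_far (fun y hy => h1 _ hy) _ hy, Finset.sum_const_zero,
      sub_zero]
  have hDc : Continuous D := (contDiff_dd _ hφ).continuous.sub
    (continuous_finsetSum _ fun i _ => (contDiff_dd _ (contDiff_dd _ hφ)).continuous)
  have hint : ∀ (g G : Sp N × ℝ → ℝ) (K : ℝ), Continuous G → (∀ y, 1 < ‖y‖ → G y = 0) →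
      Measurable g → (∀ y, |g y| ≤ K) → Integrable fun y => g y * G (z - y) :=
    fun g G K hG hG0 hg hK => by
      have hc : HasCompactSupport G := HasCompactSupport.intro (isCompact_closedBall 0 1)
        fun y hy => hG0 y (by simpa using hy)
      refine ((hG.integrable_of_hasCompactSupport hc).comp_sub_left z).bdd_mul (c := K)
        hg.aestronglyMeasurable (Filter.Eventually.of_forall hK)
  have hi1 := hint _ D A hDc hD0 (hmeas k) fun y => by
    rw [abs_of_nonneg (h0 k y)]; exact hle k y
  have hi2 := hint _ φ _ hφ.continuous (fun y hy => hφ1 y hy.le) hfm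
    fun y => abs_src_le hr (fun j => h0 j y) (fun j => hle j y) k
  have hFi : Integrable F := hi1.sub hi2
  have hfar : ∀ y ∉ S ×ˢ Icc (-(R + 2)) (R + 2), 1 < ‖z - y‖ := fun y hy => by
    by_contra! hc
    rw [mem_closedBall, dist_zero_right] at hz
    have h1 : ‖y‖ ≤ R + 2 := by
      calc ‖y‖ = ‖z - (z - y)‖ := by rw [sub_sub_cancel]
        _ ≤ ‖z‖ + ‖z - y‖ := norm_sub_le _ _
        _ ≤ _ := by linarith
    rw [Prod.norm_def, max_le_iff, norm_eq_abs, abs_le] at h1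
    exact hy ⟨by simpa [hS] using h1.1, h1.2⟩
  have hsp : ∫ y, F y = ∫ t in (-(R + 2))..(R + 2), ∫ x in S, F (x, t) := by
    rw [← setIntegral_prod_time (by linarith) hFi.integrableOn]
    refine (setIntegral_eq_integral_of_forall_compl_eq_zero fun y hy => ?_).symm
    have := hfar y hy
    simp only [hF, hD0 _ this, hφ1 _ this.le, mul_zero, sub_zero]
  have hφ2 : ContDiff ℝ 2 φ := by exact_mod_cast contDiff_infty.1 hφ 2
  have hψs : ContDiff ℝ 2 fun y => φ (z - y) :=
    hφ2.comp (contDiff_const.sub contDiff_id)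
  have hz' := hz
  rw [mem_closedBall, dist_zero_right, Prod.norm_def, max_le_iff, norm_eq_abs, abs_le] at hz'
  have hend : ∀ x, φ (z - (x, R + 2)) = 0 ∧ φ (z - (x, -(R + 2))) = 0 := fun x => by
    constructor <;>
    · refine hφ1 _ (le_trans ?_ (norm_snd_le _))
      rw [norm_eq_abs, Prod.snd_sub, le_abs]
      first
      | left; linarith [hz'.2.1, hz'.2.2]
      | right; linarith [hz'.2.1, hz'.2.2]
  have hsgn : ∀ e : ℝ, e * ∫ y, F y ≥ 0 := fun e => by
    have hs := h.superSol hr isOpen_ball isOpen_Ioo hIcc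
      (fun i x hx t ht => hu i x hx t (hIcc ht)) (Pi.single k e)
    simp only [Pi.single_apply, ite_mul, zero_mul, Finset.sum_ite_eq', Finset.mem_univ, if_true] at hs
    have hw := hs.weak isOpen_ball (by linarith) (isCompact_closedBall _ _) hsub
      (ψ := fun y => φ (z - y)) (fun x t _ => hψs.contDiffAt) (fun y t _ => hφ0 _) (fun x hx t ht =>
        hφ1 _ (hfar (x, t) fun hc => hx hc.1).le)
    simp only [(hend _).1, (hend _).2, mul_zero, integral_zero, sub_zero] at hw
    rw [hsp]
    have e1 : ∫ t in (-(R + 2))..(R + 2), ∫ x in closedBall (0 : Sp N) (R + 2),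
        (e * u k x t * heatAdj (fun y => φ (z - y)) x t +
          e * src r β (fun j => u j x t) k * φ (z - (x, t))) =
        ∫ t in (-(R + 2))..(R + 2), ∫ x in S, -e * F (x, t) := by
      refine intervalIntegral.integral_congr fun t ht => ?_
      rw [uIcc_of_le (by linarith)] at ht
      refine setIntegral_congr_fun measurableSet_closedBall fun x hx => ?_
      simp only [hF, hf, hD, clampExt_of_mem hx ht, heatAdj_const_sub hφ]
      ring
    rw [e1] at hw
    simp only [integral_const_mul, intervalIntegral.integral_const_mul] at hw
    linarith
  have hz0 : ∫ y, F y = 0 := le_antisymm (by linarith [hsgn (-1)]) (by linarith [hsgn 1])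
  have hsplit : ∫ y, F y = _ := integral_sub hi1 hi2
  rw [hz0] at hsplit
  exact (sub_eq_zero.1 hsplit.symm)

end WeakSolutions

section Liouville

variable {N m : ℕ} {r : ℝ} {β : Fin m → Fin m → ℝ}

theorem le_add_rpow_sq {a θ q : ℝ} (ha : 0 ≤ a) (hθ : 0 < θ) (hq : 1 ≤ q) :
    a ≤ θ + θ ^ (1 - 2 * q) * (a ^ q) ^ 2 := by
  rcases le_total a θ with h | h
  · exact h.trans (le_add_of_nonneg_right (by positivity))
  · have ha' : 0 < a := hθ.trans_le h
    have e : a = a ^ (1 - 2 * q) * (a ^ q) ^ 2 := by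
      rw [← rpow_natCast, ← rpow_mul ha, ← rpow_add ha']
      push_cast
      rw [show 1 - 2 * q + q * 2 = 1 by ring, rpow_one]
    calc a = a ^ (1 - 2 * q) * (a ^ q) ^ 2 := e
      _ ≤ θ ^ (1 - 2 * q) * (a ^ q) ^ 2 := mul_le_mul_of_nonneg_right
          (rpow_le_rpow_of_nonpos hθ h (by linarith)) (by positivity)
      _ ≤ _ := le_add_of_nonneg_left hθ.le

/-- Solutions bounded by `A` on a large cylinder are small at its centre. -/
def BoundedLiouville (N m : ℕ) (r : ℝ) (β : Fin m → Fin m → ℝ) : Prop :=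
  ∀ A, 0 < A → ∃ L, 1 ≤ L ∧ ∀ u : Fin m → Sp N → ℝ → ℝ, Sol r β (ball 0 L) (Ioo (-L) L) u →
    (∀ i, ∀ x ∈ ball (0 : Sp N) L, ∀ t ∈ Ioo (-L) L, u i x t ≤ A) → ∑ i, u i 0 0 < 1

theorem boundedLiouville (hN : 1 ≤ N) (hr : 0 < r) (hsym : ∀ i j, β i j = β j i)
    (hoff : ∀ i j, i ≠ j → 0 ≤ β i j) (hdiag : ∀ i, 0 < β i i)
    (hpB : N ≤ 2 ∨ (3 ≤ N ∧ 2 * r + 1 < ((N : ℝ) * (N + 2)) / ((N : ℝ) - 1) ^ 2)) :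
    BoundedLiouville N m r β := by
  intro A hA
  obtain ⟨C₀, hC₀, hmv⟩ := exists_meanValue N ((∑ i, ∑ j, |β i j|) * (A ^ r * A ^ r))
  set Q : Set (Sp N × ℝ) := closedBall (0 : Sp N) 1 ×ˢ Icc (-1 : ℝ) 0 with hQ
  have hQc : IsCompact Q := (isCompact_closedBall _ _).prod isCompact_Icc
  set V := volume.real Q with hV
  have hV0 : 0 ≤ V := measureReal_nonneg
  set θ : ℝ := 1 / (4 * (C₀ * (m * V) + 1)) with hθ
  have hθ0 : 0 < θ := by positivity
  set q := 2 * r + 1 with hq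
  set ε : ℝ := 1 / (4 * (C₀ * θ ^ (1 - 2 * q) + 1)) with hε
  have hε0 : 0 < ε := by positivity
  obtain ⟨R, C, hR, hC, hE⟩ := smallEnergy (m := m) hN hr hsym hoff hdiag hpB (A + 1) ε
    (by linarith) hε0
  refine ⟨R + 3, by linarith, fun u hu huA => ?_⟩
  have hweak := hu.weakSol hr (by linarith) hA.le huA
  have hen := hweak.energy_le hr hA hE
  have hsub : Icc (-1 : ℝ) 0 ⊆ Ioo (-(R + 3)) (R + 3) := fun t ht =>
    ⟨by linarith [ht.1], by linarith [ht.2]⟩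
  obtain ⟨s', M, K, hs⟩ := hu.superSol_neg_sum hr isOpen_ball isOpen_Ioo hsub
    fun i x hx t ht => huA i x hx t (hsub ht)
  have h1 := hmv (ball 0 (R + 3)) (fun x t => ∑ i, u i x t) s' M K isOpen_ball
    (closedBall_subset_ball (by linarith)) hs
    fun x hx t ht => Finset.sum_nonneg fun i _ => hu.nonneg i x hx t (hsub ht)
  set w : Fin m → Sp N × ℝ → ℝ := fun i => clampExt (R + 2) (u i) with hw
  have hwi : ∀ i, Integrable (w i) (volume.restrict Q) := fun i =>
    Measure.integrableOn_of_bounded (M := A) hQc.measure_lt_top.ne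
      (hweak.meas i).aestronglyMeasurable (Filter.Eventually.of_forall fun z => by
        rw [norm_eq_abs, abs_of_nonneg (hweak.nonneg i z)]; exact hweak.le i z)
  have hei : ∀ S : Set (Sp N × ℝ), IsCompact S →
      IntegrableOn (fun z => ∑ i, (w i z ^ q) ^ 2) S := fun S hS => by
    refine Measure.integrableOn_of_bounded (M := ∑ _i : Fin m, (A ^ q) ^ 2) hS.measure_lt_top.ne
      (Finset.measurable_fun_sum _ fun i _ =>
        ((hweak.meas i).pow_const q).pow_const 2).aestronglyMeasurable
      (Filter.Eventually.of_forall fun z => ?_)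
    rw [norm_eq_abs, abs_of_nonneg (Finset.sum_nonneg fun i _ => sq_nonneg _)]
    exact Finset.sum_le_sum fun i _ => pow_le_pow_left₀ (rpow_nonneg (hweak.nonneg i z) _)
      (rpow_le_rpow (hweak.nonneg i z) (hweak.le i z) (by linarith)) 2
  have h2 : ∫ t in (-1 : ℝ)..0, ∫ x in closedBall (0 : Sp N) 1, ∑ i, u i x t =
      ∫ z in Q, ∑ i, w i z := by
    rw [setIntegral_prod_time (by norm_num) (integrable_finsetSum _ fun i _ => hwi i)]
    refine intervalIntegral.integral_congr fun t ht => ?_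
    rw [uIcc_of_le (by norm_num)] at ht
    refine setIntegral_congr_fun measurableSet_closedBall fun x hx => ?_
    refine Finset.sum_congr rfl fun i _ => ?_
    exact (clampExt_of_mem (closedBall_subset_closedBall (by linarith) hx)
      ⟨by linarith [ht.1], by linarith [ht.2]⟩).symm
  have hQs : Q ⊆ closedBall (0 : Sp N × ℝ) 1 := fun z hz => by
    have h1 : ‖z.1‖ ≤ 1 := by simpa using hz.1
    rw [mem_closedBall, dist_zero_right, Prod.norm_def, max_le_iff, norm_eq_abs, abs_le]
    exact ⟨h1, hz.2.1, hz.2.2.trans zero_le_one⟩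
  have h3 : ∫ z in Q, ∑ i, w i z ≤ ∫ z in Q, (m * θ + θ ^ (1 - 2 * q) * ∑ i, (w i z ^ q) ^ 2) := by
    refine setIntegral_mono_on (integrable_finsetSum _ fun i _ => hwi i)
      ((continuousOn_const.integrableOn_compact hQc).add ((hei Q hQc).const_mul _))
      hQc.measurableSet fun z _ => ?_
    have e : (m : ℝ) * θ = ∑ _i : Fin m, θ := by simp
    rw [e, Finset.mul_sum, ← Finset.sum_add_distrib]
    exact Finset.sum_le_sum fun i _ => le_add_rpow_sq (hweak.nonneg i z) hθ0 (by linarith)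
  have h4 : ∫ z in Q, (m * θ + θ ^ (1 - 2 * q) * ∑ i, (w i z ^ q) ^ 2) =
      (∫ z in Q, (m * θ : ℝ)) + θ ^ (1 - 2 * q) * ∫ z in Q, ∑ i, (w i z ^ q) ^ 2 := by
    rw [← integral_const_mul]
    exact integral_add (f := fun _ => (m * θ : ℝ))
      (continuousOn_const.integrableOn_compact hQc) ((hei Q hQc).const_mul _)
  have h5 : ∫ z in Q, ∑ i, (w i z ^ q) ^ 2 ≤ ε := by
    refine le_trans (setIntegral_mono_set (hei _ (isCompact_closedBall 0 1)) ?_ ?_) hen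
    · exact Filter.Eventually.of_forall fun z => Finset.sum_nonneg fun i _ => sq_nonneg _
    · exact Filter.Eventually.of_forall hQs
  rw [h4, setIntegral_const, smul_eq_mul] at h3
  have hθ1 : 0 ≤ θ ^ (1 - 2 * q) := by positivity
  have h6 : C₀ * (V * (m * θ)) ≤ 1 / 4 := by
    have : C₀ * (V * (m * θ)) = (C₀ * (m * V)) * θ := by ring
    rw [this, hθ, mul_one_div, div_le_div_iff₀ (by positivity) (by norm_num)]
    linarith
  have h7 : C₀ * (θ ^ (1 - 2 * q) * ε) ≤ 1 / 4 := by
    rw [← mul_assoc, hε, mul_one_div, div_le_div_iff₀ (by positivity) (by norm_num)]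
    linarith
  have h8 : C₀ * ∫ z in Q, ∑ i, w i z ≤ C₀ * (V * (m * θ) + θ ^ (1 - 2 * q) * ε) :=
    mul_le_mul_of_nonneg_left (h3.trans (add_le_add_right
      (mul_le_mul_of_nonneg_left h5 hθ1) _)) hC₀.le
  rw [h2] at h1
  calc ∑ i, u i 0 0 ≤ _ := h1
    _ ≤ _ := h8
    _ < 1 := by rw [mul_add]; linarith

end Liouville

section UnitScale

variable {N m : ℕ} {r : ℝ} {β : Fin m → Fin m → ℝ}

theorem exists_almost_max {X : Type*} {D : Set X} {f : X → ℝ} {B : ℝ} (hB : ∀ x ∈ D, f x ≤ B)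
    {x₁ : X} (hx₁ : x₁ ∈ D) (hf : 0 < f x₁) :
    ∃ x₀ ∈ D, f x₁ ≤ f x₀ ∧ ∀ x ∈ D, f x ≤ 2 * f x₀ := by
  have hbdd : BddAbove (f '' D) := ⟨B, by rintro _ ⟨x, hx, rfl⟩; exact hB x hx⟩
  have hle : ∀ x ∈ D, f x ≤ sSup (f '' D) := fun x hx => le_csSup hbdd ⟨x, hx, rfl⟩
  by_cases h : sSup (f '' D) / 2 < f x₁
  · exact ⟨x₁, hx₁, le_rfl, fun x hx => by linarith [hle x hx]⟩
  · have hpos : 0 < sSup (f '' D) := hf.trans_le (hle x₁ hx₁)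
    obtain ⟨_, ⟨x₀, hx₀, rfl⟩, h0⟩ :=
      exists_lt_of_lt_csSup (s := f '' D) (b := sSup (f '' D) / 2) ⟨f x₁, x₁, hx₁, rfl⟩
        (by linarith)
    exact ⟨x₀, hx₀, by linarith, fun x hx => by linarith [hle x hx]⟩

theorem sqrt_abs_le {t s d : ℝ} (hd : 0 ≤ d) (h : |t - s| ≤ d ^ 2) : √|t| ≤ √|s| + d := by
  rw [sqrt_le_iff]
  refine ⟨by positivity, ?_⟩
  have h1 : |t| ≤ |s| + d ^ 2 := by
    have := abs_add_le s (t - s)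
    rw [add_sub_cancel] at this
    linarith
  have h2 := sq_sqrt (abs_nonneg s)
  nlinarith [mul_nonneg (sqrt_nonneg |s|) hd]

theorem exists_bound_of_bounded (hr : 0 < r) (hL : BoundedLiouville N m r β) :
    ∃ C, 0 < C ∧ ∀ (u : Fin m → Sp N → ℝ → ℝ) (M : ℝ), Sol r β (ball 0 1) (Ioo (-1) 1) u →
      (∀ i, ∀ x ∈ ball (0 : Sp N) 1, ∀ t ∈ Ioo (-1 : ℝ) 1, u i x t ≤ M) → ∑ i, u i 0 0 ≤ C := by
  obtain ⟨L, hL1, hL⟩ := hL (4 ^ (1 / r)) (by positivity)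
  refine ⟨(2 * L) ^ (1 / r), by positivity, fun u M hu hM => ?_⟩
  by_contra! hlt
  set D : Set (Sp N × ℝ) := ball 0 1 ×ˢ Ioo (-1) 1 with hD
  set s : Sp N × ℝ → ℝ := fun z => ∑ i, u i z.1 z.2 with hs
  have hs0 : ∀ z ∈ D, 0 ≤ s z := fun z hz =>
    Finset.sum_nonneg fun i _ => hu.nonneg i _ hz.1 _ hz.2
  have hsM : ∀ z ∈ D, s z ≤ ∑ _i : Fin m, M := fun z hz =>
    Finset.sum_le_sum fun i _ => hM i _ hz.1 _ hz.2
  set d : Sp N × ℝ → ℝ := fun z => min (1 - ‖z.1‖) (1 - √|z.2|) with hd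
  have hd0 : ∀ z ∈ D, 0 < d z := fun z hz => by
    have h1 : ‖z.1‖ < 1 := by simpa using hz.1
    have h2 : |z.2| < 1 := abs_lt.2 hz.2
    have h3 : √|z.2| < 1 := by rw [sqrt_lt' one_pos]; simpa using h2
    exact lt_min (by linarith) (by linarith)
  have hd1 : ∀ z, d z ≤ 1 := fun z => (min_le_left _ _).trans (by linarith [norm_nonneg z.1])
  have hdD : ∀ z, 0 < d z → z ∈ D := fun z hz => by
    obtain ⟨h1, h2⟩ := lt_min_iff.1 hz
    refine ⟨by simpa using h1, abs_lt.1 ?_⟩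
    have h3 : √|z.2| < 1 := by linarith
    rw [sqrt_lt' one_pos] at h3
    simpa using h3
  have h00 : (0 : Sp N × ℝ) ∈ D := ⟨by simp, by simp⟩
  have hlt' : 2 * L < s 0 ^ r := by
    have := rpow_lt_rpow (by positivity) hlt hr
    rwa [← rpow_mul (by positivity), one_div_mul_cancel hr.ne', rpow_one] at this
  have hd00 : d 0 = 1 := by simp [hd]
  obtain ⟨⟨x₀, t₀⟩, hz₀, h1, h2⟩ := exists_almost_max (D := D) (f := fun z => s z ^ r * d z)
    (B := (∑ _i : Fin m, M) ^ r) (fun z hz => by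
      have h3 := rpow_le_rpow (hs0 z hz) (hsM z hz) hr.le
      calc s z ^ r * d z ≤ s z ^ r * 1 :=
            mul_le_mul_of_nonneg_left (hd1 z) (rpow_nonneg (hs0 z hz) _)
        _ ≤ _ := by rwa [mul_one]) h00 (by rw [hd00, mul_one]; linarith)
  simp only [hd00, mul_one] at h1
  set z₀ : Sp N × ℝ := (x₀, t₀) with hz₀'
  have hdz := hd0 z₀ hz₀
  have hsz : 0 < s z₀ := by
    rcases (hs0 z₀ hz₀).eq_or_lt with h | h
    · rw [← h, zero_rpow hr.ne', zero_mul] at h1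
      linarith
    · exact h
  have hszr : 0 < s z₀ ^ r := rpow_pos_of_pos hsz _
  set c : ℝ := (s z₀ ^ r)⁻¹ with hc
  have hc0 : 0 < c := inv_pos.2 hszr
  have hcL : c * L < d z₀ / 2 := by
    rw [hc, inv_mul_lt_iff₀ hszr]
    linarith
  have hcr : c ^ (1 / r) = (s z₀)⁻¹ := by
    rw [hc, inv_rpow hszr.le, ← rpow_mul hsz.le, mul_one_div_cancel hr.ne', rpow_one]
  have hnear : ∀ x ∈ ball (0 : Sp N) L, ∀ t ∈ Ioo (-L) L,
      d z₀ / 2 ≤ d (x₀ + c • x, t₀ + c ^ 2 * t) := fun x hx t ht => by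
    rw [mem_ball, dist_zero_right] at hx
    obtain ⟨h3, h4⟩ := le_min_iff.1 (le_refl (d z₀))
    refine le_min ?_ ?_
    · have h5 : ‖x₀ + c • x‖ ≤ ‖x₀‖ + c * ‖x‖ := (norm_add_le _ _).trans (by
        rw [norm_smul, norm_eq_abs, abs_of_pos hc0])
      have h6 : c * ‖x‖ ≤ c * L := mul_le_mul_of_nonneg_left hx.le hc0.le
      change d z₀ ≤ 1 - ‖x₀‖ at h3
      change _ ≤ 1 - ‖x₀ + c • x‖
      linarith
    · have h5 : √|t₀ + c ^ 2 * t| ≤ √|t₀| + c * L := by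
        refine sqrt_abs_le (by positivity) ?_
        rw [add_sub_cancel_left, abs_mul, abs_of_nonneg (sq_nonneg c), mul_pow]
        refine mul_le_mul_of_nonneg_left ?_ (sq_nonneg c)
        nlinarith [abs_lt.2 ht]
      change d z₀ ≤ 1 - √|t₀| at h4
      change _ ≤ 1 - √|t₀ + c ^ 2 * t|
      linarith
  have hmem : ∀ x ∈ ball (0 : Sp N) L, ∀ t ∈ Ioo (-L) L, (x₀ + c • x, t₀ + c ^ 2 * t) ∈ D :=
    fun x hx t ht => hdD _ ((half_pos hdz).trans_le (hnear x hx t ht))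
  have hL0 : (0 : ℝ) ∈ Ioo (-L) L := ⟨by linarith, by linarith⟩
  have hL0' : (0 : Sp N) ∈ ball (0 : Sp N) L := mem_ball_self (by linarith)
  have hv := hu.rescale hr isOpen_ball hc0 x₀ t₀ (V := ball 0 L) (J := Ioo (-L) L)
    (fun x hx => (hmem x hx 0 hL0).1) (fun t ht => (hmem 0 hL0' t ht).2)
  have hfin := hL _ hv fun i x hx t ht => by
    have hz := hmem x hx t ht
    set z : Sp N × ℝ := (x₀ + c • x, t₀ + c ^ 2 * t) with hzdef
    have h3 : u i (x₀ + c • x) (t₀ + c ^ 2 * t) ≤ s z :=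
      Finset.single_le_sum (f := fun i => u i z.1 z.2)
        (fun j _ => hu.nonneg j _ hz.1 _ hz.2) (Finset.mem_univ i)
    have h4 : s z ^ r ≤ 4 * s z₀ ^ r := by
      have h5 := h2 z hz
      have h6 : s z ^ r * (d z₀ / 2) ≤ s z ^ r * d z :=
        mul_le_mul_of_nonneg_left (hnear x hx t ht) (rpow_nonneg (hs0 z hz) _)
      have h7 : s z ^ r * d z₀ ≤ 4 * s z₀ ^ r * d z₀ := by linarith
      exact le_of_mul_le_mul_right h7 hdz
    have h5 : s z ≤ 4 ^ (1 / r) * s z₀ := by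
      have h6 := rpow_le_rpow (rpow_nonneg (hs0 z hz) _) h4 (one_div_pos.2 hr).le
      rwa [mul_rpow (by norm_num) hszr.le, ← rpow_mul (hs0 z hz), ← rpow_mul hsz.le,
        mul_one_div_cancel hr.ne', rpow_one, rpow_one] at h6
    rw [hcr, inv_mul_le_iff₀ hsz]
    linarith
  simp only [smul_zero, mul_zero, add_zero, ← Finset.mul_sum] at hfin
  rw [hcr] at hfin
  change (s z₀)⁻¹ * s z₀ < 1 at hfin
  rw [inv_mul_cancel₀ hsz.ne'] at hfin
  exact lt_irrefl _ hfin

end UnitScale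

section LocallyBounded

variable {N m : ℕ} {r : ℝ} {β : Fin m → Fin m → ℝ}

/-- Local boundedness of a system of functions at a point of space-time. -/
def LocBdd (u : Fin m → Sp N → ℝ → ℝ) (z : Sp N × ℝ) : Prop :=
  ∃ M, ∀ᶠ y in 𝓝 z, ∀ i, u i y.1 y.2 ≤ M

theorem isOpen_setOf_locBdd (u : Fin m → Sp N → ℝ → ℝ) : IsOpen {z | LocBdd u z} := by
  rw [isOpen_iff_mem_nhds]
  rintro z ⟨M, hM⟩
  filter_upwards [hM.eventually_nhds] with y hy using ⟨M, hy⟩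

theorem exists_bound_of_locBdd {u : Fin m → Sp N → ℝ → ℝ} {K : Set (Sp N × ℝ)} (hK : IsCompact K)
    (h : ∀ z ∈ K, LocBdd u z) : ∃ M, ∀ z ∈ K, ∀ i, u i z.1 z.2 ≤ M := by
  refine hK.induction_on (p := fun s => ∃ M, ∀ z ∈ s, ∀ i, u i z.1 z.2 ≤ M) ⟨0, by simp⟩
    (fun s t hst ⟨M, hM⟩ => ⟨M, fun z hz => hM z (hst hz)⟩) ?_ fun z hz => ?_
  · rintro s t ⟨M, hM⟩ ⟨M', hM'⟩
    refine ⟨max M M', fun z hz i => ?_⟩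
    rcases hz with hz | hz
    · exact (hM z hz i).trans (le_max_left _ _)
    · exact (hM' z hz i).trans (le_max_right _ _)
  · obtain ⟨M, hM⟩ := h z hz
    exact ⟨_, mem_nhdsWithin_of_mem_nhds hM, M, fun y hy => hy⟩

theorem locBdd_comp_affine {u : Fin m → Sp N → ℝ → ℝ} {a x : Sp N} {b c t k : ℝ} (hk : 0 ≤ k)
    (h : LocBdd u (a + c • x, b + c ^ 2 * t)) :
    LocBdd (fun i x t => k * u i (a + c • x) (b + c ^ 2 * t)) (x, t) := by
  obtain ⟨M, hM⟩ := h
  have hc : Continuous fun z : Sp N × ℝ => (a + c • z.1, b + c ^ 2 * z.2) := by fun_prop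
  refine ⟨k * M, ?_⟩
  filter_upwards [hc.continuousAt.eventually hM] with y hy i
  exact mul_le_mul_of_nonneg_left (hy i) hk

theorem add_smul_mem_ball {a x : Sp N} {c ρ : ℝ} (hc : 0 < c) (hx : x ∈ ball (0 : Sp N) ρ) :
    a + c • x ∈ ball a (c * ρ) := by
  rw [mem_ball, dist_self_add_left, norm_smul, norm_eq_abs, abs_of_pos hc]
  exact mul_lt_mul_of_pos_left (by simpa using hx) hc

theorem exists_scaled_bound (hr : 0 < r) (hL : BoundedLiouville N m r β) :
    ∃ C, 0 < C ∧ ∀ (u : Fin m → Sp N → ℝ → ℝ) (a : Sp N) (b ρ : ℝ), 0 < ρ →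
      Sol r β (ball a ρ) (Ioo (b - ρ ^ 2) (b + ρ ^ 2)) u →
      (∀ x ∈ ball a ρ, ∀ t ∈ Ioo (b - ρ ^ 2) (b + ρ ^ 2), LocBdd u (x, t)) →
      ∀ i, u i a b ≤ C * ρ ^ (-(1 / r)) := by
  obtain ⟨C, hC, H⟩ := exists_bound_of_bounded hr hL
  refine ⟨C * (1 / 2) ^ (-(1 / r)), by positivity, fun u a b ρ hρ hu hb i => ?_⟩
  set c : ℝ := 1 / 2 * ρ with hc
  have hc0 : 0 < c := by positivity
  have hcρ : c ^ 2 < ρ ^ 2 := by rw [hc]; nlinarith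
  have hmx : ∀ x ∈ ball (0 : Sp N) 1, a + c • x ∈ ball a ρ := fun x hx =>
    ball_subset_ball (by rw [hc]; linarith) (add_smul_mem_ball hc0 hx)
  have hmt : ∀ t ∈ Ioo (-1 : ℝ) 1, b + c ^ 2 * t ∈ Icc (b - c ^ 2) (b + c ^ 2) := fun t ht => by
    have := sq_nonneg c
    constructor <;> nlinarith [ht.1, ht.2]
  have hsub : Icc (b - c ^ 2) (b + c ^ 2) ⊆ Ioo (b - ρ ^ 2) (b + ρ ^ 2) :=
    Icc_subset_Ioo (by linarith) (by linarith)
  obtain ⟨M, hM⟩ := exists_bound_of_locBdd (u := u)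
    ((isCompact_closedBall a c).prod (isCompact_Icc (a := b - c ^ 2) (b := b + c ^ 2)))
    (fun z hz => hb z.1 (closedBall_subset_ball (by rw [hc]; linarith) hz.1) z.2 (hsub hz.2))
  have hv := hu.rescale hr isOpen_ball hc0 a b hmx fun t ht => hsub (hmt t ht)
  have h1 := H _ (c ^ (1 / r) * M) hv fun i x hx t ht =>
    mul_le_mul_of_nonneg_left (hM (_, _) ⟨ball_subset_closedBall
      (by simpa using add_smul_mem_ball (a := a) hc0 hx), hmt t ht⟩ i) (by positivity)
  have h2 := Finset.single_le_sum (fun j _ => hv.nonneg j 0 (mem_ball_self one_pos) 0 (by simp))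
    (Finset.mem_univ i)
  have h3 := h2.trans h1
  simp only [smul_zero, mul_zero, add_zero] at h3
  rw [← le_div_iff₀' (by positivity)] at h3
  rw [mul_assoc, ← mul_rpow (by norm_num) hρ.le, ← hc, rpow_neg hc0.le, ← div_eq_mul_inv]
  exact h3

end LocallyBounded

section Harnack

variable {N m : ℕ} {r : ℝ} {β : Fin m → Fin m → ℝ}

/-- A bounded concave increasing function which is comparable with the identity on `[0, A]`. -/
noncomputable def sat (A s : ℝ) : ℝ := A * (1 - exp (-s / A))

theorem contDiff_sat (A : ℝ) : ContDiff ℝ 2 (sat A) :=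
  contDiff_const.mul (contDiff_const.sub (contDiff_id.neg.div_const A).exp)

theorem hasDerivAt_sat {A : ℝ} (hA : A ≠ 0) (s : ℝ) : HasDerivAt (sat A) (exp (-s / A)) s := by
  have h := ((((hasDerivAt_id s).neg.div_const A).exp).const_sub 1).const_mul A
  refine h.congr_deriv ?_
  simp only [id, Pi.neg_apply]
  field_simp

theorem deriv_deriv_sat_nonpos {A : ℝ} (hA : 0 < A) (s : ℝ) : deriv (deriv (sat A)) s ≤ 0 := by
  have e : deriv (sat A) = fun s => exp (-s / A) := funext fun s => (hasDerivAt_sat hA.ne' s).deriv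
  have h : HasDerivAt (fun s => exp (-s / A)) (exp (-s / A) * (-1 / A)) s :=
    ((hasDerivAt_id s).neg.div_const A).exp
  rw [e, h.deriv]
  exact mul_nonpos_of_nonneg_of_nonpos (exp_pos _).le
    (div_nonpos_of_nonpos_of_nonneg (by norm_num) hA.le)

theorem sat_nonneg {A s : ℝ} (hA : 0 < A) (hs : 0 ≤ s) : 0 ≤ sat A s := by
  refine mul_nonneg hA.le (sub_nonneg.2 (exp_le_one_iff.2 ?_))
  rw [neg_div, neg_nonpos]
  positivity

theorem sat_le {A : ℝ} (hA : 0 < A) (s : ℝ) : sat A s ≤ A := by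
  have := exp_pos (-s / A)
  unfold sat
  nlinarith

theorem sat_le_self {A : ℝ} (hA : 0 < A) (s : ℝ) : sat A s ≤ s := by
  have h := mul_le_mul_of_nonneg_left (add_one_le_exp (-s / A)) hA.le
  have e : A * (-s / A + 1) = -s + A := by field_simp
  unfold sat
  linarith

theorem half_le_sat {A s : ℝ} (hA : 0 < A) (hs : 0 ≤ s) (hsA : s ≤ A) : s / 2 ≤ sat A s := by
  have h0 : 0 ≤ s / A := by positivity
  have h1 : s / A ≤ 1 := (div_le_one hA).2 hsA
  have h2 : exp (-s / A) ≤ 1 - s / A / 2 := by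
    rw [neg_div, exp_neg, inv_le_comm₀ (exp_pos _) (by linarith)]
    refine le_trans ?_ (add_one_le_exp _)
    rw [inv_le_iff_one_le_mul₀ (by linarith)]
    nlinarith
  have h3 := mul_le_mul_of_nonneg_left h2 hA.le
  have e : A * (1 - s / A / 2) = A - s / 2 := by field_simp
  unfold sat
  linarith

theorem Sol.superSol_sat (hβ : ∀ i j, 0 ≤ β i j) {U : Set (Sp N)} {I : Set ℝ}
    {u : Fin m → Sp N → ℝ → ℝ} (h : Sol r β U I u) (hU : IsOpen U) (hI : IsOpen I) {a b A : ℝ}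
    (hab : Icc a b ⊆ I) (hA : 0 < A) (i : Fin m) :
    SuperSol U a b (fun x t => sat A (u i x t)) (fun x t => exp (-u i x t / A) * deriv (u i x) t)
      (fun _ _ => 0) A 0 := by
  have hder : ∀ x ∈ U, ∀ t ∈ Icc a b, HasDerivAt (fun t => sat A (u i x t))
      (exp (-u i x t / A) * deriv (u i x) t) t := fun x hx t ht =>
    (hasDerivAt_sat hA.ne' (u i x t)).comp t ((((h.time i x hx).contDiffAt
      (hI.mem_nhds (hab ht))).differentiableAt one_ne_zero)).hasDerivAt
  refine ⟨fun t ht => (contDiff_sat A).comp_contDiffOn (h.space i t (hab ht)), hder,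
    fun x hx => ?_, fun x hx t ht => ?_, fun _ _ _ _ => by simp, fun _ _ => continuousOn_const,
    fun _ _ => continuousOn_const, fun x hx t ht => ?_⟩
  · have hc : ContDiffOn ℝ 1 (fun t => sat A (u i x t)) I :=
      ((contDiff_sat A).of_le (by norm_num)).comp_contDiffOn (h.time i x hx)
    obtain ⟨L, hL⟩ := isCompact_Icc.exists_bound_of_continuousOn
      ((hc.continuousOn_deriv_of_isOpen hI le_rfl).mono hab)
    refine ⟨L, fun s hs t ht => ?_⟩
    have := (convex_Icc a b).norm_image_sub_le_of_norm_deriv_le (C := L)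
      (fun y hy => (hder x hx y hy).differentiableAt) hL hs ht
    simpa only [norm_eq_abs] using this
  · rw [abs_of_nonneg (sat_nonneg hA (h.nonneg i x hx t (hab ht)))]
    exact sat_le hA _
  · rw [lap_comp (contDiff_sat A) ((h.space i t (hab ht)).contDiffAt (hU.mem_nhds hx)),
      (hasDerivAt_sat hA.ne' _).deriv]
    have h1 := h.eq i x hx t (hab ht)
    have h2 := src_nonneg (r := r) hβ (fun j => h.nonneg j x hx t (hab ht)) i
    have h3 := mul_nonneg (neg_nonneg.2 (deriv_deriv_sat_nonpos hA (u i x t)))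
      (gradSq_nonneg (fun y => u i y t) x)
    have h4 := mul_nonneg (exp_pos (-u i x t / A)).le (h2.trans h1.ge)
    rw [mul_sub] at h4
    linarith

theorem exists_unit_harnack (hr : 0 < r) (hβ : ∀ i j, 0 ≤ β i j) (hL : BoundedLiouville N m r β) :
    ∃ R C, 3 ≤ R ∧ 0 < C ∧ ∀ (u : Fin m → Sp N → ℝ → ℝ),
      Sol r β (ball 0 R) (Ioo (-4) 4) u →
      (∀ x ∈ ball (0 : Sp N) 3, ∀ t ∈ Ioo (-4 : ℝ) 4, LocBdd u (x, t)) →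
      ∀ y : Sp N, ‖y‖ ≤ 4 → ∀ B, (∀ j, u j y 1 ≤ B) → ∀ i, u i 0 0 ≤ C * B := by
  obtain ⟨A, hA, hbd⟩ := exists_scaled_bound hr hL
  obtain ⟨C₁, hC₁, hmv⟩ := exists_meanValue N ((∑ i, ∑ j, |β i j|) * (A ^ r * A ^ r))
  obtain ⟨R, C₂, hR, hC₂, hwh⟩ := exists_weakHarnack N
  refine ⟨R + 4, C₁ * (m * (2 * C₂)) + 1, by linarith, by positivity, fun u hu hb y hy B hB i => ?_⟩
  have hA' : ∀ i, ∀ x ∈ ball (0 : Sp N) 2, ∀ t ∈ Icc (-1 : ℝ) 0, u i x t ≤ A := by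
    intro i x hx t ht
    have hx2 : ‖x‖ < 2 := by simpa using hx
    have hb3 : ball x 1 ⊆ ball 0 3 := ball_subset_ball' (by rw [dist_zero_right]; linarith)
    have ht4 : Ioo (t - 1 ^ 2) (t + 1 ^ 2) ⊆ Ioo (-4) 4 :=
      Ioo_subset_Ioo (by linarith [ht.1]) (by linarith [ht.2])
    have := hbd u x t 1 one_pos (hu.mono (hb3.trans (ball_subset_ball (by linarith))) ht4)
      (fun x hx t ht => hb x (hb3 hx) t (ht4 ht)) i
    simpa using this
  have h10 : Icc (-1 : ℝ) 0 ⊆ Ioo (-4) 4 := Icc_subset_Ioo (by norm_num) (by norm_num)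
  have h11 : Icc (-1 : ℝ) 1 ⊆ Ioo (-4) 4 := Icc_subset_Ioo (by norm_num) (by norm_num)
  have hu2 : Sol r β (ball 0 2) (Ioo (-4) 4) u :=
    hu.mono (ball_subset_ball (by linarith)) subset_rfl
  have h12 : closedBall (0 : Sp N) 1 ⊆ ball 0 2 := closedBall_subset_ball (by norm_num)
  have hyR : y ∈ ball (0 : Sp N) (R + 4) := by
    rw [mem_ball, dist_zero_right]
    linarith
  have hB0 : 0 ≤ B := (hu.nonneg i y hyR 1 (by norm_num)).trans (hB i)
  obtain ⟨s', M, K, hS⟩ := hu2.superSol_neg_sum hr isOpen_ball isOpen_Ioo h10 hA'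
  have h0 := hmv _ _ _ _ _ isOpen_ball h12 hS fun x hx t ht =>
    Finset.sum_nonneg fun j _ => hu2.nonneg j x hx t (h10 ht)
  have hw : ∀ j, ∀ t ∈ Icc (-1 : ℝ) 0, ∫ x in closedBall 0 1, sat A (u j x t) ≤ C₂ * B :=
    fun j t ht => (hwh _ _ _ _ _ isOpen_ball (closedBall_subset_ball (by linarith))
      (hu.superSol_sat hβ isOpen_ball isOpen_Ioo h11 hA j)
      (fun x hx t ht => sat_nonneg hA (hu.nonneg j x hx t (h11 ht))) y hy t ht).trans
      (mul_le_mul_of_nonneg_left ((sat_le_self hA _).trans (hB j)) hC₂.le)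
  have hint : ∀ t ∈ Icc (-1 : ℝ) 0,
      ∫ x in closedBall 0 1, ∑ j, u j x t ≤ m * (2 * C₂) * B := by
    intro t ht
    have hc : ∀ j, ContinuousOn (fun x => u j x t) (closedBall 0 1) := fun j =>
      (hu2.space j t (h10 ht)).continuousOn.mono h12
    have hi1 : ∀ j, IntegrableOn (fun x => u j x t) (closedBall 0 1) := fun j =>
      (hc j).integrableOn_compact (isCompact_closedBall _ _)
    have hi2 : ∀ j, IntegrableOn (fun x => sat A (u j x t)) (closedBall 0 1) := fun j =>
      ((contDiff_sat A).continuous.comp_continuousOn (hc j)).integrableOn_compact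
        (isCompact_closedBall _ _)
    rw [integral_finsetSum _ fun j _ => hi1 j]
    refine (Finset.sum_le_card_nsmul _ _ (2 * C₂ * B) fun j _ => ?_).trans_eq (by
      rw [Finset.card_univ, Fintype.card_fin, nsmul_eq_mul, mul_assoc, mul_assoc, mul_assoc])
    have h1 : ∫ x in closedBall 0 1, u j x t ≤ ∫ x in closedBall 0 1, 2 * sat A (u j x t) :=
      setIntegral_mono_on (hi1 j) ((hi2 j).const_mul 2) measurableSet_closedBall fun x hx => by
        have := half_le_sat hA (hu2.nonneg j x (h12 hx) t (h10 ht)) (hA' j x (h12 hx) t ht)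
        linarith
    rw [integral_const_mul] at h1
    linarith [hw j t ht]
  have hI : ∫ t in (-1 : ℝ)..0, ∫ x in closedBall 0 1, ∑ j, u j x t ≤ m * (2 * C₂) * B := by
    have h1 := intervalIntegral.norm_integral_le_of_norm_le_const (a := (-1 : ℝ)) (b := 0)
      (f := fun t => ∫ x in closedBall 0 1, ∑ j, u j x t) (C := m * (2 * C₂) * B) fun t ht => by
        have ht' : t ∈ Icc (-1 : ℝ) 0 := by
          rw [uIoc_of_le (by norm_num)] at ht
          exact Ioc_subset_Icc_self ht
        rw [norm_eq_abs, abs_of_nonneg (setIntegral_nonneg measurableSet_closedBall fun x hx =>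
          Finset.sum_nonneg fun j _ => hu2.nonneg j x (h12 hx) t (h10 ht'))]
        exact hint t ht'
    refine (le_abs_self _).trans (h1.trans_eq ?_)
    norm_num
  have h1 := Finset.single_le_sum (f := fun j => u j 0 0) (fun j _ => hu2.nonneg j 0
    (mem_ball_self two_pos) 0 (by norm_num)) (Finset.mem_univ i)
  have h2 := mul_le_mul_of_nonneg_left hI hC₁.le
  have h3 : u i 0 0 ≤ C₁ * (m * (2 * C₂) * B) := h1.trans (h0.trans h2)
  linarith

end Harnack

section LocalBoundedness

variable {N m : ℕ} {r : ℝ} {β : Fin m → Fin m → ℝ}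

theorem Sol.continuousOn_space {U : Set (Sp N)} {I : Set ℝ} {u : Fin m → Sp N → ℝ → ℝ}
    (h : Sol r β U I u) (i : Fin m) {t : ℝ} (ht : t ∈ I) : ContinuousOn (fun x => u i x t) U :=
  (h.space i t ht).continuousOn

/-- By Baire's theorem, a nonempty set of points where the solution is not locally bounded
has a point near which the solution is uniformly bounded on short vertical segments. -/
theorem Sol.exists_uniform_segment {Ω : Set (Sp N)} (hΩ : IsOpen Ω) {a b : ℝ}
    {u : Fin m → Sp N → ℝ → ℝ} (h : Sol r β Ω (Ioo a b) u) {S : Set (Sp N × ℝ)}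
    (hS : IsLocallyClosed S) (hSG : S ⊆ Ω ×ˢ Ioo a b) (hne : S.Nonempty) :
    ∃ z ∈ S, ∃ δ > 0, ∃ n : ℝ, 0 ≤ n ∧ ball z.1 δ ⊆ Ω ∧ Ioo (z.2 - δ) (z.2 + δ) ⊆ Ioo a b ∧
      ∀ y ∈ S, y.1 ∈ ball z.1 δ → y.2 ∈ Ioo (z.2 - δ) (z.2 + δ) →
        ∀ s ∈ Ioo (z.2 - δ) (z.2 + δ), ∀ i, u i y.1 s ≤ n := by
  have := hS.locallyCompactSpace
  have := hne.to_subtype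
  set E : ℕ → Set S := fun n =>
    {z | ∀ i, ∀ s ∈ Ioo a b, |s - z.1.2| < 1 / ((n : ℝ) + 1) → u i z.1.1 s ≤ n} with hE
  have hEc : ∀ n, IsClosed (E n) := by
    intro n
    simp only [hE, ofPred_forall]
    refine isClosed_iInter fun i => isClosed_iInter fun s => isClosed_iInter fun hs => ?_
    refine isClosed_imp (isOpen_lt (by fun_prop) continuous_const) (isClosed_le ?_ continuous_const)
    rw [continuous_iff_continuousAt]
    intro z
    have hz : z.1.1 ∈ Ω := (hSG z.2).1
    exact ((h.continuousOn_space i hs).continuousAt (hΩ.mem_nhds hz)).comp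
      (f := fun z : S => z.1.1) (by fun_prop)
  have hEu : ⋃ n, E n = univ := by
    refine eq_univ_of_forall fun z => ?_
    have hz := hSG z.2
    have hev : ∀ᶠ s in 𝓝 z.1.2, ∀ i, u i z.1.1 s < ∑ j, u j z.1.1 z.1.2 + 1 := by
      rw [Filter.eventually_all]
      intro i
      refine ((h.time i _ hz.1).continuousOn.continuousAt (Ioo_mem_nhds hz.2.1 hz.2.2)).eventually
        (gt_mem_nhds ?_)
      have := Finset.single_le_sum (f := fun j => u j z.1.1 z.1.2)
        (fun j _ => h.nonneg j _ hz.1 _ hz.2) (Finset.mem_univ i)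
      linarith
    obtain ⟨δ, hδ, hb⟩ := Metric.eventually_nhds_iff.1 hev
    obtain ⟨n₁, hn₁⟩ := exists_nat_one_div_lt hδ
    obtain ⟨n₂, hn₂⟩ := exists_nat_ge (∑ j, u j z.1.1 z.1.2 + 1)
    refine mem_iUnion.2 ⟨max n₁ n₂, fun i s _ hs => ?_⟩
    have h1 : (n₁ : ℝ) ≤ (max n₁ n₂ : ℕ) := by exact_mod_cast le_max_left _ _
    have h2 : (n₂ : ℝ) ≤ (max n₁ n₂ : ℕ) := by exact_mod_cast le_max_right _ _
    have h3 : (1 : ℝ) / ((max n₁ n₂ : ℕ) + 1) ≤ 1 / (n₁ + 1) :=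
      one_div_le_one_div_of_le (by positivity) (by linarith)
    exact ((hb (by rw [dist_eq]; linarith) i).le.trans hn₂).trans h2
  obtain ⟨n, ⟨z, hzS⟩, hz⟩ := nonempty_interior_of_iUnion_of_closed hEc hEu
  obtain ⟨ε₁, hε₁, h₁⟩ := Metric.mem_nhds_iff.1 (mem_interior_iff_mem_nhds.1 hz)
  obtain ⟨ε₂, hε₂, h₂⟩ := Metric.mem_nhds_iff.1 ((hΩ.prod isOpen_Ioo).mem_nhds (hSG hzS))
  have hn : (0 : ℝ) < 1 / ((n : ℝ) + 1) := by positivity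
  set δ := min (min ε₁ ε₂) (1 / ((n : ℝ) + 1) / 2) with hδ
  have hδ1 : δ ≤ ε₁ := (min_le_left _ _).trans (min_le_left _ _)
  have hδ2 : δ ≤ ε₂ := (min_le_left _ _).trans (min_le_right _ _)
  have hδ3 : δ ≤ 1 / ((n : ℝ) + 1) / 2 := min_le_right _ _
  have hδ0 : 0 < δ := lt_min (lt_min hε₁ hε₂) (by positivity)
  have hΩδ : ball z.1 δ ⊆ Ω := fun x hx =>
    (h₂ (show (x, z.2) ∈ ball z ε₂ by
      rw [mem_ball, Prod.dist_eq, max_lt_iff]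
      exact ⟨hx.trans_le hδ2, by rwa [dist_self]⟩)).1
  have hIδ : Ioo (z.2 - δ) (z.2 + δ) ⊆ Ioo a b := fun s hs =>
    (h₂ (show (z.1, s) ∈ ball z ε₂ by
      rw [mem_ball, Prod.dist_eq, max_lt_iff, dist_eq s]
      exact ⟨by rwa [dist_self], (abs_lt.2 ⟨by linarith [hs.1], by linarith [hs.2]⟩).trans_le hδ2⟩)).2
  refine ⟨z, hzS, δ, hδ0, n, n.cast_nonneg, hΩδ, hIδ, fun y hyS hy1 hy2 s hs i => ?_⟩
  have hyE : (⟨y, hyS⟩ : S) ∈ E n := h₁ (by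
    rw [mem_ball, Subtype.dist_eq, Prod.dist_eq, max_lt_iff, dist_eq y.2]
    exact ⟨hy1.trans_le hδ1,
      (abs_lt.2 ⟨by linarith [hy2.1], by linarith [hy2.2]⟩).trans_le hδ1⟩)
  exact hyE i s (hIδ hs) (abs_lt.2 ⟨by
    change _ < s - y.2
    linarith [hs.1, hy2.2], by
    change s - y.2 < _
    linarith [hs.2, hy2.1]⟩)

theorem Sol.locBdd (hr : 0 < r) (hβ : ∀ i j, 0 ≤ β i j) (hL : BoundedLiouville N m r β)
    {Ω : Set (Sp N)} (hΩ : IsOpen Ω) {a b : ℝ} {u : Fin m → Sp N → ℝ → ℝ}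
    (h : Sol r β Ω (Ioo a b) u) {z : Sp N × ℝ} (hz : z ∈ Ω ×ˢ Ioo a b) : LocBdd u z := by
  by_contra hnz
  obtain ⟨R, C, hR, hC, H⟩ := exists_unit_harnack hr hβ hL
  set S : Set (Sp N × ℝ) := Ω ×ˢ Ioo a b ∩ {z | LocBdd u z}ᶜ with hS
  obtain ⟨⟨x₀, t₀⟩, hzS, δ, hδ, n, hn, hΩδ, hIδ, hb⟩ := h.exists_uniform_segment hΩ (S := S)
    ((hΩ.prod isOpen_Ioo).isLocallyClosed.inter (isOpen_setOf_locBdd u).isClosed_compl.isLocallyClosed)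
    inter_subset_left ⟨z, hz, hnz⟩
  simp only at hΩδ hIδ hb
  set J := Ioo (t₀ - δ) (t₀ + δ) with hJ
  set X : Set (Sp N) := {x | x ∈ ball x₀ δ ∧ ∃ t ∈ J, (x, t) ∈ S} with hX
  have ht₀ : t₀ ∈ J := ⟨by linarith, by linarith⟩
  have hx₀ : x₀ ∈ X := ⟨mem_ball_self hδ, t₀, ht₀, hzS⟩
  have hXn : ∀ x ∈ X, ∀ s ∈ J, ∀ i, u i x s ≤ n := by
    rintro x ⟨hx, t, ht, hxt⟩ s hs i
    exact hb _ hxt hx ht s hs i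
  have hcl : ∀ x ∈ ball x₀ δ, x ∈ closure X → ∀ s ∈ J, ∀ i, u i x s ≤ n := by
    intro x hx hxX s hs i
    by_contra! hlt
    have hc := ((h.continuousOn_space i (hIδ hs)).continuousAt (hΩ.mem_nhds (hΩδ hx))).eventually
      (lt_mem_nhds hlt)
    obtain ⟨y, hy, hyX⟩ := ((mem_closure_iff_frequently.1 hxX).and_eventually hc).exists
    exact absurd (hXn y hy s hs i) (not_le.2 hyX)
  have hbd : ∀ x ∈ ball x₀ δ, x ∉ X → ∀ s ∈ J, LocBdd u (x, s) := by
    intro x hx hxX s hs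
    by_contra hnb
    exact hxX ⟨hx, s, hs, ⟨hΩδ hx, hIδ hs⟩, hnb⟩
  set η := min 1 (δ / (1 + R)) with hη
  have hη0 : 0 < η := lt_min one_pos (by positivity)
  have hη1 : η ≤ 1 := min_le_left _ _
  have hη2 : η * (1 + R) ≤ δ := (le_div_iff₀ (by linarith)).1 (min_le_right _ _)
  have hηδ : η * 4 ≤ δ := by nlinarith
  refine hzS.2 ⟨max n (C * n), ?_⟩
  filter_upwards [ball_mem_nhds (x₀, t₀) hη0] with w hw i
  obtain ⟨x, t⟩ := w
  rw [mem_ball, Prod.dist_eq, max_lt_iff, dist_eq, abs_lt] at hw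
  obtain ⟨hx, ht1, ht2⟩ := hw
  simp only at hx ht1 ht2 ⊢
  have hxδ : x ∈ ball x₀ δ := by rw [mem_ball]; linarith
  have htJ : t ∈ J := ⟨by linarith, by linarith⟩
  by_cases hxX : x ∈ closure X
  · exact (hcl x hxδ hxX t htJ i).trans (le_max_left _ _)
  refine le_trans ?_ (le_max_right _ _)
  set d := infDist x X with hd
  have hd0 : 0 < d := (infDist_pos_iff_notMem_closure ⟨x₀, hx₀⟩).1 hxX
  have hdη : d < η := (infDist_le_dist_of_mem hx₀).trans_lt hx
  obtain ⟨y, hyX, hy⟩ := (infDist_lt_iff (r := 4 / 3 * d) ⟨x₀, hx₀⟩).1 (show infDist x X < _ by linarith)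
  set c := d / 3 with hc
  have hc0 : 0 < c := by positivity
  have hmx : ∀ ξ ∈ ball (0 : Sp N) R, x + c • ξ ∈ ball x₀ δ := fun ξ hξ => by
    have h1 := add_smul_mem_ball (a := x) hc0 hξ
    rw [mem_ball] at h1 ⊢
    have h2 := dist_triangle (x + c • ξ) x x₀
    have h3 : c * R ≤ η * R := mul_le_mul_of_nonneg_right (by linarith) (by linarith)
    linarith
  have hc2 : c ^ 2 * 4 ≤ η := by
    have : c ≤ η / 3 := by linarith
    nlinarith
  have hmt : ∀ s ∈ Ioo (-4 : ℝ) 4, t + c ^ 2 * s ∈ J := fun s hs => by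
    have := sq_nonneg c
    constructor <;> nlinarith [hs.1, hs.2]
  have hv := (h.mono hΩδ hIδ).rescale hr isOpen_ball hc0 x t hmx hmt
  have hk : 0 < c ^ (1 / r) := rpow_pos_of_pos hc0 _
  have hyc : x + c • (c⁻¹ • (y - x)) = y := by rw [smul_inv_smul₀ hc0.ne']; abel
  have hfin := H _ hv (fun ξ hξ s hs => locBdd_comp_affine hk.le (hbd _
    (hmx ξ (ball_subset_ball hR hξ)) (fun hmem => by
      have h1 := infDist_le_dist_of_mem (x := x) hmem
      have h2 := add_smul_mem_ball (a := x) hc0 hξ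
      rw [mem_ball, dist_comm] at h2
      linarith) _ (hmt s hs))) (c⁻¹ • (y - x)) (by
      rw [norm_smul, norm_inv, norm_eq_abs, abs_of_pos hc0, inv_mul_le_iff₀ hc0, ← dist_eq_norm,
        dist_comm]
      linarith) (c ^ (1 / r) * n) (fun j => by
      rw [hyc]
      exact mul_le_mul_of_nonneg_left (hXn y hyX _ (hmt 1 (by norm_num)) j) hk.le) i
  simp only [smul_zero, mul_zero, add_zero] at hfin
  rw [mul_left_comm] at hfin
  exact le_of_mul_le_mul_left hfin hk

end LocalBoundedness

/-- universal space-time singularity estimate for nonnegative solutions of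
the system (S) on `Ω × (0,T)`, for an arbitrary proper domain `Ω ⊊ ℝ^N`, with a constant
depending only on `N`, `p` and `B`. -/
theorem universal_singularity_estimate
    (N m : ℕ) (hN : 1 ≤ N) (hm : 2 ≤ m)
    (r : ℝ) (hr : 0 < r)
    (β : Fin m → Fin m → ℝ)
    (hsym : ∀ i j, β i j = β j i)
    (hoff : ∀ i j, i ≠ j → 0 ≤ β i j)
    (hdiag : ∀ i, 0 < β i i)
    (hpB : N ≤ 2 ∨ (3 ≤ N ∧ 2 * r + 1 < ((N : ℝ) * (N + 2)) / ((N : ℝ) - 1) ^ 2)) :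
    ∃ C : ℝ, 0 < C ∧
      ∀ (Ω : Set (EuclideanSpace ℝ (Fin N))), IsOpen Ω → Ω.Nonempty → Ω ≠ univ →
      ∀ (T : ℝ), 0 < T →
      ∀ (u : Fin m → EuclideanSpace ℝ (Fin N) → ℝ → ℝ),
        (∀ i, ∀ t ∈ Ioo (0 : ℝ) T, ContDiffOn ℝ 2 (fun x => u i x t) Ω) →
        (∀ i, ∀ x ∈ Ω, ContDiffOn ℝ 1 (fun s => u i x s) (Ioo (0 : ℝ) T)) →
        (∀ i, ∀ x ∈ Ω, ∀ t ∈ Ioo (0 : ℝ) T, 0 ≤ u i x t) →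
        (∀ i, ∀ x ∈ Ω, ∀ t ∈ Ioo (0 : ℝ) T,
          deriv (fun s => u i x s) t - lap (fun y => u i y t) x
            = ∑ j, β i j * u i x t ^ r * u j x t ^ (r + 1)) →
        ∀ i, ∀ x ∈ Ω, ∀ t ∈ Ioo (0 : ℝ) T,
          u i x t ≤ C * (t ^ (-(1 / (2 * r + 1 - 1))) + (T - t) ^ (-(1 / (2 * r + 1 - 1)))
            + infDist x Ωᶜ ^ (-(2 / (2 * r + 1 - 1)))) := by
  have hβ := coeff_nonneg hoff hdiag
  have hL := boundedLiouville hN hr hsym hoff hdiag hpB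
  obtain ⟨C, hC, H⟩ := exists_scaled_bound hr hL
  refine ⟨C, hC, fun Ω hΩ _ hΩu T _ u hspace htime hnonneg heq i x hx t ht => ?_⟩
  have hu : Sol r β Ω (Ioo 0 T) u := ⟨hspace, htime, hnonneg, heq⟩
  have ht0 : 0 < t := ht.1
  have htT : 0 < T - t := sub_pos.2 ht.2
  have hd0 : 0 < infDist x Ωᶜ := (hΩ.isClosed_compl.notMem_iff_infDist_pos
    (nonempty_compl.2 hΩu)).1 fun hxc => hxc hx
  set ρ := min (infDist x Ωᶜ) (min √t √(T - t)) with hρ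
  have hρ0 : 0 < ρ := lt_min hd0 (lt_min (sqrt_pos.2 ht0) (sqrt_pos.2 htT))
  have hρ1 : ρ ^ 2 ≤ t := (le_sqrt hρ0.le ht0.le).1 ((min_le_right _ _).trans (min_le_left _ _))
  have hρ2 : ρ ^ 2 ≤ T - t :=
    (le_sqrt hρ0.le htT.le).1 ((min_le_right _ _).trans (min_le_right _ _))
  have hsub : ball x ρ ⊆ Ω := fun y hy => by
    by_contra hyc
    have h1 := infDist_le_dist_of_mem (x := x) (show y ∈ Ωᶜ from hyc)
    rw [mem_ball, dist_comm] at hy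
    linarith [min_le_left (infDist x Ωᶜ) (min √t √(T - t))]
  have hI : Ioo (t - ρ ^ 2) (t + ρ ^ 2) ⊆ Ioo 0 T := Ioo_subset_Ioo (by linarith) (by linarith)
  refine (H u x t ρ hρ0 (hu.mono hsub hI) (fun y hy s hs =>
    hu.locBdd hr hβ hL hΩ ⟨hsub hy, hI hs⟩) i).trans (mul_le_mul_of_nonneg_left ?_ hC.le)
  have e1 : -(1 / (2 * r + 1 - 1)) = 1 / 2 * -(1 / r) := by field_simp; ring
  have e2 : -(2 / (2 * r + 1 - 1)) = -(1 / r) := by field_simp; ring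
  rw [e1, e2, rpow_mul ht0.le, rpow_mul htT.le, ← sqrt_eq_rpow, ← sqrt_eq_rpow]
  have h1 := rpow_nonneg (sqrt_nonneg t) (-(1 / r))
  have h2 := rpow_nonneg (sqrt_nonneg (T - t)) (-(1 / r))
  have h3 := rpow_nonneg hd0.le (-(1 / r))
  rcases min_choice (infDist x Ωᶜ) (min √t √(T - t)) with h | h
  · rw [hρ, h]
    linarith
  · rcases min_choice √t √(T - t) with h' | h' <;>
    · rw [hρ, h, h']
      linarith
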